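/- Existence and uniqueness via Perron's method: suppose ψ is Hölder continuous with exponent γ (the exponent of the global barrier) in x and Lipschitz continuous in t on ∂Q_T, and f is continuous and bounded on Q_T. Then there exists a unique continuous viscosity solution u of u_t − F(x, ∇u, D²u) − h(x,t)·∇u|∇u|^α = f in Q_T with u = ψ on ∂Q_T. -/

import Mathlib

open Set Filter Metric
open scoped RealInnerProductSpace

noncomputable section

/-- Euclidean space `ℝ^N`. -/
abbrev EucSp (N : ℕ) := EuclideanSpace ℝ (Fin N)

/-- `N × N` real matrices. -/
abbrev MatN (N : ℕ) := Matrix (Fin N) (Fin N) ℝ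

variable {N : ℕ}

/-- Spatial Hessian matrix of a function `φ : ℝ^N → ℝ`. -/
noncomputable def hessMat (φ : EucSp N → ℝ) (x : EucSp N) : MatN N := fun i j =>
  iteratedFDeriv ℝ 2 φ x ![EuclideanSpace.single i (1 : ℝ), EuclideanSpace.single j (1 : ℝ)]

/-- Upper semicontinuous envelope `u*`. -/
noncomputable def uscEnv (u : EucSp N → ℝ → ℝ) (x : EucSp N) (t : ℝ) : ℝ :=
  Filter.limsup (fun p : EucSp N × ℝ => u p.1 p.2) (nhds (x, t))

/-- Lower semicontinuous envelope `u_*`. -/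
noncomputable def lscEnv (u : EucSp N → ℝ → ℝ) (x : EucSp N) (t : ℝ) : ℝ :=
  Filter.liminf (fun p : EucSp N × ℝ => u p.1 p.2) (nhds (x, t))

/-- The first order term `h(x,t)·p |p|^α`. -/
noncomputable def gradTerm (h : EucSp N → ℝ → EucSp N) (α : ℝ) (x : EucSp N) (t : ℝ)
    (p : EucSp N) : ℝ :=
  ⟪h x t, p⟫ * ‖p‖ ^ α

/-- Viscosity subsolution of `u_t - F(x,∇u,D²u) - h(x,t)·∇u|∇u|^α ≤ f` in `Ω × (0,T)`,
in the sense of Definition 1 of the paper. -/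
def IsSubSol (Ω : Set (EucSp N)) (T : ℝ) (F : EucSp N → EucSp N → MatN N → ℝ)
    (h : EucSp N → ℝ → EucSp N) (α : ℝ) (f : EucSp N → ℝ → ℝ)
    (u : EucSp N → ℝ → ℝ) : Prop :=
  ∀ x₀ ∈ Ω, ∀ t₀ ∈ Set.Ioo (0 : ℝ) T,
    (∀ φ : EucSp N → ℝ → ℝ,
      ContDiff ℝ 2 (fun p : EucSp N × ℝ => φ p.1 p.2) →
      (∀ᶠ p : EucSp N × ℝ in nhds (x₀, t₀), uscEnv u p.1 p.2 ≤ φ p.1 p.2) →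
      uscEnv u x₀ t₀ = φ x₀ t₀ →
      gradient (fun x => φ x t₀) x₀ ≠ 0 →
      deriv (fun s => φ x₀ s) t₀
          - F x₀ (gradient (fun x => φ x t₀) x₀) (hessMat (fun x => φ x t₀) x₀)
          - gradTerm h α x₀ t₀ (gradient (fun x => φ x t₀) x₀)
        ≤ f x₀ t₀) ∧
    (∀ δ₁ > (0 : ℝ), ∀ φ : ℝ → ℝ, ContDiff ℝ 2 φ → φ t₀ = 0 →
      (∀ t ∈ Set.Ioo (t₀ - δ₁) (t₀ + δ₁), uscEnv u x₀ t - φ t ≤ uscEnv u x₀ t₀) →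
      (∀ᶠ x in nhds x₀,
        sSup ((fun t => uscEnv u x t - φ t) '' Set.Ioo (t₀ - δ₁) (t₀ + δ₁)) =
          sSup ((fun t => uscEnv u x₀ t - φ t) '' Set.Ioo (t₀ - δ₁) (t₀ + δ₁))) →
      deriv φ t₀ ≤ f x₀ t₀)

/-- Viscosity supersolution of `u_t - F(x,∇u,D²u) - h(x,t)·∇u|∇u|^α ≥ f` in `Ω × (0,T)`,
in the sense of Definition 1 of the paper. -/
def IsSuperSol (Ω : Set (EucSp N)) (T : ℝ) (F : EucSp N → EucSp N → MatN N → ℝ)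
    (h : EucSp N → ℝ → EucSp N) (α : ℝ) (f : EucSp N → ℝ → ℝ)
    (u : EucSp N → ℝ → ℝ) : Prop :=
  ∀ x₀ ∈ Ω, ∀ t₀ ∈ Set.Ioo (0 : ℝ) T,
    (∀ φ : EucSp N → ℝ → ℝ,
      ContDiff ℝ 2 (fun p : EucSp N × ℝ => φ p.1 p.2) →
      (∀ᶠ p : EucSp N × ℝ in nhds (x₀, t₀), φ p.1 p.2 ≤ lscEnv u p.1 p.2) →
      lscEnv u x₀ t₀ = φ x₀ t₀ →
      gradient (fun x => φ x t₀) x₀ ≠ 0 →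
      f x₀ t₀ ≤
        deriv (fun s => φ x₀ s) t₀
          - F x₀ (gradient (fun x => φ x t₀) x₀) (hessMat (fun x => φ x t₀) x₀)
          - gradTerm h α x₀ t₀ (gradient (fun x => φ x t₀) x₀)) ∧
    (∀ δ₁ > (0 : ℝ), ∀ φ : ℝ → ℝ, ContDiff ℝ 2 φ → φ t₀ = 0 →
      (∀ t ∈ Set.Ioo (t₀ - δ₁) (t₀ + δ₁), lscEnv u x₀ t₀ ≤ lscEnv u x₀ t - φ t) →
      (∀ᶠ x in nhds x₀,
        sInf ((fun t => lscEnv u x t - φ t) '' Set.Ioo (t₀ - δ₁) (t₀ + δ₁)) =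
          sInf ((fun t => lscEnv u x₀ t - φ t) '' Set.Ioo (t₀ - δ₁) (t₀ + δ₁))) →
      f x₀ t₀ ≤ deriv φ t₀)

/-- Continuity of `F` on `Ω × (ℝ^N∖{0}) × S`. -/
def Fcont (Ω : Set (EucSp N)) (F : EucSp N → EucSp N → MatN N → ℝ) : Prop :=
  ContinuousOn (fun z : EucSp N × EucSp N × MatN N => F z.1 z.2.1 z.2.2)
    (Ω ×ˢ ({p : EucSp N | p ≠ 0} ×ˢ (Set.univ : Set (MatN N))))

/-- Hypothesis (H1): homogeneity. -/
def H1 (Ω : Set (EucSp N)) (F : EucSp N → EucSp N → MatN N → ℝ) (α : ℝ) : Prop :=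
  ∀ x ∈ Ω, ∀ p : EucSp N, p ≠ 0 → ∀ X : MatN N, X.IsSymm →
    ∀ t : ℝ, t ≠ 0 → ∀ μ : ℝ, 0 ≤ μ →
      F x (t • p) (μ • X) = |t| ^ α * μ * F x p X

/-- Hypothesis (H2): uniform ellipticity. -/
def H2 (Ω : Set (EucSp N)) (F : EucSp N → EucSp N → MatN N → ℝ) (α a A : ℝ) : Prop :=
  0 < a ∧ a ≤ A ∧
    ∀ x ∈ Ω, ∀ p : EucSp N, p ≠ 0 → ∀ M P : MatN N, M.IsSymm → P.IsSymm → P.PosSemidef →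
      a * ‖p‖ ^ α * P.trace ≤ F x p (M + P) - F x p M ∧
        F x p (M + P) - F x p M ≤ A * ‖p‖ ^ α * P.trace

/-- Hypothesis (H3): continuity estimate for doubled variables. -/
def H3 (Ω : Set (EucSp N)) (F : EucSp N → EucSp N → MatN N → ℝ) : Prop :=
  ∃ ω : ℝ → ℝ, Continuous ω ∧ ω 0 = 0 ∧
    ∀ X Y : MatN N, X.IsSymm → Y.IsSymm → ∀ ζ : ℝ, 0 < ζ →
      (Matrix.fromBlocks X 0 0 Y +
        ζ • (1 : Matrix (Fin N ⊕ Fin N) (Fin N ⊕ Fin N) ℝ)).PosSemidef →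
      ((4 * ζ) • Matrix.fromBlocks (1 : MatN N) (-1) (-1) (1 : MatN N) -
        Matrix.fromBlocks X 0 0 Y).PosSemidef →
      ∀ x ∈ Ω, ∀ y ∈ Ω, x ≠ y →
        F x (ζ • (x - y)) X - F y (ζ • (x - y)) (-Y) ≤ ω (ζ * ‖x - y‖ ^ 2)

/-- Frobenius norm of a matrix. -/
noncomputable def frobNorm (X : MatN N) : ℝ := Real.sqrt (∑ i, ∑ j, (X i j) ^ 2)

/-- Hypothesis (H4): Hölder-type continuity of `F` in `x`. -/
def H4 (Ω : Set (EucSp N)) (F : EucSp N → EucSp N → MatN N → ℝ) (α : ℝ) : Prop :=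
  ∃ ω' : ℝ → ℝ, Continuous ω' ∧ ω' 0 = 0 ∧
    ∀ x ∈ Ω, ∀ y ∈ Ω, ∀ p : EucSp N, p ≠ 0 → ∀ X : MatN N, X.IsSymm →
      |F x p X - F y p X| ≤ ω' ‖x - y‖ * ‖p‖ ^ α * frobNorm X

/-- Hypothesis (H5): regularity of `h`. -/
def H5 (Ω : Set (EucSp N)) (T : ℝ) (h : EucSp N → ℝ → EucSp N) (α : ℝ) : Prop :=
  ∃ ωh : ℝ, 0 < ωh ∧ ωh ≤ 1 ∧ ∃ ch : ℝ, 0 < ch ∧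
    (∀ x ∈ Ω, ∀ t ∈ Set.Ioo (0 : ℝ) T, ∀ s ∈ Set.Ioo (0 : ℝ) T,
      ‖h x t - h x s‖ ≤ ch * |t - s| ^ ωh) ∧
    (α ≤ 0 → ∀ x ∈ Ω, ∀ y ∈ Ω, ∀ t ∈ Set.Ioo (0 : ℝ) T,
      ‖h x t - h y t‖ ≤ ch * ‖x - y‖ ^ (1 + α)) ∧
    (0 < α → ∀ x ∈ Ω, ∀ y ∈ Ω, ∀ t ∈ Set.Ioo (0 : ℝ) T,
      ⟪h x t - h y t, x - y⟫ ≤ 0)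

/-- Hypothesis (H6): uniform Lipschitz-type condition on `F` in the gradient variable. -/
def H6 (F : EucSp N → EucSp N → MatN N → ℝ) (α : ℝ) : Prop :=
  ∃ C : ℝ, 0 < C ∧ ∀ x : EucSp N, ∀ p : EucSp N, p ≠ 0 → ∀ q : EucSp N, ‖q‖ < ‖p‖ / 2 →
    ∀ X : MatN N, X.IsSymm →
      |F x (p + q) X - F x p X| ≤ C * ‖p‖ ^ (α - 1) * ‖q‖ * frobNorm X

/-- `h` is continuous and bounded on `Ω × (0,T)`. -/
def HContBdd (Ω : Set (EucSp N)) (T : ℝ) (h : EucSp N → ℝ → EucSp N) : Prop :=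
  ContinuousOn (fun p : EucSp N × ℝ => h p.1 p.2) (Ω ×ˢ Set.Ioo 0 T) ∧
    ∃ C : ℝ, ∀ x ∈ Ω, ∀ t ∈ Set.Ioo (0 : ℝ) T, ‖h x t‖ ≤ C

/-- Uniform exterior cone condition. -/
def UnifExtCone (Ω : Set (EucSp N)) : Prop :=
  ∃ φ₀ ∈ Set.Ioo (0 : ℝ) Real.pi, ∃ r : ℝ, 0 < r ∧
    ∀ z ∈ frontier Ω, ∃ n : EucSp N, ‖n‖ = 1 ∧
      {x : EucSp N | ⟪x - z, n⟫ ≤ Real.cos φ₀ * ‖x - z‖} ∩ closure Ω ∩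
        Metric.ball z r = {z}

/-- `u = ψ` on the parabolic boundary `(∂Ω × (0,T)) ∪ (Ω × {0})`. -/
def BoundaryEq (Ω : Set (EucSp N)) (T : ℝ) (u ψ : EucSp N → ℝ → ℝ) : Prop :=
  (∀ x ∈ frontier Ω, ∀ t ∈ Set.Ioo (0 : ℝ) T, u x t = ψ x t) ∧
    (∀ x ∈ Ω, u x 0 = ψ x 0)

/-- The global barrier family of Proposition 1 of the paper, with Hölder
exponent `γ` and constants `c₁ ≤ W_z(x)/|x-z|^γ ≤ c₂`. -/
def IsBarrierFamily (Ω : Set (EucSp N)) (T : ℝ) (F : EucSp N → EucSp N → MatN N → ℝ)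
    (h : EucSp N → ℝ → EucSp N) (α γ c₁ c₂ : ℝ) : Prop :=
  γ ∈ Set.Ioo (0 : ℝ) 1 ∧ 0 < c₁ ∧ 0 < c₂ ∧
    ∀ z ∈ frontier Ω, ∃ W : EucSp N → ℝ,
      ContinuousOn W (closure Ω) ∧ W z = 0 ∧
      (∀ x ∈ Ω, x ≠ z → 0 < W x) ∧
      (∀ x ∈ Ω, gradient W x ≠ 0) ∧
      (∀ x ∈ Ω, c₁ * ‖x - z‖ ^ γ ≤ W x ∧ W x ≤ c₂ * ‖x - z‖ ^ γ) ∧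
      (∀ x₀ ∈ Ω, ∀ φ : EucSp N → ℝ, ContDiff ℝ 2 φ →
        (∀ᶠ x in nhds x₀, φ x ≤ W x) → φ x₀ = W x₀ → gradient φ x₀ ≠ 0 →
        ∀ t ∈ Set.Ioo (0 : ℝ) T,
          F x₀ (gradient φ x₀) (hessMat φ x₀) + gradTerm h α x₀ t (gradient φ x₀) ≤ -1)

/-- `ψ` is `γ`-Hölder in `x` (with constant `cψ`) and Lipschitz in `t`
(with constant `Lψ`). -/
def PsiHolderLip (Ω : Set (EucSp N)) (T γ cψ Lψ : ℝ) (ψ : EucSp N → ℝ → ℝ) : Prop :=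
  (∀ x ∈ closure Ω, ∀ y ∈ closure Ω, ∀ t ∈ Set.Icc (0 : ℝ) T,
      |ψ x t - ψ y t| ≤ cψ * ‖x - y‖ ^ γ) ∧
    (∀ x ∈ closure Ω, ∀ t ∈ Set.Icc (0 : ℝ) T, ∀ s ∈ Set.Icc (0 : ℝ) T,
      |ψ x t - ψ x s| ≤ Lψ * |t - s|)

/-- A continuous viscosity solution of the problem `1_{f,ψ}` on a bounded domain. -/
def IsSolution (Ω : Set (EucSp N)) (T : ℝ) (F : EucSp N → EucSp N → MatN N → ℝ)
    (h : EucSp N → ℝ → EucSp N) (α : ℝ) (f : EucSp N → ℝ → ℝ)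
    (ψ : EucSp N → ℝ → ℝ) (u : EucSp N → ℝ → ℝ) : Prop :=
  ContinuousOn (fun p : EucSp N × ℝ => u p.1 p.2) (closure Ω ×ˢ Set.Icc 0 T) ∧
    IsSubSol Ω T F h α f u ∧ IsSuperSol Ω T F h α f u ∧ BoundaryEq Ω T u ψ

section Alexandrov
variable {E : Type*} [NormedAddCommGroup E] [InnerProductSpace ℝ E]

/-- A variational inequality for the proximal map gives minimality. -/
lemma prox_min {f : E → ℝ} {z x y : E} (h : ⟪z - x, y - x⟫ ≤ f y - f x) :
    f x + 1 / 2 * ‖x - z‖ ^ 2 ≤ f y + 1 / 2 * ‖y - z‖ ^ 2 := by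
  have e : y - z = (y - x) - (z - x) := by abel
  rw [real_inner_comm] at h
  rw [e, norm_sub_sq_real (y - x), norm_sub_rev x z]
  nlinarith [sq_nonneg ‖y - x‖]

lemma prox_lipschitz {f : E → ℝ} {z₁ x₁ z₂ x₂ : E}
    (h₁ : ⟪z₁ - x₁, x₂ - x₁⟫ ≤ f x₂ - f x₁) (h₂ : ⟪z₂ - x₂, x₁ - x₂⟫ ≤ f x₁ - f x₂) :
    ‖x₁ - x₂‖ ≤ ‖z₁ - z₂‖ := by
  have h : ‖x₁ - x₂‖ ^ 2 ≤ ⟪z₁ - z₂, x₁ - x₂⟫ := by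
    rw [← real_inner_self_eq_norm_sq]
    simp only [inner_sub_left, inner_sub_right] at *
    linarith
  have h' := h.trans (real_inner_le_norm _ _)
  by_contra! hc
  nlinarith [norm_nonneg (z₁ - z₂)]

set_option maxHeartbeats 1600000 in
/-- Second order expansion of a convex function from differentiability of its proximal map. -/
lemma second_order_of_prox [FiniteDimensional ℝ E] {f : E → ℝ} {P : E → E} {D : E →L[ℝ] E} {r : ℝ}
    (hr : 0 < r) (hf : ConvexOn ℝ univ f) (hf0 : ∀ y, 0 ≤ f y)
    (hfr : ∀ y, ‖y‖ ≤ r → f y ≤ 1 / 2 * ‖y‖ ^ 2) (hP0 : P 0 = 0) (hD : HasFDerivAt P D 0)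
    (hLip : ∀ ζ ξ, ‖P ζ - P ξ‖ ≤ ‖ζ - ξ‖)
    (hVI : ∀ ζ, ∀ y, ‖y‖ ≤ r → ⟪ζ - P ζ, y - P ζ⟫ ≤ f y - f (P ζ)) :
    ∃ Q : E →L[ℝ] E, ∀ ε > 0, ∃ δ > 0, ∀ v, ‖v‖ < δ →
      |f v - 1 / 2 * ⟪Q v, v⟫| ≤ ε * ‖v‖ ^ 2 := by
  have hPn : ∀ ζ, ‖P ζ‖ ≤ ‖ζ‖ := fun ζ => by simpa [hP0] using hLip ζ 0
  have hs : ∀ ζ, ‖ζ‖ ≤ r / 2 → ‖ζ‖ ≤ 3 * ‖P ζ‖ := by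
    intro ζ hζ
    have h1 : ‖ζ - P ζ‖ ≤ 2 * ‖ζ‖ := (norm_sub_le _ _).trans (by linarith [hPn ζ])
    have h2 : ‖P ζ + (1 / 2 : ℝ) • (ζ - P ζ)‖ ≤ ‖P ζ‖ + 1 / 2 * ‖ζ - P ζ‖ := by
      refine (norm_add_le _ _).trans ?_
      rw [norm_smul]; norm_num
    have h3 := hVI ζ _ (h2.trans (by linarith [hPn ζ]))
    have h4 := hfr _ (h2.trans (by linarith [hPn ζ]))
    rw [add_sub_cancel_left, real_inner_smul_right, real_inner_self_eq_norm_sq] at h3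
    have h5 : ‖ζ - P ζ‖ ^ 2 ≤ (‖P ζ‖ + 1 / 2 * ‖ζ - P ζ‖) ^ 2 := by
      have := pow_le_pow_left₀ (norm_nonneg _) h2 2
      linarith [hf0 (P ζ)]
    have h6 : ‖ζ - P ζ‖ ≤ ‖P ζ‖ + 1 / 2 * ‖ζ - P ζ‖ :=
      le_of_sq_le_sq h5 (by positivity)
    have h7 : ‖ζ‖ ≤ ‖P ζ‖ + ‖ζ - P ζ‖ := by
      have := norm_add_le (P ζ) (ζ - P ζ); simpa using this
    linarith
  have hPD : ∀ ε > 0, ∃ δ > 0, ∀ ζ, ‖ζ‖ < δ → ‖P ζ - D ζ‖ ≤ ε * ‖ζ‖ := by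
    intro ε hε
    have := (hasFDerivAt_iff_isLittleO_nhds_zero.1 hD).def hε
    obtain ⟨δ, hδ, H⟩ := Metric.eventually_nhds_iff.1 this
    refine ⟨δ, hδ, fun ζ hζ => ?_⟩
    have := H (y := ζ) (by simpa using hζ)
    simpa [hP0] using this
  have hD3 : ∀ ζ, ‖ζ‖ ≤ 3 * ‖D ζ‖ := by
    intro ζ
    by_cases hz : ζ = 0
    · simp [hz]
    have hzp : 0 < ‖ζ‖ := norm_pos_iff.2 hz
    refine le_of_forall_pos_le_add fun ε hε => ?_
    obtain ⟨δ, hδ, H⟩ := hPD (ε / (3 * ‖ζ‖)) (by positivity)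
    obtain ⟨t, ht, htl⟩ : ∃ t : ℝ, 0 < t ∧ t * ‖ζ‖ < min δ (r / 2) := by
      refine ⟨min δ (r / 2) / (2 * ‖ζ‖), by positivity, ?_⟩
      have : 0 < min δ (r / 2) := by positivity
      field_simp; linarith
    have hn : ‖t • ζ‖ = t * ‖ζ‖ := by rw [norm_smul, Real.norm_of_nonneg ht.le]
    have h1 := H (t • ζ) (by rw [hn]; exact htl.trans_le (min_le_left _ _))
    have h2 := hs (t • ζ) (by rw [hn]; exact (htl.trans_le (min_le_right _ _)).le)
    have h3 : ‖P (t • ζ)‖ ≤ ‖D (t • ζ)‖ + ‖P (t • ζ) - D (t • ζ)‖ := by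
      have := norm_add_le (D (t • ζ)) (P (t • ζ) - D (t • ζ)); simpa using this
    have h4 : ‖D (t • ζ)‖ = t * ‖D ζ‖ := by
      rw [map_smul, norm_smul, Real.norm_of_nonneg ht.le]
    rw [hn] at h1 h2
    rw [h4] at h3
    have h5 : ε / (3 * ‖ζ‖) * (t * ‖ζ‖) = t * (ε / 3) := by field_simp
    rw [h5] at h1
    have : t * ‖ζ‖ ≤ t * (3 * ‖D ζ‖ + ε) := by linarith
    exact le_of_mul_le_mul_left this ht
  have hinj : Function.Injective D := by
    rw [injective_iff_map_eq_zero]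
    intro ζ h0
    have := hD3 ζ
    rw [h0, norm_zero, mul_zero] at this
    exact norm_le_zero_iff.1 this
  obtain ⟨B, hB⟩ : ∃ B : E →L[ℝ] E, ∀ v, D (B v) = v := by
    let e := LinearEquiv.ofInjectiveEndo (D : E →ₗ[ℝ] E) hinj
    refine ⟨LinearMap.toContinuousLinearMap (e.symm : E →ₗ[ℝ] E), fun v => ?_⟩
    exact e.apply_symm_apply v
  have hBn : ∀ v, ‖B v‖ ≤ 3 * ‖v‖ := fun v => by simpa [hB] using hD3 (B v)
  set e : E → ℝ := fun ζ => f (P ζ) + 1 / 2 * ‖P ζ - ζ‖ ^ 2 with he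
  have hmin : ∀ ζ y, ‖y‖ ≤ r → e ζ ≤ f y + 1 / 2 * ‖y - ζ‖ ^ 2 := fun ζ y hy =>
    prox_min (hVI ζ y hy)
  have heu : ∀ ζ ξ, ‖ζ‖ ≤ r → e ξ ≤ e ζ + ⟪ζ - P ζ, ξ - ζ⟫ + 1 / 2 * ‖ξ - ζ‖ ^ 2 := by
    intro ζ ξ hζ
    have h := hmin ξ (P ζ) ((hPn ζ).trans hζ)
    have e1 : P ζ - ξ = (P ζ - ζ) - (ξ - ζ) := by abel
    have e2 : ⟪P ζ - ζ, ξ - ζ⟫ = - ⟪ζ - P ζ, ξ - ζ⟫ := by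
      rw [← inner_neg_left]; congr 1; abel
    rw [e1, norm_sub_sq_real, e2] at h
    simp only [he] at h ⊢
    linarith
  have hder : ∀ ζ, ‖ζ‖ ≤ r / 2 → ∀ ε > 0, ∃ δ > 0, ∀ ξ, ‖ξ - ζ‖ < δ →
      |e ξ - e ζ - ⟪ζ - P ζ, ξ - ζ⟫| ≤ ε * ‖ξ - ζ‖ := by
    intro ζ hζ ε hε
    refine ⟨min (r / 2) (ε / 4), by positivity, fun ξ hξ => ?_⟩
    have h1 : ‖ξ - ζ‖ < r / 2 := hξ.trans_le (min_le_left _ _)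
    have h2 : ‖ξ - ζ‖ < ε / 4 := hξ.trans_le (min_le_right _ _)
    have h3 : ‖ξ‖ ≤ r := by
      have := norm_add_le ζ (ξ - ζ); rw [add_sub_cancel] at this; linarith
    have ha := heu ζ ξ (by linarith)
    have hb := heu ξ ζ h3
    have hc : ⟪ξ - P ξ, ζ - ξ⟫ = -⟪ζ - P ζ, ξ - ζ⟫ - ‖ξ - ζ‖ ^ 2 + ⟪P ξ - P ζ, ξ - ζ⟫ := by
      rw [← real_inner_self_eq_norm_sq]
      simp only [inner_sub_left, inner_sub_right]; ring
    have hd : ⟪P ξ - P ζ, ξ - ζ⟫ ≤ ‖ξ - ζ‖ ^ 2 := by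
      refine (real_inner_le_norm _ _).trans ?_
      nlinarith [hLip ξ ζ, norm_nonneg (ξ - ζ)]
    rw [norm_sub_rev ζ ξ, hc] at hb
    have : ‖ξ - ζ‖ ^ 2 ≤ ε / 4 * ‖ξ - ζ‖ := by nlinarith [norm_nonneg (ξ - ζ)]
    rw [abs_le]; constructor <;> nlinarith [norm_nonneg (ξ - ζ)]
  -- expansion of the envelope
  have hexp : ∀ ε > 0, ∃ δ > 0, ∀ ζ, ‖ζ‖ < δ →
      |e ζ - 1 / 2 * ⟪ζ - D ζ, ζ⟫| ≤ ε * ‖ζ‖ ^ 2 := by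
    intro ε hε
    obtain ⟨δ, hδ, H⟩ := hPD ε hε
    refine ⟨min δ (r / 2), by positivity, fun ζ hζ => ?_⟩
    have hz1 : ‖ζ‖ < δ := hζ.trans_le (min_le_left _ _)
    have hz2 : ‖ζ‖ < r / 2 := hζ.trans_le (min_le_right _ _)
    have hd : ∀ t ∈ Icc (0 : ℝ) 1, HasDerivWithinAt
        (fun t : ℝ => e (t • ζ) - t ^ 2 * (1 / 2 * ⟪ζ - D ζ, ζ⟫))
        (⟪t • ζ - P (t • ζ), ζ⟫ - 2 * t * (1 / 2 * ⟪ζ - D ζ, ζ⟫)) (Icc 0 1) t := by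
      intro t ht
      apply HasDerivAt.hasDerivWithinAt
      apply HasDerivAt.sub
      · rw [hasDerivAt_iff_isLittleO, Asymptotics.isLittleO_iff]
        intro c hc
        have htz : ‖t • ζ‖ ≤ r / 2 := by
          rw [norm_smul, Real.norm_of_nonneg ht.1]; nlinarith [ht.2, norm_nonneg ζ]
        obtain ⟨η, hη, Hη⟩ := hder (t • ζ) htz (c / (‖ζ‖ + 1)) (by positivity)
        rw [Metric.eventually_nhds_iff]
        refine ⟨η / (‖ζ‖ + 1), by positivity, fun s hs => ?_⟩
        have e1 : s • ζ - t • ζ = (s - t) • ζ := (sub_smul _ _ _).symm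
        have e2 : ‖s • ζ - t • ζ‖ = |s - t| * ‖ζ‖ := by rw [e1, norm_smul, Real.norm_eq_abs]
        rw [Real.dist_eq, lt_div_iff₀ (by positivity)] at hs
        have := Hη (s • ζ) (by rw [e2]; nlinarith [abs_nonneg (s - t), norm_nonneg ζ])
        rw [e2, e1, real_inner_smul_right] at this
        rw [Real.norm_eq_abs, Real.norm_eq_abs, smul_eq_mul]
        refine this.trans ?_
        have h0 : 0 ≤ c / (‖ζ‖ + 1) * |s - t| := by positivity
        have h1 : c / (‖ζ‖ + 1) * (‖ζ‖ + 1) = c := by field_simp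
        nlinarith [norm_nonneg ζ]
      · have := (hasDerivAt_pow 2 t).mul_const (1 / 2 * ⟪ζ - D ζ, ζ⟫)
        simpa using this
    have hb : ∀ t ∈ Ico (0 : ℝ) 1,
        ‖⟪t • ζ - P (t • ζ), ζ⟫ - 2 * t * (1 / 2 * ⟪ζ - D ζ, ζ⟫)‖ ≤ ε * ‖ζ‖ ^ 2 := by
      intro t ht
      have e1 : ⟪t • ζ - P (t • ζ), ζ⟫ - 2 * t * (1 / 2 * ⟪ζ - D ζ, ζ⟫)
          = - ⟪P (t • ζ) - D (t • ζ), ζ⟫ := by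
        rw [map_smul]
        simp only [inner_sub_left, real_inner_smul_left]; ring
      rw [e1, norm_neg]
      refine (norm_inner_le_norm _ _).trans ?_
      have htn : ‖t • ζ‖ ≤ ‖ζ‖ := by
        rw [norm_smul, Real.norm_of_nonneg ht.1]; nlinarith [ht.2, norm_nonneg ζ]
      have := H (t • ζ) (htn.trans_lt hz1)
      have h3 : ‖P (t • ζ) - D (t • ζ)‖ ≤ ε * ‖ζ‖ := this.trans (by gcongr)
      nlinarith [norm_nonneg ζ]
    have := norm_image_sub_le_of_norm_deriv_le_segment_01' hd hb
    have hf00 : f 0 = 0 := le_antisymm (by simpa using hfr 0 (by simpa using hr.le)) (hf0 0)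
    simpa [he, hP0, hf00] using this
  refine ⟨B - ContinuousLinearMap.id ℝ E, fun ε hε => ?_⟩
  obtain ⟨δ₁, hδ₁, H₁⟩ := hexp (ε / 18) (by positivity)
  obtain ⟨δ₂, hδ₂, H₂⟩ := hPD (min 1 (ε / 60)) (by positivity)
  refine ⟨min (min (δ₁ / 3) (δ₂ / 3)) (r / 4), by positivity, fun v hv => ?_⟩
  have hv1 : 3 * ‖v‖ < δ₁ := by
    have := hv.trans_le ((min_le_left _ _).trans (min_le_left _ _)); linarith
  have hv2 : 3 * ‖v‖ < δ₂ := by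
    have := hv.trans_le ((min_le_left _ _).trans (min_le_right _ _)); linarith
  have hv3 : ‖v‖ < r / 4 := hv.trans_le (min_le_right _ _)
  have k1 := H₁ (B v) ((hBn v).trans_lt hv1)
  have k2 := H₂ (B v) ((hBn v).trans_lt hv2)
  rw [hB] at k1 k2
  have hBsq : ‖B v‖ ^ 2 ≤ 9 * ‖v‖ ^ 2 := by nlinarith [hBn v, norm_nonneg (B v), norm_nonneg v]
  have k1' : |e (B v) - 1 / 2 * ⟪B v - v, B v⟫| ≤ ε / 2 * ‖v‖ ^ 2 :=
    k1.trans (by nlinarith)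
  have hd1 : ‖P (B v) - v‖ ≤ 3 * ‖v‖ := k2.trans
    ((mul_le_mul_of_nonneg_right (min_le_left _ _) (norm_nonneg _)).trans (by linarith [hBn v]))
  have hd2 : ‖P (B v) - v‖ ≤ ε / 20 * ‖v‖ := k2.trans
    ((mul_le_mul_of_nonneg_right (min_le_right _ _) (norm_nonneg _)).trans (by nlinarith [hBn v]))
  have eQ : 1 / 2 * ⟪(B - ContinuousLinearMap.id ℝ E) v, v⟫
      = 1 / 2 * ⟪B v - v, B v⟫ - 1 / 2 * ‖v - B v‖ ^ 2 := by
    rw [← real_inner_self_eq_norm_sq]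
    simp only [sub_apply, ContinuousLinearMap.id_apply, inner_sub_left,
      inner_sub_right]
    rw [real_inner_comm v (B v)]; ring
  have low := hmin (B v) v (by linarith)
  rw [abs_le] at k1'
  rw [eQ, abs_le]
  constructor
  · nlinarith [sq_nonneg ‖v‖]
  · by_cases hd0 : P (B v) = v
    · have : e (B v) = f v + 1 / 2 * ‖v - B v‖ ^ 2 := by simp only [he, hd0]
      nlinarith [sq_nonneg ‖v‖]
    set d := ‖P (B v) - v‖ with hd
    have hdp : 0 < d := norm_pos_iff.2 (sub_ne_zero.2 hd0)
    have hvp : 0 < ‖v‖ := by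
      rcases (norm_nonneg v).lt_or_eq with h | h
      · exact h
      · rw [← h] at hd1; linarith
    set ρ := ‖v‖ with hρ
    set w := v + (ρ / d) • (v - P (B v)) with hw
    have hwn : ‖w‖ ≤ 2 * ρ := by
      refine (norm_add_le _ _).trans ?_
      rw [norm_smul, norm_sub_rev v, ← hd, Real.norm_of_nonneg (by positivity), ← hρ]
      rw [div_mul_cancel₀ _ hdp.ne']; linarith
    have hconv := hf.2 (mem_univ (P (B v))) (mem_univ w)
      (show 0 ≤ ρ / (d + ρ) by positivity) (show 0 ≤ d / (d + ρ) by positivity)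
      (by field_simp; ring)
    have hcomb : (ρ / (d + ρ)) • P (B v) + (d / (d + ρ)) • w = v := by
      rw [hw, smul_add, smul_smul]
      have : d / (d + ρ) * (ρ / d) = ρ / (d + ρ) := by field_simp
      rw [this, smul_sub]
      have h2 : (ρ / (d + ρ)) • v + (d / (d + ρ)) • v = v := by
        rw [← add_smul]
        have : ρ / (d + ρ) + d / (d + ρ) = 1 := by field_simp; ring
        rw [this, one_smul]
      rw [← h2]; simp only [h2]; nth_rewrite 5 [← h2]; abel
    rw [hcomb, smul_eq_mul, smul_eq_mul] at hconv
    have hfw : f w ≤ 2 * ρ ^ 2 := (hfr w (by linarith)).trans (by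
      have := pow_le_pow_left₀ (norm_nonneg w) hwn 2; linarith)
    have h1 : ρ / (d + ρ) * f (P (B v)) ≤ f (P (B v)) := by
      have : ρ / (d + ρ) ≤ 1 := by rw [div_le_one (by positivity)]; linarith
      nlinarith [hf0 (P (B v))]
    have h2 : d / (d + ρ) * f w ≤ ε / 10 * ρ ^ 2 := by
      have h3 : d / (d + ρ) ≤ ε / 20 := by
        rw [div_le_iff₀ (by positivity)]; nlinarith
      have h4 : 0 ≤ d / (d + ρ) := by positivity
      calc d / (d + ρ) * f w ≤ d / (d + ρ) * (2 * ρ ^ 2) := by gcongr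
        _ ≤ ε / 20 * (2 * ρ ^ 2) := by gcongr
        _ = _ := by ring
    have h5 : f (P (B v)) = e (B v) - 1 / 2 * ‖P (B v) - B v‖ ^ 2 := by simp only [he]; ring
    have h6 : ‖v - B v‖ ≤ ‖P (B v) - B v‖ + d := by
      have := norm_sub_le (P (B v) - B v) (P (B v) - v)
      have e3 : P (B v) - B v - (P (B v) - v) = v - B v := by abel
      rwa [e3] at this
    have h7 : ‖P (B v) - B v‖ ≤ 6 * ρ := by
      refine (norm_sub_le _ _).trans ?_
      linarith [hPn (B v), hBn v]
    have h8 : ‖v - B v‖ ≤ 4 * ρ := by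
      refine (norm_sub_le _ _).trans ?_
      linarith [hBn v]
    have h9 : ‖v - B v‖ ^ 2 - ‖P (B v) - B v‖ ^ 2 ≤ d * (10 * ρ) := by
      have : (‖v - B v‖ - ‖P (B v) - B v‖) * (‖v - B v‖ + ‖P (B v) - B v‖) ≤ d * (10 * ρ) := by
        apply mul_le_mul (by linarith) (by linarith) (by positivity) hdp.le
      nlinarith
    nlinarith
end Alexandrov

section Jensen
variable {E : Type*} [NormedAddCommGroup E] [InnerProductSpace ℝ E]

lemma subgradient_of_touch {f : E → ℝ} (hf : ConvexOn ℝ univ f) {x q : E} {r : ℝ} (hr : 0 < r)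
    (h : ∀ v, ‖v‖ ≤ r → f (x + v) ≤ f x + ⟪q, v⟫ + 1 / 2 * ‖v‖ ^ 2) (v : E) :
    f x + ⟪q, v⟫ ≤ f (x + v) := by
  refine le_of_forall_pos_le_add fun ε hε => ?_
  obtain ⟨s, hs0, hs1, hsε⟩ : ∃ s : ℝ, 0 < s ∧ s * ‖v‖ ≤ r ∧ s * (1 / 2 * ‖v‖ ^ 2) ≤ ε := by
    refine ⟨min (r / (‖v‖ + 1)) (ε / (1 / 2 * ‖v‖ ^ 2 + 1)), by positivity, ?_, ?_⟩
    · have h1 := min_le_left (r / (‖v‖ + 1)) (ε / (1 / 2 * ‖v‖ ^ 2 + 1))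
      have h2 : r / (‖v‖ + 1) * (‖v‖ + 1) = r := by field_simp
      have h3 : 0 ≤ r / (‖v‖ + 1) := by positivity
      nlinarith [norm_nonneg v]
    · have h1 := min_le_right (r / (‖v‖ + 1)) (ε / (1 / 2 * ‖v‖ ^ 2 + 1))
      have h2 : ε / (1 / 2 * ‖v‖ ^ 2 + 1) * (1 / 2 * ‖v‖ ^ 2 + 1) = ε := by field_simp
      have h3 : 0 ≤ ε / (1 / 2 * ‖v‖ ^ 2 + 1) := by positivity
      nlinarith [sq_nonneg ‖v‖]
  have h1 := h (-(s • v)) (by rw [norm_neg, norm_smul, Real.norm_of_nonneg hs0.le]; exact hs1)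
  rw [norm_neg, norm_smul, Real.norm_of_nonneg hs0.le, inner_neg_right, real_inner_smul_right] at h1
  have h2 := hf.2 (mem_univ (x + v)) (mem_univ (x + -(s • v)))
    (show 0 ≤ s / (1 + s) by positivity) (show 0 ≤ 1 / (1 + s) by positivity) (by field_simp; ring)
  have e1 : (s / (1 + s)) • (x + v) + (1 / (1 + s)) • (x + -(s • v)) = x := by
    rw [smul_add, smul_add, smul_neg, smul_smul]
    have a1 : 1 / (1 + s) * s = s / (1 + s) := by ring
    have a2 : (s / (1 + s)) • x + (1 / (1 + s)) • x = x := by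
      rw [← add_smul]
      have : s / (1 + s) + 1 / (1 + s) = 1 := by field_simp; ring
      rw [this, one_smul]
    rw [a1]; nth_rewrite 3 [← a2]; abel
  rw [e1, smul_eq_mul, smul_eq_mul] at h2
  have h3 : f x * (1 + s) ≤ s * f (x + v) + f (x + -(s • v)) := by
    have := mul_le_mul_of_nonneg_right h2 (show 0 ≤ 1 + s by positivity)
    have e2 : (s / (1 + s) * f (x + v) + 1 / (1 + s) * f (x + -(s • v))) * (1 + s)
      = s * f (x + v) + f (x + -(s • v)) := by field_simp
    linarith
  have h4 : s * (f x + ⟪q, v⟫) ≤ s * (f (x + v) + ε) := by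
    have : s * (s * (1 / 2 * ‖v‖ ^ 2)) ≤ s * ε := by gcongr
    nlinarith
  exact le_of_mul_le_mul_left h4 hs0

variable [FiniteDimensional ℝ E]

lemma exists_prox {f : E → ℝ} (hf : ConvexOn ℝ univ f) {c : E} {R : ℝ} (hR : 0 < R) (z : E) :
    ∃ x ∈ closedBall c R, ∀ y ∈ closedBall c R, ⟪z - x, y - x⟫ ≤ f y - f x := by
  have hfc : Continuous f := continuousOn_univ.1 (hf.continuousOn isOpen_univ)
  obtain ⟨x, hx, hmin⟩ := (isCompact_closedBall c R).exists_isMinOn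
    (nonempty_closedBall.2 hR.le)
    (f := fun y => f y + 1 / 2 * ‖y - z‖ ^ 2) (by fun_prop)
  refine ⟨x, hx, fun y hy => ?_⟩
  refine le_of_forall_pos_le_add fun ε hε => ?_
  obtain ⟨s, hs0, hs1, hsε⟩ : ∃ s : ℝ, 0 < s ∧ s ≤ 1 ∧ s * (1 / 2 * ‖y - x‖ ^ 2) ≤ ε := by
    refine ⟨min 1 (ε / (1 / 2 * ‖y - x‖ ^ 2 + 1)), by positivity, min_le_left _ _, ?_⟩
    have h1 : min 1 (ε / (1 / 2 * ‖y - x‖ ^ 2 + 1)) ≤ ε / (1 / 2 * ‖y - x‖ ^ 2 + 1) :=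
      min_le_right _ _
    have h2 : ε / (1 / 2 * ‖y - x‖ ^ 2 + 1) * (1 / 2 * ‖y - x‖ ^ 2 + 1) = ε := by field_simp
    have h3 : 0 ≤ ε / (1 / 2 * ‖y - x‖ ^ 2 + 1) := by positivity
    nlinarith [sq_nonneg ‖y - x‖]
  have hmem : (1 - s) • x + s • y ∈ closedBall c R :=
    (convex_closedBall c R) hx hy (by linarith) hs0.le (by ring)
  have h1 := hmin hmem
  have h2 := hf.2 (mem_univ x) (mem_univ y) (sub_nonneg.2 hs1) hs0.le (by ring)
  have e1 : (1 - s) • x + s • y - z = s • (y - x) - (z - x) := by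
    rw [sub_smul, one_smul, smul_sub]; abel
  simp only [Set.mem_ofPred_eq] at h1
  rw [e1, norm_sub_sq_real (s • (y - x)), norm_sub_rev x z, norm_smul, Real.norm_of_nonneg hs0.le,
    real_inner_smul_left, real_inner_comm] at h1
  rw [smul_eq_mul, smul_eq_mul] at h2
  have h3 : s * ⟪z - x, y - x⟫ ≤ s * (f y - f x + ε) := by
    have : s * (s * (1 / 2 * ‖y - x‖ ^ 2)) ≤ s * ε := by gcongr
    nlinarith
  exact le_of_mul_le_mul_left h3 hs0

open MeasureTheory in
lemma exists_small_not_mem_image {P : E → E} (hP : LipschitzWith 1 P) {δ : ℝ} (hδ : 0 < δ) :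
    ∃ p : E, ‖p‖ < δ ∧ ∀ z, z - (2 : ℝ) • P z = p → DifferentiableAt ℝ P z := by
  let _ : MeasurableSpace E := borel E
  have _ : BorelSpace E := ⟨rfl⟩
  set d : ℝ := (Module.finrank ℝ E : ℝ) with hd
  have _ : (μH[d] : Measure E).IsAddHaarMeasure := by
    rw [hd]; infer_instance
  have hnull : (μH[d] : Measure E) {z | ¬ DifferentiableAt ℝ P z} = 0 :=
    hP.ae_differentiableAt (μ := (μH[d] : Measure E))
  have hG : LipschitzWith 3 (fun z => z - (2 : ℝ) • P z) := by
    refine LipschitzWith.of_dist_le_mul fun x y => ?_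
    rw [dist_eq_norm, dist_eq_norm]
    have e : x - (2 : ℝ) • P x - (y - (2 : ℝ) • P y) = (x - y) - (2 : ℝ) • (P x - P y) := by
      rw [smul_sub]; abel
    have h2 := hP.dist_le_mul x y
    rw [dist_eq_norm, dist_eq_norm] at h2
    rw [e]
    refine (norm_sub_le _ _).trans ?_
    rw [norm_smul]; norm_num at h2 ⊢; linarith
  have him : (μH[d] : Measure E)
      ((fun z => z - (2 : ℝ) • P z) '' {z | ¬ DifferentiableAt ℝ P z}) = 0 := by
    have := hG.hausdorffMeasure_image_le (d := d) (by positivity) {z | ¬ DifferentiableAt ℝ P z}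
    rw [hnull, mul_zero] at this
    exact le_antisymm this bot_le
  by_contra! hcon
  have hsub : ball (0 : E) δ ⊆ (fun z => z - (2 : ℝ) • P z) '' {z | ¬ DifferentiableAt ℝ P z} := by
    intro p hp
    obtain ⟨z, hz, hnd⟩ := hcon p (by simpa using hp)
    exact ⟨z, hnd, hz⟩
  have h0 := measure_mono_null hsub him
  exact (isOpen_ball.measure_pos (μH[d] : Measure E) (nonempty_ball.2 hδ)).ne' h0

set_option maxHeartbeats 800000 in
/-- Jensen's lemma combined with Alexandrov's theorem, for functions with `w + ‖·‖²/2` convex. -/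
lemma jensen_alexandrov_one {w : E → ℝ} {R : ℝ} (hR : 0 < R)
    (hw : ConvexOn ℝ univ (fun x => w x + 1 / 2 * ‖x‖ ^ 2)) {c : E}
    (hmax : ∀ y ∈ closedBall c R, y ≠ c → w y < w c) {η : ℝ} (hη : 0 < η) :
    ∃ (x p : E) (Q : E →L[ℝ] E), ‖x - c‖ < η ∧ ‖p‖ < η ∧
      (∀ y ∈ closedBall c R, w y ≤ w x + ⟪p, y - x⟫) ∧
      ∀ ε > 0, ∃ δ > 0, ∀ v, ‖v‖ < δ →
        |w (x + v) - w x - ⟪p, v⟫ - 1 / 2 * ⟪Q v, v⟫| ≤ ε * ‖v‖ ^ 2 := by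
  set f : E → ℝ := fun x => w x + 1 / 2 * ‖x‖ ^ 2 with hf
  have hfc : Continuous f := continuousOn_univ.1 (hw.continuousOn isOpen_univ)
  have hwc : Continuous w := by
    have : w = fun x => f x - 1 / 2 * ‖x‖ ^ 2 := by funext x; simp [hf]
    rw [this]; fun_prop
  choose P hPmem hPVI using fun z => exists_prox hw (c := c) hR z
  have hPL : ∀ z₁ z₂, ‖P z₁ - P z₂‖ ≤ ‖z₁ - z₂‖ := fun z₁ z₂ =>
    prox_lipschitz (hPVI z₁ _ (hPmem z₂)) (hPVI z₂ _ (hPmem z₁))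
  have hPLip : LipschitzWith 1 P := LipschitzWith.of_dist_le_mul fun x y => by
    rw [dist_eq_norm, dist_eq_norm]; simpa using hPL x y
  -- gap
  set ρ := min (η / 2) (R / 2) with hρ
  have hρp : 0 < ρ := by positivity
  obtain ⟨m, hm, hgap⟩ : ∃ m > 0, ∀ y ∈ closedBall c R, ρ ≤ ‖y - c‖ → w y ≤ w c - m := by
    set K := closedBall c R \ ball c ρ with hK
    have hKc : IsCompact K := (isCompact_closedBall c R).diff isOpen_ball
    rcases K.eq_empty_or_nonempty with he | hne
    · refine ⟨1, one_pos, fun y hy hyc => ?_⟩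
      exfalso
      have : y ∈ K := ⟨hy, by rw [mem_ball, dist_eq_norm]; exact not_lt.2 hyc⟩
      rw [he] at this; exact this
    · obtain ⟨y₀, hy₀, hy₀m⟩ := hKc.exists_isMaxOn hne hwc.continuousOn
      have hne' : y₀ ≠ c := by
        rintro rfl
        exact hy₀.2 (mem_ball_self hρp)
      refine ⟨w c - w y₀, sub_pos.2 (hmax _ hy₀.1 hne'), fun y hy hyc => ?_⟩
      have := hy₀m (show y ∈ K from ⟨hy, by rw [mem_ball, dist_eq_norm]; exact not_lt.2 hyc⟩)
      simp only [Set.mem_ofPred_eq] at this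
      linarith
  obtain ⟨p, hp, hpd⟩ := exists_small_not_mem_image hPLip (δ := min η (m / R)) (by positivity)
  have hpR : ‖p‖ * R < m := by
    have := hp.trans_le (min_le_right _ _)
    rwa [lt_div_iff₀ hR] at this
  obtain ⟨x, hx, hxmax⟩ := (isCompact_closedBall c R).exists_isMaxOn
    (nonempty_closedBall.2 hR.le) (f := fun y => w y - ⟪p, y⟫) (by fun_prop)
  have hxm : ∀ y ∈ closedBall c R, w y ≤ w x + ⟪p, y - x⟫ := by
    intro y hy
    have := hxmax hy
    simp only [Set.mem_ofPred_eq] at this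
    rw [inner_sub_right]; linarith
  have hxc : ‖x - c‖ < ρ := by
    by_contra! hcon
    have h1 := hgap x hx hcon
    have h2 := hxm c (mem_closedBall_self hR.le)
    have h3 : ⟪p, c - x⟫ ≤ ‖p‖ * R := by
      refine (real_inner_le_norm _ _).trans ?_
      gcongr
      rw [norm_sub_rev, ← dist_eq_norm]; exact hx
    linarith
  have hball : ∀ v, ‖v‖ ≤ R / 2 → x + v ∈ closedBall c R := by
    intro v hv
    rw [mem_closedBall, dist_eq_norm]
    have e : x + v - c = (x - c) + v := by abel
    rw [e]
    refine (norm_add_le _ _).trans ?_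
    have : ρ ≤ R / 2 := min_le_right _ _
    linarith
  have htouch : ∀ v, ‖v‖ ≤ R / 2 → f (x + v) ≤ f x + ⟪x + p, v⟫ + 1 / 2 * ‖v‖ ^ 2 := by
    intro v hv
    have := hxm _ (hball v hv)
    rw [add_sub_cancel_left] at this
    simp only [hf]
    rw [norm_add_sq_real, inner_add_left]; linarith
  have hsub := subgradient_of_touch hw (by positivity : 0 < R / 2) htouch
  have hPz : P ((2 : ℝ) • x + p) = x := by
    have h1 := hPVI ((2 : ℝ) • x + p) x hx
    have h2 : ⟪(2 : ℝ) • x + p - x, P ((2 : ℝ) • x + p) - x⟫ ≤ f (P ((2 : ℝ) • x + p)) - f x := by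
      have := hsub (P ((2 : ℝ) • x + p) - x)
      rw [add_sub_cancel] at this
      have e : (2 : ℝ) • x + p - x = x + p := by rw [two_smul]; abel
      rw [e]; simp only [hf] at this ⊢; linarith
    have := prox_lipschitz h1 h2
    rw [sub_self, norm_zero] at this
    exact sub_eq_zero.1 (norm_le_zero_iff.1 this)
  set z := (2 : ℝ) • x + p with hz
  have hdiff := hpd z (by rw [hPz, hz]; abel)
  obtain ⟨Q, hQ⟩ := second_order_of_prox (f := fun v => f (x + v) - f x - ⟪x + p, v⟫)
    (P := fun ζ => P (z + ζ) - x) (D := fderiv ℝ P z) (r := R / 2) (by positivity)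
    (by
      refine ⟨convex_univ, fun u _ v _ a b ha hb hab => ?_⟩
      have h := hw.2 (mem_univ (x + u)) (mem_univ (x + v)) ha hb hab
      have e : a • (x + u) + b • (x + v) = x + (a • u + b • v) := by
        rw [smul_add, smul_add]
        have : a • x + b • x = x := by rw [← add_smul, hab, one_smul]
        nth_rewrite 3 [← this]; abel
      rw [e, smul_eq_mul, smul_eq_mul] at h
      simp only [smul_eq_mul, inner_add_right, real_inner_smul_right]
      have : f x = a * f x + b * f x := by rw [← add_mul, hab, one_mul]
      simp only [hf] at h this ⊢
      linarith)
    (fun v => by have := hsub v; simp only [hf] at this ⊢; linarith)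
    (fun v hv => by have := htouch v hv; linarith)
    (by simp [hPz])
    (by
      have h1 : HasFDerivAt P (fderiv ℝ P z) (z + 0) := by rw [add_zero]; exact hdiff.hasFDerivAt
      have h2 : HasFDerivAt (fun ζ : E => z + ζ) (ContinuousLinearMap.id ℝ E) 0 :=
        (hasFDerivAt_id _).const_add z
      have := (h1.comp (0 : E) h2).sub_const x
      simpa using this)
    (fun ζ ξ => by simpa using hPL (z + ζ) (z + ξ))
    (by
      intro ζ y hy
      have h := hPVI (z + ζ) (x + y) (hball y hy)
      have e1 : z + ζ - P (z + ζ) = (ζ - (P (z + ζ) - x)) + (x + p) := by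
        rw [hz, two_smul]; abel
      have e2 : x + y - P (z + ζ) = y - (P (z + ζ) - x) := by abel
      rw [e1, e2, inner_add_left] at h
      rw [inner_sub_right (x + p)] at h
      have e3 : x + (P (z + ζ) - x) = P (z + ζ) := by abel
      simp only [e3]
      simp only [hf] at h ⊢
      linarith)
  refine ⟨x, p, Q - ContinuousLinearMap.id ℝ E, hxc.trans_le ?_, hp.trans_le (min_le_left _ _),
    hxm, fun ε hε => ?_⟩
  · rw [hρ]; exact (min_le_left _ _).trans (by linarith)
  obtain ⟨δ, hδ, H⟩ := hQ ε hε
  refine ⟨δ, hδ, fun v hv => ?_⟩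
  have := H v hv
  convert this using 2
  simp only [hf, sub_apply, ContinuousLinearMap.id_apply, inner_sub_left, inner_add_left,
    norm_add_sq_real, real_inner_self_eq_norm_sq]
  ring

/-- Jensen's lemma combined with Alexandrov's theorem, for semiconvex functions. -/
lemma jensen_alexandrov {w : E → ℝ} {R Λ : ℝ} (hR : 0 < R) (hΛ : 0 < Λ)
    (hw : ConvexOn ℝ univ (fun x => w x + Λ / 2 * ‖x‖ ^ 2)) {c : E}
    (hmax : ∀ y ∈ closedBall c R, y ≠ c → w y < w c) {η : ℝ} (hη : 0 < η) :
    ∃ (x p : E) (Q : E →L[ℝ] E), ‖x - c‖ < η ∧ ‖p‖ < η ∧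
      (∀ y ∈ closedBall c R, w y ≤ w x + ⟪p, y - x⟫) ∧
      ∀ ε > 0, ∃ δ > 0, ∀ v, ‖v‖ < δ →
        |w (x + v) - w x - ⟪p, v⟫ - 1 / 2 * ⟪Q v, v⟫| ≤ ε * ‖v‖ ^ 2 := by
  have hw' : ConvexOn ℝ univ (fun x => Λ⁻¹ * w x + 1 / 2 * ‖x‖ ^ 2) := by
    have := hw.smul (inv_nonneg.2 hΛ.le)
    refine this.congr fun x _ => ?_
    simp only [smul_eq_mul]; field_simp
  obtain ⟨x, p, Q, h1, h2, h3, h4⟩ := jensen_alexandrov_one hR hw' (c := c)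
    (fun y hy hyc => by have := hmax y hy hyc; gcongr) (η := min η (η / Λ)) (by positivity)
  refine ⟨x, Λ • p, Λ • Q, h1.trans_le (min_le_left _ _), ?_, fun y hy => ?_, fun ε hε => ?_⟩
  · rw [norm_smul, Real.norm_of_nonneg hΛ.le]
    have := h2.trans_le (min_le_right _ _)
    rw [lt_div_iff₀ hΛ] at this; linarith
  · have := mul_le_mul_of_nonneg_left (h3 y hy) hΛ.le
    rw [mul_add, mul_inv_cancel_left₀ hΛ.ne', mul_inv_cancel_left₀ hΛ.ne'] at this
    rwa [real_inner_smul_left]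
  · obtain ⟨δ, hδ, H⟩ := h4 (ε / Λ) (by positivity)
    refine ⟨δ, hδ, fun v hv => ?_⟩
    have := mul_le_mul_of_nonneg_left (H v hv) hΛ.le
    rw [← abs_of_pos hΛ, ← abs_mul, abs_of_pos hΛ] at this
    have e1 : Λ * (Λ⁻¹ * w (x + v) - Λ⁻¹ * w x - ⟪p, v⟫ - 1 / 2 * ⟪Q v, v⟫)
      = w (x + v) - w x - ⟪Λ • p, v⟫ - 1 / 2 * ⟪(Λ • Q) v, v⟫ := by
      rw [smul_apply, real_inner_smul_left, real_inner_smul_left]; field_simp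
    have e2 : Λ * (ε / Λ * ‖v‖ ^ 2) = ε * ‖v‖ ^ 2 := by field_simp
    rwa [e1, e2] at this
end Jensen

section Sums
variable {E : Type*} [NormedAddCommGroup E] [InnerProductSpace ℝ E]

lemma norm_sq_convex_comb (x y : E) {a b : ℝ} (hab : a + b = 1) :
    ‖a • x + b • y‖ ^ 2 = a * ‖x‖ ^ 2 + b * ‖y‖ ^ 2 - a * b * ‖x - y‖ ^ 2 := by
  rw [norm_add_sq_real, norm_sub_sq_real, norm_smul, norm_smul, real_inner_smul_left,
    real_inner_smul_right, mul_pow, mul_pow, Real.norm_eq_abs, Real.norm_eq_abs, sq_abs, sq_abs]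
  obtain rfl : b = 1 - a := by linarith
  ring

/-- `u` is the sup-convolution of `U` over `K` with parameter `lam`. -/
structure IsSupConv (K : Set E) (U : E → ℝ) (lam : ℝ) (u : E → ℝ) : Prop where
  le : ∀ z, ∀ k ∈ K, U k - lam / 2 * ‖z - k‖ ^ 2 ≤ u z
  attained : ∀ z, ∃ k ∈ K, u z = U k - lam / 2 * ‖z - k‖ ^ 2

lemma IsSupConv.semiconvex {K : Set E} {U u : E → ℝ} {lam : ℝ} (h : IsSupConv K U lam u)
    (x y : E) {a b : ℝ} (ha : 0 ≤ a) (hb : 0 ≤ b) (hab : a + b = 1) :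
    u (a • x + b • y) ≤ a * u x + b * u y + lam / 2 * (a * b * ‖x - y‖ ^ 2) := by
  obtain ⟨k, hk, e⟩ := h.attained (a • x + b • y)
  have h1 := mul_le_mul_of_nonneg_left (h.le x k hk) ha
  have h2 := mul_le_mul_of_nonneg_left (h.le y k hk) hb
  have e1 : a • x + b • y - k = a • (x - k) + b • (y - k) := by
    rw [smul_sub, smul_sub]
    have : a • k + b • k = k := by rw [← add_smul, hab, one_smul]
    nth_rewrite 1 [← this]; abel
  rw [e, e1, norm_sq_convex_comb _ _ hab, sub_sub_sub_cancel_right]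
  have : U k = a * U k + b * U k := by rw [← add_mul, hab, one_mul]
  nlinarith

/-- Comparison of second order jets. -/
lemma jet_lower {g : E → ℝ} {p q : E} {Q : E →L[ℝ] E} {lam r : ℝ} (hr : 0 < r)
    (hexp : ∀ ε > 0, ∃ δ > 0, ∀ v, ‖v‖ < δ →
      |g v - ⟪p, v⟫ - 1 / 2 * ⟪Q v, v⟫| ≤ ε * ‖v‖ ^ 2)
    (hlow : ∀ v, ‖v‖ < r → ⟪q, v⟫ - lam / 2 * ‖v‖ ^ 2 ≤ g v) :
    p = q ∧ ∀ v, - lam * ‖v‖ ^ 2 ≤ ⟪Q v, v⟫ := by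
  have key : ∀ v : E, ∀ ε > 0, ∃ s₀ > 0, ∀ s : ℝ, 0 < s → s < s₀ →
      s * ⟪q - p, v⟫ ≤ s ^ 2 * (lam / 2 * ‖v‖ ^ 2 + 1 / 2 * ⟪Q v, v⟫ + ε * ‖v‖ ^ 2) := by
    intro v ε hε
    obtain ⟨δ, hδ, H⟩ := hexp ε hε
    refine ⟨min δ r / (‖v‖ + 1), by positivity, fun s hs hs' => ?_⟩
    rw [lt_div_iff₀ (by positivity)] at hs'
    have hn : ‖s • v‖ = s * ‖v‖ := by rw [norm_smul, Real.norm_of_nonneg hs.le]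
    have hlt : ‖s • v‖ < min δ r := by rw [hn]; nlinarith
    have h1 := (abs_le.1 (H _ (hlt.trans_le (min_le_left _ _)))).2
    have h2 := hlow _ (hlt.trans_le (min_le_right _ _))
    rw [hn, map_smul, real_inner_smul_right, real_inner_smul_left, real_inner_smul_right] at h1
    rw [hn, real_inner_smul_right] at h2
    rw [inner_sub_left]; nlinarith
  have hp : p = q := by
    have h0 : ∀ v, ⟪q - p, v⟫ ≤ 0 := by
      intro v
      obtain ⟨s₀, hs₀, H⟩ := key v 1 one_pos
      refine le_of_forall_pos_le_add fun ε hε => ?_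
      set c := lam / 2 * ‖v‖ ^ 2 + 1 / 2 * ⟪Q v, v⟫ + 1 * ‖v‖ ^ 2
      have hsp : 0 < min (s₀ / 2) (ε / (|c| + 1)) := by positivity
      have h1 := H _ hsp ((min_le_left _ _).trans_lt (by linarith))
      have h2 : min (s₀ / 2) (ε / (|c| + 1)) * (|c| + 1) ≤ ε := by
        rw [← le_div_iff₀ (by positivity)]; exact min_le_right _ _
      have h3 : ⟪q - p, v⟫ ≤ min (s₀ / 2) (ε / (|c| + 1)) * c := by
        rw [pow_two, mul_assoc] at h1; exact le_of_mul_le_mul_left h1 hsp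
      nlinarith [le_abs_self c]
    have := h0 (q - p)
    rw [real_inner_self_eq_norm_sq] at this
    have h3 : ‖q - p‖ = 0 := by nlinarith [norm_nonneg (q - p)]
    exact (sub_eq_zero.1 (norm_eq_zero.1 h3)).symm
  refine ⟨hp, fun v => ?_⟩
  refine le_of_forall_pos_le_add fun ε hε => ?_
  obtain ⟨s₀, hs₀, H⟩ := key v (ε / (2 * (‖v‖ ^ 2 + 1))) (by positivity)
  have h1 := H (s₀ / 2) (by linarith) (by linarith)
  rw [hp, sub_self, inner_zero_left, mul_zero] at h1
  have h2 := nonneg_of_mul_nonneg_right h1 (by positivity)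
  have h3 : ε / (2 * (‖v‖ ^ 2 + 1)) * ‖v‖ ^ 2 ≤ ε / 2 := by
    rw [div_mul_eq_mul_div, div_le_iff₀ (by positivity)]; nlinarith [sq_nonneg ‖v‖]
  linarith

/-- The one-function part of the theorem on sums: a second order expansion of the
sup-convolution transfers to the original function. -/
lemma IsSupConv.transfer {K : Set E} {U u : E → ℝ} {lam : ℝ} (h : IsSupConv K U lam u)
    {z p : E} {X : E →L[ℝ] E}
    (hexp : ∀ ε > 0, ∃ δ > 0, ∀ v, ‖v‖ < δ →
      |u (z + v) - u z - ⟪p, v⟫ - 1 / 2 * ⟪X v, v⟫| ≤ ε * ‖v‖ ^ 2) :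
    ∃ k ∈ K, p = lam • (k - z) ∧ (∀ v, - lam * ‖v‖ ^ 2 ≤ ⟪X v, v⟫) ∧
      ∀ ε > 0, ∃ δ > 0, ∀ k' ∈ K, ‖k' - k‖ < δ →
        U k' ≤ U k + ⟪p, k' - k⟫ + 1 / 2 * ⟪X (k' - k), k' - k⟫ + ε * ‖k' - k‖ ^ 2 := by
  obtain ⟨k, hk, e⟩ := h.attained z
  have hl : ∀ v, ‖v‖ < 1 → ⟪lam • (k - z), v⟫ - lam / 2 * ‖v‖ ^ 2 ≤ u (z + v) - u z := by
    intro v _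
    have h1 := h.le (z + v) k hk
    have e1 : z + v - k = v - (k - z) := by abel
    rw [e1, norm_sub_sq_real] at h1
    rw [e, real_inner_smul_left, norm_sub_rev z k, real_inner_comm]
    nlinarith
  obtain ⟨hp, hX⟩ := jet_lower (g := fun v => u (z + v) - u z) one_pos hexp hl
  refine ⟨k, hk, hp, hX, fun ε hε => ?_⟩
  obtain ⟨δ, hδ, H⟩ := hexp ε hε
  refine ⟨δ, hδ, fun k' hk' hd => ?_⟩
  have h1 := (abs_le.1 (H _ hd)).2
  have h2 := h.le (z + (k' - k)) k' hk'
  have e1 : z + (k' - k) - k' = z - k := by abel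
  rw [e1] at h2
  linarith

lemma form_le_of_expansion {g : E × E → ℝ} {X Y : E →L[ℝ] E} {S : E → E → ℝ}
    (hS : ∀ s : ℝ, ∀ a b, S (s • a) (s • b) = s ^ 2 * S a b) {r : ℝ} (hr : 0 < r)
    (hexp : ∀ ε > 0, ∃ δ > 0, ∀ a b, ‖a‖ < δ → ‖b‖ < δ →
      |g (a, b) - 1 / 2 * ⟪X a, a⟫ - 1 / 2 * ⟪Y b, b⟫| ≤ ε * (‖a‖ ^ 2 + ‖b‖ ^ 2))
    (hle : ∀ a b, ‖a‖ < r → ‖b‖ < r → g (a, b) ≤ 1 / 2 * S a b) (a b : E) :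
    ⟪X a, a⟫ + ⟪Y b, b⟫ ≤ S a b := by
  refine le_of_forall_pos_le_add fun ε hε => ?_
  obtain ⟨δ, hδ, H⟩ := hexp (ε / (2 * (‖a‖ ^ 2 + ‖b‖ ^ 2 + 1))) (by positivity)
  set s := min δ r / (2 * (‖a‖ + ‖b‖ + 1)) with hs
  have hm : 0 < min δ r := by positivity
  have hsp : 0 < s := by positivity
  have hs1 : s * (2 * (‖a‖ + ‖b‖ + 1)) = min δ r := by rw [hs]; field_simp
  have hna : ‖s • a‖ = s * ‖a‖ := by rw [norm_smul, Real.norm_of_nonneg hsp.le]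
  have hnb : ‖s • b‖ = s * ‖b‖ := by rw [norm_smul, Real.norm_of_nonneg hsp.le]
  have hla : ‖s • a‖ < min δ r := by
    rw [hna]; nlinarith [norm_nonneg a, norm_nonneg b, mul_nonneg hsp.le (norm_nonneg a),
      mul_nonneg hsp.le (norm_nonneg b)]
  have hlb : ‖s • b‖ < min δ r := by
    rw [hnb]; nlinarith [norm_nonneg a, norm_nonneg b, mul_nonneg hsp.le (norm_nonneg a),
      mul_nonneg hsp.le (norm_nonneg b)]
  have h1 := (abs_le.1 (H _ _ (hla.trans_le (min_le_left _ _)) (hlb.trans_le (min_le_left _ _)))).1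
  have h2 := hle _ _ (hla.trans_le (min_le_right _ _)) (hlb.trans_le (min_le_right _ _))
  rw [hS] at h2
  rw [hna, hnb, map_smul, map_smul, real_inner_smul_left, real_inner_smul_right,
    real_inner_smul_left, real_inner_smul_right] at h1
  have h3 : ε / (2 * (‖a‖ ^ 2 + ‖b‖ ^ 2 + 1)) * (‖a‖ ^ 2 + ‖b‖ ^ 2) ≤ ε / 2 := by
    rw [div_mul_eq_mul_div, div_le_iff₀ (by positivity)]; nlinarith [sq_nonneg ‖a‖, sq_nonneg ‖b‖]
  have h4 : s ^ 2 * (⟪X a, a⟫ + ⟪Y b, b⟫) ≤ s ^ 2 * (S a b + ε) := by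
    have := mul_le_mul_of_nonneg_left h3 (sq_nonneg s)
    nlinarith
  exact le_of_mul_le_mul_left h4 (by positivity)

set_option maxHeartbeats 1600000 in
/-- The theorem on sums, for sup-convolutions. -/
lemma theorem_on_sums [FiniteDimensional ℝ E] {K₁ K₂ : Set E} {U V u v : E → ℝ} {lam : ℝ}
    (hlam : 0 < lam) (hu : IsSupConv K₁ U lam u) (hv : IsSupConv K₂ V lam v) {z₀ ζ₀ p q : E}
    {L : E →L[ℝ] E} {r : ℝ} (hr : 0 < r)
    (hmax : ∀ a b, ‖a‖ < r → ‖b‖ < r →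
      u (z₀ + a) + v (ζ₀ + b) ≤ u z₀ + v ζ₀ + ⟪p, a⟫ + ⟪q, b⟫ + 1 / 2 * ‖L (a - b)‖ ^ 2)
    {η : ℝ} (hη : 0 < η) :
    ∃ k ∈ K₁, ∃ l ∈ K₂, ∃ (p' q' : E) (X Y : E →L[ℝ] E),
      ‖k - (z₀ + lam⁻¹ • p)‖ < η ∧ ‖l - (ζ₀ + lam⁻¹ • q)‖ < η ∧ ‖p' - p‖ < η ∧ ‖q' - q‖ < η ∧
      (∀ a, - lam * ‖a‖ ^ 2 ≤ ⟪X a, a⟫) ∧ (∀ b, - lam * ‖b‖ ^ 2 ≤ ⟪Y b, b⟫) ∧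
      (∀ a b, ⟪X a, a⟫ + ⟪Y b, b⟫ ≤ ‖L (a - b)‖ ^ 2 + η * (‖a‖ ^ 2 + ‖b‖ ^ 2)) ∧
      (∀ ε > 0, ∃ δ > 0, ∀ k' ∈ K₁, ‖k' - k‖ < δ →
        U k' ≤ U k + ⟪p', k' - k⟫ + 1 / 2 * ⟪X (k' - k), k' - k⟫ + ε * ‖k' - k‖ ^ 2) ∧
      (∀ ε > 0, ∃ δ > 0, ∀ l' ∈ K₂, ‖l' - l‖ < δ →
        V l' ≤ V l + ⟪q', l' - l⟫ + 1 / 2 * ⟪Y (l' - l), l' - l⟫ + ε * ‖l' - l‖ ^ 2) := by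
  set w : WithLp 2 (E × E) → ℝ := fun x =>
    u (z₀ + x.fst) + v (ζ₀ + x.snd) - ⟪p, x.fst⟫ - ⟪q, x.snd⟫ - 1 / 2 * ‖L (x.fst - x.snd)‖ ^ 2
      - η / 2 * (‖x.fst‖ ^ 2 + ‖x.snd‖ ^ 2) with hw
  set Λ : ℝ := lam + η + 2 * ‖L‖ ^ 2 with hΛ
  have hnsq : ∀ x : WithLp 2 (E × E), ‖x‖ ^ 2 = ‖x.fst‖ ^ 2 + ‖x.snd‖ ^ 2 :=
    fun x => WithLp.prod_norm_sq_eq_of_L2 x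
  have hΛp : 0 < Λ := by positivity
  have hconv : ConvexOn ℝ univ (fun x => w x + Λ / 2 * ‖x‖ ^ 2) := by
    refine ⟨convex_univ, fun x _ y _ a b ha hb hab => ?_⟩
    have a1 : z₀ + (a • x + b • y).fst = a • (z₀ + x.fst) + b • (z₀ + y.fst) := by
      have : a • z₀ + b • z₀ = z₀ := by rw [← add_smul, hab, one_smul]
      nth_rewrite 1 [← this]
      simp only [WithLp.add_fst, WithLp.smul_fst, smul_add]; abel
    have a2 : ζ₀ + (a • x + b • y).snd = a • (ζ₀ + x.snd) + b • (ζ₀ + y.snd) := by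
      have : a • ζ₀ + b • ζ₀ = ζ₀ := by rw [← add_smul, hab, one_smul]
      nth_rewrite 1 [← this]
      simp only [WithLp.add_snd, WithLp.smul_snd, smul_add]; abel
    have h1 := hu.semiconvex (z₀ + x.fst) (z₀ + y.fst) ha hb hab
    have h2 := hv.semiconvex (ζ₀ + x.snd) (ζ₀ + y.snd) ha hb hab
    rw [add_sub_add_left_eq_sub] at h1 h2
    have a3 : L ((a • x + b • y).fst - (a • x + b • y).snd)
        = a • L (x.fst - x.snd) + b • L (y.fst - y.snd) := by
      rw [← map_smul, ← map_smul, ← map_add]; congr 1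
      simp only [WithLp.add_fst, WithLp.smul_fst, WithLp.add_snd, WithLp.smul_snd, smul_sub]; abel
    have h3 := norm_sq_convex_comb (L (x.fst - x.snd)) (L (y.fst - y.snd)) hab
    have h4 := norm_sq_convex_comb x.fst y.fst hab
    have h5 := norm_sq_convex_comb x.snd y.snd hab
    have h6 : ‖L (x.fst - x.snd) - L (y.fst - y.snd)‖ ^ 2
        ≤ 2 * ‖L‖ ^ 2 * (‖x.fst - y.fst‖ ^ 2 + ‖x.snd - y.snd‖ ^ 2) := by
      rw [← map_sub]
      have e : x.fst - x.snd - (y.fst - y.snd) = (x.fst - y.fst) - (x.snd - y.snd) := by abel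
      rw [e]
      have b1 := L.le_opNorm ((x.fst - y.fst) - (x.snd - y.snd))
      have b2 := norm_sub_le (x.fst - y.fst) (x.snd - y.snd)
      have b3 : ‖L (x.fst - y.fst - (x.snd - y.snd))‖
        ≤ ‖L‖ * (‖x.fst - y.fst‖ + ‖x.snd - y.snd‖) := b1.trans (by gcongr)
      have b4 := pow_le_pow_left₀ (norm_nonneg _) b3 2
      refine b4.trans ?_
      rw [mul_pow]
      nlinarith [sq_nonneg (‖x.fst - y.fst‖ - ‖x.snd - y.snd‖), sq_nonneg ‖L‖,
        mul_nonneg (sq_nonneg ‖L‖) (sq_nonneg (‖x.fst - y.fst‖ - ‖x.snd - y.snd‖))]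
    have hab' : 0 ≤ a * b := mul_nonneg ha hb
    have h7 := mul_le_mul_of_nonneg_left h6 hab'
    simp only [hw, smul_eq_mul, hnsq, a1, a2, a3, h3]
    simp only [WithLp.add_fst, WithLp.smul_fst, WithLp.add_snd, WithLp.smul_snd, h4, h5,
      inner_add_right, real_inner_smul_right]
    rw [hΛ]
    nlinarith
  have hw0 : w 0 = u z₀ + v ζ₀ := by simp [hw]
  have hfn : ∀ x : WithLp 2 (E × E), ‖x.fst‖ ≤ ‖x‖ := fun x => by
    have := hnsq x; nlinarith [norm_nonneg x, sq_nonneg ‖x.snd‖, norm_nonneg x.fst]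
  have hsn : ∀ x : WithLp 2 (E × E), ‖x.snd‖ ≤ ‖x‖ := fun x => by
    have := hnsq x; nlinarith [norm_nonneg x, sq_nonneg ‖x.fst‖, norm_nonneg x.snd]
  have hstrict : ∀ y ∈ closedBall (0 : WithLp 2 (E × E)) (r / 2), y ≠ 0 → w y < w 0 := by
    intro y hy hy0
    rw [mem_closedBall, dist_zero_right] at hy
    have := hmax y.fst y.snd ((hfn y).trans_lt (by linarith)) ((hsn y).trans_lt (by linarith))
    rw [hw0]
    have hp : 0 < ‖y‖ ^ 2 := by have := norm_pos_iff.2 hy0; positivity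
    rw [hnsq] at hp
    simp only [hw]
    nlinarith
  set c : ℝ := 1 + ‖(ContinuousLinearMap.adjoint L).comp L‖ * 2 + η with hc
  have hc1 : 1 ≤ c := by
    have := norm_nonneg ((ContinuousLinearMap.adjoint L).comp L)
    linarith
  obtain ⟨x, P, Q, hx, hP, hxm, hQ⟩ := jensen_alexandrov (half_pos hr) hΛp hconv hstrict
    (η := min (min (η / (3 * c)) (r / 8)) (η * lam / (4 * (c + lam)))) (by positivity)
  rw [sub_zero] at hx
  have hx1 := hx.trans_le ((min_le_left _ _).trans (min_le_left _ _))
  have hx2 := hx.trans_le ((min_le_left _ _).trans (min_le_right _ _))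
  have hx3 := hx.trans_le (min_le_right _ _)
  have hP1 := hP.trans_le ((min_le_left _ _).trans (min_le_left _ _))
  have hP3 := hP.trans_le (min_le_right _ _)
  set LL := (ContinuousLinearMap.adjoint L).comp L with hLL
  have hLLi : ∀ a b : E, ⟪L a, L b⟫ = ⟪LL a, b⟫ := fun a b => by
    rw [hLL, ContinuousLinearMap.comp_apply, ContinuousLinearMap.adjoint_inner_left]
  set a₀ := x.fst with ha₀
  set b₀ := x.snd with hb₀
  set p' : E := p + (P.fst + LL (a₀ - b₀) + η • a₀) with hp'
  set q' : E := q + (P.snd - LL (a₀ - b₀) + η • b₀) with hq'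
  have hdn : ‖LL (a₀ - b₀)‖ ≤ ‖LL‖ * (2 * ‖x‖) := by
    refine (LL.le_opNorm _).trans ?_
    gcongr
    refine (norm_sub_le _ _).trans ?_
    linarith [hfn x, hsn x]
  have hpn : ‖p' - p‖ ≤ ‖P‖ + c * ‖x‖ := by
    rw [hp', add_sub_cancel_left]
    refine (norm_add_le _ _).trans ?_
    have h1 := norm_add_le P.fst (LL (a₀ - b₀))
    rw [norm_smul, Real.norm_of_nonneg hη.le, hc]
    nlinarith [hfn x, hfn P, norm_nonneg x]
  have hqn : ‖q' - q‖ ≤ ‖P‖ + c * ‖x‖ := by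
    rw [hq', add_sub_cancel_left]
    refine (norm_add_le _ _).trans ?_
    have h1 := norm_sub_le P.snd (LL (a₀ - b₀))
    rw [norm_smul, Real.norm_of_nonneg hη.le, hc]
    nlinarith [hsn x, hsn P, norm_nonneg x]
  have hsmall : ‖P‖ + c * ‖x‖ < η := by
    rw [lt_div_iff₀ (by positivity)] at hx1 hP1
    nlinarith [norm_nonneg P]
  have hsmall2 : ‖x‖ + lam⁻¹ * (‖P‖ + c * ‖x‖) < η := by
    rw [lt_div_iff₀ (by positivity)] at hx3 hP3
    have : lam * ‖x‖ + (‖P‖ + c * ‖x‖) < lam * η := by nlinarith [norm_nonneg P, norm_nonneg x]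
    have h2 : lam * (‖x‖ + lam⁻¹ * (‖P‖ + c * ‖x‖)) < lam * η := by
      rw [mul_add, mul_inv_cancel_left₀ hlam.ne']; exact this
    exact lt_of_mul_lt_mul_left h2 hlam.le
  let j₁ : E →L[ℝ] WithLp 2 (E × E) :=
    ((WithLp.prodContinuousLinearEquiv 2 ℝ E E).symm : E × E →L[ℝ] WithLp 2 (E × E)).comp
      (ContinuousLinearMap.inl ℝ E E)
  let j₂ : E →L[ℝ] WithLp 2 (E × E) :=
    ((WithLp.prodContinuousLinearEquiv 2 ℝ E E).symm : E × E →L[ℝ] WithLp 2 (E × E)).comp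
      (ContinuousLinearMap.inr ℝ E E)
  have j1f : ∀ a, (j₁ a).fst = a := fun a => rfl
  have j1s : ∀ a, (j₁ a).snd = 0 := fun a => rfl
  have j2f : ∀ a, (j₂ a).fst = 0 := fun a => rfl
  have j2s : ∀ a, (j₂ a).snd = a := fun a => rfl
  have j1n : ∀ a, ‖j₁ a‖ = ‖a‖ := fun a => by
    have := hnsq (j₁ a)
    rw [j1f, j1s, norm_zero] at this
    rw [← sq_eq_sq₀ (norm_nonneg _) (norm_nonneg _)]; simpa using this
  have j2n : ∀ a, ‖j₂ a‖ = ‖a‖ := fun a => by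
    have := hnsq (j₂ a)
    rw [j2f, j2s, norm_zero] at this
    rw [← sq_eq_sq₀ (norm_nonneg _) (norm_nonneg _)]; simpa using this
  set X : E →L[ℝ] E := (ContinuousLinearMap.adjoint j₁).comp (Q.comp j₁) + LL
    + η • ContinuousLinearMap.id ℝ E with hX
  set Y : E →L[ℝ] E := (ContinuousLinearMap.adjoint j₂).comp (Q.comp j₂) + LL
    + η • ContinuousLinearMap.id ℝ E with hY
  have hXf : ∀ a, ⟪X a, a⟫ = ⟪Q (j₁ a), j₁ a⟫ + ‖L a‖ ^ 2 + η * ‖a‖ ^ 2 := fun a => by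
    rw [hX, ← real_inner_self_eq_norm_sq (L a), hLLi, ← real_inner_self_eq_norm_sq a]
    simp only [add_apply, inner_add_left, ContinuousLinearMap.comp_apply,
      ContinuousLinearMap.adjoint_inner_left, smul_apply, ContinuousLinearMap.id_apply,
      real_inner_smul_left]
  have hYf : ∀ a, ⟪Y a, a⟫ = ⟪Q (j₂ a), j₂ a⟫ + ‖L a‖ ^ 2 + η * ‖a‖ ^ 2 := fun a => by
    rw [hY, ← real_inner_self_eq_norm_sq (L a), hLLi, ← real_inner_self_eq_norm_sq a]
    simp only [add_apply, inner_add_left, ContinuousLinearMap.comp_apply,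
      ContinuousLinearMap.adjoint_inner_left, smul_apply, ContinuousLinearMap.id_apply,
      real_inner_smul_left]
  have hPi : ∀ y : WithLp 2 (E × E), ⟪P, y⟫ = ⟪P.fst, y.fst⟫ + ⟪P.snd, y.snd⟫ := fun y =>
    WithLp.prod_inner_apply P y
  have hXexp : ∀ ε > 0, ∃ δ > 0, ∀ a, ‖a‖ < δ →
      |u (z₀ + a₀ + a) - u (z₀ + a₀) - ⟪p', a⟫ - 1 / 2 * ⟪X a, a⟫| ≤ ε * ‖a‖ ^ 2 := by
    intro ε hε
    obtain ⟨δ, hδ, H⟩ := hQ ε hε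
    refine ⟨δ, hδ, fun a ha => ?_⟩
    have h1 := H (j₁ a) (by rwa [j1n])
    rw [j1n] at h1
    convert h1 using 2
    rw [hXf, hPi, j1f, j1s, inner_zero_right]
    simp only [hw, WithLp.add_fst, WithLp.add_snd, j1f, j1s, ← ha₀, ← hb₀, add_zero, hp',
      inner_add_left, inner_add_right, real_inner_smul_left, norm_add_sq_real, ← add_assoc]
    have e : a₀ + a - b₀ = (a₀ - b₀) + a := by abel
    rw [e, map_add, norm_add_sq_real, hLLi]
    ring
  have hYexp : ∀ ε > 0, ∃ δ > 0, ∀ a, ‖a‖ < δ →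
      |v (ζ₀ + b₀ + a) - v (ζ₀ + b₀) - ⟪q', a⟫ - 1 / 2 * ⟪Y a, a⟫| ≤ ε * ‖a‖ ^ 2 := by
    intro ε hε
    obtain ⟨δ, hδ, H⟩ := hQ ε hε
    refine ⟨δ, hδ, fun a ha => ?_⟩
    have h1 := H (j₂ a) (by rwa [j2n])
    rw [j2n] at h1
    convert h1 using 2
    rw [hYf, hPi, j2f, j2s, inner_zero_right]
    simp only [hw, WithLp.add_fst, WithLp.add_snd, j2f, j2s, ← ha₀, ← hb₀, add_zero, hq',
      inner_add_left, inner_sub_left, inner_add_right, real_inner_smul_left, norm_add_sq_real,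
      ← add_assoc]
    have e : a₀ - (b₀ + a) = (a₀ - b₀) - a := by abel
    rw [e, map_sub L (a₀ - b₀) a, norm_sub_sq_real, hLLi]
    ring
  obtain ⟨k, hk, hpk, hXl, hUk⟩ := hu.transfer hXexp
  obtain ⟨l, hl, hql, hYl, hVl⟩ := hv.transfer hYexp
  refine ⟨k, hk, l, hl, p', q', X, Y, ?_, ?_, hpn.trans_lt hsmall, hqn.trans_lt hsmall, hXl, hYl,
    ?_, hUk, hVl⟩
  · have e : k - (z₀ + lam⁻¹ • p) = a₀ + lam⁻¹ • (p' - p) := by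
      rw [hpk, smul_sub, smul_smul, inv_mul_cancel₀ hlam.ne', one_smul]; abel
    rw [e]
    refine (norm_add_le _ _).trans_lt (lt_of_le_of_lt ?_ hsmall2)
    rw [norm_smul, Real.norm_of_nonneg (inv_nonneg.2 hlam.le)]
    gcongr
    exact hfn x
  · have e : l - (ζ₀ + lam⁻¹ • q) = b₀ + lam⁻¹ • (q' - q) := by
      rw [hql, smul_sub, smul_smul, inv_mul_cancel₀ hlam.ne', one_smul]; abel
    rw [e]
    refine (norm_add_le _ _).trans_lt (lt_of_le_of_lt ?_ hsmall2)
    rw [norm_smul, Real.norm_of_nonneg (inv_nonneg.2 hlam.le)]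
    gcongr
    exact hsn x
  · refine form_le_of_expansion (S := fun a b => ‖L (a - b)‖ ^ 2 + η * (‖a‖ ^ 2 + ‖b‖ ^ 2))
      (g := fun y => u (z₀ + a₀ + y.1) - u (z₀ + a₀) - ⟪p', y.1⟫
        + (v (ζ₀ + b₀ + y.2) - v (ζ₀ + b₀) - ⟪q', y.2⟫)) ?_ (by positivity : 0 < r / 8) ?_ ?_
    · intro s a b
      rw [← smul_sub, map_smul, norm_smul, norm_smul, norm_smul, mul_pow, mul_pow, mul_pow,
        Real.norm_eq_abs, sq_abs]
      ring
    · intro ε hε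
      obtain ⟨δ₁, hδ₁, H₁⟩ := hXexp ε hε
      obtain ⟨δ₂, hδ₂, H₂⟩ := hYexp ε hε
      refine ⟨min δ₁ δ₂, by positivity, fun a b ha hb => ?_⟩
      have h1 := abs_le.1 (H₁ a (ha.trans_le (min_le_left _ _)))
      have h2 := abs_le.1 (H₂ b (hb.trans_le (min_le_right _ _)))
      rw [abs_le]; constructor <;> linarith [h1.1, h1.2, h2.1, h2.2]
    · intro a b ha hb
      have hmem : x + (j₁ a + j₂ b) ∈ closedBall (0 : WithLp 2 (E × E)) (r / 2) := by
        rw [mem_closedBall, dist_zero_right]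
        have h1 := norm_add_le x (j₁ a + j₂ b)
        have h2 := norm_add_le (j₁ a) (j₂ b)
        rw [j1n, j2n] at h2
        linarith
      have h1 := hxm _ hmem
      rw [add_sub_cancel_left, inner_add_right, hPi, hPi, j1f, j1s, j2f, j2s, inner_zero_right,
        inner_zero_right] at h1
      simp only [hw, WithLp.add_fst, WithLp.add_snd, j1f, j1s, j2f, j2s, ← ha₀, ← hb₀, add_zero,
        zero_add, inner_add_right, ← add_assoc] at h1
      have e : a₀ + a - (b₀ + b) = (a₀ - b₀) + (a - b) := by abel
      rw [e, map_add, norm_add_sq_real, hLLi, norm_add_sq_real a₀, norm_add_sq_real b₀] at h1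
      simp only [hp', hq', inner_add_left, inner_sub_left, real_inner_smul_left]
      rw [inner_sub_right] at h1
      nlinarith
end Sums

section MatrixForms

/-- The matrix-vector product on Euclidean space. -/
def mv (X : MatN N) (v : EucSp N) : EucSp N := Matrix.toEuclideanCLM (𝕜 := ℝ) X v

/-- The quadratic form of a matrix. -/
def qf (X : MatN N) (v : EucSp N) : ℝ := ⟪mv X v, v⟫

lemma mv_add_left (X Y : MatN N) (v : EucSp N) : mv (X + Y) v = mv X v + mv Y v := by
  simp [mv]
lemma mv_sub_left (X Y : MatN N) (v : EucSp N) : mv (X - Y) v = mv X v - mv Y v := by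
  simp [mv]
lemma mv_neg_left (X : MatN N) (v : EucSp N) : mv (-X) v = -mv X v := by
  simp [mv]
lemma mv_smul_left (c : ℝ) (X : MatN N) (v : EucSp N) : mv (c • X) v = c • mv X v := by
  simp [mv]
lemma mv_one (v : EucSp N) : mv (1 : MatN N) v = v := by
  simp [mv]
lemma mv_zero_left (v : EucSp N) : mv (0 : MatN N) v = 0 := by
  simp [mv]
lemma mv_add (X : MatN N) (v w : EucSp N) : mv X (v + w) = mv X v + mv X w := by
  simp [mv]
lemma mv_sub (X : MatN N) (v w : EucSp N) : mv X (v - w) = mv X v - mv X w := by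
  simp [mv]
lemma mv_smul (c : ℝ) (X : MatN N) (v : EucSp N) : mv X (c • v) = c • mv X v := by
  simp [mv]
lemma mv_zero (X : MatN N) : mv X 0 = 0 := by simp [mv]
lemma mv_mul (X Y : MatN N) (v : EucSp N) : mv (X * Y) v = mv X (mv Y v) := by
  simp [mv]

lemma mv_ext {X Y : MatN N} (h : ∀ v, mv X v = mv Y v) : X = Y :=
  (Matrix.toEuclideanCLM (n := Fin N) (𝕜 := ℝ)).injective (ContinuousLinearMap.ext h)

lemma continuous_mv (X : MatN N) : Continuous (mv X) :=
  (Matrix.toEuclideanCLM (𝕜 := ℝ) X).continuous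

lemma inner_mv_transpose (X : MatN N) (v w : EucSp N) : ⟪mv X.transpose v, w⟫ = ⟪v, mv X w⟫ := by
  have : Matrix.toEuclideanCLM (𝕜 := ℝ) X.transpose
      = ContinuousLinearMap.adjoint (Matrix.toEuclideanCLM (𝕜 := ℝ) X) := by
    rw [← ContinuousLinearMap.star_eq_adjoint, ← map_star, Matrix.star_eq_conjTranspose,
      Matrix.conjTranspose_eq_transpose_of_trivial]
  rw [mv, this, ContinuousLinearMap.adjoint_inner_left, mv]

lemma inner_mv_symm {X : MatN N} (hX : X.IsSymm) (v w : EucSp N) :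
    ⟪mv X v, w⟫ = ⟪v, mv X w⟫ := by
  have := inner_mv_transpose X v w
  rwa [hX.eq] at this

lemma isSymm_of_inner {X : MatN N} (h : ∀ v w, ⟪mv X v, w⟫ = ⟪v, mv X w⟫) : X.IsSymm := by
  refine mv_ext fun v => ext_inner_right ℝ fun w => ?_
  rw [inner_mv_transpose, h]

lemma qf_add_left (X Y : MatN N) (v : EucSp N) : qf (X + Y) v = qf X v + qf Y v := by
  simp [qf, mv_add_left, inner_add_left]
lemma qf_sub_left (X Y : MatN N) (v : EucSp N) : qf (X - Y) v = qf X v - qf Y v := by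
  simp [qf, mv_sub_left, inner_sub_left]
lemma qf_neg_left (X : MatN N) (v : EucSp N) : qf (-X) v = -qf X v := by
  simp [qf, mv_neg_left]
lemma qf_smul_left (c : ℝ) (X : MatN N) (v : EucSp N) : qf (c • X) v = c * qf X v := by
  simp [qf, mv_smul_left, real_inner_smul_left]
lemma qf_one (v : EucSp N) : qf (1 : MatN N) v = ‖v‖ ^ 2 := by
  simp [qf, mv_one]
lemma qf_zero (X : MatN N) : qf X 0 = 0 := by simp [qf]
lemma qf_smul (c : ℝ) (X : MatN N) (v : EucSp N) : qf X (c • v) = c ^ 2 * qf X v := by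
  simp [qf, mv_smul, real_inner_smul_left, real_inner_smul_right]; ring
lemma qf_add {X : MatN N} (hX : X.IsSymm) (v w : EucSp N) :
    qf X (v + w) = qf X v + 2 * ⟪mv X v, w⟫ + qf X w := by
  have h : ⟪mv X w, v⟫ = ⟪mv X v, w⟫ := by
    rw [inner_mv_symm hX, real_inner_comm]
  simp only [qf, mv_add, inner_add_left, inner_add_right, h]; ring

lemma continuous_qf (X : MatN N) : Continuous (qf X) :=
  (continuous_mv X).inner continuous_id

lemma dotProduct_mulVec_eq_qf (X : MatN N) (v : Fin N → ℝ) :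
    dotProduct (star v) (X.mulVec v) = qf X (WithLp.toLp 2 v) := by
  rw [qf, mv, Matrix.toEuclideanCLM_toLp]
  simp [PiLp.inner_apply, dotProduct]

lemma posSemidef_of_qf {X : MatN N} (hX : X.IsSymm) (h : ∀ v, 0 ≤ qf X v) : X.PosSemidef := by
  refine Matrix.PosSemidef.of_dotProduct_mulVec_nonneg ?_ fun v => ?_
  · rw [Matrix.IsHermitian, Matrix.conjTranspose_eq_transpose_of_trivial]; exact hX
  · rw [dotProduct_mulVec_eq_qf]; exact h _

/-- The symmetric matrix with the same quadratic form as a given operator. -/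
def symMat (S : EucSp N →L[ℝ] EucSp N) : MatN N :=
  (Matrix.toEuclideanCLM (n := Fin N) (𝕜 := ℝ)).symm
    ((1 / 2 : ℝ) • (S + ContinuousLinearMap.adjoint S))

lemma mv_symMat (S : EucSp N →L[ℝ] EucSp N) (v : EucSp N) :
    mv (symMat S) v = (1 / 2 : ℝ) • (S v + ContinuousLinearMap.adjoint S v) := by
  rw [mv, symMat, StarAlgEquiv.apply_symm_apply]; rfl

lemma symMat_isSymm (S : EucSp N →L[ℝ] EucSp N) : (symMat S).IsSymm := by
  refine isSymm_of_inner fun v w => ?_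
  simp only [mv_symMat, real_inner_smul_left, real_inner_smul_right, inner_add_left,
    inner_add_right, ContinuousLinearMap.adjoint_inner_left,
    ContinuousLinearMap.adjoint_inner_right]
  ring

lemma qf_symMat (S : EucSp N →L[ℝ] EucSp N) (v : EucSp N) : qf (symMat S) v = ⟪S v, v⟫ := by
  simp only [qf, mv_symMat, real_inner_smul_left, inner_add_left,
    ContinuousLinearMap.adjoint_inner_left]
  rw [real_inner_comm (S v) v]; ring

lemma isSymm_one : (1 : MatN N).IsSymm := Matrix.isSymm_one

/-- Matrix units: entries of a symmetric matrix are controlled by its quadratic form. -/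
lemma abs_entry_le {X : MatN N} (hX : X.IsSymm) {c : ℝ} (h : ∀ v, |qf X v| ≤ c * ‖v‖ ^ 2)
    (i j : Fin N) : |X i j| ≤ 2 * c := by
  have hent : X i j = ⟪mv X (EuclideanSpace.single j 1), EuclideanSpace.single i (1:ℝ)⟫ := by
    rw [mv, EuclideanSpace.inner_single_right]
    simp [Matrix.ofLp_toEuclideanCLM]
  set v := EuclideanSpace.single j (1:ℝ)
  set w := EuclideanSpace.single i (1:ℝ)
  have hv : ‖v‖ = 1 := by simp [v]
  have hw : ‖w‖ = 1 := by simp [w]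
  have h1 := qf_add hX v w
  have h2 := qf_add hX v (-w)
  have h3 : qf X (-w) = qf X w := by
    have := qf_smul (-1) X w; simpa using this
  rw [inner_neg_right, h3] at h2
  have hs := parallelogram_law_with_norm ℝ v w
  rw [hv, hw] at hs
  have a1 := abs_le.1 (h (v + w))
  have a2 := abs_le.1 (h (v + -w))
  rw [← sub_eq_add_neg] at a2 h2
  rw [hent, abs_le]
  constructor <;> nlinarith
end MatrixForms

section Power

lemma one_add_pow_le_quadratic (k : ℕ) {y : ℝ} (hy : |y| ≤ 1) :
    (1 + y) ^ k ≤ 1 + k * y + 3 ^ k * y ^ 2 := by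
  have hy' := abs_le.1 hy
  induction k with
  | zero => simp; positivity
  | succ k ih =>
    have hk : (k : ℝ) ≤ 3 ^ k := by
      exact_mod_cast (Nat.lt_pow_self (by norm_num)).le
    have h3 : (0:ℝ) ≤ 3 ^ k * y ^ 2 * (1 - y) :=
      mul_nonneg (by positivity) (by linarith)
    have h4 : (k : ℝ) * y ^ 2 ≤ 3 ^ k * y ^ 2 := by gcongr
    calc (1 + y) ^ (k + 1) = (1 + y) * (1 + y) ^ k := by ring
      _ ≤ (1 + y) * (1 + k * y + 3 ^ k * y ^ 2) := by
        gcongr; linarith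
      _ ≤ _ := by push_cast; rw [pow_succ 3 k]; nlinarith

/-- The constant in the second order expansion of `‖·‖ ^ (2 * k)`. -/
def powConst (k : ℕ) : ℝ := k + 9 * 3 ^ k

lemma powConst_pos (k : ℕ) : 0 < powConst k := by unfold powConst; positivity

lemma norm_add_pow_le {E : Type*} [NormedAddCommGroup E] [InnerProductSpace ℝ E] {k : ℕ}
    (hk : 1 ≤ k) {d v : E} (hv : ‖v‖ ≤ ‖d‖ / 3) :
    ‖d + v‖ ^ (2 * k) ≤ ‖d‖ ^ (2 * k) + 2 * k * ‖d‖ ^ (2 * k - 2) * ⟪d, v⟫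
      + powConst k * ‖d‖ ^ (2 * k - 2) * ‖v‖ ^ 2 := by
  obtain ⟨m, rfl⟩ : ∃ m, k = m + 1 := ⟨k - 1, by omega⟩
  have e2 : 2 * (m + 1) - 2 = 2 * m := by omega
  rw [e2]
  rcases eq_or_ne d 0 with rfl | hd
  · have : v = 0 := by
      have : ‖v‖ ≤ 0 := by simpa using hv
      exact norm_le_zero_iff.1 this
    subst this; simp
  have hd0 : 0 < ‖d‖ := norm_pos_iff.2 hd
  set y : ℝ := (2 * ⟪d, v⟫ + ‖v‖ ^ 2) / ‖d‖ ^ 2 with hy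
  have hin := abs_le.1 (abs_real_inner_le_norm d v)
  have hvn := norm_nonneg v
  have hnum : |2 * ⟪d, v⟫ + ‖v‖ ^ 2| ≤ 7 / 3 * (‖d‖ * ‖v‖) := by
    rw [abs_le]; constructor <;> nlinarith
  have hy1 : |y| ≤ 1 := by
    rw [hy, abs_div, abs_of_pos (by positivity : 0 < ‖d‖ ^ 2), div_le_one (by positivity)]
    nlinarith
  have hyd : y * ‖d‖ ^ 2 = 2 * ⟪d, v⟫ + ‖v‖ ^ 2 := by rw [hy]; field_simp
  have hy2 : y ^ 2 * ‖d‖ ^ 2 ≤ 9 * ‖v‖ ^ 2 := by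
    have : (y * ‖d‖ ^ 2) ^ 2 ≤ (7 / 3 * (‖d‖ * ‖v‖)) ^ 2 := by
      rw [hyd]; exact sq_le_sq' (by linarith [(abs_le.1 hnum).1]) (abs_le.1 hnum).2
    have h2 : y ^ 2 * ‖d‖ ^ 2 * ‖d‖ ^ 2 ≤ (9 * ‖v‖ ^ 2) * ‖d‖ ^ 2 := by
      nlinarith [sq_nonneg (‖d‖ * ‖v‖)]
    exact le_of_mul_le_mul_right h2 (by positivity)
  have hsq : ‖d + v‖ ^ 2 = ‖d‖ ^ 2 * (1 + y) := by
    rw [norm_add_sq_real]; linarith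
  have key := one_add_pow_le_quadratic (m + 1) hy1
  have h3 : (0:ℝ) < 3 ^ (m + 1) := by positivity
  have hdm : (0:ℝ) < ‖d‖ ^ (2 * m) := by positivity
  calc ‖d + v‖ ^ (2 * (m + 1)) = (‖d‖ ^ 2) ^ (m + 1) * (1 + y) ^ (m + 1) := by
        rw [pow_mul, hsq, mul_pow]
    _ ≤ (‖d‖ ^ 2) ^ (m + 1) * (1 + ((m + 1 : ℕ) : ℝ) * y + 3 ^ (m + 1) * y ^ 2) := by gcongr
    _ = ‖d‖ ^ (2 * (m + 1)) + ‖d‖ ^ (2 * m) * (((m + 1 : ℕ) : ℝ) * (y * ‖d‖ ^ 2)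
          + 3 ^ (m + 1) * (y ^ 2 * ‖d‖ ^ 2)) := by rw [← pow_mul, pow_mul]; ring
    _ ≤ ‖d‖ ^ (2 * (m + 1)) + ‖d‖ ^ (2 * m) * (((m + 1 : ℕ) : ℝ) * (2 * ⟪d, v⟫ + ‖v‖ ^ 2)
          + 3 ^ (m + 1) * (9 * ‖v‖ ^ 2)) := by rw [hyd]; gcongr
    _ = _ := by unfold powConst; ring

end Power

section Viscosity

/-- The data of the problem together with the structural assumptions. -/
structure EqData (Ω : Set (EucSp N)) (T : ℝ) (F : EucSp N → EucSp N → MatN N → ℝ)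
    (h : EucSp N → ℝ → EucSp N) (α : ℝ) (f : EucSp N → ℝ → ℝ) (a A Ch Mf : ℝ) (k : ℕ) :
    Prop where
  isOpen : IsOpen Ω
  alpha : -1 < α
  cont : Fcont Ω F
  hom : H1 Ω F α
  ell : H2 Ω F α a A
  h_cont : ContinuousOn (fun p : EucSp N × ℝ => h p.1 p.2) (Ω ×ˢ Ioo 0 T)
  h_bdd : ∀ x ∈ Ω, ∀ t ∈ Ioo (0 : ℝ) T, ‖h x t‖ ≤ Ch
  f_cont : ContinuousOn (fun p : EucSp N × ℝ => f p.1 p.2) (Ω ×ˢ Ioo 0 T)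
  f_bdd : ∀ x ∈ Ω, ∀ t ∈ Ioo (0 : ℝ) T, |f x t| ≤ Mf
  two_le : 2 ≤ k
  k_alpha : 1 < (2 * k - 1) * (1 + α)

/-- The operator satisfied by `-u` when `u` satisfies the equation with `F`. -/
def flipF (F : EucSp N → EucSp N → MatN N → ℝ) (x p : EucSp N) (X : MatN N) : ℝ :=
  -F x (-p) (-X)

/-- `u` is a viscosity subsolution at `(x₀, t₀)`, tested with polynomials. -/
structure ViscSubAt (F : EucSp N → EucSp N → MatN N → ℝ) (h : EucSp N → ℝ → EucSp N) (α : ℝ)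
    (f : EucSp N → ℝ → ℝ) (k : ℕ) (u : EucSp N × ℝ → ℝ) (x₀ : EucSp N) (t₀ : ℝ) : Prop where
  quad : ∀ (p : EucSp N) (τ : ℝ) (X : MatN N) (C : ℝ), p ≠ 0 → X.IsSymm →
    (∀ᶠ z in nhds (x₀, t₀), u z ≤ u (x₀, t₀) + ⟪p, z.1 - x₀⟫ + τ * (z.2 - t₀)
      + 1 / 2 * qf X (z.1 - x₀) + C * (z.2 - t₀) ^ 2) →
    τ - F x₀ p X - gradTerm h α x₀ t₀ p ≤ f x₀ t₀
  flat : ∀ (τ C : ℝ),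
    (∀ᶠ z in nhds (x₀, t₀), u z ≤ u (x₀, t₀) + τ * (z.2 - t₀)
      + C * (z.2 - t₀) ^ 2 + C * ‖z.1 - x₀‖ ^ (2 * k)) →
    τ ≤ f x₀ t₀

/-- `u` is a viscosity subsolution on `Ω × (0, T)`, tested with polynomials. -/
def ViscSub (Ω : Set (EucSp N)) (T : ℝ) (F : EucSp N → EucSp N → MatN N → ℝ)
    (h : EucSp N → ℝ → EucSp N) (α : ℝ) (f : EucSp N → ℝ → ℝ) (k : ℕ)
    (u : EucSp N × ℝ → ℝ) : Prop :=
  ∀ x ∈ Ω, ∀ t ∈ Ioo (0 : ℝ) T, ViscSubAt F h α f k u x t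

variable {Ω : Set (EucSp N)} {T : ℝ} {F : EucSp N → EucSp N → MatN N → ℝ}
  {h : EucSp N → ℝ → EucSp N} {α : ℝ} {f : EucSp N → ℝ → ℝ} {a A Ch Mf : ℝ} {k : ℕ}

lemma EqData.flip (D : EqData Ω T F h α f a A Ch Mf k) :
    EqData Ω T (flipF F) h α (fun x t => -f x t) a A Ch Mf k where
  isOpen := D.isOpen
  alpha := D.alpha
  cont := by
    have hc : ContinuousOn (fun z : EucSp N × EucSp N × MatN N => (z.1, -z.2.1, -z.2.2))
        (Ω ×ˢ ({p : EucSp N | p ≠ 0} ×ˢ (Set.univ : Set (MatN N)))) := by fun_prop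
    exact (D.cont.comp hc fun z hz => ⟨hz.1, neg_ne_zero.2 hz.2.1, trivial⟩).neg
  hom := by
    intro x hx p hp X hX t ht μ hμ
    have := D.hom x hx (-p) (neg_ne_zero.2 hp) (-X) hX.neg t ht μ hμ
    simp only [flipF, ← smul_neg, this]; ring
  ell := by
    refine ⟨D.ell.1, D.ell.2.1, fun x hx p hp M P hM hP hPs => ?_⟩
    have := D.ell.2.2 x hx (-p) (neg_ne_zero.2 hp) (-(M + P)) P (hM.add hP).neg hP hPs
    have e : -(M + P) + P = -M := by abel
    rw [e, norm_neg] at this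
    simp only [flipF]
    constructor <;> linarith [this.1, this.2]
  h_cont := D.h_cont
  h_bdd := D.h_bdd
  f_cont := D.f_cont.neg
  f_bdd := by intro x hx t ht; rw [abs_neg]; exact D.f_bdd x hx t ht
  two_le := D.two_le
  k_alpha := D.k_alpha

namespace EqData

lemma A_pos (D : EqData Ω T F h α f a A Ch Mf k) : 0 < A := D.ell.1.trans_le D.ell.2.1

lemma F_zero (D : EqData Ω T F h α f a A Ch Mf k)
    {x p : EucSp N} (hx : x ∈ Ω) (hp : p ≠ 0) : F x p 0 = 0 := by
  have := D.hom x hx p hp 0 Matrix.isSymm_zero 1 one_ne_zero 0 le_rfl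
  simpa using this

lemma F_mono (D : EqData Ω T F h α f a A Ch Mf k)
    {x p : EucSp N} (hx : x ∈ Ω) (hp : p ≠ 0) {X Y : MatN N} (hX : X.IsSymm)
    (hY : Y.IsSymm) (hXY : ∀ v, qf X v ≤ qf Y v) : F x p X ≤ F x p Y := by
  have hP : (Y - X).PosSemidef := posSemidef_of_qf (hY.sub hX) fun v => by
    rw [qf_sub_left]; linarith [hXY v]
  have := (D.ell.2.2 x hx p hp X (Y - X) hX (hY.sub hX) hP).1
  rw [add_sub_cancel] at this
  have h2 : 0 ≤ a * ‖p‖ ^ α * (Y - X).trace :=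
    mul_nonneg (mul_nonneg D.ell.1.le (by positivity)) hP.trace_nonneg
  linarith

lemma F_le (D : EqData Ω T F h α f a A Ch Mf k)
    {x p : EucSp N} (hx : x ∈ Ω) (hp : p ≠ 0) {X : MatN N} (hX : X.IsSymm) {c : ℝ}
    (hc : 0 ≤ c) (h : ∀ v, qf X v ≤ c * ‖v‖ ^ 2) : F x p X ≤ A * N * c * ‖p‖ ^ α := by
  have hs : (c • (1 : MatN N)).IsSymm := isSymm_one.smul c
  have h1 : F x p X ≤ F x p (c • 1) := D.F_mono hx hp hX hs fun v => by
    rw [qf_smul_left, qf_one]; exact h v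
  have hP : (c • (1 : MatN N)).PosSemidef := posSemidef_of_qf hs fun v => by
    rw [qf_smul_left, qf_one]; positivity
  have h2 := (D.ell.2.2 x hx p hp 0 (c • 1) Matrix.isSymm_zero hs hP).2
  rw [zero_add, D.F_zero hx hp] at h2
  have h3 : (c • (1 : MatN N)).trace = N * c := by
    rw [Matrix.trace_smul, Matrix.trace_one]; simp [mul_comm]
  rw [h3] at h2
  nlinarith

lemma le_F (D : EqData Ω T F h α f a A Ch Mf k)
    {x p : EucSp N} (hx : x ∈ Ω) (hp : p ≠ 0) {X : MatN N} (hX : X.IsSymm) {c : ℝ}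
    (hc : 0 ≤ c) (h : ∀ v, -(c * ‖v‖ ^ 2) ≤ qf X v) : -(A * N * c * ‖p‖ ^ α) ≤ F x p X := by
  have := D.flip.F_le hx (neg_ne_zero.2 hp) hX.neg hc fun v => by
    rw [qf_neg_left]; linarith [h v]
  simp only [flipF, neg_neg, norm_neg] at this
  linarith

lemma abs_gradTerm_le (D : EqData Ω T F h α f a A Ch Mf k)
    {x p : EucSp N} (hx : x ∈ Ω) (hp : p ≠ 0) {t : ℝ} (ht : t ∈ Ioo 0 T) :
    |gradTerm h α x t p| ≤ Ch * ‖p‖ ^ (1 + α) := by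
  have hp0 : 0 < ‖p‖ := norm_pos_iff.2 hp
  rw [gradTerm, abs_mul, abs_of_nonneg (by positivity : 0 ≤ ‖p‖ ^ α), Real.rpow_add hp0,
    Real.rpow_one, ← mul_assoc]
  gcongr
  exact (abs_real_inner_le_norm _ _).trans (by gcongr; exact D.h_bdd x hx t ht)

lemma tendsto_F (D : EqData Ω T F h α f a A Ch Mf k)
    {ι : Type*} {l : Filter ι} {x p : ι → EucSp N} {X : ι → MatN N}
    {x₀ p₀ : EucSp N} {X₀ : MatN N} (hx₀ : x₀ ∈ Ω) (hp₀ : p₀ ≠ 0) (hx : Tendsto x l (nhds x₀))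
    (hp : Tendsto p l (nhds p₀)) (hX : Tendsto X l (nhds X₀)) :
    Tendsto (fun i => F (x i) (p i) (X i)) l (nhds (F x₀ p₀ X₀)) := by
  have ho : IsOpen (Ω ×ˢ ({p : EucSp N | p ≠ 0} ×ˢ (Set.univ : Set (MatN N)))) :=
    D.isOpen.prod (isOpen_ne.prod isOpen_univ)
  have := (D.cont.continuousAt (x := (x₀, p₀, X₀)) (ho.mem_nhds ⟨hx₀, hp₀, trivial⟩)).tendsto
  exact this.comp (hx.prodMk_nhds (hp.prodMk_nhds hX))

lemma tendsto_f (D : EqData Ω T F h α f a A Ch Mf k)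
    {ι : Type*} {l : Filter ι} {x : ι → EucSp N} {t : ι → ℝ}
    {x₀ : EucSp N} {t₀ : ℝ} (hx₀ : x₀ ∈ Ω) (ht₀ : t₀ ∈ Ioo 0 T) (hx : Tendsto x l (nhds x₀))
    (ht : Tendsto t l (nhds t₀)) :
    Tendsto (fun i => f (x i) (t i)) l (nhds (f x₀ t₀)) :=
  ((D.f_cont.continuousAt (x := (x₀, t₀)) ((D.isOpen.prod isOpen_Ioo).mem_nhds
    ⟨hx₀, ht₀⟩)).tendsto).comp (hx.prodMk_nhds ht)

lemma tendsto_gradTerm (D : EqData Ω T F h α f a A Ch Mf k)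
    {ι : Type*} {l : Filter ι} {x p : ι → EucSp N} {t : ι → ℝ}
    {x₀ p₀ : EucSp N} {t₀ : ℝ} (hx₀ : x₀ ∈ Ω) (ht₀ : t₀ ∈ Ioo 0 T) (hp₀ : p₀ ≠ 0)
    (hx : Tendsto x l (nhds x₀)) (ht : Tendsto t l (nhds t₀)) (hp : Tendsto p l (nhds p₀)) :
    Tendsto (fun i => gradTerm h α (x i) (t i) (p i)) l (nhds (gradTerm h α x₀ t₀ p₀)) := by
  have h1 : Tendsto (fun i => h (x i) (t i)) l (nhds (h x₀ t₀)) :=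
    ((D.h_cont.continuousAt (x := (x₀, t₀)) ((D.isOpen.prod isOpen_Ioo).mem_nhds
      ⟨hx₀, ht₀⟩)).tendsto).comp (hx.prodMk_nhds ht)
  exact (h1.inner hp).mul (hp.norm.rpow_const (Or.inl (norm_ne_zero_iff.2 hp₀)))

end EqData

/-- The error in the equation produced by the test function `M * ‖x - x₀‖ ^ (2 * k)`. -/
def powErr (N : ℕ) (A Ch α : ℝ) (k : ℕ) (M r : ℝ) : ℝ :=
  A * N * (2 * M * powConst k) * (2 * k * M) ^ α * r ^ ((2 * k - 1) * (1 + α) - 1)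
    + Ch * (2 * k * M) ^ (1 + α) * r ^ ((2 * k - 1) * (1 + α))

lemma tendsto_powErr (A Ch M : ℝ) (hk : 1 < (2 * k - 1) * (1 + α)) :
    Tendsto (powErr N A Ch α k M) (nhds 0) (nhds 0) := by
  have h1 : Tendsto (fun r : ℝ => r ^ ((2 * k - 1) * (1 + α) - 1)) (nhds 0) (nhds 0) := by
    have := (Real.continuousAt_rpow_const 0 ((2 * k - 1) * (1 + α) - 1)
      (Or.inr (by linarith))).tendsto
    rwa [Real.zero_rpow (by linarith)] at this
  have h2 : Tendsto (fun r : ℝ => r ^ ((2 * k - 1) * (1 + α))) (nhds 0) (nhds 0) := by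
    have := (Real.continuousAt_rpow_const 0 ((2 * k - 1) * (1 + α))
      (Or.inr (by linarith))).tendsto
    rwa [Real.zero_rpow (by linarith)] at this
  have h3 := (h1.const_mul (A * N * (2 * M * powConst k) * (2 * k * M) ^ α)).add
    (h2.const_mul (Ch * (2 * k * M) ^ (1 + α)))
  rw [mul_zero, mul_zero, add_zero] at h3
  exact h3

/-- Algebra of the exponents in `powErr`. -/
lemma powErr_eq {r M : ℝ} (hr : 0 < r) (hM : 0 < M) (hk : 2 ≤ k) :
    powErr N A Ch α k M r = A * N * (2 * M * powConst k * r ^ (2 * k - 2)) *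
      (2 * k * M * r ^ (2 * k - 1)) ^ α + Ch * (2 * k * M * r ^ (2 * k - 1)) ^ (1 + α) := by
  have hk0 : (0:ℝ) < k := by exact_mod_cast (by omega : 0 < k)
  have e1 : (r ^ (2 * k - 1) : ℝ) = r ^ (2 * (k:ℝ) - 1) := by
    rw [← Real.rpow_natCast, Nat.cast_sub (by omega)]; push_cast; rfl
  have e2 : (r ^ (2 * k - 2) : ℝ) = r ^ (2 * (k:ℝ) - 2) := by
    rw [← Real.rpow_natCast, Nat.cast_sub (by omega)]; push_cast; rfl
  rw [e1, e2, Real.mul_rpow (x := 2 * k * M) (z := α) (by positivity) (by positivity),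
    Real.mul_rpow (x := 2 * k * M) (z := 1 + α) (by positivity) (by positivity), ← Real.rpow_mul hr.le, ← Real.rpow_mul hr.le,
    powErr]
  have e3 : (2 * (k:ℝ) - 1) * (1 + α) - 1 = (2 * (k:ℝ) - 2) + (2 * (k:ℝ) - 1) * α := by ring
  rw [e3, Real.rpow_add hr]
  ring

lemma power_of_quad (D : EqData Ω T F h α f a A Ch Mf k) {u : EucSp N × ℝ → ℝ}
    {x₁ : EucSp N} {t₁ : ℝ} (hx₁ : x₁ ∈ Ω) (ht₁ : t₁ ∈ Ioo 0 T)
    (hu : ∀ (p : EucSp N) (τ : ℝ) (X : MatN N) (C : ℝ), p ≠ 0 → X.IsSymm →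
      (∀ᶠ z in nhds (x₁, t₁), u z ≤ u (x₁, t₁) + ⟪p, z.1 - x₁⟫ + τ * (z.2 - t₁)
        + 1 / 2 * qf X (z.1 - x₁) + C * (z.2 - t₁) ^ 2) →
      τ - F x₁ p X - gradTerm h α x₁ t₁ p ≤ f x₁ t₁)
    {x₀ : EucSp N} (hne : x₁ ≠ x₀) {τ C M : ℝ} (hM : 0 < M)
    (ht : ∀ᶠ z in nhds (x₁, t₁), u z ≤ u (x₁, t₁) + τ * (z.2 - t₁) + C * (z.2 - t₁) ^ 2
      + M * (‖z.1 - x₀‖ ^ (2 * k) - ‖x₁ - x₀‖ ^ (2 * k))) :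
    τ ≤ f x₁ t₁ + powErr N A Ch α k M ‖x₁ - x₀‖ := by
  have hk1 : 1 ≤ k := by have := D.two_le; omega
  have hk0 : (0:ℝ) < k := by exact_mod_cast hk1
  set d := x₁ - x₀ with hd
  have hd0 : d ≠ 0 := sub_ne_zero.2 hne
  have hdn : 0 < ‖d‖ := norm_pos_iff.2 hd0
  set p : EucSp N := (2 * k * M * ‖d‖ ^ (2 * k - 2)) • d with hp
  set c := 2 * M * powConst k * ‖d‖ ^ (2 * k - 2) with hc
  have hc0 : 0 ≤ c := by have := powConst_pos k; positivity
  have hp0 : p ≠ 0 := smul_ne_zero (by positivity) hd0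
  have hpn : ‖p‖ = 2 * k * M * ‖d‖ ^ (2 * k - 1) := by
    rw [hp, norm_smul, Real.norm_of_nonneg (by positivity), mul_assoc, ← pow_succ]
    congr 2; omega
  have key := hu p τ (c • 1) C hp0 (isSymm_one.smul c) ?_
  · have hF := D.F_le hx₁ hp0 (isSymm_one.smul c) hc0 fun v => by
      rw [qf_smul_left, qf_one]
    have hg := (abs_le.1 (D.abs_gradTerm_le hx₁ hp0 ht₁)).2
    rw [powErr_eq hdn hM D.two_le, ← hpn]
    linarith
  · have hnear : ∀ᶠ z : EucSp N × ℝ in nhds (x₁, t₁), ‖z.1 - x₁‖ < ‖d‖ / 3 := by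
      have : Tendsto (fun z : EucSp N × ℝ => ‖z.1 - x₁‖) (nhds (x₁, t₁)) (nhds 0) := by
        have h1 : Continuous (fun z : EucSp N × ℝ => ‖z.1 - x₁‖) := by fun_prop
        simpa using h1.tendsto (x₁, t₁)
      exact this.eventually (gt_mem_nhds (by positivity))
    filter_upwards [ht, hnear] with z hz hzn
    have hexp := norm_add_pow_le hk1 (d := d) (v := z.1 - x₁) hzn.le
    have e : d + (z.1 - x₁) = z.1 - x₀ := by rw [hd]; abel
    rw [e] at hexp
    refine hz.trans ?_
    rw [qf_smul_left, qf_one, hp, real_inner_smul_left, hc]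
    nlinarith [mul_le_mul_of_nonneg_left hexp hM.le]

lemma ViscSubAt.power (D : EqData Ω T F h α f a A Ch Mf k) {u : EucSp N × ℝ → ℝ}
    {x₁ : EucSp N} {t₁ : ℝ} (hx₁ : x₁ ∈ Ω) (ht₁ : t₁ ∈ Ioo 0 T)
    (hu : ViscSubAt F h α f k u x₁ t₁) {x₀ : EucSp N} {τ C M : ℝ} (hM : 0 < M)
    (ht : ∀ᶠ z in nhds (x₁, t₁), u z ≤ u (x₁, t₁) + τ * (z.2 - t₁) + C * (z.2 - t₁) ^ 2
      + M * (‖z.1 - x₀‖ ^ (2 * k) - ‖x₁ - x₀‖ ^ (2 * k))) :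
    τ ≤ f x₁ t₁ + powErr N A Ch α k M ‖x₁ - x₀‖ := by
  rcases eq_or_ne x₁ x₀ with rfl | hne
  · have h0 : powErr N A Ch α k M ‖x₁ - x₁‖ = 0 := by
      have := D.k_alpha
      simp only [powErr, sub_self, norm_zero]
      rw [Real.zero_rpow (by linarith), Real.zero_rpow (by linarith)]; ring
    rw [h0, add_zero]
    refine hu.flat τ (max C M) ?_
    filter_upwards [ht] with z hz
    refine hz.trans ?_
    have : ‖x₁ - x₁‖ ^ (2 * k) = 0 := by have := D.two_le; simp; omega
    rw [this, sub_zero]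
    gcongr
    · exact le_max_left _ _
    · exact le_max_right _ _
  · exact power_of_quad D hx₁ ht₁ hu.quad hne hM ht

end Viscosity

section Tests

lemma lin_quad_nonpos {c b : ℝ} (h : ∀ᶠ s in nhds (0:ℝ), c * s + b * s ^ 2 ≤ 0) :
    c = 0 ∧ b ≤ 0 := by
  obtain ⟨δ, hδ, hs⟩ := Metric.eventually_nhds_iff.1 h
  have hbound : ∀ s, 0 < s → s < δ → |c| ≤ |b| * s := by
    intro s hs0 hsδ
    have h1 := hs (y := s) (by simpa [abs_of_pos hs0] using hsδ)
    have h2 := hs (y := -s) (by simpa [abs_of_pos hs0] using hsδ)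
    have hb := neg_abs_le b
    have h3 : c * s ≤ |b| * s * s := by nlinarith [sq_nonneg s]
    have h4 : -c * s ≤ |b| * s * s := by nlinarith [sq_nonneg s]
    have h5 := le_of_mul_le_mul_right h3 hs0
    have h6 := le_of_mul_le_mul_right h4 hs0
    exact abs_le'.2 ⟨h5, h6⟩
  have hc : c = 0 := by
    by_contra hne
    have hc0 := abs_pos.2 hne
    have hb1 : (0:ℝ) < |b| + 1 := by positivity
    set s := min (δ / 2) (|c| / (2 * (|b| + 1))) with hsdef
    have hs0 : 0 < s := lt_min (by positivity) (by positivity)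
    have := hbound s hs0 ((min_le_left _ _).trans_lt (by linarith))
    have h2 : s ≤ |c| / (2 * (|b| + 1)) := min_le_right _ _
    rw [le_div_iff₀ (by positivity)] at h2
    nlinarith [abs_nonneg b]
  refine ⟨hc, ?_⟩
  have h1 := hs (y := δ / 2) (by
    rw [dist_zero_right, Real.norm_of_nonneg (by positivity)]; linarith)
  rw [hc] at h1
  have : 0 < (δ / 2) ^ 2 := by positivity
  nlinarith

lemma eventually_line {x₀ : EucSp N} {t₀ : ℝ} {P : EucSp N × ℝ → Prop}
    (h : ∀ᶠ z in nhds (x₀, t₀), P z) (v : EucSp N) (w : ℝ) :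
    ∀ᶠ s in nhds (0:ℝ), P (x₀ + s • v, t₀ + s * w) := by
  have hc : Continuous fun s : ℝ => (x₀ + s • v, t₀ + s * w) := by fun_prop
  have := hc.tendsto 0
  simp only [zero_smul, add_zero, zero_mul] at this
  exact this.eventually h

lemma jet_compare {x₀ : EucSp N} {t₀ : ℝ} {p q : EucSp N} {τ σ B C : ℝ} {X Y : MatN N}
    (h : ∀ᶠ z in nhds (x₀, t₀), ⟪p, z.1 - x₀⟫ + τ * (z.2 - t₀) + 1 / 2 * qf X (z.1 - x₀)
        + B * (z.2 - t₀) ^ 2 ≤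
      ⟪q, z.1 - x₀⟫ + σ * (z.2 - t₀) + 1 / 2 * qf Y (z.1 - x₀) + C * (z.2 - t₀) ^ 2) :
    p = q ∧ τ = σ ∧ ∀ v, qf X v ≤ qf Y v := by
  have hx : ∀ v, ⟪p - q, v⟫ = 0 ∧ 1 / 2 * (qf X v - qf Y v) ≤ 0 := by
    intro v
    refine lin_quad_nonpos ?_
    filter_upwards [eventually_line h v 0] with s hs
    simp only [add_sub_cancel_left, mul_zero, add_zero, sub_self, qf_smul,
      real_inner_smul_right] at hs
    rw [inner_sub_left]
    nlinarith
  refine ⟨?_, ?_, fun v => by linarith [(hx v).2]⟩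
  · exact sub_eq_zero.1 (inner_self_eq_zero (𝕜 := ℝ).1 (hx (p - q)).1)
  · have : τ - σ = 0 ∧ B - C ≤ 0 := by
      refine lin_quad_nonpos ?_
      filter_upwards [eventually_line h 0 1] with s hs
      simp only [smul_zero, add_zero, sub_self, inner_zero_right, qf_zero, mul_one,
        add_sub_cancel_left] at hs
      nlinarith
    linarith [this.1]

lemma jet_compare_flat {x₀ : EucSp N} {t₀ : ℝ} {p : EucSp N} {τ σ B C : ℝ} {X : MatN N}
    {k : ℕ} (hk : 2 ≤ k)
    (h : ∀ᶠ z in nhds (x₀, t₀), ⟪p, z.1 - x₀⟫ + τ * (z.2 - t₀) + 1 / 2 * qf X (z.1 - x₀)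
        + B * (z.2 - t₀) ^ 2 ≤
      σ * (z.2 - t₀) + C * (z.2 - t₀) ^ 2 + C * ‖z.1 - x₀‖ ^ (2 * k)) :
    p = 0 ∧ τ = σ := by
  have hnear : ∀ᶠ z : EucSp N × ℝ in nhds (x₀, t₀), ‖z.1 - x₀‖ < 1 := by
    have h1 : Continuous (fun z : EucSp N × ℝ => ‖z.1 - x₀‖) := by fun_prop
    have : Tendsto (fun z : EucSp N × ℝ => ‖z.1 - x₀‖) (nhds (x₀, t₀)) (nhds 0) := by
      simpa using h1.tendsto (x₀, t₀)
    exact this.eventually (gt_mem_nhds one_pos)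
  have := jet_compare (x₀ := x₀) (t₀ := t₀) (p := p) (q := 0) (τ := τ) (σ := σ) (B := B) (C := C)
    (X := X) (Y := (2 * |C|) • 1) (by
      filter_upwards [h, hnear] with z hz hz1
      refine hz.trans ?_
      rw [inner_zero_left, qf_smul_left, qf_one]
      have : ‖z.1 - x₀‖ ^ (2 * k) ≤ ‖z.1 - x₀‖ ^ 2 :=
        pow_le_pow_of_le_one (norm_nonneg _) hz1.le (by omega)
      have h2 : C * ‖z.1 - x₀‖ ^ (2 * k) ≤ |C| * ‖z.1 - x₀‖ ^ 2 :=
        mul_le_mul (le_abs_self C) this (by positivity) (abs_nonneg C)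
      linarith)
  exact ⟨this.1, this.2.1⟩

variable {Ω : Set (EucSp N)} {T : ℝ} {F : EucSp N → EucSp N → MatN N → ℝ}
  {h : EucSp N → ℝ → EucSp N} {α : ℝ} {f : EucSp N → ℝ → ℝ} {a A Ch Mf : ℝ} {k : ℕ}

/-- A function with a subsolution second order jet from below is a subsolution. -/
lemma ViscSubAt.of_lower (D : EqData Ω T F h α f a A Ch Mf k) {u : EucSp N × ℝ → ℝ}
    {x₁ : EucSp N} {t₁ : ℝ} (hx₁ : x₁ ∈ Ω) {p : EucSp N} {τ C : ℝ} {X : MatN N}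
    (hX : X.IsSymm)
    (hlow : ∀ᶠ z in nhds (x₁, t₁), u (x₁, t₁) + ⟪p, z.1 - x₁⟫ + τ * (z.2 - t₁)
      + 1 / 2 * qf X (z.1 - x₁) + C * (z.2 - t₁) ^ 2 ≤ u z)
    (hne : p ≠ 0 → τ - F x₁ p X - gradTerm h α x₁ t₁ p ≤ f x₁ t₁)
    (he : p = 0 → τ ≤ f x₁ t₁) : ViscSubAt F h α f k u x₁ t₁ where
  quad := by
    intro q σ Y B hq hY ht
    obtain ⟨rfl, rfl, hXY⟩ := jet_compare (x₀ := x₁) (t₀ := t₁) (p := p) (q := q) (τ := τ)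
      (σ := σ) (B := C) (C := B) (X := X) (Y := Y) (by
        filter_upwards [hlow, ht] with z h1 h2; linarith)
    have := D.F_mono hx₁ hq hX hY hXY
    linarith [hne hq]
  flat := by
    intro σ B ht
    obtain ⟨hp, rfl⟩ := jet_compare_flat (x₀ := x₁) (t₀ := t₁) (p := p) (τ := τ)
      (σ := σ) (B := C) (C := B) (X := X) D.two_le (by
        filter_upwards [hlow, ht] with z h1 h2; linarith)
    exact he hp

/-- Subsolution tests pass to a larger function touching at the point. -/
lemma ViscSubAt.of_le {u w : EucSp N × ℝ → ℝ} {x₁ : EucSp N} {t₁ : ℝ}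
    (hu : ViscSubAt F h α f k u x₁ t₁) (hle : ∀ᶠ z in nhds (x₁, t₁), u z ≤ w z)
    (heq : u (x₁, t₁) = w (x₁, t₁)) : ViscSubAt F h α f k w x₁ t₁ where
  quad := by
    intro p τ X C hp hX ht
    refine hu.quad p τ X C hp hX ?_
    filter_upwards [hle, ht] with z h1 h2
    rw [heq]; exact h1.trans h2
  flat := by
    intro τ C ht
    refine hu.flat τ C ?_
    filter_upwards [hle, ht] with z h1 h2
    rw [heq]; exact h1.trans h2

lemma isCompact_closedBall_prod (z₀ : EucSp N × ℝ) (r : ℝ) : IsCompact (closedBall z₀ r) :=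
  isCompact_closedBall z₀ r

/-- Perturbation of a touching point: an approximating family touches near `z₀`. -/
lemma exists_touch_near {Q : Set (EucSp N × ℝ)} {u : EucSp N × ℝ → ℝ}
    {S : Set (EucSp N × ℝ → ℝ)}
    (hQ : IsOpen Q) (hS : ∀ w ∈ S, UpperSemicontinuousOn w Q ∧ ∀ z ∈ Q, w z ≤ u z)
    {z₀ : EucSp N × ℝ} (hz₀ : z₀ ∈ Q)
    (happ : ∀ ε > 0, ∃ w ∈ S, ∃ z ∈ Q, dist z z₀ < ε ∧ u z₀ - ε < w z)
    {P R : EucSp N × ℝ → ℝ} (hP : Continuous P) (hR : Continuous R) (hP0 : P z₀ = 0)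
    (hR0 : R z₀ = 0) (hRpos : ∀ z, z ≠ z₀ → 0 < R z)
    (ht : ∀ᶠ z in nhds z₀, u z ≤ u z₀ + P z) {ε : ℝ} (hε : 0 < ε) :
    ∃ w ∈ S, ∃ y ∈ Q, dist y z₀ < ε ∧
      ∀ᶠ z in nhds y, w z ≤ w y + (P z + R z) - (P y + R y) := by
  obtain ⟨r₀, hr₀, hball⟩ := Metric.eventually_nhds_iff.1 (ht.and (hQ.mem_nhds hz₀))
  set r := min (r₀ / 2) (ε / 2) with hr
  have hrpos : 0 < r := lt_min (by positivity) (by positivity)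
  have hrr₀ : r < r₀ := (min_le_left _ _).trans_lt (by linarith)
  have hrε : r < ε := (min_le_right _ _).trans_lt (by linarith)
  have hin : ∀ z ∈ closedBall z₀ r, u z ≤ u z₀ + P z ∧ z ∈ Q := fun z hz =>
    hball ((mem_closedBall.1 hz).trans_lt hrr₀)
  obtain ⟨m, hm, hmR⟩ : ∃ m > 0, ∀ z ∈ sphere z₀ r, m ≤ R z := by
    rcases (sphere z₀ r).eq_empty_or_nonempty with he | hne
    · exact ⟨1, one_pos, by simp [he]⟩
    · obtain ⟨z, hz, hmin⟩ := (isCompact_sphere z₀ r).exists_isMinOn hne hR.continuousOn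
      refine ⟨R z, hRpos z ?_, fun y hy => hmin hy⟩
      rintro rfl
      rw [mem_sphere, dist_self] at hz; linarith
  have hPR : Tendsto (fun z => P z + R z) (nhds z₀) (nhds 0) := by
    have hc : Continuous fun z => P z + R z := by fun_prop
    have := hc.tendsto z₀
    simpa only [hP0, hR0, add_zero] using this
  obtain ⟨δ, hδ, hδm⟩ := Metric.eventually_nhds_iff.1
    (hPR.eventually (gt_mem_nhds (by positivity : 0 < m / 4)))
  obtain ⟨w, hw, z, hzQ, hzd, hzw⟩ := happ (min (min δ r) (m / 4))
    (lt_min (lt_min hδ hrpos) (by positivity))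
  have hzδ : dist z z₀ < δ := hzd.trans_le ((min_le_left _ _).trans (min_le_left _ _))
  have hzr : dist z z₀ < r := hzd.trans_le ((min_le_left _ _).trans (min_le_right _ _))
  have hzm := min_le_right (min δ r) (m / 4)
  have hPRz := hδm hzδ
  obtain ⟨husc, hle⟩ := hS w hw
  have husc2 : UpperSemicontinuousOn (fun z => w z + -(P z + R z)) (closedBall z₀ r) :=
    (husc.mono fun z hz => (hin z hz).2).add
      ((hP.add hR).neg.upperSemicontinuous.upperSemicontinuousOn _)
  obtain ⟨y, hy, hmax⟩ := husc2.exists_isMaxOn ⟨z₀, mem_closedBall_self hrpos.le⟩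
    (isCompact_closedBall_prod z₀ r)
  have hyz : w z + -(P z + R z) ≤ w y + -(P y + R y) := hmax hzr.le
  have hyu := (hin y hy)
  have hyw := hle y hyu.2
  have hylt : dist y z₀ < r := by
    refine lt_of_le_of_ne hy fun heq => ?_
    have := hmR y heq
    linarith [hyu.1]
  refine ⟨w, hw, y, hyu.2, hylt.trans hrε, ?_⟩
  filter_upwards [isOpen_ball.mem_nhds hylt] with z' hz'
  have : w z' + -(P z' + R z') ≤ w y + -(P y + R y) := hmax (ball_subset_closedBall hz')
  linarith

lemma tendsto_of_dist_lt {X : Type*} [PseudoMetricSpace X] {y : ℕ → X} {z : X}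
    (h : ∀ n : ℕ, dist (y n) z < 1 / ((n : ℝ) + 1)) : Tendsto y atTop (nhds z) :=
  tendsto_iff_dist_tendsto_zero.2 (squeeze_zero (fun _ => dist_nonneg) (fun n => (h n).le)
    tendsto_one_div_add_atTop_nhds_zero_nat)

/-- Suprema of subsolutions are subsolutions. -/
theorem ViscSub.of_sup (D : EqData Ω T F h α f a A Ch Mf k) {u : EucSp N × ℝ → ℝ}
    {S : Set (EucSp N × ℝ → ℝ)}
    (hS : ∀ w ∈ S, ViscSub Ω T F h α f k w ∧ UpperSemicontinuousOn w (Ω ×ˢ Ioo 0 T) ∧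
      ∀ z ∈ Ω ×ˢ Ioo 0 T, w z ≤ u z)
    (happ : ∀ z₀ ∈ Ω ×ˢ Ioo 0 T, ∀ ε > 0, ∃ w ∈ S, ∃ z ∈ Ω ×ˢ Ioo 0 T,
      dist z z₀ < ε ∧ u z₀ - ε < w z) :
    ViscSub Ω T F h α f k u := by
  intro x₀ hx₀ t₀ ht₀
  have hQ : IsOpen (Ω ×ˢ Ioo 0 T) := D.isOpen.prod isOpen_Ioo
  have hz₀ : (x₀, t₀) ∈ Ω ×ˢ Ioo 0 T := ⟨hx₀, ht₀⟩
  have htouch := fun (P R : EucSp N × ℝ → ℝ) hP hR hP0 hR0 hRp ht ε hε =>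
    exists_touch_near hQ (fun w hw => (hS w hw).2) hz₀ (happ _ hz₀) (P := P) (R := R)
      hP hR hP0 hR0 hRp ht (ε := ε) hε
  constructor
  · intro p τ X C hp hX ht
    have hstep : ∀ n : ℕ, ∃ w ∈ S, ∃ y ∈ Ω ×ˢ Ioo 0 T, dist y (x₀, t₀) < 1 / ((n:ℝ) + 1) ∧
        ∀ᶠ z in nhds y, w z ≤ w y
          + ((⟪p, z.1 - x₀⟫ + τ * (z.2 - t₀) + 1 / 2 * qf X (z.1 - x₀) + C * (z.2 - t₀) ^ 2)
            + (1 / ((n:ℝ) + 1) * ‖z.1 - x₀‖ ^ 2 + (z.2 - t₀) ^ 2))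
          - ((⟪p, y.1 - x₀⟫ + τ * (y.2 - t₀) + 1 / 2 * qf X (y.1 - x₀) + C * (y.2 - t₀) ^ 2)
            + (1 / ((n:ℝ) + 1) * ‖y.1 - x₀‖ ^ 2 + (y.2 - t₀) ^ 2)) := by
      intro n
      have hn : (0:ℝ) < 1 / ((n:ℝ) + 1) := by positivity
      have hqc := continuous_qf X
      refine htouch
        (fun z => ⟪p, z.1 - x₀⟫ + τ * (z.2 - t₀) + 1 / 2 * qf X (z.1 - x₀) + C * (z.2 - t₀) ^ 2)
        (fun z => 1 / ((n:ℝ) + 1) * ‖z.1 - x₀‖ ^ 2 + (z.2 - t₀) ^ 2)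
        (by fun_prop) (by fun_prop) (by simp [qf_zero]) (by simp) ?_ ?_ _ hn
      · rintro ⟨x, t⟩ hne
        rcases eq_or_ne x x₀ with rfl | hx
        · have : t - t₀ ≠ 0 := sub_ne_zero.2 fun h => hne (by rw [h])
          simp; positivity
        · have : 0 < ‖x - x₀‖ := norm_pos_iff.2 (sub_ne_zero.2 hx)
          simp only; positivity
      · filter_upwards [ht] with z hz
        linarith
    choose w hw y hy hyd hyt using hstep
    have hyl := tendsto_of_dist_lt hyd
    have hy1 : Tendsto (fun n : ℕ => (y n).1) atTop (nhds x₀) := (continuous_fst.tendsto _).comp hyl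
    have hy2 : Tendsto (fun n : ℕ => (y n).2) atTop (nhds t₀) := (continuous_snd.tendsto _).comp hyl
    have hn0 : Tendsto (fun n : ℕ => 1 / ((n:ℝ) + 1)) atTop (nhds 0) :=
      tendsto_one_div_add_atTop_nhds_zero_nat
    set Xn : ℕ → MatN N := fun n => X + (2 * (1 / ((n:ℝ) + 1))) • (1 : MatN N) with hXn
    have hXs : ∀ n, (Xn n).IsSymm := fun n => hX.add (isSymm_one.smul _)
    have hXl : Tendsto Xn atTop (nhds X) := by
      have h1 : Tendsto (fun n : ℕ => X + (2 * (1 / ((n:ℝ) + 1))) • (1 : MatN N)) atTop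
          (nhds (X + (2 * (0:ℝ)) • (1 : MatN N))) :=
        ((hn0.const_mul 2).smul_const (1 : MatN N)).const_add X
      rw [mul_zero, zero_smul, add_zero] at h1
      exact h1
    set pn : ℕ → EucSp N := fun n => p + mv (Xn n) ((y n).1 - x₀) with hpn
    set τn : ℕ → ℝ := fun n => τ + 2 * (C + 1) * ((y n).2 - t₀) with hτn
    have hpl : Tendsto pn atTop (nhds p) := by
      have hd : Tendsto (fun n : ℕ => (y n).1 - x₀) atTop (nhds 0) := by
        simpa using hy1.sub_const x₀
      have h1 : Tendsto (fun n : ℕ => mv X ((y n).1 - x₀)) atTop (nhds 0) := by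
        have := ((continuous_mv X).tendsto 0).comp hd
        rwa [mv_zero] at this
      have h2 : Tendsto (fun n : ℕ => (2 * (1 / ((n:ℝ) + 1))) • ((y n).1 - x₀)) atTop
          (nhds ((2 * (0:ℝ)) • (0 : EucSp N))) := (hn0.const_mul 2).smul hd
      have h3 := (h1.add h2).const_add p
      simp only [smul_zero, add_zero] at h3
      refine h3.congr fun n => ?_
      simp only [hpn, hXn, mv_add_left, mv_smul_left, mv_one]
    have hτl : Tendsto τn atTop (nhds τ) := by
      have h1 := ((hy2.sub_const t₀).const_mul (2 * (C + 1))).const_add τ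
      simpa using h1
    have hineq : ∀ᶠ n in atTop, τn n - F (y n).1 (pn n) (Xn n)
        - gradTerm h α (y n).1 (y n).2 (pn n) ≤ f (y n).1 (y n).2 := by
      filter_upwards [hpl.eventually_ne hp] with n hpne
      refine ((hS _ (hw n)).1 _ (hy n).1 _ (hy n).2).quad _ _ _ (C + 1) hpne (hXs n) ?_
      filter_upwards [hyt n] with z hz
      refine hz.trans (le_of_eq ?_)
      have e : z.1 - x₀ = ((y n).1 - x₀) + (z.1 - (y n).1) := by abel
      have e1 : qf X (z.1 - x₀) = qf X ((y n).1 - x₀)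
          + 2 * ⟪mv X ((y n).1 - x₀), z.1 - (y n).1⟫ + qf X (z.1 - (y n).1) := by
        rw [e, qf_add hX]
      have e2 : ‖z.1 - x₀‖ ^ 2 = ‖(y n).1 - x₀‖ ^ 2
          + 2 * ⟪(y n).1 - x₀, z.1 - (y n).1⟫ + ‖z.1 - (y n).1‖ ^ 2 := by
        rw [e, norm_add_sq_real]
      have e3 : ⟪p, z.1 - x₀⟫ = ⟪p, (y n).1 - x₀⟫ + ⟪p, z.1 - (y n).1⟫ := by
        rw [e, inner_add_right]
      simp only [hpn, hτn, hXn, e1, e2, e3, mv_add_left, mv_smul_left, mv_one, inner_add_left,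
        real_inner_smul_left, qf_add_left, qf_smul_left, qf_one]
      ring
    exact le_of_tendsto_of_tendsto
      ((hτl.sub (D.tendsto_F hx₀ hp hy1 hpl hXl)).sub (D.tendsto_gradTerm hx₀ ht₀ hp hy1 hy2 hpl))
      (D.tendsto_f hx₀ ht₀ hy1 hy2) hineq
  · intro τ C ht
    have hC : (0:ℝ) < |C| + 1 := by positivity
    have hk0 : 2 * k ≠ 0 := by have := D.two_le; omega
    have hstep : ∀ n : ℕ, ∃ w ∈ S, ∃ y ∈ Ω ×ˢ Ioo 0 T, dist y (x₀, t₀) < 1 / ((n:ℝ) + 1) ∧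
        ∀ᶠ z in nhds y, w z ≤ w y
          + ((τ * (z.2 - t₀) + |C| * (z.2 - t₀) ^ 2 + |C| * ‖z.1 - x₀‖ ^ (2 * k))
            + (‖z.1 - x₀‖ ^ (2 * k) + (z.2 - t₀) ^ 2))
          - ((τ * (y.2 - t₀) + |C| * (y.2 - t₀) ^ 2 + |C| * ‖y.1 - x₀‖ ^ (2 * k))
            + (‖y.1 - x₀‖ ^ (2 * k) + (y.2 - t₀) ^ 2)) := by
      intro n
      have hn : (0:ℝ) < 1 / ((n:ℝ) + 1) := by positivity
      refine htouch
        (fun z => τ * (z.2 - t₀) + |C| * (z.2 - t₀) ^ 2 + |C| * ‖z.1 - x₀‖ ^ (2 * k))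
        (fun z => ‖z.1 - x₀‖ ^ (2 * k) + (z.2 - t₀) ^ 2)
        (by fun_prop) (by fun_prop) (by simp [hk0]) (by simp [hk0]) ?_ ?_ _ hn
      · rintro ⟨x, t⟩ hne
        rcases eq_or_ne x x₀ with rfl | hx
        · have : t - t₀ ≠ 0 := sub_ne_zero.2 fun h => hne (by rw [h])
          simp only [sub_self, norm_zero, zero_pow hk0, zero_add]; positivity
        · have : 0 < ‖x - x₀‖ := norm_pos_iff.2 (sub_ne_zero.2 hx)
          simp only; positivity
      · filter_upwards [ht] with z hz
        have h1 : C * (z.2 - t₀) ^ 2 ≤ |C| * (z.2 - t₀) ^ 2 := by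
          gcongr; exact le_abs_self C
        have h2 : C * ‖z.1 - x₀‖ ^ (2 * k) ≤ |C| * ‖z.1 - x₀‖ ^ (2 * k) := by
          gcongr; exact le_abs_self C
        linarith
    choose w hw y hy hyd hyt using hstep
    have hyl := tendsto_of_dist_lt hyd
    have hy1 : Tendsto (fun n : ℕ => (y n).1) atTop (nhds x₀) := (continuous_fst.tendsto _).comp hyl
    have hy2 : Tendsto (fun n : ℕ => (y n).2) atTop (nhds t₀) := (continuous_snd.tendsto _).comp hyl
    have hineq : ∀ n, τ + 2 * (|C| + 1) * ((y n).2 - t₀) ≤ f (y n).1 (y n).2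
        + powErr N A Ch α k (|C| + 1) ‖(y n).1 - x₀‖ := by
      intro n
      refine ((hS _ (hw n)).1 _ (hy n).1 _ (hy n).2).power D (hy n).1 (hy n).2 (C := |C| + 1)
        hC ?_
      filter_upwards [hyt n] with z hz
      refine hz.trans (le_of_eq ?_)
      ring
    have hl := ((hy2.sub_const t₀).const_mul (2 * (|C| + 1))).const_add τ
    have hd : Tendsto (fun n : ℕ => ‖(y n).1 - x₀‖) atTop (nhds 0) := by
      simpa using (hy1.sub_const x₀).norm
    have hr := (D.tendsto_f hx₀ ht₀ hy1 hy2).add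
      ((tendsto_powErr (N := N) A Ch (|C| + 1) D.k_alpha).comp hd)
    rw [sub_self, mul_zero, add_zero] at hl
    rw [add_zero] at hr
    exact le_of_tendsto_of_tendsto hl hr (Eventually.of_forall hineq)

end Tests

section Taylor

variable {E : Type*} [NormedAddCommGroup E] [NormedSpace ℝ E]

/-- Second order Taylor expansion with Peano remainder. -/
lemma taylor_two {φ : E → ℝ} (hφ : ContDiff ℝ 2 φ) (z₀ : E) {ε : ℝ} (hε : 0 < ε) :
    ∀ᶠ z in nhds z₀, φ z ≤ φ z₀ + fderiv ℝ φ z₀ (z - z₀)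
      + 1 / 2 * fderiv ℝ (fderiv ℝ φ) z₀ (z - z₀) (z - z₀) + ε * ‖z - z₀‖ ^ 2 := by
  have hd1 : Differentiable ℝ φ := hφ.differentiable (by norm_num)
  have hc1 : ContDiff ℝ 1 (fderiv ℝ φ) := hφ.fderiv_right (by norm_num)
  have hd2 : Differentiable ℝ (fderiv ℝ φ) := hc1.differentiable (by norm_num)
  set B := fderiv ℝ (fderiv ℝ φ) z₀ with hB
  have hsymm : ∀ v w, B v w = B w v := by
    have := (hφ.contDiffAt (x := z₀)).isSymmSndFDerivAt (by simp)
    exact fun v w => this v w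
  have hlo := (hd2 z₀).hasFDerivAt.isLittleO.def hε
  obtain ⟨δ, hδ, hball⟩ := Metric.eventually_nhds_iff.1 hlo
  set g : E → ℝ := fun z => φ z - (fderiv ℝ φ z₀ (z - z₀) + 1 / 2 * B (z - z₀) (z - z₀)) with hg
  have hgd : ∀ z, HasFDerivAt g (fderiv ℝ φ z - (fderiv ℝ φ z₀ + B (z - z₀))) z := by
    intro z
    have h1 : HasFDerivAt (fun z : E => z - z₀) (ContinuousLinearMap.id ℝ E) z :=
      (hasFDerivAt_id z).sub_const z₀
    have h2 : HasFDerivAt (fun z : E => fderiv ℝ φ z₀ (z - z₀)) (fderiv ℝ φ z₀) z :=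
      ((fderiv ℝ φ z₀).hasFDerivAt.comp z h1).congr_fderiv (by ext; simp)
    have h3 : HasFDerivAt (fun z : E => B (z - z₀)) B z :=
      (B.hasFDerivAt.comp z h1).congr_fderiv (by ext; simp)
    have h4 := (h3.clm_apply h1).const_mul (1 / 2)
    refine ((hd1 z).hasFDerivAt.sub (h2.add h4)).congr_fderiv ?_
    ext v
    simp only [sub_apply, add_apply,
      smul_apply, ContinuousLinearMap.comp_apply,
      ContinuousLinearMap.flip_apply, ContinuousLinearMap.id_apply, smul_eq_mul]
    rw [hsymm v (z - z₀)]; ring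
  filter_upwards [isOpen_ball.mem_nhds (mem_ball_self hδ)] with z hz
  have hcv := (convex_closedBall z₀ (dist z z₀)).norm_image_sub_le_of_norm_hasFDerivWithin_le
    (f := g) (f' := fun y => fderiv ℝ φ y - (fderiv ℝ φ z₀ + B (y - z₀)))
    (C := ε * dist z z₀) (x := z₀) (y := z)
    (fun y _ => (hgd y).hasFDerivWithinAt) ?_ (mem_closedBall_self dist_nonneg)
    (mem_closedBall.2 le_rfl)
  · have h1 := le_of_abs_le hcv
    simp only [hg, sub_self, map_zero, mul_zero, add_zero,
      sub_zero] at h1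
    rw [dist_eq_norm] at h1
    nlinarith
  · intro y hy
    have hy2 : dist y z₀ < δ := (mem_closedBall.1 hy).trans_lt hz
    have := hball hy2
    rw [← sub_sub]
    refine this.trans ?_
    rw [← dist_eq_norm]
    exact mul_le_mul_of_nonneg_left (mem_closedBall.1 hy) hε.le

end Taylor

section Bridges

variable {Ω : Set (EucSp N)} {T : ℝ} {F : EucSp N → EucSp N → MatN N → ℝ}
  {h : EucSp N → ℝ → EucSp N} {α : ℝ} {f : EucSp N → ℝ → ℝ} {a A Ch Mf : ℝ} {k : ℕ}

lemma uscEnv_eq {u : EucSp N → ℝ → ℝ} {x : EucSp N} {t : ℝ}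
    (hu : ContinuousAt (fun p : EucSp N × ℝ => u p.1 p.2) (x, t)) : uscEnv u x t = u x t :=
  hu.tendsto.limsup_eq

lemma lscEnv_eq_neg (u : EucSp N → ℝ → ℝ) (x : EucSp N) (t : ℝ) :
    lscEnv u x t = -uscEnv (fun x t => -u x t) x t := by
  rw [lscEnv, uscEnv, Filter.liminf_eq, Filter.limsup_eq, Real.sInf_def, neg_neg]
  congr 1
  ext b
  simp only [Set.mem_neg, Set.mem_ofPred_eq, neg_le_neg_iff]

lemma gradient_neg (φ : EucSp N → ℝ) (x : EucSp N) :
    gradient (fun y => -φ y) x = -gradient φ x := by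
  have : (fun y => -φ y) = -φ := rfl
  rw [gradient, gradient, this, fderiv_neg, map_neg]

lemma hessMat_neg (φ : EucSp N → ℝ) (x : EucSp N) :
    hessMat (fun y => -φ y) x = -hessMat φ x := by
  have e : (fun y => -φ y) = -φ := rfl
  funext i j
  show iteratedFDeriv ℝ 2 (fun y => -φ y) x _ = -(iteratedFDeriv ℝ 2 φ x _)
  rw [e, iteratedFDeriv_neg_apply]; rfl

lemma gradTerm_neg (x : EucSp N) (t : ℝ) (p : EucSp N) :
    gradTerm h α x t (-p) = -gradTerm h α x t p := by
  simp [gradTerm]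

lemma sSup_image_neg {ι : Type*} (g : ι → ℝ) (s : Set ι) :
    sSup ((fun i => -g i) '' s) = -sInf (g '' s) := by
  rw [Real.sInf_def, neg_neg]
  congr 1
  ext b
  simp only [mem_image, Set.mem_neg]
  constructor
  · rintro ⟨i, hi, rfl⟩; exact ⟨i, hi, by simp⟩
  · rintro ⟨i, hi, hb⟩; exact ⟨i, hi, by rw [hb]; simp⟩

lemma isSuperSol_iff {u : EucSp N → ℝ → ℝ} :
    IsSuperSol Ω T F h α f u ↔
      IsSubSol Ω T (flipF F) h α (fun x t => -f x t) (fun x t => -u x t) := by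
  have hl : ∀ x t, lscEnv u x t = -uscEnv (fun x t => -u x t) x t := lscEnv_eq_neg u
  unfold IsSuperSol IsSubSol
  simp only [hl]
  set U := uscEnv (fun x t => -u x t) with hU
  refine forall₂_congr fun x₀ _ => forall₂_congr fun t₀ _ => and_congr ?_ ?_
  · constructor
    · intro H φ hφ h1 h2 h3
      have := H (fun x t => -φ x t) hφ.neg (h1.mono fun z hz => neg_le_neg hz) (by rw [h2]) (by
        rw [gradient_neg]; exact neg_ne_zero.2 h3)
      simp only [gradient_neg, hessMat_neg, gradTerm_neg, deriv.fun_neg] at this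
      simp only [flipF]
      linarith
    · intro H φ hφ h1 h2 h3
      have := H (fun x t => -φ x t) hφ.neg (h1.mono fun z hz => by linarith) (by
        rw [← h2, neg_neg]) (by rw [gradient_neg]; exact neg_ne_zero.2 h3)
      simp only [gradient_neg, hessMat_neg, gradTerm_neg, deriv.fun_neg, flipF, neg_neg] at this
      linarith
  · constructor
    · intro H δ hδ φ hφ h0 h1 h2
      have := H δ hδ (fun t => -φ t) hφ.neg (by simp [h0]) (fun t ht => by linarith [h1 t ht]) ?_
      · rw [deriv.fun_neg] at this; linarith
      · filter_upwards [h2] with x hx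
        have e : ∀ x, (fun t => U x t - φ t) = fun t => -(-U x t - -φ t) := by
          intro x; funext t; ring
        rw [e, e x₀, sSup_image_neg, sSup_image_neg] at hx
        linarith
    · intro H δ hδ φ hφ h0 h1 h2
      have := H δ hδ (fun t => -φ t) hφ.neg (by simp [h0]) (fun t ht => by linarith [h1 t ht]) ?_
      · rw [deriv.fun_neg] at this; linarith
      · filter_upwards [h2] with x hx
        have e : ∀ x, (fun t => U x t - -φ t) = fun t => -(-U x t - φ t) := by
          intro x; funext t; ring
        rw [e, e x₀, sSup_image_neg, sSup_image_neg, hx]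

end Bridges

section Bridges

variable {Ω : Set (EucSp N)} {T : ℝ} {F : EucSp N → EucSp N → MatN N → ℝ}
  {h : EucSp N → ℝ → EucSp N} {α : ℝ} {f : EucSp N → ℝ → ℝ} {a A Ch Mf : ℝ} {k : ℕ}

lemma contDiff_qf (X : MatN N) : ContDiff ℝ 2 (qf X) :=
  (Matrix.toEuclideanCLM (𝕜 := ℝ) X).contDiff.inner ℝ contDiff_id

lemma hasFDerivAt_quadratic {X : MatN N} (hX : X.IsSymm) (c : ℝ) (p x₀ x : EucSp N) :
    HasFDerivAt (fun y => c + ⟪p, y - x₀⟫ + 1 / 2 * qf X (y - x₀))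
      (innerSL ℝ (p + mv X (x - x₀))) x := by
  have h1 : HasFDerivAt (fun z : EucSp N => z - x₀) (ContinuousLinearMap.id ℝ (EucSp N)) x :=
    (hasFDerivAt_id x).sub_const x₀
  have h2 : HasFDerivAt (fun z : EucSp N => mv X (z - x₀)) (Matrix.toEuclideanCLM (𝕜 := ℝ) X) x :=
    ((Matrix.toEuclideanCLM (𝕜 := ℝ) X).hasFDerivAt.comp x h1).congr_fderiv (by ext; simp)
  have h3 := (((hasFDerivAt_const p x).inner ℝ h1).const_add c).add
    ((h2.inner ℝ h1).const_mul (1 / 2))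
  refine h3.congr_fderiv ?_
  ext v
  have e : ⟪mv X v, x - x₀⟫ = ⟪mv X (x - x₀), v⟫ := by
    rw [inner_mv_symm hX, real_inner_comm]
  have e' : ⟪Matrix.toEuclideanCLM (𝕜 := ℝ) X v, x - x₀⟫ = ⟪mv X (x - x₀), v⟫ := e
  simp [fderivInnerCLM_apply, e']
  ring

lemma gradient_quadratic {X : MatN N} (hX : X.IsSymm) (c : ℝ) (p x₀ : EucSp N) :
    gradient (fun y => c + ⟪p, y - x₀⟫ + 1 / 2 * qf X (y - x₀)) x₀ = p := by
  refine HasGradientAt.gradient ?_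
  have := hasFDerivAt_quadratic hX c p x₀ x₀
  rw [sub_self, mv_zero, add_zero] at this
  exact this

lemma hessMat_quadratic {X : MatN N} (hX : X.IsSymm) (c : ℝ) (p x₀ : EucSp N) :
    hessMat (fun y => c + ⟪p, y - x₀⟫ + 1 / 2 * qf X (y - x₀)) x₀ = X := by
  have hf : fderiv ℝ (fun y => c + ⟪p, y - x₀⟫ + 1 / 2 * qf X (y - x₀))
      = fun x => innerSL ℝ (p + mv X (x - x₀)) :=
    funext fun x => (hasFDerivAt_quadratic hX c p x₀ x).fderiv
  have h1 : HasFDerivAt (fun z : EucSp N => z - x₀) (ContinuousLinearMap.id ℝ (EucSp N)) x₀ :=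
    (hasFDerivAt_id x₀).sub_const x₀
  have h2 : HasFDerivAt (fun z : EucSp N => p + mv X (z - x₀))
      (Matrix.toEuclideanCLM (𝕜 := ℝ) X) x₀ :=
    (((Matrix.toEuclideanCLM (𝕜 := ℝ) X).hasFDerivAt.comp x₀ h1).const_add p).congr_fderiv
      (by ext; simp)
  have h3 := ((innerSL ℝ (E := EucSp N)).hasFDerivAt.comp x₀ h2).fderiv
  funext i j
  show iteratedFDeriv ℝ 2 _ x₀ _ = X i j
  rw [iteratedFDeriv_two_apply, hf]
  have h4 : fderiv ℝ (fun x => innerSL ℝ (p + mv X (x - x₀))) x₀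
    = (innerSL ℝ (E := EucSp N)).comp (Matrix.toEuclideanCLM (𝕜 := ℝ) X) := h3
  rw [h4]
  simp only [Matrix.cons_val_zero, Matrix.cons_val_one, ContinuousLinearMap.comp_apply,
    innerSL_apply_apply]
  rw [EuclideanSpace.inner_single_right]
  simp [Matrix.ofLp_toEuclideanCLM]
  exact hX.apply i j

lemma quad_of_isSubSol (hQ : IsOpen Ω) {u : EucSp N → ℝ → ℝ}
    (huc : ContinuousOn (fun z : EucSp N × ℝ => u z.1 z.2) (Ω ×ˢ Ioo 0 T))
    (hu : IsSubSol Ω T F h α f u) {x₀ : EucSp N} (hx₀ : x₀ ∈ Ω) {t₀ : ℝ} (ht₀ : t₀ ∈ Ioo 0 T)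
    (p : EucSp N) (τ : ℝ) (X : MatN N) (C : ℝ) (hp : p ≠ 0) (hX : X.IsSymm)
    (ht : ∀ᶠ z in nhds (x₀, t₀), u z.1 z.2 ≤ u x₀ t₀ + ⟪p, z.1 - x₀⟫ + τ * (z.2 - t₀)
      + 1 / 2 * qf X (z.1 - x₀) + C * (z.2 - t₀) ^ 2) :
    τ - F x₀ p X - gradTerm h α x₀ t₀ p ≤ f x₀ t₀ := by
  have hQo : IsOpen (Ω ×ˢ Ioo 0 T) := hQ.prod isOpen_Ioo
  have huse : ∀ z ∈ Ω ×ˢ Ioo 0 T, uscEnv u z.1 z.2 = u z.1 z.2 := fun z hz =>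
    uscEnv_eq (huc.continuousAt (hQo.mem_nhds hz))
  have hg : (fun x : EucSp N => u x₀ t₀ + ⟪p, x - x₀⟫ + τ * (t₀ - t₀) + 1 / 2 * qf X (x - x₀)
      + C * (t₀ - t₀) ^ 2) = fun x => u x₀ t₀ + ⟪p, x - x₀⟫ + 1 / 2 * qf X (x - x₀) := by
    funext x; ring
  have hτ : HasDerivAt (fun s : ℝ => u x₀ t₀ + ⟪p, x₀ - x₀⟫ + τ * (s - t₀)
      + 1 / 2 * qf X (x₀ - x₀) + C * (s - t₀) ^ 2) τ t₀ := by
    have h1 : HasDerivAt (fun s : ℝ => s - t₀) 1 t₀ := (hasDerivAt_id t₀).sub_const t₀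
    have h2 := ((((h1.const_mul τ).const_add (u x₀ t₀ + ⟪p, x₀ - x₀⟫)).add_const
      (1 / 2 * qf X (x₀ - x₀)))).add ((h1.pow 2).const_mul C)
    refine h2.congr_deriv ?_
    simp
  have := (hu x₀ hx₀ t₀ ht₀).1 (fun x t => u x₀ t₀ + ⟪p, x - x₀⟫ + τ * (t - t₀)
      + 1 / 2 * qf X (x - x₀) + C * (t - t₀) ^ 2) ?_ ?_ ?_ ?_
  · rw [hg, gradient_quadratic hX, hessMat_quadratic hX, hτ.deriv] at this
    exact this
  · have h1 : ContDiff ℝ 2 fun z : EucSp N × ℝ => ⟪p, z.1 - x₀⟫ :=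
      contDiff_const.inner ℝ (by fun_prop)
    have h2 : ContDiff ℝ 2 fun z : EucSp N × ℝ => qf X (z.1 - x₀) :=
      (contDiff_qf X).comp (by fun_prop)
    exact (((contDiff_const.add h1).add (by fun_prop)).add (contDiff_const.mul h2)).add
      (by fun_prop)
  · filter_upwards [ht, hQo.mem_nhds (show (x₀, t₀) ∈ Ω ×ˢ Ioo 0 T from ⟨hx₀, ht₀⟩)] with z h1 h2
    rw [huse z h2]; exact h1
  · rw [huse (x₀, t₀) ⟨hx₀, ht₀⟩]; simp [qf_zero]
  · rw [hg, gradient_quadratic hX]; exact hp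

lemma eq_of_sub_le_pow {g : EucSp N → ℝ} {x₀ : EucSp N} {ρ M : ℝ} {n : ℕ} (hn : 2 ≤ n)
    (hg : ∀ x ∈ ball x₀ ρ, ∀ y ∈ ball x₀ ρ, g x - g y ≤ M * ‖x - y‖ ^ n) :
    ∀ x ∈ ball x₀ ρ, g x = g x₀ := by
  intro x hx
  have hρ : 0 < ρ := pos_of_mem_ball hx
  have hder : ∀ y ∈ ball x₀ ρ, HasFDerivAt g (0 : EucSp N →L[ℝ] ℝ) y := by
    intro y hy
    rw [hasFDerivAt_iff_isLittleO]
    have hO : (fun z => g z - g y - (0 : EucSp N →L[ℝ] ℝ) (z - y)) =O[nhds y]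
        fun z => ‖z - y‖ ^ n := by
      refine Asymptotics.IsBigO.of_bound M ?_
      filter_upwards [isOpen_ball.mem_nhds hy] with z hz
      simp only [zero_apply, sub_zero, Real.norm_eq_abs]
      rw [abs_of_nonneg (by positivity : (0:ℝ) ≤ ‖z - y‖ ^ n), abs_le]
      have h1 := hg z hz y hy
      have h2 := hg y hy z hz
      rw [norm_sub_rev] at h2
      constructor <;> linarith
    refine hO.trans_isLittleO ?_
    have := (Asymptotics.isLittleO_norm_pow_id (E' := EucSp N) (n := n) (by omega : 1 < n))
    have ht : Tendsto (fun z : EucSp N => z - y) (nhds y) (nhds 0) := by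
      have : Continuous fun z : EucSp N => z - y := by fun_prop
      simpa using this.tendsto y
    exact this.comp_tendsto ht
  have := (convex_ball x₀ ρ).is_const_of_fderivWithin_eq_zero (𝕜 := ℝ) (f := g)
    (fun y hy => (hder y hy).differentiableAt.differentiableWithinAt)
    (fun y hy => by
      rw [fderivWithin_of_isOpen isOpen_ball hy]; exact (hder y hy).fderiv)
    hx (mem_ball_self hρ)
  exact this

lemma penalized_max_bound {x x₀ x₁ : EucSp N} {c M s B : ℝ} (hc : 0 ≤ c) (hM : M = c * 4 ^ k + 1)
    (hk : 1 ≤ k)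
    (h : s ^ 2 + M * ‖x - x₁‖ ^ (2 * k) ≤ c * ‖x - x₀‖ ^ (2 * k) + M * ‖x₁ - x₀‖ ^ (2 * k))
    (hB : B = ‖x₁ - x₀‖) :
    s ^ 2 ≤ 2 * M * B ^ (2 * k) ∧ ‖x - x₁‖ ^ (2 * k) ≤ 2 * M * B ^ (2 * k) := by
  subst hB
  have h1 : ‖x - x₀‖ ^ (2 * k) ≤ 4 ^ k * (‖x - x₁‖ ^ (2 * k) + ‖x₁ - x₀‖ ^ (2 * k)) := by
    calc ‖x - x₀‖ ^ (2 * k) ≤ (‖x - x₁‖ + ‖x₁ - x₀‖) ^ (2 * k) := by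
          gcongr; exact norm_sub_le_norm_sub_add_norm_sub _ _ _
      _ ≤ 2 ^ (2 * k - 1) * (‖x - x₁‖ ^ (2 * k) + ‖x₁ - x₀‖ ^ (2 * k)) :=
          add_pow_le (norm_nonneg _) (norm_nonneg _) _
      _ ≤ 2 ^ (2 * k) * (‖x - x₁‖ ^ (2 * k) + ‖x₁ - x₀‖ ^ (2 * k)) := by
          gcongr
          · norm_num
          · omega
      _ = _ := by rw [pow_mul]; norm_num
  have h2 := mul_le_mul_of_nonneg_left h1 hc
  have e1 : (0:ℝ) ≤ ‖x - x₁‖ ^ (2 * k) := by positivity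
  have e2 : (0:ℝ) ≤ ‖x₁ - x₀‖ ^ (2 * k) := by positivity
  have hc4 : 0 ≤ c * 4 ^ k := by positivity
  have h3 : s ^ 2 + ‖x - x₁‖ ^ (2 * k) ≤ 2 * M * ‖x₁ - x₀‖ ^ (2 * k) := by
    rw [hM] at h ⊢
    nlinarith
  constructor <;> nlinarith [sq_nonneg s]

theorem ViscSub.of_isSubSol (D : EqData Ω T F h α f a A Ch Mf k) {u : EucSp N → ℝ → ℝ}
    (huc : ContinuousOn (fun z : EucSp N × ℝ => u z.1 z.2) (Ω ×ˢ Ioo 0 T))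
    (hu : IsSubSol Ω T F h α f u) : ViscSub Ω T F h α f k (fun z => u z.1 z.2) := by
  intro x₀ hx₀ t₀ ht₀
  refine ⟨quad_of_isSubSol D.isOpen huc hu hx₀ ht₀, fun τ C ht => ?_⟩
  have hQo : IsOpen (Ω ×ˢ Ioo 0 T) := D.isOpen.prod isOpen_Ioo
  have hk1 : 1 ≤ k := by have := D.two_le; omega
  have hz₀ : (x₀, t₀) ∈ Ω ×ˢ Ioo 0 T := ⟨hx₀, ht₀⟩
  have huse : ∀ z ∈ Ω ×ˢ Ioo 0 T, uscEnv u z.1 z.2 = u z.1 z.2 := fun z hz =>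
    uscEnv_eq (huc.continuousAt (hQo.mem_nhds hz))
  obtain ⟨r₀, hr₀, hball⟩ := Metric.eventually_nhds_iff.1 (ht.and (hQo.mem_nhds hz₀))
  set r := r₀ / 2 with hr
  have hrpos : 0 < r := by positivity
  set g : ℝ → ℝ := fun t => τ * (t - t₀) + (|C| + 1) * (t - t₀) ^ 2 with hg
  have hgc : Continuous g := by fun_prop
  have hin : ∀ z ∈ closedBall (x₀, t₀) r,
      u z.1 z.2 - g z.2 ≤ u x₀ t₀ - (z.2 - t₀) ^ 2 + |C| * ‖z.1 - x₀‖ ^ (2 * k)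
      ∧ z ∈ Ω ×ˢ Ioo 0 T := by
    intro z hz
    have := hball (y := z) ((mem_closedBall.1 hz).trans_lt (by linarith))
    refine ⟨?_, this.2⟩
    have h1 : C * (z.2 - t₀) ^ 2 ≤ |C| * (z.2 - t₀) ^ 2 := by
      gcongr; exact le_abs_self C
    have h2 : C * ‖z.1 - x₀‖ ^ (2 * k) ≤ |C| * ‖z.1 - x₀‖ ^ (2 * k) := by
      gcongr; exact le_abs_self C
    have h3 := this.1
    simp only [hg] at h3 ⊢
    linarith
  set M : ℝ := |C| * 4 ^ k + 1 with hM
  have hMpos : 0 < M := by positivity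
  have hmax : ∀ x₁ : EucSp N, ∃ y ∈ closedBall (x₀, t₀) r, ∀ z ∈ closedBall (x₀, t₀) r,
      u z.1 z.2 - g z.2 - M * ‖z.1 - x₁‖ ^ (2 * k)
        ≤ u y.1 y.2 - g y.2 - M * ‖y.1 - x₁‖ ^ (2 * k) := by
    intro x₁
    have hc : ContinuousOn (fun z : EucSp N × ℝ => u z.1 z.2 - g z.2 - M * ‖z.1 - x₁‖ ^ (2 * k))
        (closedBall (x₀, t₀) r) :=
      ((huc.mono fun z hz => (hin z hz).2).sub (by fun_prop)).sub (by fun_prop)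
    obtain ⟨y, hy, hm⟩ := (isCompact_closedBall_prod (x₀, t₀) r).exists_isMaxOn
      ⟨_, mem_closedBall_self hrpos.le⟩ hc
    exact ⟨y, hy, fun z hz => hm hz⟩
  choose Y hYb hYm using hmax
  have hbd : ∀ x₁, ((Y x₁).2 - t₀) ^ 2 ≤ 2 * M * ‖x₁ - x₀‖ ^ (2 * k) ∧
      ‖(Y x₁).1 - x₁‖ ^ (2 * k) ≤ 2 * M * ‖x₁ - x₀‖ ^ (2 * k) := by
    intro x₁
    refine penalized_max_bound (abs_nonneg C) hM hk1 ?_ rfl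
    have h1 := hYm x₁ (x₀, t₀) (mem_closedBall_self hrpos.le)
    have h2 := (hin _ (hYb x₁)).1
    have h3 : g t₀ = 0 := by simp [hg]
    simp only [h3, norm_sub_rev x₀ x₁] at h1
    linarith
  have hBt : Tendsto (fun x₁ => 2 * M * ‖x₁ - x₀‖ ^ (2 * k)) (nhds x₀) (nhds 0) := by
    have hc : Continuous fun x₁ => 2 * M * ‖x₁ - x₀‖ ^ (2 * k) := by fun_prop
    have := hc.tendsto x₀
    have hk0 : 2 * k ≠ 0 := by omega
    simpa [hk0] using this
  have hdt : Tendsto (fun x₁ => ‖(Y x₁).1 - x₁‖) (nhds x₀) (nhds 0) := by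
    have h1 : Tendsto (fun x₁ => ‖(Y x₁).1 - x₁‖ ^ (2 * k)) (nhds x₀) (nhds 0) :=
      squeeze_zero (fun _ => by positivity) (fun x₁ => (hbd x₁).2) hBt
    rw [Metric.tendsto_nhds] at h1 ⊢
    intro ε hε
    filter_upwards [h1 (ε ^ (2 * k)) (by positivity)] with x hx
    rw [dist_zero_right, Real.norm_of_nonneg (by positivity)] at hx ⊢
    exact lt_of_pow_lt_pow_left₀ _ hε.le hx
  have htt : Tendsto (fun x₁ => (Y x₁).2) (nhds x₀) (nhds t₀) := by
    have h1 : Tendsto (fun x₁ => ((Y x₁).2 - t₀) ^ 2) (nhds x₀) (nhds 0) :=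
      squeeze_zero (fun _ => by positivity) (fun x₁ => (hbd x₁).1) hBt
    rw [Metric.tendsto_nhds] at h1 ⊢
    intro ε hε
    filter_upwards [h1 (ε ^ 2) (by positivity)] with x hx
    rw [dist_zero_right, Real.norm_of_nonneg (by positivity)] at hx
    rw [Real.dist_eq]
    exact abs_lt_of_sq_lt_sq hx hε.le
  have hxt : Tendsto (fun x₁ => (Y x₁).1) (nhds x₀) (nhds x₀) := by
    have h1 : Tendsto (fun x₁ => (Y x₁).1 - x₁) (nhds x₀) (nhds 0) :=
      tendsto_zero_iff_norm_tendsto_zero.2 hdt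
    have := h1.add (tendsto_id (x := nhds x₀))
    simpa using this
  have hYt : Tendsto Y (nhds x₀) (nhds (x₀, t₀)) := hxt.prodMk_nhds htt
  have hYr : ∀ᶠ x₁ in nhds x₀, Y x₁ ∈ ball (x₀, t₀) r :=
    hYt.eventually (isOpen_ball.mem_nhds (mem_ball_self hrpos))
  by_cases hfreq : ∃ᶠ x₁ in nhds x₀, (Y x₁).1 ≠ x₁
  · have hineq : ∃ᶠ x₁ in nhds x₀, τ + 2 * (|C| + 1) * ((Y x₁).2 - t₀) ≤ f (Y x₁).1 (Y x₁).2
        + powErr N A Ch α k M ‖(Y x₁).1 - x₁‖ := by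
      refine (hfreq.and_eventually hYr).mono ?_
      rintro x₁ ⟨hne, hb⟩
      have hq := (hin _ (hYb x₁)).2
      refine power_of_quad D (u := fun z => u z.1 z.2) hq.1 hq.2
        (quad_of_isSubSol D.isOpen huc hu hq.1 hq.2) hne (C := |C| + 1) hMpos ?_
      filter_upwards [isOpen_ball.mem_nhds hb] with z hz
      have := hYm x₁ z (ball_subset_closedBall hz)
      simp only [hg] at this ⊢
      nlinarith
    have hl := ((htt.sub_const t₀).const_mul (2 * (|C| + 1))).const_add τ
    have hrr := (D.tendsto_f hx₀ ht₀ hxt htt).add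
      ((tendsto_powErr (N := N) A Ch M D.k_alpha).comp hdt)
    rw [sub_self, mul_zero, add_zero] at hl
    rw [add_zero] at hrr
    exact le_of_tendsto_of_tendsto_of_frequently hl hrr hineq
  · have hev : ∀ᶠ x₁ in nhds x₀, (Y x₁).1 = x₁ := by
      simpa [Filter.not_frequently] using hfreq
    obtain ⟨ρ₀, hρ₀, hρ⟩ := Metric.eventually_nhds_iff.1 (hev.and hYr)
    set ρ := min ρ₀ r with hρdef
    have hρpos : 0 < ρ := lt_min hρ₀ hrpos
    set m : EucSp N → ℝ := fun x =>
      sSup ((fun t => uscEnv u x t - g t) '' Ioo (t₀ - r) (t₀ + r)) with hm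
    have hIn : ∀ x ∈ ball x₀ ρ, ∀ t ∈ Ioo (t₀ - r) (t₀ + r), (x, t) ∈ closedBall (x₀, t₀) r := by
      intro x hx t ht
      rw [mem_closedBall, Prod.dist_eq]
      refine max_le ((mem_ball.1 hx).le.trans (min_le_right _ _)) ?_
      rw [Real.dist_eq, abs_le]; constructor <;> linarith [ht.1, ht.2]
    have hgreat : ∀ x ∈ ball x₀ ρ,
        IsGreatest ((fun t => uscEnv u x t - g t) '' Ioo (t₀ - r) (t₀ + r))
          (u x (Y x).2 - g (Y x).2) := by
      intro x hx
      have hx' := hρ (y := x) ((mem_ball.1 hx).trans_le (min_le_left _ _))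
      have hYt0 : (Y x).2 ∈ Ioo (t₀ - r) (t₀ + r) := by
        have h1 := hx'.2
        rw [mem_ball, Prod.dist_eq] at h1
        have h2 := (le_max_right _ _).trans_lt h1
        rw [Real.dist_eq, abs_lt] at h2
        constructor <;> linarith [h2.1, h2.2]
      refine ⟨⟨(Y x).2, hYt0, ?_⟩, ?_⟩
      · have := huse _ (hin _ (hIn x hx _ hYt0)).2
        simp only at this ⊢
        rw [this]
      · rintro _ ⟨t, htI, rfl⟩
        have h1 := hYm x (x, t) (hIn x hx t htI)
        have h2 := huse _ (hin _ (hIn x hx _ htI)).2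
        simp only at h1 h2 ⊢
        rw [hx'.1] at h1
        rw [h2]; linarith
    have hmeq : ∀ x ∈ ball x₀ ρ, m x = u x (Y x).2 - g (Y x).2 := fun x hx =>
      (hgreat x hx).csSup_eq
    have hconst : ∀ x ∈ ball x₀ ρ, m x = m x₀ := by
      refine eq_of_sub_le_pow (n := 2 * k) (M := M) (by omega) fun x hx y hy => ?_
      have hx' := hρ (y := x) ((mem_ball.1 hx).trans_le (min_le_left _ _))
      have hy' := hρ (y := y) ((mem_ball.1 hy).trans_le (min_le_left _ _))
      have h1 := hYm y (Y x) (hYb x)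
      rw [hx'.1, hy'.1, sub_self, norm_zero, zero_pow (by omega)] at h1
      rw [hmeq x hx, hmeq y hy]; linarith
    have hgt₀ : g t₀ = 0 := by simp [hg]
    have hfin := (hu x₀ hx₀ t₀ ht₀).2 r hrpos g (by fun_prop) hgt₀ (fun t htI => by
        have h0 := hIn x₀ (mem_ball_self hρpos) t htI
        have h1 := (hin _ h0).1
        rw [huse _ (hin _ h0).2, huse _ hz₀]
        simp only [sub_self, norm_zero] at h1
        rw [zero_pow (by omega)] at h1
        nlinarith [sq_nonneg (t - t₀)]) (by
        filter_upwards [isOpen_ball.mem_nhds (mem_ball_self hρpos)] with x hx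
        exact hconst x hx)
    have hgd : HasDerivAt g τ t₀ := by
      have h1 : HasDerivAt (fun s : ℝ => s - t₀) 1 t₀ := (hasDerivAt_id t₀).sub_const t₀
      refine ((h1.const_mul τ).add ((h1.pow 2).const_mul (|C| + 1))).congr_deriv ?_
      simp
    rwa [hgd.deriv] at hfin

end Bridges

section BridgeBack

variable {Ω : Set (EucSp N)} {T : ℝ} {F : EucSp N → EucSp N → MatN N → ℝ}
  {h : EucSp N → ℝ → EucSp N} {α : ℝ} {f : EucSp N → ℝ → ℝ} {a A Ch Mf : ℝ} {k : ℕ}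

lemma qf_eq_sum (X : MatN N) (v : EucSp N) : qf X v = ∑ i, ∑ j, X i j * v i * v j := by
  have := dotProduct_mulVec_eq_qf X (WithLp.ofLp v)
  rw [WithLp.toLp_ofLp] at this
  rw [← this]
  simp only [dotProduct, Matrix.mulVec, Finset.mul_sum, Pi.star_apply, star_trivial]
  exact Finset.sum_congr rfl fun i _ => Finset.sum_congr rfl fun j _ => by ring

lemma qf_of_bilin (B : EucSp N →L[ℝ] EucSp N →L[ℝ] ℝ) {X : MatN N}
    (hX : ∀ i j, X i j = B (EuclideanSpace.single i 1) (EuclideanSpace.single j 1))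
    (v : EucSp N) : qf X v = B v v := by
  have hv : v = ∑ i, v i • EuclideanSpace.single i (1:ℝ) := by
    ext j
    simp [Finset.sum_apply, Pi.single_apply]
  rw [qf_eq_sum]
  conv_rhs => rw [hv]
  simp only [map_sum, map_smul, sum_apply, smul_apply, smul_eq_mul, hX,
    Finset.mul_sum]
  rw [Finset.sum_comm]
  refine Finset.sum_congr rfl fun i _ => Finset.sum_congr rfl fun j _ => by ring

/-- Derivatives of a space-time function in terms of the spatial ones. -/
lemma spatial_derivs {Φ : EucSp N × ℝ → ℝ} (hΦ : ContDiff ℝ 2 Φ) (x₀ : EucSp N) (t₀ : ℝ) :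
    (∀ v, ⟪gradient (fun x => Φ (x, t₀)) x₀, v⟫ = fderiv ℝ Φ (x₀, t₀) (v, 0)) ∧
    deriv (fun s => Φ (x₀, s)) t₀ = fderiv ℝ Φ (x₀, t₀) (0, 1) ∧
    (hessMat (fun x => Φ (x, t₀)) x₀).IsSymm ∧
    ∀ v, qf (hessMat (fun x => Φ (x, t₀)) x₀) v
      = fderiv ℝ (fderiv ℝ Φ) (x₀, t₀) (v, 0) (v, 0) := by
  have hd1 : Differentiable ℝ Φ := hΦ.differentiable (by norm_num)
  have hc1 : ContDiff ℝ 1 (fderiv ℝ Φ) := hΦ.fderiv_right (by norm_num)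
  have hd2 : Differentiable ℝ (fderiv ℝ Φ) := hc1.differentiable (by norm_num)
  have hi : ∀ x, HasFDerivAt (fun x : EucSp N => (x, t₀)) (ContinuousLinearMap.inl ℝ (EucSp N) ℝ) x :=
    fun x => hasFDerivAt_prodMk_left x t₀
  have hx : ∀ x, HasFDerivAt (fun x => Φ (x, t₀))
      ((fderiv ℝ Φ (x, t₀)).comp (ContinuousLinearMap.inl ℝ (EucSp N) ℝ)) x := fun x =>
    (hd1 (x, t₀)).hasFDerivAt.comp x (hi x)
  have hfx : fderiv ℝ (fun x => Φ (x, t₀)) = fun x =>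
      (fderiv ℝ Φ (x, t₀)).comp (ContinuousLinearMap.inl ℝ (EucSp N) ℝ) :=
    funext fun x => (hx x).fderiv
  have h2 : HasFDerivAt (fun x => fderiv ℝ Φ (x, t₀))
      ((fderiv ℝ (fderiv ℝ Φ) (x₀, t₀)).comp (ContinuousLinearMap.inl ℝ (EucSp N) ℝ)) x₀ :=
    (hd2 (x₀, t₀)).hasFDerivAt.comp x₀ (hi x₀)
  have h3 := (h2.clm_comp (hasFDerivAt_const (ContinuousLinearMap.inl ℝ (EucSp N) ℝ) x₀)).fderiv
  have hent : ∀ v w, fderiv ℝ (fderiv ℝ (fun x => Φ (x, t₀))) x₀ v w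
      = fderiv ℝ (fderiv ℝ Φ) (x₀, t₀) (v, 0) (w, 0) := by
    intro v w
    rw [hfx, h3]; simp
  have hHij : ∀ i j, hessMat (fun x => Φ (x, t₀)) x₀ i j
      = fderiv ℝ (fderiv ℝ (fun x => Φ (x, t₀))) x₀ (EuclideanSpace.single i 1)
        (EuclideanSpace.single j 1) := by
    intro i j
    show iteratedFDeriv ℝ 2 _ x₀ _ = _
    rw [iteratedFDeriv_two_apply]; rfl
  refine ⟨fun v => ?_, ?_, ?_, fun v => ?_⟩
  · rw [gradient, InnerProductSpace.toDual_symm_apply, hfx]; simp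
  · have := ((hd1 (x₀, t₀)).hasFDerivAt.comp_hasDerivAt t₀
      ((hasDerivAt_const t₀ x₀).prodMk (hasDerivAt_id t₀))).deriv
    exact this
  · refine Matrix.IsSymm.ext fun i j => ?_
    rw [hHij, hHij, hent, hent]
    exact (hΦ.contDiffAt (x := (x₀, t₀))).isSymmSndFDerivAt (by simp) _ _
  · rw [qf_of_bilin _ hHij, hent]

set_option maxHeartbeats 1000000 in
lemma eventually_quad_of_c2 {Φ : EucSp N × ℝ → ℝ} (hΦ : ContDiff ℝ 2 Φ) (x₀ : EucSp N) (t₀ : ℝ)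
    {ε : ℝ} (hε : 0 < ε) : ∃ C, ∀ᶠ z in nhds (x₀, t₀), Φ z ≤ Φ (x₀, t₀)
      + ⟪gradient (fun x => Φ (x, t₀)) x₀, z.1 - x₀⟫
      + deriv (fun s => Φ (x₀, s)) t₀ * (z.2 - t₀)
      + 1 / 2 * qf (hessMat (fun x => Φ (x, t₀)) x₀ + ε • (1 : MatN N)) (z.1 - x₀)
      + C * (z.2 - t₀) ^ 2 := by
  obtain ⟨hg, hτ, -, hq⟩ := spatial_derivs hΦ x₀ t₀
  set B := fderiv ℝ (fderiv ℝ Φ) (x₀, t₀) with hB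
  set b := ‖B‖ with hb
  have hb0 : 0 ≤ b := norm_nonneg B
  refine ⟨b ^ 2 / ε + b + ε, ?_⟩
  filter_upwards [taylor_two hΦ (x₀, t₀) (by positivity : 0 < ε / 4)] with z hz
  obtain ⟨x, t⟩ := z
  simp only [Prod.mk_sub_mk] at hz ⊢
  set v := x - x₀
  set s := t - t₀
  have e : ((v, s) : EucSp N × ℝ) = (v, 0) + s • (0, 1) := by simp
  have hn01 : ‖((0, 1) : EucSp N × ℝ)‖ = 1 := by simp [Prod.norm_def]
  have hnv : ‖((v, 0) : EucSp N × ℝ)‖ = ‖v‖ := by simp [Prod.norm_def]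
  have hBe : ∀ p q, |B p q| ≤ b * ‖p‖ * ‖q‖ := fun p q => B.le_opNorm₂ p q
  have h1 := (abs_le.1 (hBe (v, 0) (0, 1)))
  have h2 := (abs_le.1 (hBe (0, 1) (v, 0)))
  have h3 := (abs_le.1 (hBe (0, 1) (0, 1)))
  rw [hn01, hnv] at h1 h2
  rw [hn01] at h3
  have hnvs : ‖((v, s) : EucSp N × ℝ)‖ ^ 2 ≤ ‖v‖ ^ 2 + s ^ 2 := by
    rw [Prod.norm_def]
    rcases max_cases ‖v‖ ‖s‖ with ⟨hm, _⟩ | ⟨hm, _⟩ <;> simp only [hm]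
    · nlinarith [sq_nonneg s]
    · rw [Real.norm_eq_abs, sq_abs]; nlinarith [sq_nonneg ‖v‖]
  rw [e] at hz
  simp only [map_add, map_smul, add_apply, smul_apply, smul_eq_mul] at hz
  rw [← e, ← hg, ← hτ, ← hq] at hz
  rw [qf_add_left, qf_smul_left, qf_one]
  have hc1 : s * B (v, 0) (0, 1) ≤ |s| * (b * ‖v‖) := by
    refine (le_abs_self _).trans ?_
    rw [abs_mul]; gcongr
    rw [abs_le]; constructor <;> linarith [h1.1, h1.2]
  have hc2 : s * B (0, 1) (v, 0) ≤ |s| * (b * ‖v‖) := by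
    refine (le_abs_self _).trans ?_
    rw [abs_mul]; gcongr
    rw [abs_le]; constructor <;> linarith [h2.1, h2.2]
  have hy : |s| * (b * ‖v‖) ≤ ε / 4 * ‖v‖ ^ 2 + b ^ 2 / ε * s ^ 2 := by
    have h0 : 0 ≤ (ε / 2 * ‖v‖ - b * |s|) ^ 2 / ε := by positivity
    have e2 : (ε / 2 * ‖v‖ - b * |s|) ^ 2 / ε
        = ε / 4 * ‖v‖ ^ 2 + b ^ 2 / ε * s ^ 2 - |s| * (b * ‖v‖) := by
      field_simp
      rw [← sq_abs s]; ring
    linarith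
  have hs2 := sq_nonneg s
  have hc3 : s * (s * B (0, 1) (0, 1)) ≤ b * s ^ 2 := by nlinarith [h3.2]
  nlinarith [hz, hnvs, hc1, hc2, hc3, hy]

lemma abs_uscEnv_le {u : EucSp N → ℝ → ℝ} {B : ℝ} (hB : ∀ x t, |u x t| ≤ B) (x : EucSp N) (t : ℝ) :
    |uscEnv u x t| ≤ B := by
  have hb : IsBoundedUnder (· ≤ ·) (nhds (x, t)) (fun p : EucSp N × ℝ => u p.1 p.2) :=
    ⟨B, eventually_map.2 (Eventually.of_forall fun p => (abs_le.1 (hB p.1 p.2)).2)⟩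
  have hb2 : IsBoundedUnder (· ≥ ·) (nhds (x, t)) (fun p : EucSp N × ℝ => u p.1 p.2) :=
    ⟨-B, eventually_map.2 (Eventually.of_forall fun p => (abs_le.1 (hB p.1 p.2)).1)⟩
  rw [abs_le]
  constructor
  · exact le_limsup_of_frequently_le
      (Frequently.of_forall fun p => (abs_le.1 (hB p.1 p.2)).1) hb
  · exact limsup_le_of_le hb2.isCoboundedUnder_le
      (Eventually.of_forall fun p => (abs_le.1 (hB p.1 p.2)).2)

theorem ViscSub.isSubSol (D : EqData Ω T F h α f a A Ch Mf k) {u : EucSp N → ℝ → ℝ}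
    (huc : ContinuousOn (fun z : EucSp N × ℝ => u z.1 z.2) (Ω ×ˢ Ioo 0 T)) {B : ℝ}
    (hB : ∀ x t, |u x t| ≤ B)
    (hu : ViscSub Ω T F h α f k (fun z => u z.1 z.2)) : IsSubSol Ω T F h α f u := by
  intro x₀ hx₀ t₀ ht₀
  have hQo : IsOpen (Ω ×ˢ Ioo 0 T) := D.isOpen.prod isOpen_Ioo
  have hz₀ : (x₀, t₀) ∈ Ω ×ˢ Ioo 0 T := ⟨hx₀, ht₀⟩
  have huse : ∀ z ∈ Ω ×ˢ Ioo 0 T, uscEnv u z.1 z.2 = u z.1 z.2 := fun z hz =>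
    uscEnv_eq (huc.continuousAt (hQo.mem_nhds hz))
  constructor
  · intro φ hφ hle heq hg
    set Φ : EucSp N × ℝ → ℝ := fun z => φ z.1 z.2 with hΦ
    set p := gradient (fun x => φ x t₀) x₀ with hp
    set X := hessMat (fun x => φ x t₀) x₀ with hX
    set τ := deriv (fun s => φ x₀ s) t₀ with hτ
    have hXs : X.IsSymm := (spatial_derivs hφ x₀ t₀).2.2.1
    have hn0 : Tendsto (fun n : ℕ => 1 / ((n:ℝ) + 1)) atTop (nhds 0) :=
      tendsto_one_div_add_atTop_nhds_zero_nat
    have hXl : Tendsto (fun n : ℕ => X + (1 / ((n:ℝ) + 1)) • (1 : MatN N)) atTop (nhds X) := by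
      have h1 := (hn0.smul_const (1 : MatN N)).const_add X
      rwa [zero_smul, add_zero] at h1
    have hineq : ∀ n : ℕ, τ - F x₀ p (X + (1 / ((n:ℝ) + 1)) • (1 : MatN N))
        - gradTerm h α x₀ t₀ p ≤ f x₀ t₀ := by
      intro n
      obtain ⟨C, hC⟩ := eventually_quad_of_c2 hφ x₀ t₀ (by positivity : 0 < 1 / ((n:ℝ) + 1))
      refine (hu x₀ hx₀ t₀ ht₀).quad p τ _ C hg (hXs.add (isSymm_one.smul _)) ?_
      filter_upwards [hC, hle, hQo.mem_nhds hz₀] with z h1 h2 h3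
      rw [huse z h3] at h2
      have h4 := huse _ hz₀
      simp only at h4 h1 h2 ⊢
      rw [← h4, heq]
      exact h2.trans h1
    exact le_of_tendsto ((tendsto_const_nhds.sub (D.tendsto_F hx₀ hg tendsto_const_nhds
      tendsto_const_nhds hXl)).sub_const _) (Eventually.of_forall hineq)
  · intro δ hδ φ hφ hφ0 hle hsup
    have hu₀ := huse _ hz₀
    simp only at hu₀
    have hΦ : ContDiff ℝ 2 (fun z : EucSp N × ℝ => φ z.2) := hφ.comp contDiff_snd
    obtain ⟨C, hC⟩ := eventually_quad_of_c2 hΦ x₀ t₀ one_pos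
    have hline : ∀ᶠ t in nhds t₀, φ t ≤ deriv φ t₀ * (t - t₀) + C * (t - t₀) ^ 2 := by
      have hc : Tendsto (fun t : ℝ => (x₀, t)) (nhds t₀) (nhds (x₀, t₀)) :=
        (Continuous.tendsto (by fun_prop) t₀)
      filter_upwards [hc.eventually hC] with t ht
      simp only [hφ0, sub_self, inner_zero_right, qf_zero] at ht
      have e : deriv (fun s => φ s) t₀ = deriv φ t₀ := rfl
      rw [e] at ht
      linarith
    refine (hu x₀ hx₀ t₀ ht₀).flat _ (|C|) ?_
    have hbdd : ∀ x, BddAbove ((fun t => uscEnv u x t - φ t) '' Ioo (t₀ - δ) (t₀ + δ)) := by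
      intro x
      obtain ⟨m, hm⟩ := (isCompact_Icc (a := t₀ - δ) (b := t₀ + δ)).exists_bound_of_continuousOn
        hφ.continuous.continuousOn
      refine ⟨B + m, ?_⟩
      rintro _ ⟨t, ht, rfl⟩
      have h1 := (abs_le.1 (abs_uscEnv_le hB x t)).2
      have h2 := hm t (Ioo_subset_Icc_self ht)
      rw [Real.norm_eq_abs, abs_le] at h2
      simp only
      linarith [h2.1]
    have hs₀ : sSup ((fun t => uscEnv u x₀ t - φ t) '' Ioo (t₀ - δ) (t₀ + δ)) ≤ u x₀ t₀ := by
      refine csSup_le ⟨_, ⟨t₀, ⟨by linarith, by linarith⟩, rfl⟩⟩ ?_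
      rintro _ ⟨t, ht, rfl⟩
      rw [← hu₀]; exact hle t ht
    have h1 : ∀ᶠ z : EucSp N × ℝ in nhds (x₀, t₀), sSup ((fun t => uscEnv u z.1 t - φ t) ''
        Ioo (t₀ - δ) (t₀ + δ)) = sSup ((fun t => uscEnv u x₀ t - φ t) '' Ioo (t₀ - δ) (t₀ + δ)) :=
      (continuous_fst.tendsto (x₀, t₀)).eventually hsup
    have h2 : ∀ᶠ z : EucSp N × ℝ in nhds (x₀, t₀), z.2 ∈ Ioo (t₀ - δ) (t₀ + δ) :=
      (continuous_snd.tendsto (x₀, t₀)).eventually (isOpen_Ioo.mem_nhds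
        ⟨by linarith, by linarith⟩)
    have h3 : ∀ᶠ z : EucSp N × ℝ in nhds (x₀, t₀),
        φ z.2 ≤ deriv φ t₀ * (z.2 - t₀) + C * (z.2 - t₀) ^ 2 :=
      (continuous_snd.tendsto (x₀, t₀)).eventually hline
    filter_upwards [h1, h2, h3, hQo.mem_nhds hz₀] with z e1 e2 e3 e4
    have e5 := le_csSup (hbdd z.1) ⟨z.2, e2, rfl⟩
    have e6 := huse z e4
    simp only at e5
    rw [e6, e1] at e5
    have e7 : C * (z.2 - t₀) ^ 2 ≤ |C| * (z.2 - t₀) ^ 2 := by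
      gcongr; exact le_abs_self C
    have e8 : 0 ≤ |C| * ‖z.1 - x₀‖ ^ (2 * k) := by positivity
    linarith

end BridgeBack

section Relaxation

lemma exists_resolvent {X : MatN N} (hX : X.IsSymm) {μ : ℝ} (hμ : 0 < μ)
    (h : ∀ v, qf X v ≤ μ * ‖v‖ ^ 2) :
    ∃ X' : MatN N, X'.IsSymm ∧ (∀ v, -(4 * μ * ‖v‖ ^ 2) ≤ qf X' v) ∧ (∀ v, qf X v ≤ qf X' v) ∧
      ∀ ξ, ∃ w, qf X' ξ = qf X w - 4 * μ * ‖ξ - w‖ ^ 2 := by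
  set R : MatN N := 1 - (4 * μ)⁻¹ • X with hR
  have hRs : R.IsSymm := isSymm_one.sub (hX.smul _)
  have hmR : ∀ v, mv R v = v - (4 * μ)⁻¹ • mv X v := fun v => by
    rw [hR, mv_sub_left, mv_one, mv_smul_left]
  have hXR : ∀ v, mv X v = (4 * μ) • (v - mv R v) := fun v => by
    rw [hmR, sub_sub_cancel, smul_smul, mul_inv_cancel₀ (by positivity), one_smul]
  have hRq : ∀ v, qf R v = ‖v‖ ^ 2 - (4 * μ)⁻¹ * qf X v := fun v => by
    rw [hR, qf_sub_left, qf_one, qf_smul_left]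
  have hRpos : ∀ v, 3 / 4 * ‖v‖ ^ 2 ≤ qf R v := fun v => by
    have h1 : (4 * μ)⁻¹ * qf X v ≤ (4 * μ)⁻¹ * (μ * ‖v‖ ^ 2) :=
      mul_le_mul_of_nonneg_left (h v) (by positivity)
    have h2 : (4 * μ)⁻¹ * (μ * ‖v‖ ^ 2) = 1 / 4 * ‖v‖ ^ 2 := by field_simp
    rw [hRq]; linarith
  have hunit : IsUnit R.det := by
    rw [isUnit_iff_ne_zero]
    intro h0
    obtain ⟨v, hv, hv0⟩ := Matrix.exists_mulVec_eq_zero_iff.2 h0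
    have h1 := dotProduct_mulVec_eq_qf R v
    rw [hv0, dotProduct_zero] at h1
    have h2 := hRpos (WithLp.toLp 2 v)
    have h3 : ‖(WithLp.toLp 2 v : EucSp N)‖ ^ 2 = 0 :=
      le_antisymm (by linarith) (by positivity)
    have h4 : (WithLp.toLp 2 v : EucSp N) = 0 := by simpa using h3
    exact hv (by simpa using h4)
  have hRS : ∀ v, mv R (mv R⁻¹ v) = v := fun v => by
    rw [← mv_mul, Matrix.mul_nonsing_inv _ hunit, mv_one]
  have hSs : (R⁻¹).IsSymm := by
    rw [Matrix.IsSymm, Matrix.transpose_nonsing_inv, hRs]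
  have key : ∀ ξ, qf ((4 * μ) • (R⁻¹ - 1)) ξ = 4 * μ * (⟪mv R⁻¹ ξ, ξ⟫ - ‖ξ‖ ^ 2) := fun ξ => by
    rw [qf_smul_left, qf_sub_left, qf_one, qf]
  refine ⟨(4 * μ) • (R⁻¹ - 1), (hSs.sub isSymm_one).smul _, fun v => ?_, fun v => ?_, fun v => ?_⟩
  · have h1 := hRpos (mv R⁻¹ v)
    rw [qf, hRS, real_inner_comm] at h1
    have h2 : 0 ≤ 4 * μ * ⟪mv R⁻¹ v, v⟫ :=
      mul_nonneg (by positivity) (le_trans (by positivity) h1)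
    rw [key]; linarith
  · set w := mv R⁻¹ v with hw
    have hwv : mv R w = v := hRS v
    have h1 := (hRpos (w - v)).trans' (by positivity : (0:ℝ) ≤ 3 / 4 * ‖w - v‖ ^ 2)
    have h3 : ⟪mv R v, w⟫ = ‖v‖ ^ 2 := by
      rw [inner_mv_symm hRs, hwv, real_inner_self_eq_norm_sq]
    rw [qf, mv_sub, hwv, inner_sub_left, inner_sub_right, inner_sub_right, h3,
      real_inner_self_eq_norm_sq] at h1
    have h4 : qf X v = 4 * μ * (‖v‖ ^ 2 - ⟪mv R v, v⟫) := by
      rw [qf, hXR, real_inner_smul_left, inner_sub_left, real_inner_self_eq_norm_sq]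
    rw [key, h4, real_inner_comm v w] at *
    nlinarith
  · refine ⟨mv R⁻¹ v, ?_⟩
    set w := mv R⁻¹ v with hw
    have hwv : mv R w = v := hRS v
    have h4 : qf X w = 4 * μ * (‖w‖ ^ 2 - ⟪w, v⟫) := by
      rw [qf, hXR, hwv, real_inner_smul_left, inner_sub_left, real_inner_self_eq_norm_sq,
        real_inner_comm]
    rw [key, h4, ← hw, norm_sub_sq_real, real_inner_comm v w]
    ring

lemma posSemidef_fromBlocks {X Y : MatN N} {P Q : MatN N} (hX : X.IsSymm) (hY : Y.IsSymm)
    (hPQ : P.transpose = Q)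
    (h : ∀ v w, 0 ≤ qf X v + ⟪mv P w, v⟫ + ⟪mv Q v, w⟫ + qf Y w) :
    (Matrix.fromBlocks X P Q Y).PosSemidef := by
  refine Matrix.PosSemidef.of_dotProduct_mulVec_nonneg ?_ fun v => ?_
  · rw [Matrix.IsHermitian, Matrix.conjTranspose_eq_transpose_of_trivial,
      Matrix.fromBlocks_transpose, hX, hY, hPQ, ← hPQ, Matrix.transpose_transpose]
  · have := h (WithLp.toLp 2 (v ∘ Sum.inl)) (WithLp.toLp 2 (v ∘ Sum.inr))
    have hd : ∀ (Z : MatN N) (a b : Fin N → ℝ),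
        ⟪mv Z (WithLp.toLp 2 a), (WithLp.toLp 2 b : EucSp N)⟫ = dotProduct b (Z.mulVec a) := by
      intro Z a b
      rw [mv, Matrix.toEuclideanCLM_toLp]
      simp [PiLp.inner_apply, dotProduct]
    rw [qf, qf, hd, hd, hd, hd] at this
    rw [Matrix.fromBlocks_mulVec]
    simp only [dotProduct, Fintype.sum_sum_type, star_trivial, Sum.elim_inl, Sum.elim_inr,
      Pi.add_apply, Function.comp, mul_add, Finset.sum_add_distrib] at this ⊢
    linarith

variable {Ω : Set (EucSp N)} {T : ℝ} {F : EucSp N → EucSp N → MatN N → ℝ}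
  {h : EucSp N → ℝ → EucSp N} {α : ℝ} {f : EucSp N → ℝ → ℝ} {a A Ch Mf : ℝ} {k : ℕ}

/-- The structure condition (H3) for matrices satisfying only the upper bound of the block
inequality, and for gradients which are arbitrary positive multiples of `x - y`. -/
lemma EqData.F_add_flip_le (D : EqData Ω T F h α f a A Ch Mf k) {ω : ℝ → ℝ}
    (hω : ∀ X Y : MatN N, X.IsSymm → Y.IsSymm → ∀ ζ : ℝ, 0 < ζ →
      (Matrix.fromBlocks X 0 0 Y +
        ζ • (1 : Matrix (Fin N ⊕ Fin N) (Fin N ⊕ Fin N) ℝ)).PosSemidef →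
      ((4 * ζ) • Matrix.fromBlocks (1 : MatN N) (-1) (-1) (1 : MatN N) -
        Matrix.fromBlocks X 0 0 Y).PosSemidef →
      ∀ x ∈ Ω, ∀ y ∈ Ω, x ≠ y →
        F x (ζ • (x - y)) X - F y (ζ • (x - y)) (-Y) ≤ ω (ζ * ‖x - y‖ ^ 2))
    {x y : EucSp N} (hx : x ∈ Ω) (hy : y ∈ Ω) (hxy : x ≠ y) {X Y : MatN N} (hX : X.IsSymm)
    (hY : Y.IsSymm) {μ : ℝ} (hμ : 0 < μ)
    (hXY : ∀ v w, qf X v + qf Y w ≤ μ * ‖v - w‖ ^ 2) {c : ℝ} (hc : 0 < c) :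
    F x (c • (x - y)) X + flipF F y (-(c • (x - y))) Y
      ≤ (c / (4 * μ)) ^ α * ω (4 * μ * ‖x - y‖ ^ 2) := by
  obtain ⟨X', hX', hXl, hXX, hXw⟩ := exists_resolvent hX hμ fun v => by
    have := hXY v 0; rwa [qf_zero, add_zero, sub_zero] at this
  obtain ⟨Y', hY', hYl, hYY, hYw⟩ := exists_resolvent hY hμ fun v => by
    have := hXY 0 v; rwa [qf_zero, zero_add, zero_sub, norm_neg] at this
  have hne : x - y ≠ 0 := sub_ne_zero.2 hxy
  have hp : c • (x - y) ≠ 0 := smul_ne_zero hc.ne' hne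
  have h1 := D.F_mono hx hp hX hX' hXX
  have h2 := D.F_mono hy hp hY'.neg hY.neg fun v => by
    rw [qf_neg_left, qf_neg_left]; linarith [hYY v]
  have hsc : c • (x - y) = (c / (4 * μ)) • ((4 * μ) • (x - y)) := by
    rw [smul_smul]; congr 1; field_simp
  have hz : (4 * μ) • (x - y) ≠ 0 := smul_ne_zero (by positivity) hne
  have hcz : 0 < c / (4 * μ) := by positivity
  have h3 : ∀ z ∈ Ω, ∀ Z : MatN N, Z.IsSymm →
      F z (c • (x - y)) Z = (c / (4 * μ)) ^ α * F z ((4 * μ) • (x - y)) Z := by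
    intro z hz' Z hZ
    have := D.hom z hz' _ hz Z hZ (c / (4 * μ)) hcz.ne' 1 zero_le_one
    rw [one_smul, mul_one, abs_of_pos hcz] at this
    rw [hsc, this]
  have h4 := hω X' Y' hX' hY' (4 * μ) (by positivity) ?_ ?_ x hx y hy hxy
  · have h5 : flipF F y (-(c • (x - y))) Y = -F y (c • (x - y)) (-Y) := by
      rw [flipF, neg_neg]
    rw [h5]
    calc F x (c • (x - y)) X + -F y (c • (x - y)) (-Y)
        ≤ F x (c • (x - y)) X' - F y (c • (x - y)) (-Y') := by linarith
      _ = (c / (4 * μ)) ^ α * (F x ((4 * μ) • (x - y)) X' - F y ((4 * μ) • (x - y)) (-Y')) := by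
          rw [h3 x hx _ hX', h3 y hy _ hY'.neg]; ring
      _ ≤ _ := by gcongr
  · rw [← Matrix.fromBlocks_one, Matrix.fromBlocks_smul, Matrix.fromBlocks_add]
    refine posSemidef_fromBlocks (hX'.add (isSymm_one.smul _)) (hY'.add (isSymm_one.smul _))
      (by simp) fun v w => ?_
    simp only [smul_zero, add_zero, mv_zero_left, inner_zero_left, qf_add_left, qf_smul_left,
      qf_one]
    linarith [hXl v, hYl w]
  · rw [Matrix.fromBlocks_smul, sub_eq_add_neg, Matrix.fromBlocks_neg, Matrix.fromBlocks_add]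
    refine posSemidef_fromBlocks ((isSymm_one.smul _).add hX'.neg)
      ((isSymm_one.smul _).add hY'.neg) (by simp) fun v w => ?_
    simp only [neg_zero, add_zero, qf_add_left, qf_smul_left, qf_neg_left, mv_smul_left,
      mv_neg_left, qf_one, mv_one, real_inner_smul_left, inner_neg_left]
    obtain ⟨v', e1⟩ := hXw v
    obtain ⟨w', e2⟩ := hYw w
    have h5 := hXY v' w'
    have h6 : ‖v' - w'‖ ≤ ‖v - w‖ + ‖v - v'‖ + ‖w - w'‖ := by
      have : v' - w' = (v - w) + -(v - v') + (w - w') := by abel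
      rw [this]
      refine (norm_add_le _ _).trans ?_
      gcongr
      exact (norm_add_le _ _).trans (by rw [norm_neg])
    have h7 : ‖v' - w'‖ ^ 2 ≤ 3 * (‖v - w‖ ^ 2 + ‖v - v'‖ ^ 2 + ‖w - w'‖ ^ 2) := by
      have := pow_le_pow_left₀ (norm_nonneg _) h6 2
      nlinarith [sq_nonneg (‖v - w‖ - ‖v - v'‖), sq_nonneg (‖v - w‖ - ‖w - w'‖),
        sq_nonneg (‖w - w'‖ - ‖v - v'‖)]
    have h8 := mul_le_mul_of_nonneg_left h7 hμ.le
    have h9 := norm_sub_sq_real v w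
    have h10 : 0 ≤ μ * ‖v - v'‖ ^ 2 := by positivity
    have h11 : 0 ≤ μ * ‖w - w'‖ ^ 2 := by positivity
    have h12 : 0 ≤ μ * ‖v - w‖ ^ 2 := by positivity
    rw [h9] at h8 h12
    rw [e1, e2, real_inner_comm v w]
    nlinarith

end Relaxation

section penalized

variable {E : Type*} [NormedAddCommGroup E]

lemma exists_isSupConv {K : Set E} (hK : IsCompact K) (hne : K.Nonempty) {U : E → ℝ}
    (hU : UpperSemicontinuousOn U K) (lam : ℝ) : ∃ u, IsSupConv K U lam u := by
  have hc : ∀ z, Continuous fun k : E => -(lam / 2 * ‖z - k‖ ^ 2) := fun z => by fun_prop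
  have : ∀ z, ∃ k ∈ K, ∀ k' ∈ K,
      U k' - lam / 2 * ‖z - k'‖ ^ 2 ≤ U k - lam / 2 * ‖z - k‖ ^ 2 := by
    intro z
    obtain ⟨k, hk, hm⟩ := UpperSemicontinuousOn.exists_isMaxOn hne hK
      (hU.add (hc z).continuousOn.upperSemicontinuousOn)
    exact ⟨k, hk, fun k' hk' => by simpa [sub_eq_add_neg] using hm hk'⟩
  choose κ hκ hmax using this
  exact ⟨fun z => U (κ z) - lam / 2 * ‖z - κ z‖ ^ 2, fun z k hk => hmax z k hk,
    fun z => ⟨κ z, hκ z, rfl⟩⟩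

/-- `(z, ζ, k, l)` maximizes the penalized functional. -/
structure IsPenMax (K : Set E) (U V : E → ℝ) (lam : ℝ) (g : E → ℝ) (z ζ k l : E) : Prop where
  mem_left : k ∈ K
  mem_right : l ∈ K
  le : ∀ z' ζ', ∀ k' ∈ K, ∀ l' ∈ K,
    U k' + V l' - lam / 2 * ‖z' - k'‖ ^ 2 - lam / 2 * ‖ζ' - l'‖ ^ 2 - g (z' - ζ')
      ≤ U k + V l - lam / 2 * ‖z - k‖ ^ 2 - lam / 2 * ‖ζ - l‖ ^ 2 - g (z - ζ)

lemma exists_isPenMax [ProperSpace E] {K : Set E} (hK : IsCompact K) (hne : K.Nonempty)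
    {U V : E → ℝ} (hU : UpperSemicontinuousOn U K) (hV : UpperSemicontinuousOn V K) {B : ℝ}
    (hUB : ∀ k ∈ K, U k ≤ B) (hVB : ∀ k ∈ K, V k ≤ B) {lam : ℝ} (hlam : 1 ≤ lam) {g : E → ℝ}
    (hg : Continuous g) (hg0 : ∀ e, 0 ≤ g e) : ∃ z ζ k l, IsPenMax K U V lam g z ζ k l := by
  obtain ⟨k₀, hk₀⟩ := hne
  set v₀ := U k₀ + V k₀ - g 0 with hv₀
  obtain ⟨R₀, hR₀⟩ := hK.isBounded.exists_norm_le
  set R := R₀ + 2 + 2 * |2 * B - v₀| with hR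
  have hR₀0 : 0 ≤ R₀ := (norm_nonneg _).trans (hR₀ k₀ hk₀)
  have hRR : R₀ ≤ R := by rw [hR]; nlinarith [abs_nonneg (2 * B - v₀)]
  set S : Set (E × E × E × E) :=
    closedBall 0 R ×ˢ (closedBall 0 R ×ˢ (K ×ˢ K)) with hS
  have hSc : IsCompact S :=
    (isCompact_closedBall _ _).prod ((isCompact_closedBall _ _).prod (hK.prod hK))
  have hk₀R : k₀ ∈ closedBall (0:E) R := by
    rw [mem_closedBall_zero_iff]; exact (hR₀ k₀ hk₀).trans hRR
  have hSne : S.Nonempty := ⟨(k₀, k₀, k₀, k₀), hk₀R, hk₀R, hk₀, hk₀⟩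
  have hU' : UpperSemicontinuousOn (fun q : E × E × E × E => U q.2.2.1) S :=
    hU.comp (g := fun q : E × E × E × E => q.2.2.1) (by fun_prop) fun q hq => hq.2.2.1
  have hV' : UpperSemicontinuousOn (fun q : E × E × E × E => V q.2.2.2) S :=
    hV.comp (g := fun q : E × E × E × E => q.2.2.2) (by fun_prop) fun q hq => hq.2.2.2
  have hc : Continuous (fun q : E × E × E × E => -(lam / 2 * ‖q.1 - q.2.2.1‖ ^ 2
      + lam / 2 * ‖q.2.1 - q.2.2.2‖ ^ 2 + g (q.1 - q.2.1))) := by fun_prop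
  obtain ⟨⟨z, ζ, k, l⟩, hm, hmax⟩ := UpperSemicontinuousOn.exists_isMaxOn hSne hSc
    ((hU'.add hV').add hc.continuousOn.upperSemicontinuousOn)
  have hmax' : ∀ q ∈ S, U q.2.2.1 + V q.2.2.2 + -(lam / 2 * ‖q.1 - q.2.2.1‖ ^ 2
      + lam / 2 * ‖q.2.1 - q.2.2.2‖ ^ 2 + g (q.1 - q.2.1)) ≤ U k + V l +
      -(lam / 2 * ‖z - k‖ ^ 2 + lam / 2 * ‖ζ - l‖ ^ 2 + g (z - ζ)) := fun q hq => hmax hq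
  have hbase := hmax' (k₀, k₀, k₀, k₀) ⟨hk₀R, hk₀R, hk₀, hk₀⟩
  simp only [sub_self, norm_zero] at hbase
  have hfar : ∀ z' : E, ∀ k' ∈ K, z' ∉ closedBall (0:E) R → 2 * B - v₀ ≤ lam / 2 * ‖z' - k'‖ ^ 2 := by
    intro z' k' hk' hz'
    rw [mem_closedBall_zero_iff, not_le] at hz'
    have h1 := norm_sub_norm_le z' k'
    have h2 := hR₀ k' hk'
    have h3 : 2 + 2 * |2 * B - v₀| ≤ ‖z' - k'‖ := by linarith
    have h4 : 2 * |2 * B - v₀| ≤ ‖z' - k'‖ ^ 2 := by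
      nlinarith [abs_nonneg (2 * B - v₀)]
    nlinarith [le_abs_self (2 * B - v₀), sq_nonneg ‖z' - k'‖]
  refine ⟨z, ζ, k, l, hm.2.2.1, hm.2.2.2, fun z' ζ' k' hk' l' hl' => ?_⟩
  have hUk := hUB k' hk'
  have hVl := hVB l' hl'
  have hgz := hg0 (z' - ζ')
  have n1 : 0 ≤ lam / 2 * ‖z' - k'‖ ^ 2 := by positivity
  have n2 : 0 ≤ lam / 2 * ‖ζ' - l'‖ ^ 2 := by positivity
  by_cases hz' : z' ∈ closedBall (0:E) R
  · by_cases hζ' : ζ' ∈ closedBall (0:E) R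
    · have := hmax' (z', ζ', k', l') ⟨hz', hζ', hk', hl'⟩
      simp only at this
      linarith
    · have := hfar ζ' l' hl' hζ'
      linarith
  · have := hfar z' k' hk' hz'
    linarith

variable [InnerProductSpace ℝ E]

lemma inner_left_eq_zero_of_le {w : E} {c r : ℝ} (hr : 0 < r)
    (h : ∀ a : E, ‖a‖ < r → 0 ≤ ⟪w, a⟫ + c * ‖a‖ ^ 2) : w = 0 := by
  have h1 : ∀ᶠ s in nhds (0:ℝ), (-⟪w, w⟫) * s + (-(c * ‖w‖ ^ 2)) * s ^ 2 ≤ 0 := by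
    have hc : Continuous fun s : ℝ => ‖s • w‖ := by fun_prop
    have := hc.tendsto 0
    rw [zero_smul, norm_zero] at this
    filter_upwards [this.eventually (gt_mem_nhds hr)] with s hs
    have := h (s • w) hs
    rw [real_inner_smul_right, norm_smul, mul_pow, Real.norm_eq_abs, sq_abs] at this
    linarith
  have := (lin_quad_nonpos h1).1
  rw [neg_eq_zero, inner_self_eq_zero] at this
  exact this

/-- First and second order information at a maximum of the penalized functional. -/
lemma IsPenMax.sums [FiniteDimensional ℝ E] {K : Set E} (hK : IsCompact K) {U V : E → ℝ}
    (hU : UpperSemicontinuousOn U K) (hV : UpperSemicontinuousOn V K) {lam : ℝ} (hlam : 0 < lam)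
    {g : E → ℝ} {z ζ k l p : E} (hm : IsPenMax K U V lam g z ζ k l) {L : E →L[ℝ] E} {r : ℝ}
    (hr : 0 < r) (hg : ∀ v, ‖v‖ < r → g (z - ζ + v) ≤ g (z - ζ) + ⟪p, v⟫ + 1 / 2 * ‖L v‖ ^ 2) :
    k = z + lam⁻¹ • p ∧ l = ζ - lam⁻¹ • p ∧ ∀ η > 0,
    ∃ k' ∈ K, ∃ l' ∈ K, ∃ (p' q' : E) (X Y : E →L[ℝ] E),
      ‖k' - k‖ < η ∧ ‖l' - l‖ < η ∧ ‖p' - p‖ < η ∧ ‖q' - -p‖ < η ∧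
      (∀ a, - lam * ‖a‖ ^ 2 ≤ ⟪X a, a⟫) ∧ (∀ b, - lam * ‖b‖ ^ 2 ≤ ⟪Y b, b⟫) ∧
      (∀ a b, ⟪X a, a⟫ + ⟪Y b, b⟫ ≤ ‖L (a - b)‖ ^ 2 + η * (‖a‖ ^ 2 + ‖b‖ ^ 2)) ∧
      (∀ ε > 0, ∃ δ > 0, ∀ j ∈ K, ‖j - k'‖ < δ →
        U j ≤ U k' + ⟪p', j - k'⟫ + 1 / 2 * ⟪X (j - k'), j - k'⟫ + ε * ‖j - k'‖ ^ 2) ∧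
      (∀ ε > 0, ∃ δ > 0, ∀ j ∈ K, ‖j - l'‖ < δ →
        V j ≤ V l' + ⟪q', j - l'⟫ + 1 / 2 * ⟪Y (j - l'), j - l'⟫ + ε * ‖j - l'‖ ^ 2) := by
  have hL : ∀ v, 1 / 2 * ‖L v‖ ^ 2 ≤ ‖L‖ ^ 2 / 2 * ‖v‖ ^ 2 := fun v => by
    have := pow_le_pow_left₀ (norm_nonneg _) (L.le_opNorm v) 2
    rw [mul_pow] at this; linarith
  have e1 : lam • (z - k) + p = 0 := by
    refine inner_left_eq_zero_of_le hr (c := lam / 2 + ‖L‖ ^ 2 / 2) fun a ha => ?_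
    have h1 := hm.le (z + a) ζ k hm.mem_left l hm.mem_right
    have h2 := hg a ha
    have h3 : z + a - ζ = z - ζ + a := by abel
    have h4 : z + a - k = z - k + a := by abel
    rw [h3, h4, norm_add_sq_real] at h1
    rw [inner_add_left, real_inner_smul_left]
    nlinarith [hL a]
  have e2 : lam • (ζ - l) - p = 0 := by
    refine inner_left_eq_zero_of_le hr (c := lam / 2 + ‖L‖ ^ 2 / 2) fun a ha => ?_
    have h1 := hm.le z (ζ + a) k hm.mem_left l hm.mem_right
    have h2 := hg (-a) (by rwa [norm_neg])
    have h3 : z - (ζ + a) = z - ζ + -a := by abel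
    have h4 : ζ + a - l = ζ - l + a := by abel
    rw [h3, h4, norm_add_sq_real] at h1
    rw [inner_neg_right] at h2
    have h5 := hL (-a)
    rw [norm_neg a] at h5
    rw [inner_sub_left, real_inner_smul_left]
    nlinarith
  have k1 : k = z + lam⁻¹ • p := by
    have : p = lam • (k - z) := by
      rw [← neg_sub z k, smul_neg]; exact eq_neg_of_add_eq_zero_right e1
    rw [this, smul_smul, inv_mul_cancel₀ hlam.ne', one_smul]; abel
  have l1 : l = ζ - lam⁻¹ • p := by
    have : p = lam • (ζ - l) := (sub_eq_zero.1 e2).symm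
    rw [this, smul_smul, inv_mul_cancel₀ hlam.ne', one_smul]; abel
  refine ⟨k1, l1, fun η hη => ?_⟩
  obtain ⟨u, hu⟩ := exists_isSupConv hK ⟨k, hm.mem_left⟩ hU lam
  obtain ⟨v, hv⟩ := exists_isSupConv hK ⟨l, hm.mem_right⟩ hV lam
  have huz := hu.le z k hm.mem_left
  have hvz := hv.le ζ l hm.mem_right
  obtain ⟨k', hk', l', hl', p', q', X, Y, h1, h2, h3⟩ := theorem_on_sums hlam hu hv
    (z₀ := z) (ζ₀ := ζ) (p := p) (q := -p) (L := L) (r := r / 2) (by positivity) (by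
      intro a b ha hb
      obtain ⟨ka, hka, ea⟩ := hu.attained (z + a)
      obtain ⟨lb, hlb, eb⟩ := hv.attained (ζ + b)
      have i1 := hm.le (z + a) (ζ + b) ka hka lb hlb
      have i2 := hg (a - b) ((norm_sub_le a b).trans_lt (by linarith))
      have i3 : z + a - (ζ + b) = z - ζ + (a - b) := by abel
      rw [i3] at i1
      rw [inner_sub_right] at i2
      rw [inner_neg_left]
      linarith) hη
  rw [← k1] at h1
  rw [smul_neg, ← sub_eq_add_neg, ← l1] at h2
  exact ⟨k', hk', l', hl', p', q', X, Y, h1, h2, h3⟩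

end penalized

section Comparison

/-- Space-time with its Euclidean structure. -/
abbrev STp (N : ℕ) := WithLp 2 (EucSp N × ℝ)

lemma stp_inner (a b : STp N) : ⟪a, b⟫ = ⟪a.fst, b.fst⟫ + a.snd * b.snd := by
  rw [WithLp.prod_inner_apply]
  congr 1
  simp [mul_comm]

lemma stp_norm_sq (a : STp N) : ‖a‖ ^ 2 = ‖a.fst‖ ^ 2 + a.snd ^ 2 := by
  rw [WithLp.prod_norm_sq_eq_of_L2]; simp

/-- The linear equivalence between space-time with the sup norm and with the Euclidean norm. -/
abbrev stEquiv (N : ℕ) : STp N ≃L[ℝ] EucSp N × ℝ := WithLp.prodContinuousLinearEquiv 2 ℝ _ _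

/-- The spatial block of an operator on space-time. -/
def spatialBlock (X : STp N →L[ℝ] STp N) : EucSp N →L[ℝ] EucSp N :=
  (ContinuousLinearMap.fst ℝ (EucSp N) ℝ) ∘L (stEquiv N : STp N →L[ℝ] EucSp N × ℝ) ∘L X ∘L
    ((stEquiv N).symm : EucSp N × ℝ →L[ℝ] STp N) ∘L (ContinuousLinearMap.inl ℝ (EucSp N) ℝ)

lemma inner_spatialBlock (X : STp N →L[ℝ] STp N) (v : EucSp N) :
    ⟪spatialBlock X v, v⟫ = ⟪X (WithLp.toLp 2 (v, 0)), WithLp.toLp 2 (v, 0)⟫ := by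
  rw [stp_inner]; simp [spatialBlock]

lemma exists_spatial_bound (X : STp N →L[ℝ] STp N) {ε : ℝ} (hε : 0 < ε) :
    ∃ C, 0 ≤ C ∧ ∀ a : STp N, ⟪X a, a⟫ ≤ qf (symMat (spatialBlock X) + ε • (1 : MatN N)) a.fst
      + C * a.snd ^ 2 := by
  set b := ‖X‖ with hb
  have hb0 : 0 ≤ b := norm_nonneg X
  refine ⟨b ^ 2 / ε + b, by positivity, fun a => ?_⟩
  set a1 : STp N := WithLp.toLp 2 (a.fst, 0)
  set a2 : STp N := WithLp.toLp 2 (0, a.snd)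
  have ha : a = a1 + a2 := by
    apply (WithLp.ofLp_injective 2)
    simp [a1, a2]; rfl
  have n1 : ‖a1‖ = ‖a.fst‖ := by
    refine (sq_eq_sq₀ (norm_nonneg _) (norm_nonneg _)).1 ?_
    rw [stp_norm_sq]; simp [a1]
  have n2 : ‖a2‖ = |a.snd| := by
    refine (sq_eq_sq₀ (norm_nonneg _) (abs_nonneg _)).1 ?_
    rw [stp_norm_sq]; simp [a2]
  have hXb : ∀ u w, ⟪X u, w⟫ ≤ b * ‖u‖ * ‖w‖ := fun u w =>
    (real_inner_le_norm _ _).trans (by gcongr; exact X.le_opNorm u)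
  have h12 := hXb a1 a2
  have h21 := hXb a2 a1
  have h22 := hXb a2 a2
  rw [qf_add_left, qf_symMat, inner_spatialBlock, qf_smul_left, qf_one]
  have e : ⟪X a, a⟫ = ⟪X a1, a1⟫ + ⟪X a1, a2⟫ + ⟪X a2, a1⟫ + ⟪X a2, a2⟫ := by
    rw [ha, map_add, inner_add_left, inner_add_right, inner_add_right]; ring
  rw [e]
  rw [n1, n2] at h12 h21
  rw [n2] at h22
  have hs : |a.snd| * |a.snd| = a.snd ^ 2 := by rw [← sq, sq_abs]
  have hy : 2 * (b * ‖a.fst‖ * |a.snd|) ≤ ε * ‖a.fst‖ ^ 2 + b ^ 2 / ε * a.snd ^ 2 := by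
    have h0 : 0 ≤ (ε * ‖a.fst‖ - b * |a.snd|) ^ 2 / ε := by positivity
    have e2 : (ε * ‖a.fst‖ - b * |a.snd|) ^ 2 / ε
        = ε * ‖a.fst‖ ^ 2 + b ^ 2 / ε * a.snd ^ 2 - 2 * (b * ‖a.fst‖ * |a.snd|) := by
      field_simp
      rw [← sq_abs a.snd]; ring
    linarith
  have h22' : ⟪X a2, a2⟫ ≤ b * a.snd ^ 2 := by rw [mul_assoc, hs] at h22; exact h22
  linarith

/-- Diagonal operators on space-time. -/
def diagOp (N : ℕ) (c e : ℝ) : STp N →L[ℝ] STp N :=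
  ((stEquiv N).symm : EucSp N × ℝ →L[ℝ] STp N) ∘L
    (((c • ContinuousLinearMap.id ℝ (EucSp N)).prodMap (e • ContinuousLinearMap.id ℝ ℝ)) ∘L
      (stEquiv N : STp N →L[ℝ] EucSp N × ℝ))

lemma norm_diagOp_sq (c e : ℝ) (a : STp N) :
    ‖diagOp N c e a‖ ^ 2 = c ^ 2 * ‖a.fst‖ ^ 2 + e ^ 2 * a.snd ^ 2 := by
  rw [stp_norm_sq]
  simp [diagOp, norm_smul, mul_pow]

variable {Ω : Set (EucSp N)} {T : ℝ} {F : EucSp N → EucSp N → MatN N → ℝ}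
  {h : EucSp N → ℝ → EucSp N} {α : ℝ} {f : EucSp N → ℝ → ℝ} {a A Ch Mf : ℝ} {k : ℕ}

/-- `G` is locally bounded above by parabolas with slope `G'`. -/
def UpperParabola (T : ℝ) (G G' : ℝ → ℝ) : Prop :=
  ∀ t ∈ Ioo (0 : ℝ) T, ∃ C, ∀ᶠ s in nhds t, G s ≤ G t + G' t * (s - t) + C * (s - t) ^ 2

lemma tendsto_toLp (z : STp N) :
    Tendsto (fun y : EucSp N × ℝ => (WithLp.toLp 2 y : STp N)) (nhds (z.fst, z.snd)) (nhds z) := by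
  have := ((stEquiv N).symm.continuous.tendsto (z.fst, z.snd))
  exact this

lemma ViscSub.of_jet {u : EucSp N × ℝ → ℝ} (hu : ViscSub Ω T F h α f k u) {G G' : ℝ → ℝ}
    (hG : UpperParabola T G G') {K : Set (STp N)} {z p : STp N} (hz : K ∈ nhds z)
    (hx : z.fst ∈ Ω) (ht : z.snd ∈ Ioo 0 T) {X : STp N →L[ℝ] STp N} (hp : p.fst ≠ 0)
    (hjet : ∀ ε > 0, ∃ δ > 0, ∀ j ∈ K, ‖j - z‖ < δ →
        u (j.fst, j.snd) - G j.snd ≤ u (z.fst, z.snd) - G z.snd + ⟪p, j - z⟫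
          + 1 / 2 * ⟪X (j - z), j - z⟫ + ε * ‖j - z‖ ^ 2) {ε : ℝ} (hε : 0 < ε) :
    p.snd + G' z.snd - F z.fst p.fst (symMat (spatialBlock X) + ε • (1 : MatN N))
      - gradTerm h α z.fst z.snd p.fst ≤ f z.fst z.snd := by
  obtain ⟨C₁, hC₁⟩ := hG _ ht
  obtain ⟨C₂, -, hC₂⟩ := exists_spatial_bound X (by positivity : 0 < ε / 2)
  obtain ⟨δ, hδ, hj⟩ := hjet (ε / 4) (by positivity)
  refine (hu _ hx _ ht).quad p.fst (p.snd + G' z.snd) _ (C₁ + 1 / 2 * C₂ + ε / 4) hp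
    ((symMat_isSymm _).add (isSymm_one.smul _)) ?_
  have e1 := (tendsto_toLp z).eventually (Filter.inter_mem hz (Metric.ball_mem_nhds z hδ))
  have e2 : ∀ᶠ y : EucSp N × ℝ in nhds (z.fst, z.snd), G y.2 ≤ G z.snd + G' z.snd * (y.2 - z.snd)
      + C₁ * (y.2 - z.snd) ^ 2 := (continuous_snd.tendsto (z.fst, z.snd)).eventually hC₁
  filter_upwards [e1, e2] with y hy1 hy2
  have h1 := hj _ hy1.1 (by have := hy1.2; rwa [mem_ball, dist_eq_norm] at this)
  have h2 := hC₂ (WithLp.toLp 2 y - z)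
  rw [stp_inner, stp_norm_sq] at h1
  simp only [WithLp.sub_fst, WithLp.sub_snd] at h1 h2
  change u y - G y.2 ≤ u (z.fst, z.snd) - G z.snd
    + (⟪p.fst, y.1 - z.fst⟫ + p.snd * (y.2 - z.snd)) + _
    + ε / 4 * (‖y.1 - z.fst‖ ^ 2 + (y.2 - z.snd) ^ 2) at h1
  change _ ≤ qf _ (y.1 - z.fst) + C₂ * (y.2 - z.snd) ^ 2 at h2
  rw [qf_add_left, qf_smul_left, qf_one] at h2 ⊢
  linarith

lemma exists_subseq_symm (X : ℕ → MatN N) (hX : ∀ m, (X m).IsSymm) {c : ℝ}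
    (hc : ∀ m v, |qf (X m) v| ≤ c * ‖v‖ ^ 2) :
    ∃ X₀ : MatN N, ∃ φ : ℕ → ℕ, StrictMono φ ∧ X₀.IsSymm ∧
      Tendsto (X ∘ φ) atTop (nhds X₀) ∧
      ∀ v, Tendsto (fun m => qf (X (φ m)) v) atTop (nhds (qf X₀ v)) := by
  have hcpt : IsCompact (Set.pi univ fun _ : Fin N => Set.pi univ fun _ : Fin N =>
      Icc (-(2 * c)) (2 * c) : Set (Fin N → Fin N → ℝ)) :=
    isCompact_univ_pi fun _ => isCompact_univ_pi fun _ => isCompact_Icc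
  obtain ⟨X₀, -, φ, hφ, hl⟩ := hcpt.tendsto_subseq (x := fun m i j => X m i j)
    fun m i _ j _ => abs_le.1 (abs_entry_le (hX m) (hc m) i j)
  have hl' : Tendsto (X ∘ φ) atTop (nhds (Matrix.of X₀)) := hl
  refine ⟨Matrix.of X₀, φ, hφ, ?_, hl', fun v => ?_⟩
  · have hcl : IsClosed {Z : MatN N | Z.IsSymm} :=
      isClosed_eq (Continuous.matrix_transpose continuous_id) continuous_id
    exact hcl.mem_of_tendsto hl' (Eventually.of_forall fun m => hX _)
  · have hcont : Continuous fun Z : MatN N => qf Z v := by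
      have : ∀ Z : MatN N, qf Z v = dotProduct (star v.ofLp) (Z.mulVec v.ofLp) := fun Z => by
        rw [dotProduct_mulVec_eq_qf]
      simp only [this]
      exact Continuous.dotProduct continuous_const
        (Continuous.matrix_mulVec continuous_id continuous_const)
    exact (hcont.tendsto _).comp hl'

lemma tendsto_of_norm_sub_lt {E : Type*} [NormedAddCommGroup E] {x : ℕ → E} {y : E}
    (h : ∀ m, ‖x m - y‖ < 1 / ((m : ℝ) + 1)) : Tendsto x atTop (nhds y) := by
  rw [tendsto_iff_norm_sub_tendsto_zero]
  exact squeeze_zero (fun _ => norm_nonneg _) (fun m => (h m).le)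
    tendsto_one_div_add_atTop_nhds_zero_nat

lemma stp_fst_tendsto {x : ℕ → STp N} {y : STp N} (h : Tendsto x atTop (nhds y)) :
    Tendsto (fun m => (x m).fst) atTop (nhds y.fst) :=
  ((continuous_fst.comp (stEquiv N).continuous).tendsto y).comp h

lemma stp_snd_tendsto {x : ℕ → STp N} {y : STp N} (h : Tendsto x atTop (nhds y)) :
    Tendsto (fun m => (x m).snd) atTop (nhds y.snd) :=
  ((continuous_snd.comp (stEquiv N).continuous).tendsto y).comp h

lemma EqData.visc_limit (D : EqData Ω T F h α f a A Ch Mf k) {u : EucSp N × ℝ → ℝ}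
    (hu : ViscSub Ω T F h α f k u) {G G' : ℝ → ℝ}
    (hG : UpperParabola T G G') (hG' : ContinuousOn G' (Ioo 0 T)) {K : Set (STp N)} {z p : STp N}
    (hz : K ∈ nhds z) (hx : z.fst ∈ Ω) (ht : z.snd ∈ Ioo 0 T) (hp : p.fst ≠ 0)
    {zm pm : ℕ → STp N} {Xm : ℕ → STp N →L[ℝ] STp N}
    (hzm : ∀ m : ℕ, ‖zm m - z‖ < 1 / ((m : ℝ) + 1))
    (hpm : ∀ m : ℕ, ‖pm m - p‖ < 1 / ((m : ℝ) + 1))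
    (hjet : ∀ m, ∀ ε > 0, ∃ δ > 0, ∀ j ∈ K, ‖j - zm m‖ < δ →
        u (j.fst, j.snd) - G j.snd ≤ u ((zm m).fst, (zm m).snd) - G (zm m).snd + ⟪pm m, j - zm m⟫
          + 1 / 2 * ⟪Xm m (j - zm m), j - zm m⟫ + ε * ‖j - zm m‖ ^ 2)
    {φ : ℕ → ℕ} (hφ : StrictMono φ) {X₀ : MatN N}
    (hX : Tendsto ((fun m => symMat (spatialBlock (Xm m)) + (1 / ((m : ℝ) + 1)) • (1 : MatN N)) ∘ φ)
      atTop (nhds X₀)) :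
    p.snd + G' z.snd - F z.fst p.fst X₀ - gradTerm h α z.fst z.snd p.fst ≤ f z.fst z.snd := by
  have hzt := (tendsto_of_norm_sub_lt hzm).comp hφ.tendsto_atTop
  have hpt := (tendsto_of_norm_sub_lt hpm).comp hφ.tendsto_atTop
  have z1 := stp_fst_tendsto hzt
  have z2 := stp_snd_tendsto hzt
  have p1 := stp_fst_tendsto hpt
  have p2 := stp_snd_tendsto hpt
  have hGc : Tendsto (fun m => G' (zm (φ m)).snd) atTop (nhds (G' z.snd)) :=
    ((hG'.continuousAt (isOpen_Ioo.mem_nhds ht)).tendsto).comp z2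
  refine le_of_tendsto_of_tendsto
    (((p2.add hGc).sub (D.tendsto_F hx hp z1 p1 hX)).sub (D.tendsto_gradTerm hx ht hp z1 z2 p1))
    (D.tendsto_f hx ht z1 z2) ?_
  filter_upwards [hzt.eventually (eventually_mem_nhds_iff.2 hz),
    z1.eventually (D.isOpen.mem_nhds hx), z2.eventually (isOpen_Ioo.mem_nhds ht),
    p1.eventually (isOpen_ne.mem_nhds hp)] with m e1 e2 e3 e4
  exact hu.of_jet hG e1 e2 e3 e4 (hjet _) (by positivity)

/-- The viscosity inequalities at a maximum of the penalized functional with nonzero gradient. -/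
lemma EqData.visc_of_penMax (D : EqData Ω T F h α f a A Ch Mf k) {u v : EucSp N × ℝ → ℝ}
    (hu : ViscSub Ω T F h α f k u) (hv : ViscSub Ω T (flipF F) h α (fun x t => -f x t) k v)
    {G G' H H' : ℝ → ℝ} (hG : UpperParabola T G G') (hG' : ContinuousOn G' (Ioo 0 T))
    (hH : UpperParabola T H H') (hH' : ContinuousOn H' (Ioo 0 T)) {K : Set (STp N)}
    (hK : IsCompact K) (hU : UpperSemicontinuousOn (fun z : STp N => u (z.fst, z.snd) - G z.snd) K)
    (hV : UpperSemicontinuousOn (fun z : STp N => v (z.fst, z.snd) - H z.snd) K)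
    {lam : ℝ} (hlam : 0 < lam) {g : STp N → ℝ} {z ζ κ l p : STp N}
    (hm : IsPenMax K (fun z => u (z.fst, z.snd) - G z.snd) (fun z => v (z.fst, z.snd) - H z.snd)
      lam g z ζ κ l) (hκK : K ∈ nhds κ) (hlK : K ∈ nhds l)
    (hKΩ : ∀ z ∈ K, z.fst ∈ Ω ∧ z.snd ∈ Ioo 0 T) {r μ ν : ℝ} (hr : 0 < r) (hμ : 0 ≤ μ)
    (hν : 0 ≤ ν) (hg : ∀ v, ‖v‖ < r → g (z - ζ + v) ≤ g (z - ζ) + ⟪p, v⟫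
      + 1 / 2 * (μ * ‖v.fst‖ ^ 2 + ν * v.snd ^ 2)) (hp : p.fst ≠ 0) :
    ∃ X Y : MatN N, X.IsSymm ∧ Y.IsSymm ∧ (∀ v w, qf X v + qf Y w ≤ μ * ‖v - w‖ ^ 2) ∧
      p.snd + G' κ.snd - F κ.fst p.fst X - gradTerm h α κ.fst κ.snd p.fst ≤ f κ.fst κ.snd ∧
      -p.snd + H' l.snd - flipF F l.fst (-p.fst) Y - gradTerm h α l.fst l.snd (-p.fst)
        ≤ -f l.fst l.snd := by
  obtain ⟨-, -, hs⟩ := hm.sums hK hU hV hlam (p := p) (L := diagOp N (Real.sqrt μ) (Real.sqrt ν)) hr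
    fun v hv => by rw [norm_diagOp_sq, Real.sq_sqrt hμ, Real.sq_sqrt hν]; exact hg v hv
  have hη : ∀ m : ℕ, (0:ℝ) < 1 / ((m : ℝ) + 1) := fun m => by positivity
  have hη1 : ∀ m : ℕ, (1:ℝ) / ((m : ℝ) + 1) ≤ 1 := fun m => by
    rw [div_le_one (by positivity)]; linarith [(Nat.cast_nonneg m : (0:ℝ) ≤ m)]
  choose κm hκm lm hlm pm qm Xm Ym i1 i2 i3 i4 i5 i6 i7 i8 i9 using fun m : ℕ => hs _ (hη m)
  set X' : ℕ → MatN N :=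
    fun m => symMat (spatialBlock (Xm m)) + (1 / ((m : ℝ) + 1)) • (1 : MatN N) with hX'
  set Y' : ℕ → MatN N :=
    fun m => symMat (spatialBlock (Ym m)) + (1 / ((m : ℝ) + 1)) • (1 : MatN N) with hY'
  have hqX : ∀ m v, qf (X' m) v = ⟪Xm m (WithLp.toLp 2 (v, 0)), WithLp.toLp 2 (v, 0)⟫
      + 1 / ((m : ℝ) + 1) * ‖v‖ ^ 2 := fun m v => by
    rw [hX', qf_add_left, qf_symMat, inner_spatialBlock, qf_smul_left, qf_one]
  have hqY : ∀ m v, qf (Y' m) v = ⟪Ym m (WithLp.toLp 2 (v, 0)), WithLp.toLp 2 (v, 0)⟫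
      + 1 / ((m : ℝ) + 1) * ‖v‖ ^ 2 := fun m v => by
    rw [hY', qf_add_left, qf_symMat, inner_spatialBlock, qf_smul_left, qf_one]
  have hn : ∀ v : EucSp N, ‖(WithLp.toLp 2 (v, 0) : STp N)‖ ^ 2 = ‖v‖ ^ 2 := fun v => by
    rw [stp_norm_sq]; simp
  have hsum : ∀ m v w, qf (X' m) v + qf (Y' m) w ≤ μ * ‖v - w‖ ^ 2
      + 2 * (1 / ((m : ℝ) + 1)) * (‖v‖ ^ 2 + ‖w‖ ^ 2) := fun m v w => by
    have := i7 m (WithLp.toLp 2 (v, 0)) (WithLp.toLp 2 (w, 0))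
    rw [norm_diagOp_sq, Real.sq_sqrt hμ, hn, hn] at this
    simp only [WithLp.sub_fst, WithLp.sub_snd, WithLp.toLp_fst, WithLp.toLp_snd, sub_self] at this
    rw [hqX, hqY]
    linarith
  have hXl : ∀ m v, -lam * ‖v‖ ^ 2 ≤ qf (X' m) v := fun m v => by
    have := i5 m (WithLp.toLp 2 (v, 0))
    rw [hn] at this
    rw [hqX]
    have : 0 ≤ 1 / ((m : ℝ) + 1) * ‖v‖ ^ 2 := by have := hη m; positivity
    linarith
  have hYl : ∀ m v, -lam * ‖v‖ ^ 2 ≤ qf (Y' m) v := fun m v => by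
    have := i6 m (WithLp.toLp 2 (v, 0))
    rw [hn] at this
    rw [hqY]
    have : 0 ≤ 1 / ((m : ℝ) + 1) * ‖v‖ ^ 2 := by have := hη m; positivity
    linarith
  have hXb : ∀ m v, |qf (X' m) v| ≤ (lam + μ + 2) * ‖v‖ ^ 2 := fun m v => by
    have h1 := hsum m v 0
    rw [qf_zero, sub_zero, norm_zero] at h1
    have h2 : 1 / ((m : ℝ) + 1) * ‖v‖ ^ 2 ≤ 1 * ‖v‖ ^ 2 := by gcongr; exact hη1 m
    have h3 := hXl m v
    have h4 := sq_nonneg ‖v‖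
    have h5 := mul_nonneg hμ h4
    have h6 := mul_nonneg hlam.le h4
    rw [abs_le]; constructor <;> linarith
  have hYb : ∀ m v, |qf (Y' m) v| ≤ (lam + μ + 2) * ‖v‖ ^ 2 := fun m v => by
    have h1 := hsum m 0 v
    rw [qf_zero, zero_sub, norm_neg, norm_zero] at h1
    have h2 : 1 / ((m : ℝ) + 1) * ‖v‖ ^ 2 ≤ 1 * ‖v‖ ^ 2 := by gcongr; exact hη1 m
    have h3 := hYl m v
    have h4 := sq_nonneg ‖v‖
    have h5 := mul_nonneg hμ h4
    have h6 := mul_nonneg hlam.le h4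
    rw [abs_le]; constructor <;> linarith
  have hX's : ∀ m, (X' m).IsSymm := fun m => (symMat_isSymm _).add (isSymm_one.smul _)
  have hY's : ∀ m, (Y' m).IsSymm := fun m => (symMat_isSymm _).add (isSymm_one.smul _)
  obtain ⟨X₀, φ, hφ, hX₀, hXt, hXq⟩ := exists_subseq_symm X' hX's hXb
  obtain ⟨Y₀, θ, hθ, hY₀, hYt, hYq⟩ := exists_subseq_symm (fun m => Y' (φ m)) (fun m => hY's _)
    fun m => hYb _
  have hκ := hKΩ κ hm.mem_left
  have hl := hKΩ l hm.mem_right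
  refine ⟨X₀, Y₀, hX₀, hY₀, fun v w => ?_, ?_, ?_⟩
  · have hsub : Tendsto (fun m => φ (θ m)) atTop atTop :=
      hφ.tendsto_atTop.comp hθ.tendsto_atTop
    have t1 : Tendsto (fun m => qf (X' (φ (θ m))) v) atTop (nhds (qf X₀ v)) :=
      (hXq v).comp hθ.tendsto_atTop
    have t2 : Tendsto (fun m => μ * ‖v - w‖ ^ 2
        + 2 * (1 / ((φ (θ m) : ℝ) + 1)) * (‖v‖ ^ 2 + ‖w‖ ^ 2)) atTop
        (nhds (μ * ‖v - w‖ ^ 2 + 2 * 0 * (‖v‖ ^ 2 + ‖w‖ ^ 2))) :=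
      tendsto_const_nhds.add
        (((tendsto_one_div_add_atTop_nhds_zero_nat.comp hsub).const_mul 2).mul_const _)
    have := le_of_tendsto_of_tendsto (t1.add (hYq w)) t2
      (Eventually.of_forall fun m => hsum _ v w)
    simpa using this
  · exact D.visc_limit hu hG hG' hκK hκ.1 hκ.2 hp i1 i3 i8 hφ hXt
  · have hp' : (-p).fst ≠ 0 := by rw [WithLp.neg_fst]; exact neg_ne_zero.2 hp
    have := D.flip.visc_limit hv hH hH' hlK hl.1 hl.2 hp' i2 i4 i9 (hφ.comp hθ) hYt
    rwa [WithLp.neg_fst, WithLp.neg_snd] at this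

/-- The doubling penalization. -/
def penFun (k : ℕ) (n : ℝ) (e : STp N) : ℝ := n * (‖e.fst‖ ^ (2 * k) / (2 * k) + e.snd ^ 2 / 2)

lemma continuous_penFun (n : ℝ) : Continuous (penFun (N := N) k n) := by
  have h1 : Continuous fun e : STp N => e.fst := continuous_fst.comp (stEquiv N).continuous
  have h2 : Continuous fun e : STp N => e.snd := continuous_snd.comp (stEquiv N).continuous
  unfold penFun; fun_prop

lemma penFun_nonneg {n : ℝ} (hn : 0 ≤ n) (e : STp N) : 0 ≤ penFun k n e := by
  unfold penFun
  have : 0 ≤ ‖e.fst‖ ^ (2 * k) := by positivity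
  positivity

lemma norm_stp_fst_le (v : STp N) : ‖v.fst‖ ≤ ‖v‖ := by
  have := stp_norm_sq v
  exact abs_le_of_sq_le_sq' (by nlinarith [sq_nonneg v.snd]) (norm_nonneg _) |>.2

lemma penFun_add_le (hk : 1 ≤ k) {n : ℝ} (hn : 0 ≤ n) {d v : STp N}
    (hv : ‖v‖ < ‖d.fst‖ / 3) :
    penFun k n (d + v) ≤ penFun k n d
      + ⟪(WithLp.toLp 2 ((n * ‖d.fst‖ ^ (2 * k - 2)) • d.fst, n * d.snd) : STp N), v⟫
      + 1 / 2 * (n * powConst k / k * ‖d.fst‖ ^ (2 * k - 2) * ‖v.fst‖ ^ 2 + n * v.snd ^ 2) := by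
  have h1 := norm_add_pow_le hk ((norm_stp_fst_le v).trans hv.le)
  have hk0 : (0:ℝ) < k := by exact_mod_cast hk
  rw [stp_inner]
  simp only [penFun, WithLp.add_fst, WithLp.add_snd, WithLp.toLp_fst, WithLp.toLp_snd,
    real_inner_smul_left]
  have h2 : ‖d.fst + v.fst‖ ^ (2 * k) / (2 * k) ≤ ‖d.fst‖ ^ (2 * k) / (2 * k)
      + ‖d.fst‖ ^ (2 * k - 2) * ⟪d.fst, v.fst⟫
      + 1 / 2 * (powConst k / k * ‖d.fst‖ ^ (2 * k - 2) * ‖v.fst‖ ^ 2) := by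
    rw [div_le_iff₀ (by positivity)]
    refine h1.trans (le_of_eq ?_)
    field_simp
  have h3 := mul_le_mul_of_nonneg_left h2 hn
  have e1 : n * (1 / 2 * (powConst k / k * ‖d.fst‖ ^ (2 * k - 2) * ‖v.fst‖ ^ 2))
     = 1 / 2 * (n * powConst k / k * ‖d.fst‖ ^ (2 * k - 2) * ‖v.fst‖ ^ 2) := by ring
  nlinarith

lemma ViscSub.flat_of_penMax {u : EucSp N × ℝ → ℝ} (hu : ViscSub Ω T F h α f k u)
    {G G' : ℝ → ℝ} (hG : UpperParabola T G G') {K : Set (STp N)} {κ : STp N} (hκ : K ∈ nhds κ)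
    (hx : κ.fst ∈ Ω) (ht : κ.snd ∈ Ioo 0 T) (hk : 1 ≤ k) {n : ℝ} (hn : 0 ≤ n) {d : STp N}
    (hd : d.fst = 0)
    (hle : ∀ j ∈ K, u (j.fst, j.snd) - G j.snd - penFun k n (d + (j - κ))
      ≤ u (κ.fst, κ.snd) - G κ.snd - penFun k n d) :
    n * d.snd + G' κ.snd ≤ f κ.fst κ.snd := by
  obtain ⟨C, hC⟩ := hG _ ht
  refine (hu _ hx _ ht).flat _ (n + |C|) ?_
  have e2 : ∀ᶠ y : EucSp N × ℝ in nhds (κ.fst, κ.snd), G y.2 ≤ G κ.snd + G' κ.snd * (y.2 - κ.snd)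
      + C * (y.2 - κ.snd) ^ 2 := (continuous_snd.tendsto (κ.fst, κ.snd)).eventually hC
  filter_upwards [(tendsto_toLp κ).eventually hκ, e2] with y hy1 hy2
  have h1 := hle _ hy1
  simp only [penFun, WithLp.add_fst, WithLp.add_snd, WithLp.sub_fst, WithLp.sub_snd, hd, zero_add,
    norm_zero] at h1
  change u y - G y.2 - n * (‖y.1 - κ.fst‖ ^ (2 * k) / (2 * k) + (d.snd + (y.2 - κ.snd)) ^ 2 / 2)
    ≤ _ at h1
  rw [zero_pow (by omega)] at h1
  have hk0 : (1:ℝ) ≤ k := by exact_mod_cast hk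
  have h3 : ‖y.1 - κ.fst‖ ^ (2 * k) / (2 * k) ≤ ‖y.1 - κ.fst‖ ^ (2 * k) :=
    div_le_self (by positivity) (by linarith)
  have h4 := mul_le_mul_of_nonneg_left h3 hn
  have h5 : 0 ≤ |C| * ‖y.1 - κ.fst‖ ^ (2 * k) := by positivity
  have h6 : C * (y.2 - κ.snd) ^ 2 ≤ |C| * (y.2 - κ.snd) ^ 2 := by gcongr; exact le_abs_self C
  have h7 : 0 ≤ n * (y.2 - κ.snd) ^ 2 := by positivity
  rw [zero_div, zero_add] at h1
  have e3 : n * (‖y.1 - κ.fst‖ ^ (2 * k) / (2 * k) + (d.snd + (y.2 - κ.snd)) ^ 2 / 2)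
      = n * (‖y.1 - κ.fst‖ ^ (2 * k) / (2 * k)) + n * d.snd * (y.2 - κ.snd)
        + n * (y.2 - κ.snd) ^ 2 / 2 + n * (d.snd ^ 2 / 2) := by ring
  rw [e3] at h1
  linarith

/-- Nearly optimal points of a penalized functional have small penalty. -/
lemma exists_small_penalty {ι : Type*} {P : Set ι} {J pen : ι → ℝ} {B c σ : ℝ}
    (hJ : ∀ q ∈ P, J q ≤ B) (hpen : ∀ q ∈ P, 0 ≤ pen q)
    (hc : ∀ n : ℕ, ∃ q ∈ P, c ≤ J q - n * pen q) (hσ : 0 < σ) (N₀ : ℕ) :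
    ∃ n : ℕ, N₀ ≤ n ∧ 1 ≤ n ∧ ∃ θ, c ≤ θ ∧ (∀ q ∈ P, J q - n * pen q ≤ θ) ∧
      (∃ q ∈ P, θ - σ < J q - n * pen q) ∧
      ∀ η, ∀ q ∈ P, θ - η ≤ J q - n * pen q → n * pen q ≤ 2 * (η + σ) := by
  set θ : ℕ → ℝ := fun n => sSup ((fun q => J q - n * pen q) '' P) with hθ
  have hbdd : ∀ n : ℕ, BddAbove ((fun q => J q - n * pen q) '' P) := fun n => by
    refine ⟨B, ?_⟩
    rintro _ ⟨q, hq, rfl⟩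
    have := mul_nonneg n.cast_nonneg (hpen q hq) (α := ℝ)
    have := hJ q hq
    change J q - n * pen q ≤ B
    linarith
  have hle : ∀ n : ℕ, ∀ q ∈ P, J q - n * pen q ≤ θ n := fun n q hq =>
    le_csSup (hbdd n) (mem_image_of_mem _ hq)
  have hcθ : ∀ n, c ≤ θ n := fun n => by
    obtain ⟨q, hq, hcq⟩ := hc n
    exact hcq.trans (hle n q hq)
  obtain ⟨j, hj, hjσ⟩ : ∃ j, N₀ ≤ j ∧ θ (2 ^ j) - σ ≤ θ (2 ^ (j + 1)) := by
    by_contra! hcon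
    have key : ∀ i : ℕ, θ (2 ^ (N₀ + i)) ≤ θ (2 ^ N₀) - i * σ := fun i => by
      induction i with
      | zero => simp
      | succ i ih =>
        have := hcon (N₀ + i) (by omega)
        rw [← add_assoc]; push_cast; linarith
    obtain ⟨i, hi⟩ := exists_nat_gt ((θ (2 ^ N₀) - c) / σ)
    rw [div_lt_iff₀ hσ] at hi
    have := key i
    have := hcθ (2 ^ (N₀ + i))
    linarith
  refine ⟨2 ^ (j + 1), ?_, Nat.one_le_two_pow, θ (2 ^ (j + 1)), hcθ _, hle _, ?_, ?_⟩
  · exact hj.trans ((Nat.le_succ j).trans (Nat.lt_two_pow_self).le)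
  · obtain ⟨q₀, hq₀, -⟩ := hc 0
    obtain ⟨_, ⟨q, hq, rfl⟩, hlt⟩ := exists_lt_of_lt_csSup
      (s := (fun q => J q - (2 ^ (j + 1) : ℕ) * pen q) '' P) ⟨_, mem_image_of_mem _ hq₀⟩
      (sub_lt_self (θ (2 ^ (j + 1))) hσ)
    exact ⟨q, hq, hlt⟩
  · intro η q hq hη
    have h1 := hle (2 ^ j) q hq
    push_cast [pow_succ] at h1 hη ⊢
    rw [pow_succ] at hjσ
    linarith

lemma time_error_le {n r τ e ωh : ℝ} (hk : 1 ≤ k) (hn : 1 ≤ n) (hr : 0 ≤ r)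
    (h1 : n * r ^ (2 * k) ≤ e) (h2 : n * τ ^ 2 ≤ e) (he : e ≤ 1) (hω : 0 < ωh)
    (hα : 0 < 1 + α) (hkω : 1 + α ≤ k * ωh) :
    |3 * τ| ^ ωh * (n * r ^ (2 * k - 1)) ^ (1 + α) ≤ 3 ^ ωh * e ^ (ωh / 2) := by
  have hn0 : 0 < n := by linarith
  have hk0 : (0:ℝ) < k := by exact_mod_cast hk
  have he0 : 0 ≤ e := le_trans (by positivity) h2
  set P := n * r ^ (2 * k - 1) with hP
  have hP0 : 0 ≤ P := by positivity
  have hP1 : P ^ (2 * k) ≤ n := by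
    obtain ⟨m, rfl⟩ : ∃ m, k = m + 1 := ⟨k - 1, by omega⟩
    have e1 : P ^ (2 * (m + 1)) = n * (n * r ^ (2 * (m + 1))) ^ (2 * m + 1) := by
      rw [hP, mul_pow, mul_pow, ← pow_mul, ← pow_mul,
        show (2 * (m + 1) - 1) * (2 * (m + 1)) = 2 * (m + 1) * (2 * m + 1) by
          rw [show 2 * (m + 1) - 1 = 2 * m + 1 by omega]; ring]
      ring
    rw [e1]
    have : (n * r ^ (2 * (m + 1))) ^ (2 * m + 1) ≤ 1 :=
      pow_le_one₀ (by positivity) (h1.trans he)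
    nlinarith
  have hP2 : P ^ (1 + α) ≤ n ^ (ωh / 2) := by
    have e1 : P ^ (1 + α) = (P ^ (2 * k)) ^ ((1 + α) / (2 * k)) := by
      rw [← Real.rpow_natCast P, ← Real.rpow_mul hP0]
      congr 1; push_cast; field_simp
    rw [e1]
    calc (P ^ (2 * k)) ^ ((1 + α) / (2 * k)) ≤ n ^ ((1 + α) / (2 * k)) := by gcongr
      _ ≤ n ^ (ωh / 2) := by
        refine Real.rpow_le_rpow_of_exponent_le hn ?_
        rw [div_le_iff₀ (by positivity)]; linarith
  have hτ : |3 * τ| ^ ωh ≤ 3 ^ ωh * (e / n) ^ (ωh / 2) := by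
    rw [abs_mul, abs_of_pos (by norm_num : (0:ℝ) < 3), Real.mul_rpow (by norm_num) (abs_nonneg _)]
    have e1 : |τ| ^ ωh = (τ ^ 2) ^ (ωh / 2) := by
      rw [← sq_abs, ← Real.rpow_natCast |τ|, ← Real.rpow_mul (abs_nonneg _)]
      congr 1; push_cast; ring
    rw [e1]
    gcongr
    rw [le_div_iff₀ hn0]; linarith
  calc |3 * τ| ^ ωh * P ^ (1 + α) ≤ (3 ^ ωh * (e / n) ^ (ωh / 2)) * n ^ (ωh / 2) := by gcongr
    _ = 3 ^ ωh * e ^ (ωh / 2) := by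
      rw [mul_assoc, ← Real.mul_rpow (by positivity) hn0.le, div_mul_cancel₀ _ hn0.ne']

/-- The first order terms in the doubling argument. -/
lemma gradTerm_sub_le {ωh ch : ℝ} (hch : 0 ≤ ch)
    (ht : ∀ x ∈ Ω, ∀ t ∈ Set.Ioo (0 : ℝ) T, ∀ s ∈ Set.Ioo (0 : ℝ) T,
      ‖h x t - h x s‖ ≤ ch * |t - s| ^ ωh)
    (hneg : α ≤ 0 → ∀ x ∈ Ω, ∀ y ∈ Ω, ∀ t ∈ Set.Ioo (0 : ℝ) T,
      ‖h x t - h y t‖ ≤ ch * ‖x - y‖ ^ (1 + α))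
    (hpos : 0 < α → ∀ x ∈ Ω, ∀ y ∈ Ω, ∀ t ∈ Set.Ioo (0 : ℝ) T, ⟪h x t - h y t, x - y⟫ ≤ 0)
    {x y p : EucSp N} (hx : x ∈ Ω) (hy : y ∈ Ω) {t s : ℝ} (htT : t ∈ Ioo 0 T) (hsT : s ∈ Ioo 0 T)
    {c : ℝ} (hc : 0 ≤ c) (hp : p = c • (x - y)) (hp0 : p ≠ 0) :
    gradTerm h α x t p - gradTerm h α y s p ≤
      ch * (‖x - y‖ * ‖p‖) ^ (1 + α) + ch * (|t - s| ^ ωh * ‖p‖ ^ (1 + α)) := by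
  have hpn : 0 < ‖p‖ := norm_pos_iff.2 hp0
  have hpα : 0 < ‖p‖ ^ α := Real.rpow_pos_of_pos hpn _
  have hpp : ‖p‖ ^ (1 + α) = ‖p‖ * ‖p‖ ^ α := by rw [Real.rpow_add hpn, Real.rpow_one]
  have e1 : gradTerm h α x t p - gradTerm h α y s p
      = ⟪h x t - h y t, p⟫ * ‖p‖ ^ α + ⟪h y t - h y s, p⟫ * ‖p‖ ^ α := by
    simp only [gradTerm, inner_sub_left]; ring
  rw [e1]
  refine add_le_add ?_ ?_
  · rcases le_or_gt α 0 with hα | hα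
    · calc ⟪h x t - h y t, p⟫ * ‖p‖ ^ α ≤ (ch * ‖x - y‖ ^ (1 + α)) * ‖p‖ * ‖p‖ ^ α := by
            gcongr
            exact (real_inner_le_norm _ _).trans (by gcongr; exact hneg hα x hx y hy t htT)
        _ = _ := by
            rw [Real.mul_rpow (norm_nonneg _) (norm_nonneg _), hpp]; ring
    · have h1 : ⟪h x t - h y t, p⟫ ≤ 0 := by
        rw [hp, real_inner_smul_right]
        exact mul_nonpos_of_nonneg_of_nonpos hc (hpos hα x hx y hy t htT)
      exact (mul_nonpos_of_nonpos_of_nonneg h1 hpα.le).trans (by positivity)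
  · calc ⟪h y t - h y s, p⟫ * ‖p‖ ^ α ≤ (ch * |t - s| ^ ωh) * ‖p‖ * ‖p‖ ^ α := by
          gcongr
          exact (real_inner_le_norm _ _).trans (by gcongr; exact ht y hy t htT s hsT)
      _ = _ := by rw [hpp]; ring

/-- The regularity in `x` and `t` used for comparison. -/
structure RegData (Ω : Set (EucSp N)) (T : ℝ) (F : EucSp N → EucSp N → MatN N → ℝ)
    (h : EucSp N → ℝ → EucSp N) (α : ℝ) (k : ℕ) (ω : ℝ → ℝ) (ωh ch : ℝ) : Prop where
  ω_cont : Continuous ω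
  ω_zero : ω 0 = 0
  F_reg : ∀ X Y : MatN N, X.IsSymm → Y.IsSymm → ∀ ζ : ℝ, 0 < ζ →
    (Matrix.fromBlocks X 0 0 Y +
      ζ • (1 : Matrix (Fin N ⊕ Fin N) (Fin N ⊕ Fin N) ℝ)).PosSemidef →
    ((4 * ζ) • Matrix.fromBlocks (1 : MatN N) (-1) (-1) (1 : MatN N) -
      Matrix.fromBlocks X 0 0 Y).PosSemidef →
    ∀ x ∈ Ω, ∀ y ∈ Ω, x ≠ y →
      F x (ζ • (x - y)) X - F y (ζ • (x - y)) (-Y) ≤ ω (ζ * ‖x - y‖ ^ 2)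
  ωh_pos : 0 < ωh
  ch_nonneg : 0 ≤ ch
  exponent : 1 + α ≤ k * ωh
  h_time : ∀ x ∈ Ω, ∀ t ∈ Set.Ioo (0 : ℝ) T, ∀ s ∈ Set.Ioo (0 : ℝ) T,
    ‖h x t - h x s‖ ≤ ch * |t - s| ^ ωh
  h_neg : α ≤ 0 → ∀ x ∈ Ω, ∀ y ∈ Ω, ∀ t ∈ Set.Ioo (0 : ℝ) T,
    ‖h x t - h y t‖ ≤ ch * ‖x - y‖ ^ (1 + α)
  h_pos : 0 < α → ∀ x ∈ Ω, ∀ y ∈ Ω, ∀ t ∈ Set.Ioo (0 : ℝ) T, ⟪h x t - h y t, x - y⟫ ≤ 0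

lemma tendsto_mul_rpow_nhdsGE {c b s : ℝ} (hs : 0 < s) :
    Tendsto (fun e : ℝ => (c * e) ^ s * b) (nhds 0) (nhds 0) := by
  have h1 : Tendsto (fun e : ℝ => c * e) (nhds 0) (nhds 0) := by
    simpa using (tendsto_id (α := ℝ) (x := nhds 0)).const_mul c
  have := ((Real.continuousAt_rpow_const 0 s (Or.inr hs.le)).tendsto.comp h1).mul_const b
  simpa [Real.zero_rpow hs.ne'] using this

lemma rpow_le_max {c₁ c₂ c s : ℝ} (h0 : 0 < c₁) (h1 : c₁ ≤ c) (h2 : c ≤ c₂) :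
    c ^ s ≤ c₁ ^ s + c₂ ^ s := by
  have hc : 0 < c := h0.trans_le h1
  have p1 := Real.rpow_pos_of_pos h0 s
  have p2 := Real.rpow_pos_of_pos (hc.trans_le h2) s
  rcases le_or_gt 0 s with hs | hs
  · have := Real.rpow_le_rpow hc.le h2 hs
    linarith
  · have := Real.rpow_le_rpow_of_nonpos h0 h1 hs.le
    linarith

/-- The error terms of the doubling argument vanish with the penalty. -/
lemma RegData.exists_error {ω : ℝ → ℝ} {ωh ch : ℝ} (R : RegData Ω T F h α k ω ωh ch)
    (hα : -1 < α) (C₀ C₁ : ℝ) (hC₁ : 0 ≤ C₁) {η : ℝ} (hη : 0 < η) :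
    ∃ e₀ > 0, e₀ ≤ 1 ∧ ∀ s, 0 ≤ s → s ≤ C₁ * e₀ →
      C₀ * |ω s| + ch * (3 * e₀) ^ (1 + α) + ch * (3 ^ ωh * e₀ ^ (ωh / 2)) ≤ η := by
  have t1 : Tendsto (fun s => C₀ * |ω s|) (nhds 0) (nhds 0) := by
    have := ((R.ω_cont.tendsto 0).abs).const_mul C₀
    simpa [R.ω_zero] using this
  have t2 := tendsto_mul_rpow_nhdsGE (c := 3) (b := ch) (s := 1 + α) (by linarith)
  have t3 := tendsto_mul_rpow_nhdsGE (c := 1) (b := ch * 3 ^ ωh) (s := ωh / 2) (half_pos R.ωh_pos)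
  obtain ⟨δ, hδ, h1⟩ := Metric.eventually_nhds_iff.1
    ((t1.eventually (gt_mem_nhds (by positivity : (0:ℝ) < η / 3))))
  obtain ⟨δ', hδ', h2⟩ := Metric.eventually_nhds_iff.1
    ((t2.eventually (gt_mem_nhds (by positivity : (0:ℝ) < η / 3))).and
      (t3.eventually (gt_mem_nhds (by positivity : (0:ℝ) < η / 3))))
  set e₀ := min 1 (min (δ' / 2) (δ / 2 / (C₁ + 1))) with he₀
  have hpos : 0 < e₀ := by positivity
  refine ⟨e₀, hpos, min_le_left _ _, fun s hs0 hs => ?_⟩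
  have i1 : e₀ ≤ δ' / 2 := (min_le_right _ _).trans (min_le_left _ _)
  have i2 : e₀ ≤ δ / 2 / (C₁ + 1) := (min_le_right _ _).trans (min_le_right _ _)
  rw [le_div_iff₀ (by positivity)] at i2
  have j1 := h1 (y := s) (by rw [Real.dist_0_eq_abs, abs_of_nonneg hs0]; nlinarith)
  have j2 := h2 (y := e₀) (by rw [Real.dist_0_eq_abs, abs_of_pos hpos]; linarith)
  rw [one_mul] at j2
  have e1 : ch * (3 * e₀) ^ (1 + α) = (3 * e₀) ^ (1 + α) * ch := mul_comm _ _
  have e2 : ch * (3 ^ ωh * e₀ ^ (ωh / 2)) = e₀ ^ (ωh / 2) * (ch * 3 ^ ωh) := by ring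
  rw [e1, e2]
  linarith [j2.1, j2.2]

set_option maxHeartbeats 1000000 in
/-- The comparison inequality at a maximum of the penalized functional. -/
lemma EqData.exists_penMax_le (D : EqData Ω T F h α f a A Ch Mf k) {ω : ℝ → ℝ} {ωh ch : ℝ}
    (R : RegData Ω T F h α k ω ωh ch) {η : ℝ} (hη : 0 < η) : ∃ e₀ > 0, e₀ ≤ 1 ∧
    ∀ (u v : EucSp N × ℝ → ℝ) (G G' H H' : ℝ → ℝ) (K : Set (STp N)) (n : ℝ) (z ζ κ l : STp N),
    ViscSub Ω T F h α f k u → ViscSub Ω T (flipF F) h α (fun x t => -f x t) k v →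
    UpperParabola T G G' → ContinuousOn G' (Ioo 0 T) →
    UpperParabola T H H' → ContinuousOn H' (Ioo 0 T) → IsCompact K →
    UpperSemicontinuousOn (fun z : STp N => u (z.fst, z.snd) - G z.snd) K →
    UpperSemicontinuousOn (fun z : STp N => v (z.fst, z.snd) - H z.snd) K →
    (∀ z ∈ K, z.fst ∈ Ω ∧ z.snd ∈ Ioo 0 T) → 1 ≤ n →
    IsPenMax K (fun z => u (z.fst, z.snd) - G z.snd) (fun z => v (z.fst, z.snd) - H z.snd)
      n (penFun k n) z ζ κ l → K ∈ nhds κ → K ∈ nhds l →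
    n * ‖(z - ζ).fst‖ ^ (2 * k) ≤ e₀ → n * (z - ζ).snd ^ 2 ≤ e₀ →
    G' κ.snd + H' l.snd ≤ f κ.fst κ.snd - f l.fst l.snd + η := by
  have hk := D.two_le
  have hk1 : 1 ≤ k := by omega
  have hk0 : (0:ℝ) < k := by exact_mod_cast hk1
  have hCp := powConst_pos k
  set C := powConst k with hC
  obtain ⟨e₀, he₀, he1, herr⟩ := R.exists_error D.alpha
    ((k / (12 * C)) ^ α + (k / (4 * C)) ^ α) (36 * C / k) (by positivity) hη
  refine ⟨e₀, he₀, he1, ?_⟩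
  intro u v G G' H H' K n z ζ κ l hu hv hG hG' hH hH' hK hU hV hKΩ hn hm hκ hl hd1 hd2
  have hn0 : 0 < n := by linarith
  set d := z - ζ with hd
  have hκΩ := hKΩ κ hm.mem_left
  have hlΩ := hKΩ l hm.mem_right
  have herr0 := herr 0 le_rfl (by positivity)
  by_cases hd0 : d.fst = 0
  · have i1 : n * d.snd + G' κ.snd ≤ f κ.fst κ.snd := by
      refine hu.flat_of_penMax hG hκ hκΩ.1 hκΩ.2 hk1 hn0.le hd0 fun j hj => ?_
      have := hm.le (z + (j - κ)) ζ j hj l hm.mem_right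
      rw [show z + (j - κ) - j = z - κ by abel, show z + (j - κ) - ζ = d + (j - κ) by
        rw [hd]; abel, ← hd] at this
      linarith
    have i2 : n * (-d).snd + H' l.snd ≤ -f l.fst l.snd := by
      refine hv.flat_of_penMax hH hl hlΩ.1 hlΩ.2 hk1 hn0.le
        (by rw [WithLp.neg_fst, hd0, neg_zero]) fun j hj => ?_
      have h1 := hm.le z (ζ + (j - l)) κ hm.mem_left j hj
      have hev : ∀ e : STp N, penFun k n (-e) = penFun k n e := fun e => by
        simp [penFun, WithLp.neg_fst, WithLp.neg_snd]
      rw [show ζ + (j - l) - j = ζ - l by abel, show z - (ζ + (j - l)) = -(-d + (j - l)) by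
        rw [hd]; abel, hev, ← hd] at h1
      rw [hev]
      linarith
    rw [WithLp.neg_snd] at i2
    linarith
  · set r := ‖d.fst‖ with hr
    have hr0 : 0 < r := norm_pos_iff.2 hd0
    set q := r ^ (2 * k - 2) with hq
    have hq0 : 0 < q := by positivity
    have hqr : q * r ^ 2 = r ^ (2 * k) := by rw [hq, ← pow_add]; congr 1; omega
    have hqr1 : q * r = r ^ (2 * k - 1) := by rw [hq, ← pow_succ]; congr 1; omega
    have hr2k : r ^ (2 * k) ≤ 1 := by
      have : r ^ (2 * k) ≤ n * r ^ (2 * k) := le_mul_of_one_le_left (by positivity) hn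
      linarith
    have hr1 : r ≤ 1 := by
      by_contra! hcon
      exact absurd hr2k (not_le.2 (one_lt_pow₀ hcon (by omega)))
    have hq1 : q ≤ 1 := pow_le_one₀ hr0.le hr1
    set p : STp N := WithLp.toLp 2 ((n * q) • d.fst, n * d.snd) with hp
    have hp1 : p.fst = (n * q) • d.fst := rfl
    have hp2 : p.snd = n * d.snd := rfl
    have hpne : p.fst ≠ 0 := by rw [hp1]; exact smul_ne_zero (by positivity) hd0
    set μ := n * C / k * q with hμ
    have hμ0 : 0 < μ := by positivity
    have hgp : ∀ v : STp N, ‖v‖ < r / 3 → penFun k n (z - ζ + v) ≤ penFun k n (z - ζ) + ⟪p, v⟫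
        + 1 / 2 * (μ * ‖v.fst‖ ^ 2 + n * v.snd ^ 2) := fun v hv => penFun_add_le hk1 hn0.le hv
    obtain ⟨X, Y, hX, hY, hXY, v1, v2⟩ := D.visc_of_penMax hu hv hG hG' hH hH' hK hU hV hn0 hm hκ hl
      hKΩ (by positivity : 0 < r / 3) hμ0.le hn0.le hgp hpne
    obtain ⟨eκ, el, -⟩ := hm.sums hK hU hV hn0 (p := p)
      (L := diagOp N (Real.sqrt μ) (Real.sqrt n)) (by positivity : 0 < r / 3) fun v hv => by
        rw [norm_diagOp_sq, Real.sq_sqrt hμ0.le, Real.sq_sqrt hn0.le]; exact hgp v hv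
    have exy : κ.fst - l.fst = (1 + 2 * q) • d.fst := by
      have e1 : κ - l = d + (2 * n⁻¹) • p := by rw [eκ, el, hd]; module
      have e2 := congrArg WithLp.fst e1
      rw [WithLp.sub_fst, WithLp.add_fst, WithLp.smul_fst, hp1] at e2
      rw [e2, smul_smul, add_smul, one_smul]
      congr 2; field_simp
    have ets : κ.snd - l.snd = 3 * d.snd := by
      have e1 : κ - l = d + (2 * n⁻¹) • p := by rw [eκ, el, hd]; module
      have e2 := congrArg WithLp.snd e1
      rw [WithLp.sub_snd, WithLp.add_snd, WithLp.smul_snd, hp2] at e2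
      rw [e2, smul_eq_mul]; field_simp; ring
    have hxy : κ.fst ≠ l.fst := by
      rw [← sub_ne_zero, exy]; exact smul_ne_zero (by positivity) hd0
    have hnxy : ‖κ.fst - l.fst‖ = (1 + 2 * q) * r := by
      rw [exy, norm_smul, Real.norm_of_nonneg (by positivity)]
    set c := n * q / (1 + 2 * q) with hc
    have hc0 : 0 < c := by positivity
    have hpc : p.fst = c • (κ.fst - l.fst) := by
      rw [hp1, exy, smul_smul]; congr 1; rw [hc]; field_simp
    have hpn : ‖p.fst‖ = n * r ^ (2 * k - 1) := by
      rw [hp1, norm_smul, Real.norm_of_nonneg (by positivity), ← hqr1, ← hr]; ring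
    have hF := D.F_add_flip_le R.F_reg hκΩ.1 hlΩ.1 hxy hX hY hμ0 hXY hc0
    rw [← hpc] at hF
    have hcμ : c / (4 * μ) = k / (4 * C * (1 + 2 * q)) := by
      rw [hc, hμ]; field_simp
    have hcμ' : (c / (4 * μ)) ^ α ≤ (k / (12 * C)) ^ α + (k / (4 * C)) ^ α := by
      rw [hcμ]
      refine rpow_le_max (by positivity) ?_ ?_
      · apply div_le_div_of_nonneg_left hk0.le (by positivity)
        linarith [mul_le_mul_of_nonneg_left hq1 (by positivity : 0 ≤ C)]
      · apply div_le_div_of_nonneg_left hk0.le (by positivity)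
        linarith [mul_nonneg (by positivity : 0 ≤ C) hq0.le]
    have hs0 : 0 ≤ 4 * μ * ‖κ.fst - l.fst‖ ^ 2 := by positivity
    have hs : 4 * μ * ‖κ.fst - l.fst‖ ^ 2 ≤ 36 * C / k * e₀ := by
      have e1 : 4 * μ * ‖κ.fst - l.fst‖ ^ 2
          = 4 * C / k * ((1 + 2 * q) ^ 2 * (n * r ^ (2 * k))) := by
        rw [hnxy, hμ, ← hqr]; ring
      have e2 : (1 + 2 * q) ^ 2 ≤ 9 := by
        have : 1 + 2 * q ≤ 3 := by linarith
        calc (1 + 2 * q) ^ 2 ≤ 3 ^ 2 := by gcongr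
          _ = 9 := by norm_num
      calc _ = 4 * C / k * ((1 + 2 * q) ^ 2 * (n * r ^ (2 * k))) := e1
        _ ≤ 4 * C / k * (9 * e₀) := by gcongr
        _ = _ := by ring
    have herr' := herr _ hs0 hs
    have hFω : (c / (4 * μ)) ^ α * ω (4 * μ * ‖κ.fst - l.fst‖ ^ 2)
        ≤ ((k / (12 * C)) ^ α + (k / (4 * C)) ^ α) * |ω (4 * μ * ‖κ.fst - l.fst‖ ^ 2)| := by
      have : 0 ≤ (c / (4 * μ)) ^ α := by positivity
      calc _ ≤ (c / (4 * μ)) ^ α * |ω (4 * μ * ‖κ.fst - l.fst‖ ^ 2)| := by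
            gcongr; exact le_abs_self _
        _ ≤ _ := by gcongr
    have hgr := gradTerm_sub_le R.ch_nonneg R.h_time R.h_neg R.h_pos hκΩ.1 hlΩ.1 hκΩ.2 hlΩ.2 hc0.le
      hpc hpne
    have hα1 : 0 < 1 + α := by linarith [D.alpha]
    have hspace : ch * (‖κ.fst - l.fst‖ * ‖p.fst‖) ^ (1 + α) ≤ ch * (3 * e₀) ^ (1 + α) := by
      have hch := R.ch_nonneg
      have hb : ‖κ.fst - l.fst‖ * ‖p.fst‖ ≤ 3 * e₀ := by
        rw [hnxy, hpn, ← hqr1]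
        calc (1 + 2 * q) * r * (n * (q * r)) = (1 + 2 * q) * (n * (q * r ^ 2)) := by ring
          _ ≤ 3 * e₀ := by rw [hqr]; gcongr; linarith only [hq1]
      exact mul_le_mul_of_nonneg_left (Real.rpow_le_rpow (by positivity) hb hα1.le) hch
    have htime : ch * (|κ.snd - l.snd| ^ ωh * ‖p.fst‖ ^ (1 + α))
        ≤ ch * (3 ^ ωh * e₀ ^ (ωh / 2)) := by
      refine mul_le_mul_of_nonneg_left ?_ R.ch_nonneg
      rw [ets, hpn]
      exact time_error_le hk1 hn hr0.le hd1 hd2 he1 R.ωh_pos hα1 R.exponent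
    rw [gradTerm_neg] at v2
    linarith

lemma upperParabola_div {T' b : ℝ} (hT : T ≤ T') (hb : 0 ≤ b) :
    UpperParabola T (fun s => b / (T' - s)) (fun s => b / (T' - s) ^ 2) := by
  intro t ht
  have hw : 0 < T' - t := by linarith [ht.2]
  refine ⟨2 * b / (T' - t) ^ 3, ?_⟩
  filter_upwards [gt_mem_nhds (show t < (t + T') / 2 by linarith)] with s hs
  have hv : 0 < T' - s := by linarith
  have e1 : b / (T' - s) = b / (T' - t) + b / (T' - t) ^ 2 * (s - t)
      + b * (s - t) ^ 2 / (T' - t) ^ 2 / (T' - s) := by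
    field_simp; ring
  rw [e1]
  gcongr
  rw [div_le_iff₀ hv]
  have e2 : 2 * b / (T' - t) ^ 3 * (s - t) ^ 2 * (T' - s)
      = b * (s - t) ^ 2 / (T' - t) ^ 2 * (2 * (T' - s) / (T' - t)) := by field_simp
  rw [e2]
  refine le_mul_of_one_le_right (by positivity) ?_
  rw [le_div_iff₀ hw]; linarith

lemma UpperParabola.add {G G' H H' : ℝ → ℝ} (hG : UpperParabola T G G')
    (hH : UpperParabola T H H') :
    UpperParabola T (fun s => G s + H s) (fun s => G' s + H' s) := by
  intro t ht
  obtain ⟨C, hC⟩ := hG t ht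
  obtain ⟨C', hC'⟩ := hH t ht
  refine ⟨C + C', ?_⟩
  filter_upwards [hC, hC'] with s h1 h2
  linarith

lemma continuousOn_div_sub {T' b : ℝ} (hT : T ≤ T') (m : ℕ) :
    ContinuousOn (fun s => b / (T' - s) ^ m) (Ioo 0 T) := by
  refine ContinuousOn.div (by fun_prop) (by fun_prop) fun s hs => pow_ne_zero _ ?_
  have := hs.2
  have : 0 < T' - s := by linarith
  exact this.ne'

/-- A small increasing weight with a large derivative at the final time. -/
lemma exists_time_weight (hT : 0 < T) {ε M : ℝ} (hε : 0 < ε) (hM : 0 ≤ M) :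
    ∃ κ₀ > 0, ∃ g g' : ℝ → ℝ, UpperParabola T g g' ∧ ContinuousOn g (Ioo 0 T) ∧
      ContinuousOn g' (Ioo 0 T) ∧ (∀ t ∈ Ioo 0 T, 0 ≤ g t ∧ g t ≤ ε ∧ κ₀ ≤ g' t) ∧
      ∃ δ > 0, ∀ t ∈ Ioo 0 T, T - δ < t → 2 * M + κ₀ ≤ g' t := by
  set δ := ε / (2 * M + 2) with hδ
  have hδ0 : 0 < δ := by positivity
  have hev : ∀ᶠ t in nhds T, 2 * M + 1 < ε * δ / (T + δ - t) ^ 2 := by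
    have hc : ContinuousAt (fun t => ε * δ / (T + δ - t) ^ 2) T := by
      refine ContinuousAt.div (by fun_prop) (by fun_prop) ?_
      rw [add_sub_cancel_left]; positivity
    refine hc.tendsto.eventually (lt_mem_nhds ?_)
    rw [add_sub_cancel_left]
    have : ε * δ / δ ^ 2 = 2 * M + 2 := by rw [hδ]; field_simp
    rw [this]; linarith
  obtain ⟨δ₁, hδ₁, h1⟩ := Metric.eventually_nhds_iff.1 hev
  refine ⟨min 1 (ε * δ / (T + δ) ^ 2), by positivity, fun t => ε * δ / (T + δ - t),
    fun t => ε * δ / (T + δ - t) ^ 2, upperParabola_div (by linarith) (by positivity), ?_,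
    continuousOn_div_sub (by linarith) 2, fun t ht => ⟨?_, ?_, ?_⟩, δ₁, hδ₁, fun t ht ht' => ?_⟩
  · simpa using continuousOn_div_sub (T := T) (T' := T + δ) (b := ε * δ) (by linarith) 1
  · have : 0 < T + δ - t := by linarith [ht.2]
    positivity
  · have : 0 < T + δ - t := by linarith [ht.2]
    rw [div_le_iff₀ this]
    have := ht.2
    gcongr; linarith
  · refine (min_le_right _ _).trans ?_
    have h2 : 0 < T + δ - t := by linarith [ht.2]
    have h3 := ht.1
    have h4 : T + δ - t ≤ T + δ := by linarith
    change ε * δ / (T + δ) ^ 2 ≤ ε * δ / (T + δ - t) ^ 2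
    gcongr
  · have := h1 (y := t) (by rw [Real.dist_eq, abs_lt]; constructor <;> linarith [ht.2])
    linarith [min_le_left 1 (ε * δ / (T + δ) ^ 2)]

/-- The compact exhaustion of the cylinder. -/
def cylCore (Ω : Set (EucSp N)) (ρ T' : ℝ) : Set (STp N) :=
  {z | ρ ≤ infDist z.fst Ωᶜ ∧ ρ ≤ z.snd ∧ z.snd ≤ T'}

lemma continuous_stp_fst : Continuous fun z : STp N => z.fst :=
  continuous_fst.comp (stEquiv N).continuous

lemma continuous_stp_snd : Continuous fun z : STp N => z.snd :=
  continuous_snd.comp (stEquiv N).continuous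

lemma mem_of_infDist_pos {ρ : ℝ} (hρ : 0 < ρ) {x : EucSp N} (hx : ρ ≤ infDist x Ωᶜ) : x ∈ Ω := by
  by_contra hcon
  rw [infDist_zero_of_mem (show x ∈ Ωᶜ from hcon)] at hx
  linarith

lemma cylCore_subset {ρ T' : ℝ} (hρ : 0 < ρ) (hT' : T' < T) {z : STp N} (hz : z ∈ cylCore Ω ρ T') :
    z.fst ∈ Ω ∧ z.snd ∈ Ioo 0 T :=
  ⟨mem_of_infDist_pos hρ hz.1, by linarith [hz.2.1], by linarith [hz.2.2]⟩

lemma isCompact_cylCore (hΩ : Bornology.IsBounded Ω) {ρ T' : ℝ} (hρ : 0 < ρ) :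
    IsCompact (cylCore Ω ρ T') := by
  have hc : IsClosed (cylCore Ω ρ T') := by
    have h1 := continuous_stp_fst (N := N)
    have h2 := continuous_stp_snd (N := N)
    exact (isClosed_le continuous_const ((continuous_infDist_pt _).comp h1)).inter
      ((isClosed_le continuous_const h2).inter (isClosed_le h2 continuous_const))
  refine isCompact_of_isClosed_isBounded hc ?_
  obtain ⟨R, hR⟩ := hΩ.exists_norm_le
  refine (isBounded_iff_forall_norm_le).2 ⟨|R| + |T'|, fun z hz => ?_⟩
  have h1 := (hR _ (mem_of_infDist_pos hρ hz.1)).trans (le_abs_self R)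
  have h2 := stp_norm_sq z
  have h3 : |z.snd| ≤ |T'| := by
    have := hz.2.1
    rw [abs_of_pos (by linarith)]
    exact hz.2.2.trans (le_abs_self _)
  have h4 : z.snd ^ 2 ≤ |T'| ^ 2 := by rw [← sq_abs]; gcongr
  have h5 : ‖z.fst‖ ^ 2 ≤ |R| ^ 2 := by gcongr
  refine abs_le_of_sq_le_sq' ?_ (by positivity) |>.2
  nlinarith [mul_nonneg (abs_nonneg R) (abs_nonneg T')]

lemma cylCore_mem_nhds {ρ T' : ℝ} {z : STp N} (h1 : ρ < infDist z.fst Ωᶜ) (h2 : ρ < z.snd)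
    (h3 : z.snd < T') : cylCore Ω ρ T' ∈ nhds z := by
  have c1 := (continuous_infDist_pt Ωᶜ).comp (continuous_stp_fst (N := N))
  have c2 := continuous_stp_snd (N := N)
  filter_upwards [c1.continuousAt.eventually (lt_mem_nhds h1),
    c2.continuousAt.eventually (lt_mem_nhds h2), c2.continuousAt.eventually (gt_mem_nhds h3)]
    with y e1 e2 e3
  exact ⟨le_of_lt e1, e2.le, e3.le⟩

/-- The full penalty. -/
def fullPen (k : ℕ) (q : STp N × STp N × STp N × STp N) : ℝ :=
  1 / 2 * ‖q.1 - q.2.2.1‖ ^ 2 + 1 / 2 * ‖q.2.1 - q.2.2.2‖ ^ 2 + penFun k 1 (q.1 - q.2.1)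

lemma fullPen_nonneg (q : STp N × STp N × STp N × STp N) : 0 ≤ fullPen k q := by
  unfold fullPen
  have := penFun_nonneg (k := k) zero_le_one (q.1 - q.2.1)
  positivity

lemma le_fullPen (hk : 1 ≤ k) (z ζ κ l : STp N) :
    ‖z - κ‖ ^ 2 ≤ 2 * fullPen k (z, ζ, κ, l) ∧ ‖ζ - l‖ ^ 2 ≤ 2 * fullPen k (z, ζ, κ, l) ∧
      ‖(z - ζ).fst‖ ^ (2 * k) ≤ 2 * k * fullPen k (z, ζ, κ, l) ∧
      (z - ζ).snd ^ 2 ≤ 2 * fullPen k (z, ζ, κ, l) := by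
  have hk0 : (0:ℝ) < k := by exact_mod_cast hk
  simp only [fullPen, penFun, one_mul]
  have h1 := sq_nonneg ‖z - κ‖
  have h2 := sq_nonneg ‖ζ - l‖
  have h3 : 0 ≤ ‖(z - ζ).fst‖ ^ (2 * k) / (2 * k) := by positivity
  have h4 := sq_nonneg (z - ζ).snd
  refine ⟨by linarith, by linarith, ?_, by linarith⟩
  have h5 : ‖(z - ζ).fst‖ ^ (2 * k) = 2 * k * (‖(z - ζ).fst‖ ^ (2 * k) / (2 * k)) := by field_simp
  have h6 : ‖(z - ζ).fst‖ ^ (2 * k) / (2 * k) ≤ 1 / 2 * ‖z - κ‖ ^ 2 + 1 / 2 * ‖ζ - l‖ ^ 2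
      + (‖(z - ζ).fst‖ ^ (2 * k) / (2 * k) + (z - ζ).snd ^ 2 / 2) := by linarith
  exact h5.le.trans (mul_le_mul_of_nonneg_left h6 (by positivity))

lemma abs_stp_snd_le (v : STp N) : |v.snd| ≤ ‖v‖ := by
  have := stp_norm_sq v
  exact abs_le_of_sq_le_sq (by nlinarith [sq_nonneg ‖v.fst‖]) (norm_nonneg _)

lemma exists_close_of_penalty (hk : 1 ≤ k) {s e : ℝ} (hs : 0 < s) :
    ∃ N₀ : ℕ, ∀ n : ℕ, N₀ ≤ n → ∀ z ζ κ l : STp N, n * fullPen k (z, ζ, κ, l) ≤ e →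
      ‖κ.fst - l.fst‖ < s ∧ |κ.snd - l.snd| < s := by
  set b := min ((s / 4) ^ 2 / 2) ((s / 4) ^ (2 * k) / (2 * k)) with hb
  have hk0 : (0:ℝ) < k := by exact_mod_cast hk
  have hb0 : 0 < b := by positivity
  obtain ⟨N₀, hN₀⟩ := exists_nat_gt (e / b)
  refine ⟨N₀ + 1, fun n hn z ζ κ l hpen => ?_⟩
  have hnN : (N₀ : ℝ) + 1 ≤ n := by exact_mod_cast hn
  have hN0 : (0:ℝ) ≤ N₀ := N₀.cast_nonneg
  have hp0 := fullPen_nonneg (k := k) (z, ζ, κ, l)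
  have hpb : fullPen k (z, ζ, κ, l) < b := by
    rw [div_lt_iff₀ hb0] at hN₀
    by_contra! hcon
    have : (n:ℝ) * b ≤ n * fullPen k (z, ζ, κ, l) := by gcongr
    nlinarith
  obtain ⟨i1, i2, i3, i4⟩ := le_fullPen hk z ζ κ l
  have j1 : fullPen k (z, ζ, κ, l) < (s / 4) ^ 2 / 2 := hpb.trans_le (min_le_left _ _)
  have j2 : fullPen k (z, ζ, κ, l) < (s / 4) ^ (2 * k) / (2 * k) := hpb.trans_le (min_le_right _ _)
  rw [lt_div_iff₀ (by positivity)] at j2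
  have a1 : ‖z - κ‖ < s / 4 := lt_of_pow_lt_pow_left₀ 2 (by positivity) (by linarith)
  have a2 : ‖ζ - l‖ < s / 4 := lt_of_pow_lt_pow_left₀ 2 (by positivity) (by linarith)
  have a3 : ‖(z - ζ).fst‖ < s / 4 := lt_of_pow_lt_pow_left₀ (2 * k) (by positivity) (by linarith)
  have a4 : |(z - ζ).snd| < s / 4 := lt_of_pow_lt_pow_left₀ 2 (by positivity) (by
    rw [sq_abs]; linarith)
  have e0 : κ - l = (z - ζ) - (z - κ) + (ζ - l) := by abel
  have b1 := norm_stp_fst_le (z - κ)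
  have b2 := norm_stp_fst_le (ζ - l)
  have b3 := abs_stp_snd_le (z - κ)
  have b4 := abs_stp_snd_le (ζ - l)
  constructor
  · rw [← WithLp.sub_fst, e0, WithLp.add_fst, WithLp.sub_fst]
    have := norm_add_le ((z - ζ).fst - (z - κ).fst) (ζ - l).fst
    have := norm_sub_le (z - ζ).fst (z - κ).fst
    linarith
  · rw [← WithLp.sub_snd, e0, WithLp.add_snd, WithLp.sub_snd]
    have := abs_add_le ((z - ζ).snd - (z - κ).snd) (ζ - l).snd
    have := abs_sub (z - ζ).snd (z - κ).snd
    linarith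

set_option maxHeartbeats 1000000 in
/-- The comparison principle with a modulus of continuity. -/
theorem EqData.comparison (D : EqData Ω T F h α f a A Ch Mf k) {ω : ℝ → ℝ} {ωh ch : ℝ}
    (R : RegData Ω T F h α k ω ωh ch) (hT : 0 < T) (hΩ : Bornology.IsBounded Ω)
    {u v : EucSp N × ℝ → ℝ} (hu : ViscSub Ω T F h α f k u)
    (hv : ViscSub Ω T (flipF F) h α (fun x t => -f x t) k v)
    (huc : UpperSemicontinuousOn u (Ω ×ˢ Ioo 0 T)) (hvc : UpperSemicontinuousOn v (Ω ×ˢ Ioo 0 T))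
    {M : ℝ} (huM : ∀ z ∈ Ω ×ˢ Ioo 0 T, u z ≤ M) (hvM : ∀ z ∈ Ω ×ˢ Ioo 0 T, v z ≤ M)
    (hbd : ∀ ε > 0, ∃ ρ > 0, ∀ z ∈ Ω ×ˢ Ioo 0 T, ∀ w ∈ Ω ×ˢ Ioo 0 T, ‖z.1 - w.1‖ < ρ →
      |z.2 - w.2| < ρ → (infDist z.1 Ωᶜ < ρ ∨ z.2 < ρ) → u z + v w ≤ ε)
    {ε : ℝ} (hε : 0 < ε) :
    ∃ n : ℕ, ∀ z ∈ Ω ×ˢ Ioo 0 T, ∀ w ∈ Ω ×ˢ Ioo 0 T,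
      u z + v w ≤ ε + n * (‖z.1 - w.1‖ ^ (2 * k) + |z.2 - w.2| ^ 2) := by
  by_contra! hcon
  have hk := D.two_le
  have hk1 : 1 ≤ k := by omega
  have hk0 : (1:ℝ) ≤ k := by exact_mod_cast hk1
  obtain ⟨κ₀, hκ₀, g, g', hg, hgc, hg'c, hgt, δ, hδ, hgδ⟩ :=
    exists_time_weight hT (by positivity : 0 < ε / 4) (abs_nonneg Mf)
  obtain ⟨e₀, he₀, -, hmain⟩ := D.exists_penMax_le R (half_pos hκ₀)
  obtain ⟨ρ₁, hρ₁, hbd₁⟩ := hbd (ε / 4) (by positivity)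
  set σ := min (ε / 16) (e₀ / (12 * k)) with hσ
  have hσ0 : 0 < σ := by positivity
  have hσ1 : σ ≤ ε / 16 := min_le_left _ _
  have hσ2 : 12 * k * σ ≤ e₀ := by
    have : σ ≤ e₀ / (12 * k) := min_le_right _ _
    rw [le_div_iff₀ (by positivity)] at this; linarith
  -- uniform continuity of the right-hand side
  set ρ := ρ₁ / 2 with hρ
  have hρ0 : 0 < ρ := half_pos hρ₁
  have hfu : UniformContinuousOn (fun z : STp N => f z.fst z.snd) (cylCore Ω ρ (T - δ / 2)) := by
    refine (isCompact_cylCore hΩ hρ0).uniformContinuousOn_of_continuous ?_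
    exact D.f_cont.comp (continuous_stp_fst.prodMk continuous_stp_snd).continuousOn
      fun z hz => cylCore_subset hρ0 (by linarith) hz
  rw [Metric.uniformContinuousOn_iff] at hfu
  obtain ⟨s₀, hs₀, hf₀⟩ := hfu (κ₀ / 4) (by positivity)
  set s₁ := min (ρ₁ / 4) (min (δ / 2) (s₀ / 2)) with hs₁
  have hs₁0 : 0 < s₁ := by positivity
  have hs1 : s₁ ≤ ρ₁ / 4 := min_le_left _ _
  have hs2 : s₁ ≤ δ / 2 := (min_le_right _ _).trans (min_le_left _ _)
  have hs3 : s₁ ≤ s₀ / 2 := (min_le_right _ _).trans (min_le_right _ _)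
  obtain ⟨N₀, hN₀⟩ := exists_close_of_penalty (N := N) (e := 6 * σ) hk1 hs₁0
  -- nearly optimal points
  set P : Set (STp N × STp N × STp N × STp N) :=
    {q | (q.2.2.1.fst ∈ Ω ∧ q.2.2.1.snd ∈ Ioo 0 T) ∧ q.2.2.2.fst ∈ Ω ∧ q.2.2.2.snd ∈ Ioo 0 T}
    with hP
  set J : STp N × STp N × STp N × STp N → ℝ := fun q =>
    u (q.2.2.1.fst, q.2.2.1.snd) - g q.2.2.1.snd + v (q.2.2.2.fst, q.2.2.2.snd) with hJ
  have hJB : ∀ q ∈ P, J q ≤ 2 * M := fun q hq => by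
    have h1 := huM (q.2.2.1.fst, q.2.2.1.snd) hq.1
    have h2 := hvM (q.2.2.2.fst, q.2.2.2.snd) hq.2
    have h3 := (hgt _ hq.1.2).1
    simp only [hJ]; linarith
  have hJc : ∀ n : ℕ, ∃ q ∈ P, 3 * ε / 4 ≤ J q - n * fullPen k q := fun n => by
    obtain ⟨z, hz, w, hw, hlt⟩ := hcon n
    refine ⟨(WithLp.toLp 2 z, WithLp.toLp 2 w, WithLp.toLp 2 z, WithLp.toLp 2 w), ⟨hz, hw⟩, ?_⟩
    have h3 := (hgt _ hz.2).2.1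
    have h4 : fullPen k (WithLp.toLp 2 z, WithLp.toLp 2 w, WithLp.toLp 2 z, WithLp.toLp 2 w)
        ≤ ‖z.1 - w.1‖ ^ (2 * k) + |z.2 - w.2| ^ 2 := by
      simp only [fullPen, penFun, sub_self, norm_zero, one_mul, WithLp.sub_fst, WithLp.sub_snd,
        WithLp.toLp_fst, WithLp.toLp_snd, sq_abs]
      have h5 : ‖z.1 - w.1‖ ^ (2 * k) / (2 * k) ≤ ‖z.1 - w.1‖ ^ (2 * k) :=
        div_le_self (by positivity) (by linarith)
      have h6 := sq_nonneg (z.2 - w.2)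
      linarith
    have h5 := mul_le_mul_of_nonneg_left h4 (n.cast_nonneg (α := ℝ))
    change _ ≤ u z - g z.2 + v w - _
    linarith
  obtain ⟨n, hnN, hn1, θ, hcθ, hθle, ⟨⟨z₀, ζ₀, κ₁, l₁⟩, hq₀, hq₀θ⟩, hsmall⟩ :=
    exists_small_penalty hJB (fun q _ => fullPen_nonneg q) hJc hσ0 N₀
  have hnr : (1:ℝ) ≤ n := by exact_mod_cast hn1
  have hn0 : (0:ℝ) < n := by linarith
  -- nearly optimal points stay away from the boundary
  have hinner : ∀ z ζ κ l : STp N, (z, ζ, κ, l) ∈ P →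
      θ - 2 * σ ≤ J (z, ζ, κ, l) - n * fullPen k (z, ζ, κ, l) →
      n * fullPen k (z, ζ, κ, l) ≤ 6 * σ ∧ ‖κ.fst - l.fst‖ < s₁ ∧ |κ.snd - l.snd| < s₁ ∧
      ρ < infDist κ.fst Ωᶜ ∧ ρ < κ.snd ∧ ρ < infDist l.fst Ωᶜ ∧ ρ < l.snd := by
    intro z ζ κ l hq hqθ
    have h1 := hsmall _ _ hq hqθ
    have h1' : n * fullPen k (z, ζ, κ, l) ≤ 6 * σ := by linarith
    obtain ⟨h2, h3⟩ := hN₀ n hnN z ζ κ l h1'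
    have h4 : ε / 4 < u (κ.fst, κ.snd) + v (l.fst, l.snd) := by
      have h5 := (hgt _ hq.1.2).1
      have h6 := mul_nonneg hn0.le (fullPen_nonneg (k := k) (z, ζ, κ, l))
      simp only [hJ] at hqθ
      linarith
    have h5 : ¬ (infDist κ.fst Ωᶜ < ρ₁ ∨ κ.snd < ρ₁) := fun hor => by
      have := hbd₁ (κ.fst, κ.snd) hq.1 (l.fst, l.snd) hq.2 (by change ‖κ.fst - l.fst‖ < _; linarith)
        (by change |κ.snd - l.snd| < _; linarith) hor
      linarith
    push Not at h5
    have h6 : infDist κ.fst Ωᶜ ≤ infDist l.fst Ωᶜ + dist κ.fst l.fst := infDist_le_infDist_add_dist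
    rw [dist_eq_norm] at h6
    have h7 := abs_lt.1 h3
    exact ⟨h1', h2, h3, by linarith [h5.1], by linarith [h5.2], by linarith [h5.1],
      by linarith [h5.2]⟩
  obtain ⟨-, -, -, c1, c2, c3, c4⟩ := hinner z₀ ζ₀ κ₁ l₁ hq₀ (by linarith)
  -- the time barrier
  set T₁ := max κ₁.snd l₁.snd with hT₁
  have hT₁T : T₁ < T := max_lt hq₀.1.2.2 hq₀.2.2.2
  set b := σ * (T - T₁) / 2 with hb
  have hb0 : 0 < b := by have := sub_pos.2 hT₁T; positivity
  set β : ℝ → ℝ := fun s => b / (T - s) with hβ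
  have hβ1 : ∀ s, s ≤ T₁ → β s ≤ σ / 2 := fun s hs => by
    have : 0 < T - s := by linarith
    simp only [hβ]
    rw [div_le_iff₀ this, hb]
    linarith [mul_le_mul_of_nonneg_left (sub_le_sub_left hs T) hσ0.le]
  have hβ0 : ∀ s, s < T → 0 ≤ β s := fun s hs => by
    have : 0 < T - s := by linarith
    simp only [hβ]; positivity
  set T' := T - b / (4 * σ) with hT'
  have hbσ : 0 < b / (4 * σ) := by positivity
  have hT'T : T' < T := by linarith
  have hT₁T' : T₁ ≤ T' := by
    have : b / (4 * σ) = (T - T₁) / 8 := by rw [hb]; field_simp; ring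
    rw [hT', this]; linarith
  have hβ2 : ∀ s, s < T → β s ≤ 2 * σ → s < T' := fun s hs hle => by
    have h0 : 0 < T - s := by linarith
    simp only [hβ] at hle
    rw [div_le_iff₀ h0] at hle
    have : b / (4 * σ) ≤ (T - s) / 2 := by
      rw [div_le_iff₀ (by positivity)]; nlinarith
    rw [hT']; linarith
  have hβp := upperParabola_div (T := T) (T' := T) (b := b) le_rfl hb0.le
  have hβc : ContinuousOn β (Ioo 0 T) := by
    simpa using continuousOn_div_sub (T := T) (T' := T) (b := b) le_rfl 1
  have hβc' := continuousOn_div_sub (T := T) (T' := T) (b := b) le_rfl 2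
  -- the maximum point
  set K := cylCore Ω ρ T' with hK
  have hKc : IsCompact K := isCompact_cylCore hΩ hρ0
  have hKQ : ∀ z ∈ K, z.fst ∈ Ω ∧ z.snd ∈ Ioo 0 T := fun z hz => cylCore_subset hρ0 hT'T hz
  have hmap : ContinuousOn (fun z : STp N => ((z.fst, z.snd) : EucSp N × ℝ)) K :=
    (continuous_stp_fst.prodMk continuous_stp_snd).continuousOn
  have hsnd : ContinuousOn (fun z : STp N => z.snd) K := continuous_stp_snd.continuousOn
  have hU : UpperSemicontinuousOn
      (fun z : STp N => u (z.fst, z.snd) - (g z.snd + β z.snd)) K := by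
    have h1 : UpperSemicontinuousOn (fun z : STp N => u (z.fst, z.snd)) K :=
      huc.comp hmap fun z hz => hKQ z hz
    have h2 : ContinuousOn (fun z : STp N => -(g z.snd + β z.snd)) K :=
      ((hgc.add hβc).comp hsnd fun z hz => (hKQ z hz).2).neg
    simpa only [sub_eq_add_neg] using h1.add h2.upperSemicontinuousOn
  have hV : UpperSemicontinuousOn (fun z : STp N => v (z.fst, z.snd) - β z.snd) K := by
    have h1 : UpperSemicontinuousOn (fun z : STp N => v (z.fst, z.snd)) K :=
      hvc.comp hmap fun z hz => hKQ z hz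
    have h2 : ContinuousOn (fun z : STp N => -β z.snd) K :=
      (hβc.comp hsnd fun z hz => (hKQ z hz).2).neg
    simpa only [sub_eq_add_neg] using h1.add h2.upperSemicontinuousOn
  have hκ₁K : κ₁ ∈ K := ⟨c1.le, c2.le, (le_max_left _ _).trans hT₁T'⟩
  have hl₁K : l₁ ∈ K := ⟨c3.le, c4.le, (le_max_right _ _).trans hT₁T'⟩
  obtain ⟨z, ζ, κ, l, hm⟩ := exists_isPenMax hKc ⟨κ₁, hκ₁K⟩ hU hV (B := M)
    (fun z hz => by
      have h1 := huM (z.fst, z.snd) (hKQ z hz)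
      have h2 := hβ0 _ (hKQ z hz).2.2
      have h3 := (hgt _ (hKQ z hz).2).1
      linarith)
    (fun z hz => by
      have h1 := hvM (z.fst, z.snd) (hKQ z hz)
      have h2 := hβ0 _ (hKQ z hz).2.2
      linarith)
    hnr (continuous_penFun (k := k) n) (penFun_nonneg hn0.le)
  have hpen : ∀ z ζ κ l : STp N, n / 2 * ‖z - κ‖ ^ 2 + n / 2 * ‖ζ - l‖ ^ 2 + penFun k n (z - ζ)
      = n * fullPen k (z, ζ, κ, l) := fun z ζ κ l => by
    simp only [fullPen, penFun]; ring
  have hκQ := hKQ κ hm.mem_left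
  have hlQ := hKQ l hm.mem_right
  have hqP : (z, ζ, κ, l) ∈ P := ⟨hκQ, hlQ⟩
  have hle := hm.le z₀ ζ₀ κ₁ hκ₁K l₁ hl₁K
  have p1 := hpen z ζ κ l
  have p2 := hpen z₀ ζ₀ κ₁ l₁
  have b1 := hβ1 κ₁.snd (le_max_left _ _)
  have b2 := hβ1 l₁.snd (le_max_right _ _)
  have b3 := hβ0 κ.snd hκQ.2.2
  have b4 := hβ0 l.snd hlQ.2.2
  have hJq : θ - 2 * σ + (β κ.snd + β l.snd)
      ≤ J (z, ζ, κ, l) - n * fullPen k (z, ζ, κ, l) := by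
    simp only [hJ] at hq₀θ ⊢
    linarith
  have hJθ := hθle _ hqP
  obtain ⟨d1, d2, d3, d4, d5, d6, d7⟩ := hinner z ζ κ l hqP (by linarith)
  have hκK : K ∈ nhds κ := cylCore_mem_nhds d4 d5 (hβ2 _ hκQ.2.2 (by linarith))
  have hlK : K ∈ nhds l := cylCore_mem_nhds d6 d7 (hβ2 _ hlQ.2.2 (by linarith))
  obtain ⟨-, -, i3, i4⟩ := le_fullPen hk1 z ζ κ l
  have hkσ : σ ≤ k * σ := le_mul_of_one_le_left hσ0.le hk0
  have hfin := hmain u v _ _ _ _ K n z ζ κ l hu hv (hg.add hβp) (hg'c.add hβc') hβp hβc' hKc hU hV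
    hKQ hnr hm hκK hlK
    (by
      calc (n:ℝ) * ‖(z - ζ).fst‖ ^ (2 * k) ≤ n * (2 * k * fullPen k (z, ζ, κ, l)) := by gcongr
        _ = 2 * k * (n * fullPen k (z, ζ, κ, l)) := by ring
        _ ≤ 2 * k * (6 * σ) := by gcongr
        _ ≤ e₀ := by linarith)
    (by
      calc (n:ℝ) * (z - ζ).snd ^ 2 ≤ n * (2 * fullPen k (z, ζ, κ, l)) := by gcongr
        _ = 2 * (n * fullPen k (z, ζ, κ, l)) := by ring
        _ ≤ 2 * (6 * σ) := by gcongr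
        _ ≤ e₀ := by linarith)
  have q1 : 0 ≤ b / (T - κ.snd) ^ 2 := by positivity
  have q2 : 0 ≤ b / (T - l.snd) ^ 2 := by positivity
  rcases lt_or_ge (T - δ) κ.snd with hlate | hearly
  · have h1 := hgδ _ hκQ.2 hlate
    have h2 := (abs_le.1 (D.f_bdd _ hκQ.1 _ hκQ.2)).2
    have h3 := (abs_le.1 (D.f_bdd _ hlQ.1 _ hlQ.2)).1
    have h4 := le_abs_self Mf
    linarith
  · have h1 := (hgt _ hκQ.2).2.2
    have h7 := abs_lt.1 d3
    have h2 : |f κ.fst κ.snd - f l.fst l.snd| < κ₀ / 4 := by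
      refine hf₀ κ ⟨d4.le, d5.le, by linarith⟩ l ⟨d6.le, d7.le, by linarith [h7.1]⟩ ?_
      rw [dist_eq_norm]
      have h8 := stp_norm_sq (κ - l)
      rw [WithLp.sub_fst, WithLp.sub_snd] at h8
      have h9 : (κ.snd - l.snd) ^ 2 ≤ s₁ ^ 2 := by rw [← sq_abs]; gcongr
      have h10 : ‖κ.fst - l.fst‖ ^ 2 ≤ s₁ ^ 2 := by gcongr
      refine lt_of_pow_lt_pow_left₀ 2 hs₀.le ?_
      have h11 : s₁ ^ 2 ≤ (s₀ / 2) ^ 2 := by gcongr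
      rw [div_pow] at h11
      have h12 : 0 < s₀ ^ 2 := by positivity
      linarith
    have h3 := (abs_lt.1 h2).2
    linarith

/-- A function bounded above by a continuous function has an upper semicontinuous hull. -/
lemma exists_usc_hull {E : Type*} [PseudoMetricSpace E] {Q : Set E} (hQ : IsOpen Q) {g b : E → ℝ}
    (hb : ContinuousOn b Q) (hgb : ∀ z ∈ Q, g z ≤ b z) :
    ∃ G : E → ℝ, (∀ z ∈ Q, g z ≤ G z) ∧ UpperSemicontinuousOn G Q ∧
      ∀ z₀ ∈ Q, ∀ ε > 0, ∃ z ∈ Q, dist z z₀ < ε ∧ G z₀ - ε < g z := by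
  set V : E → Set ℝ := fun z => {c | ∀ᶠ y in nhds z, g y ≤ c} with hV
  have hbel : ∀ z, g z ∈ lowerBounds (V z) := fun z c hc => by
    rw [hV, Set.mem_ofPred_eq] at hc; exact hc.self_of_nhds
  have hne : ∀ z ∈ Q, (V z).Nonempty := fun z hz => by
    refine ⟨b z + 1, ?_⟩
    rw [hV, Set.mem_ofPred_eq]
    have hbz := (hb.continuousAt (hQ.mem_nhds hz)).eventually (gt_mem_nhds (lt_add_one (b z)))
    filter_upwards [hbz, hQ.mem_nhds hz] with y h1 h2
    exact (hgb y h2).trans h1.le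
  refine ⟨fun z => sInf (V z), fun z hz => le_csInf (hne z hz) (hbel z), ?_, ?_⟩
  · intro z hz c hc
    obtain ⟨d, hd, hdc⟩ := exists_lt_of_csInf_lt (hne z hz) hc
    rw [hV, Set.mem_ofPred_eq] at hd
    refine Filter.Eventually.filter_mono nhdsWithin_le_nhds ?_
    filter_upwards [hd.eventually_nhds] with y hy
    exact (csInf_le ⟨_, hbel y⟩ hy).trans_lt hdc
  · intro z₀ hz₀ ε hε
    by_contra! hcon
    have : sInf (V z₀) - ε ∈ V z₀ := by
      rw [hV, Set.mem_ofPred_eq]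
      filter_upwards [hQ.mem_nhds hz₀, Metric.ball_mem_nhds z₀ hε] with y h1 h2
      exact hcon y h1 (Metric.mem_ball.1 h2)
    have := csInf_le ⟨_, hbel z₀⟩ this
    linarith

lemma le_of_usc_of_approx {E : Type*} [PseudoMetricSpace E] {Q : Set E} {g c : E → ℝ}
    {z₀ : E} {G : ℝ} (hz₀ : z₀ ∈ Q) (hc : UpperSemicontinuousOn c Q) (hgc : ∀ z ∈ Q, g z ≤ c z)
    (happ : ∀ ε > 0, ∃ z ∈ Q, dist z z₀ < ε ∧ G - ε < g z) : G ≤ c z₀ := by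
  refine le_of_forall_pos_le_add fun ε hε => ?_
  have h1 := hc z₀ hz₀ (c z₀ + ε / 2) (by linarith)
  obtain ⟨r, hr, hball⟩ := Metric.mem_nhdsWithin_iff.1 h1
  obtain ⟨z, hz, hzr, hz2⟩ := happ (min r (ε / 2)) (by positivity)
  have h2 : c z < c z₀ + ε / 2 := hball ⟨Metric.mem_ball.2 (hzr.trans_le (min_le_left _ _)), hz⟩
  have := hgc z hz
  have := min_le_right r (ε / 2)
  linarith

/-- `φ` is a strict classical subsolution at `z`, through a polynomial touching from below. -/
def HasSubJet (F : EucSp N → EucSp N → MatN N → ℝ) (h : EucSp N → ℝ → EucSp N) (α : ℝ)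
    (f : EucSp N → ℝ → ℝ) (φ : EucSp N × ℝ → ℝ) (z₁ : EucSp N × ℝ) : Prop :=
  ∃ (p : EucSp N) (τ C : ℝ) (X : MatN N), X.IsSymm ∧
    (∀ᶠ z in nhds z₁, φ z₁ + ⟪p, z.1 - z₁.1⟫ + τ * (z.2 - z₁.2)
      + 1 / 2 * qf X (z.1 - z₁.1) + C * (z.2 - z₁.2) ^ 2 ≤ φ z) ∧
    (p ≠ 0 → τ - F z₁.1 p X - gradTerm h α z₁.1 z₁.2 p ≤ f z₁.1 z₁.2) ∧
    (p = 0 → τ ≤ f z₁.1 z₁.2)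

lemma ViscSubAt.of_hasSubJet (D : EqData Ω T F h α f a A Ch Mf k) {φ u : EucSp N × ℝ → ℝ}
    {x : EucSp N} {t : ℝ} (hx : x ∈ Ω) (hφ : HasSubJet F h α f φ (x, t)) {c : ℝ}
    (hle : ∀ᶠ z in nhds (x, t), φ z + c ≤ u z) (heq : u (x, t) = φ (x, t) + c) :
    ViscSubAt F h α f k u x t := by
  obtain ⟨p, τ, C, X, hX, hlow, h1, h2⟩ := hφ
  refine ViscSubAt.of_lower D hx (p := p) (τ := τ) (C := C) hX ?_ h1 h2
  filter_upwards [hlow, hle] with z h3 h4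
  rw [heq]; linarith

/-- Raising a subsolution near a point by a strict subsolution. -/
lemma ViscSub.bump (D : EqData Ω T F h α f a A Ch Mf k) {u φ R : EucSp N × ℝ → ℝ}
    (hu : ViscSub Ω T F h α f k u) (huc : UpperSemicontinuousOn u (Ω ×ˢ Ioo 0 T))
    {z₀ : EucSp N × ℝ} (hφ : Continuous φ) (hR : Continuous R)
    (hRpos : ∀ z, z ≠ z₀ → 0 < R z) (hle : ∀ᶠ z in nhds z₀, φ z + R z ≤ u z)
    (hjet : ∀ᶠ z in nhds z₀, HasSubJet F h α f φ z) {ε : ℝ} (hε : 0 < ε) :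
    ∃ W : EucSp N × ℝ → ℝ, ∃ δ > 0, ViscSub Ω T F h α f k W ∧
      UpperSemicontinuousOn W (Ω ×ˢ Ioo 0 T) ∧
      (∀ z, W z = u z ∨ (dist z z₀ < ε ∧ W z ≤ φ z + ε)) ∧
      ∀ᶠ z in nhds z₀, φ z + δ ≤ W z := by
  classical
  obtain ⟨r₀, hr₀, hball⟩ := Metric.eventually_nhds_iff_ball.1 (hle.and hjet)
  set r := min ε (r₀ / 2) with hr
  have hr0 : 0 < r := by positivity
  have hrr₀ : r < r₀ := (min_le_right _ _).trans_lt (by linarith)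
  set K := closedBall z₀ r \ ball z₀ (r / 2) with hK
  have hKc : IsCompact K := (isCompact_closedBall_prod z₀ r).diff isOpen_ball
  obtain ⟨m, hm, hmK⟩ : ∃ m > 0, ∀ z ∈ K, m ≤ R z := by
    rcases K.eq_empty_or_nonempty with h0 | h0
    · exact ⟨1, one_pos, by simp [h0]⟩
    · obtain ⟨y, hy, hmin⟩ := hKc.exists_isMinOn h0 hR.continuousOn
      refine ⟨R y, hRpos y fun hyz => ?_, fun z hz => hmin hz⟩
      rw [hyz] at hy
      exact hy.2 (mem_ball_self (by linarith))
  set δ := min m ε with hδ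
  have hδ0 : 0 < δ := by positivity
  have hann : ∀ z, r / 2 ≤ dist z z₀ → dist z z₀ ≤ r → φ z + δ ≤ u z := fun z h1 h2 => by
    have h3 := (hball z (mem_ball.2 (h2.trans_lt hrr₀))).1
    have h4 := hmK z ⟨mem_closedBall.2 h2, fun h5 => absurd (mem_ball.1 h5) (not_lt.2 h1)⟩
    linarith [min_le_left m ε]
  set W : EucSp N × ℝ → ℝ := fun z => if dist z z₀ < r then max (u z) (φ z + δ) else u z with hW
  have hWin : ∀ z, dist z z₀ < r → W z = max (u z) (φ z + δ) := fun z hz => by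
    simp only [hW, if_pos hz]
  have hWout : ∀ z, r / 2 < dist z z₀ → W z = u z := fun z hz => by
    by_cases h1 : dist z z₀ < r
    · rw [hWin z h1, max_eq_left (hann z hz.le h1.le)]
    · simp only [hW, if_neg h1]
  have huW : ∀ z, u z ≤ W z := fun z => by
    by_cases h1 : dist z z₀ < r
    · rw [hWin z h1]; exact le_max_left _ _
    · simp only [hW, if_neg h1]; exact le_rfl
  have hin : ∀ z, dist z z₀ < r → ∀ᶠ y in nhds z, dist y z₀ < r := fun z hz =>
    isOpen_ball.mem_nhds (mem_ball.2 hz)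
  refine ⟨W, δ, hδ0, ?_, ?_, ?_, ?_⟩
  · intro x hx t ht
    by_cases h1 : dist (x, t) z₀ < r ∧ u (x, t) < φ (x, t) + δ
    · refine ViscSubAt.of_hasSubJet D hx (hball _ (mem_ball.2 (h1.1.trans hrr₀))).2 (c := δ) ?_ ?_
      · filter_upwards [hin _ h1.1] with z hz
        rw [hWin z hz]; exact le_max_right _ _
      · rw [hWin _ h1.1, max_eq_right h1.2.le]
    · refine (hu x hx t ht).of_le (Eventually.of_forall huW) ?_
      by_cases h2 : dist (x, t) z₀ < r
      · have h3 : φ (x, t) + δ ≤ u (x, t) := not_lt.1 fun h3 => h1 ⟨h2, h3⟩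
        rw [hWin _ h2, max_eq_left h3]
      · rw [hWout _ (by linarith)]
  · intro z hz
    by_cases h1 : dist z z₀ < r
    · intro c hc
      have h2 : u z < c := (huW z).trans_lt hc
      have h3 : φ z + δ < c := by rw [hWin z h1] at hc; exact (le_max_right _ _).trans_lt hc
      have h4 : ∀ᶠ y in nhdsWithin z (Ω ×ˢ Ioo 0 T), φ y + δ < c :=
        ((hφ.add continuous_const).continuousAt.eventually (gt_mem_nhds h3)).filter_mono
          nhdsWithin_le_nhds
      filter_upwards [huc z hz c h2, h4, (hin z h1).filter_mono nhdsWithin_le_nhds] with y a1 a2 a3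
      rw [hWin y a3]; exact max_lt a1 a2
    · intro c hc
      rw [hWout z (by linarith)] at hc
      have h4 : ∀ᶠ y in nhds z, r / 2 < dist y z₀ :=
        (continuous_id.dist continuous_const).continuousAt.eventually
          (lt_mem_nhds (show r / 2 < dist (id z) z₀ by simp only [id]; linarith))
      filter_upwards [huc z hz c hc, h4.filter_mono nhdsWithin_le_nhds] with y a1 a2
      rw [hWout y a2]; exact a1
  · intro z
    by_cases h1 : dist z z₀ < r
    · rw [hWin z h1]
      rcases le_total (φ z + δ) (u z) with h2 | h2
      · left; exact max_eq_left h2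
      · right
        refine ⟨h1.trans_le (min_le_left _ _), ?_⟩
        rw [max_eq_right h2]; linarith [min_le_right m ε]
    · left; simp only [hW, if_neg h1]
  · filter_upwards [Metric.ball_mem_nhds z₀ hr0] with z hz
    rw [hWin z (mem_ball.1 hz)]; exact le_max_right _ _

/-- A downward power is a subsolution up to a small error. -/
lemma EqData.hasSubJet_power (D : EqData Ω T F h α f a A Ch Mf k) {x₀ x₁ : EucSp N} {t₀ t₁ : ℝ}
    (hx₁ : x₁ ∈ Ω) (ht₁ : t₁ ∈ Ioo 0 T) {c τ B M : ℝ} (hM : 0 < M)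
    (hτ : τ + 2 * B * (t₁ - t₀) + powErr N A Ch α k M ‖x₁ - x₀‖ ≤ f x₁ t₁) :
    HasSubJet F h α f (fun z => c + τ * (z.2 - t₀) + B * (z.2 - t₀) ^ 2
      - M * ‖z.1 - x₀‖ ^ (2 * k)) (x₁, t₁) := by
  have hk1 : 1 ≤ k := by have := D.two_le; omega
  have hk0 : (0:ℝ) < k := by exact_mod_cast hk1
  rcases eq_or_ne x₁ x₀ with rfl | hne
  · have h0 : powErr N A Ch α k M ‖x₁ - x₁‖ = 0 := by
      have := D.k_alpha
      simp only [powErr, sub_self, norm_zero]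
      rw [Real.zero_rpow (by linarith), Real.zero_rpow (by linarith)]; ring
    rw [h0, add_zero] at hτ
    refine ⟨0, τ + 2 * B * (t₁ - t₀), B, -((2 * M) • 1), (isSymm_one.smul _).neg, ?_,
      fun hne => absurd rfl hne, fun _ => hτ⟩
    have hnear : ∀ᶠ z : EucSp N × ℝ in nhds (x₁, t₁), ‖z.1 - x₁‖ < 1 := by
      have : Tendsto (fun z : EucSp N × ℝ => ‖z.1 - x₁‖) (nhds (x₁, t₁)) (nhds 0) := by
        have h1 : Continuous (fun z : EucSp N × ℝ => ‖z.1 - x₁‖) := by fun_prop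
        simpa using h1.tendsto (x₁, t₁)
      exact this.eventually (gt_mem_nhds one_pos)
    filter_upwards [hnear] with z hz
    have h1 : ‖z.1 - x₁‖ ^ (2 * k) ≤ ‖z.1 - x₁‖ ^ 2 :=
      pow_le_pow_of_le_one (norm_nonneg _) hz.le (by omega)
    have h2 : ‖x₁ - x₁‖ ^ (2 * k) = 0 := by simp; omega
    simp only [h2, inner_zero_left, qf_neg_left, qf_smul_left, qf_one]
    nlinarith [mul_le_mul_of_nonneg_left h1 hM.le]
  · set d := x₁ - x₀ with hd
    have hd0 : d ≠ 0 := sub_ne_zero.2 hne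
    have hdn : 0 < ‖d‖ := norm_pos_iff.2 hd0
    set p : EucSp N := (2 * k * M * ‖d‖ ^ (2 * k - 2)) • d with hp
    set c₁ := 2 * M * powConst k * ‖d‖ ^ (2 * k - 2) with hc
    have hc0 : 0 ≤ c₁ := by have := powConst_pos k; positivity
    have hp0 : p ≠ 0 := smul_ne_zero (by positivity) hd0
    have hpn : ‖-p‖ = 2 * k * M * ‖d‖ ^ (2 * k - 1) := by
      rw [norm_neg, hp, norm_smul, Real.norm_of_nonneg (by positivity), mul_assoc, ← pow_succ]
      congr 2; omega
    refine ⟨-p, τ + 2 * B * (t₁ - t₀), B, -(c₁ • 1), (isSymm_one.smul _).neg, ?_,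
      fun hp0' => ?_, fun h0 => absurd (neg_eq_zero.1 h0) hp0⟩
    · have hnear : ∀ᶠ z : EucSp N × ℝ in nhds (x₁, t₁), ‖z.1 - x₁‖ < ‖d‖ / 3 := by
        have : Tendsto (fun z : EucSp N × ℝ => ‖z.1 - x₁‖) (nhds (x₁, t₁)) (nhds 0) := by
          have h1 : Continuous (fun z : EucSp N × ℝ => ‖z.1 - x₁‖) := by fun_prop
          simpa using h1.tendsto (x₁, t₁)
        exact this.eventually (gt_mem_nhds (by positivity))
      filter_upwards [hnear] with z hzn
      have hexp := norm_add_pow_le hk1 (d := d) (v := z.1 - x₁) hzn.le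
      have e : d + (z.1 - x₁) = z.1 - x₀ := by rw [hd]; abel
      rw [e] at hexp
      simp only [qf_neg_left, qf_smul_left, qf_one, inner_neg_left, hp, real_inner_smul_left, hc]
      simp only [← hd]
      nlinarith [mul_le_mul_of_nonneg_left hexp hM.le]
    · have hF := D.le_F hx₁ hp0' (X := -(c₁ • 1)) (isSymm_one.smul c₁).neg hc0 fun v => by
        rw [qf_neg_left, qf_smul_left, qf_one]
      have hg := (abs_le.1 (D.abs_gradTerm_le hx₁ hp0' ht₁)).1
      rw [powErr_eq hdn hM D.two_le, ← hpn] at hτ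
      dsimp only at hF hg ⊢
      linarith

lemma eventually_mem_cyl (hΩ : IsOpen Ω) {x₀ : EucSp N} {t₀ : ℝ} (hx₀ : x₀ ∈ Ω)
    (ht₀ : t₀ ∈ Ioo 0 T) : ∀ᶠ z : EucSp N × ℝ in nhds (x₀, t₀), z.1 ∈ Ω ∧ z.2 ∈ Ioo 0 T :=
  (hΩ.prod isOpen_Ioo).mem_nhds ⟨hx₀, ht₀⟩

lemma EqData.eventually_hasSubJet_quad (D : EqData Ω T F h α f a A Ch Mf k) {x₀ : EucSp N} {t₀ : ℝ}
    (hx₀ : x₀ ∈ Ω) (ht₀ : t₀ ∈ Ioo 0 T) {p : EucSp N} {τ B c : ℝ} {X : MatN N} (hp : p ≠ 0)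
    (hX : X.IsSymm) (hlt : τ - F x₀ p X - gradTerm h α x₀ t₀ p < f x₀ t₀) :
    ∀ᶠ z in nhds (x₀, t₀), HasSubJet F h α f (fun z => c + ⟪p, z.1 - x₀⟫ + τ * (z.2 - t₀)
      + 1 / 2 * qf X (z.1 - x₀) + B * (z.2 - t₀) ^ 2) z := by
  have hx : Tendsto (fun z : EucSp N × ℝ => z.1) (nhds (x₀, t₀)) (nhds x₀) :=
    continuous_fst.tendsto (x₀, t₀)
  have ht : Tendsto (fun z : EucSp N × ℝ => z.2) (nhds (x₀, t₀)) (nhds t₀) :=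
    continuous_snd.tendsto (x₀, t₀)
  have hpt : Tendsto (fun z : EucSp N × ℝ => p + mv X (z.1 - x₀)) (nhds (x₀, t₀)) (nhds p) := by
    have h1 : Continuous fun z : EucSp N × ℝ => p + mv X (z.1 - x₀) :=
      continuous_const.add ((continuous_mv X).comp (by fun_prop))
    simpa [mv_zero] using h1.tendsto (x₀, t₀)
  have hτt : Tendsto (fun z : EucSp N × ℝ => τ + 2 * B * (z.2 - t₀)) (nhds (x₀, t₀)) (nhds τ) := by
    have h1 : Continuous fun z : EucSp N × ℝ => τ + 2 * B * (z.2 - t₀) := by fun_prop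
    simpa using h1.tendsto (x₀, t₀)
  have hlim := (hτt.sub (D.tendsto_F hx₀ hp hx hpt (tendsto_const_nhds (x := X)))).sub
    (D.tendsto_gradTerm hx₀ ht₀ hp hx ht hpt)
  filter_upwards [hlim.eventually_lt (D.tendsto_f hx₀ ht₀ hx ht) hlt,
    hpt.eventually_ne hp] with z hz hz0
  refine ⟨_, _, B, X, hX, Eventually.of_forall fun y => le_of_eq ?_, fun _ => hz.le,
    fun h0 => absurd h0 hz0⟩
  have e1 : y.1 - x₀ = (z.1 - x₀) + (y.1 - z.1) := by abel
  simp only [e1, qf_add hX, inner_add_left, inner_add_right]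
  ring

/-- If the quadratic test fails at a point, then there is a strict subsolution below. -/
lemma EqData.exists_strict_quad (D : EqData Ω T F h α f a A Ch Mf k) {v : EucSp N × ℝ → ℝ}
    {x₀ : EucSp N} {t₀ : ℝ} (hx₀ : x₀ ∈ Ω) (ht₀ : t₀ ∈ Ioo 0 T) {p : EucSp N} {τ C : ℝ}
    {X : MatN N} (hp : p ≠ 0) (hX : X.IsSymm)
    (ht : ∀ᶠ z in nhds (x₀, t₀), v z ≤ v (x₀, t₀) + ⟪p, z.1 - x₀⟫ + τ * (z.2 - t₀)
      + 1 / 2 * qf X (z.1 - x₀) + C * (z.2 - t₀) ^ 2)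
    (hfail : -f x₀ t₀ < τ - flipF F x₀ p X - gradTerm h α x₀ t₀ p) :
    ∃ φ R : EucSp N × ℝ → ℝ, Continuous φ ∧ Continuous R ∧ (∀ z, z ≠ (x₀, t₀) → 0 < R z) ∧
      φ (x₀, t₀) = -v (x₀, t₀) ∧ (∀ᶠ z in nhds (x₀, t₀), φ z + R z ≤ -v z) ∧
      ∀ᶠ z in nhds (x₀, t₀), HasSubJet F h α f φ z := by
  have hXe : Tendsto (fun e : ℝ => -(X + (2 * e) • (1 : MatN N))) (nhds 0) (nhds (-X)) := by
    have h1 : Continuous fun e : ℝ => -(X + (2 * e) • (1 : MatN N)) := by fun_prop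
    simpa using h1.tendsto 0
  have hlim := D.tendsto_F hx₀ (neg_ne_zero.2 hp) (tendsto_const_nhds (x := x₀))
    (tendsto_const_nhds (x := -p)) hXe
  have hlt : -τ - F x₀ (-p) (-X) - gradTerm h α x₀ t₀ (-p) < f x₀ t₀ := by
    rw [gradTerm_neg]; rw [flipF] at hfail; linarith
  have hev := ((tendsto_const_nhds (x := -τ)).sub hlim).sub
    (tendsto_const_nhds (x := gradTerm h α x₀ t₀ (-p))) |>.eventually (gt_mem_nhds hlt)
  obtain ⟨e, he, he0⟩ := ((hev.filter_mono nhdsWithin_le_nhds).and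
    (self_mem_nhdsWithin (a := (0:ℝ)) (s := Ioi 0))).exists
  have he0 : 0 < e := he0
  have hXs : (-(X + (2 * e) • (1 : MatN N))).IsSymm := (hX.add (isSymm_one.smul _)).neg
  refine ⟨fun z => -v (x₀, t₀) + ⟪-p, z.1 - x₀⟫ + (-τ) * (z.2 - t₀)
      + 1 / 2 * qf (-(X + (2 * e) • (1 : MatN N))) (z.1 - x₀) + (-(C + e)) * (z.2 - t₀) ^ 2,
    fun z => e * (‖z.1 - x₀‖ ^ 2 + (z.2 - t₀) ^ 2), ?_, by fun_prop, ?_, ?_, ?_,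
    D.eventually_hasSubJet_quad hx₀ ht₀ (neg_ne_zero.2 hp) hXs he⟩
  · have := continuous_qf (-(X + (2 * e) • (1 : MatN N)))
    have h2 : Continuous fun z : EucSp N × ℝ => qf (-(X + (2 * e) • (1 : MatN N))) (z.1 - x₀) :=
      this.comp (by fun_prop)
    fun_prop
  · intro z hz
    refine mul_pos he0 ?_
    by_contra! hcon
    refine hz (Prod.ext ?_ ?_)
    · have : ‖z.1 - x₀‖ ^ 2 = 0 := by nlinarith [sq_nonneg ‖z.1 - x₀‖, sq_nonneg (z.2 - t₀)]
      exact sub_eq_zero.1 (norm_eq_zero.1 (pow_eq_zero_iff two_ne_zero |>.1 this))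
    · have : (z.2 - t₀) ^ 2 = 0 := by nlinarith [sq_nonneg ‖z.1 - x₀‖, sq_nonneg (z.2 - t₀)]
      exact sub_eq_zero.1 (pow_eq_zero_iff two_ne_zero |>.1 this)
  · simp [qf_zero]
  · filter_upwards [ht] with z hz
    simp only [qf_neg_left, qf_add_left, qf_smul_left, qf_one, inner_neg_left]
    linarith

/-- If the flat test fails at a point, then there is a strict subsolution below. -/
lemma EqData.exists_strict_flat (D : EqData Ω T F h α f a A Ch Mf k) {v : EucSp N × ℝ → ℝ}
    {x₀ : EucSp N} {t₀ : ℝ} (hx₀ : x₀ ∈ Ω) (ht₀ : t₀ ∈ Ioo 0 T) {τ C : ℝ}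
    (ht : ∀ᶠ z in nhds (x₀, t₀), v z ≤ v (x₀, t₀) + τ * (z.2 - t₀)
      + C * (z.2 - t₀) ^ 2 + C * ‖z.1 - x₀‖ ^ (2 * k))
    (hfail : -f x₀ t₀ < τ) :
    ∃ φ R : EucSp N × ℝ → ℝ, Continuous φ ∧ Continuous R ∧ (∀ z, z ≠ (x₀, t₀) → 0 < R z) ∧
      φ (x₀, t₀) = -v (x₀, t₀) ∧ (∀ᶠ z in nhds (x₀, t₀), φ z + R z ≤ -v z) ∧
      ∀ᶠ z in nhds (x₀, t₀), HasSubJet F h α f φ z := by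
  have hk2 : 2 * k ≠ 0 := by have := D.two_le; omega
  have hM : 0 < |C| + 1 := by positivity
  refine ⟨fun z => -v (x₀, t₀) + (-τ) * (z.2 - t₀) + (-(|C| + 1)) * (z.2 - t₀) ^ 2
      - (|C| + 1) * ‖z.1 - x₀‖ ^ (2 * k),
    fun z => ‖z.1 - x₀‖ ^ (2 * k) + (z.2 - t₀) ^ 2, by fun_prop, by fun_prop, ?_, ?_, ?_, ?_⟩
  · intro z hz
    by_contra! hcon
    have h1 : 0 ≤ ‖z.1 - x₀‖ ^ (2 * k) := by positivity
    refine hz (Prod.ext ?_ ?_)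
    · have : ‖z.1 - x₀‖ ^ (2 * k) = 0 := by nlinarith [sq_nonneg (z.2 - t₀)]
      exact sub_eq_zero.1 (norm_eq_zero.1 (pow_eq_zero_iff hk2 |>.1 this))
    · have : (z.2 - t₀) ^ 2 = 0 := by nlinarith [sq_nonneg (z.2 - t₀)]
      exact sub_eq_zero.1 (pow_eq_zero_iff two_ne_zero |>.1 this)
  · simp [hk2]
  · filter_upwards [ht] with z hz
    have h1 : 0 ≤ ‖z.1 - x₀‖ ^ (2 * k) := by positivity
    have h2 := mul_le_mul_of_nonneg_right (le_abs_self C) h1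
    have h3 := mul_le_mul_of_nonneg_right (le_abs_self C) (sq_nonneg (z.2 - t₀))
    linarith
  · have hx : Tendsto (fun z : EucSp N × ℝ => z.1) (nhds (x₀, t₀)) (nhds x₀) :=
      continuous_fst.tendsto (x₀, t₀)
    have htt : Tendsto (fun z : EucSp N × ℝ => z.2) (nhds (x₀, t₀)) (nhds t₀) :=
      continuous_snd.tendsto (x₀, t₀)
    have h1 : Tendsto (fun z : EucSp N × ℝ => -τ + 2 * (-(|C| + 1)) * (z.2 - t₀))
        (nhds (x₀, t₀)) (nhds (-τ)) := by
      have : Continuous fun z : EucSp N × ℝ => -τ + 2 * (-(|C| + 1)) * (z.2 - t₀) := by fun_prop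
      simpa using this.tendsto (x₀, t₀)
    have h2 : Tendsto (fun z : EucSp N × ℝ => ‖z.1 - x₀‖) (nhds (x₀, t₀)) (nhds 0) := by
      have : Continuous fun z : EucSp N × ℝ => ‖z.1 - x₀‖ := by fun_prop
      simpa using this.tendsto (x₀, t₀)
    have h3 := h1.add ((tendsto_powErr (N := N) A Ch (|C| + 1) D.k_alpha).comp h2)
    filter_upwards [h3.eventually_lt (D.tendsto_f hx₀ ht₀ hx htt) (by simpa using by linarith),
      eventually_mem_cyl D.isOpen hx₀ ht₀] with z hz hzQ
    exact D.hasSubJet_power hzQ.1 hzQ.2 hM (by simpa using hz.le)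

/-- Perron's method: between a family of subsolutions and a family of supersolutions there are a
subsolution `u` and a supersolution `-v ≤ u`. -/
theorem EqData.perron (D : EqData Ω T F h α f a A Ch Mf k)
    {Lo Up : Set (EucSp N × ℝ → ℝ)}
    (hLo : ∀ l ∈ Lo, ContinuousOn l (Ω ×ˢ Ioo 0 T) ∧ ViscSub Ω T F h α f k l)
    (hUp : ∀ b ∈ Up, ContinuousOn b (Ω ×ˢ Ioo 0 T) ∧
      ViscSub Ω T (flipF F) h α (fun x t => -f x t) k (fun z => -b z))
    (hle : ∀ l ∈ Lo, ∀ b ∈ Up, ∀ z ∈ Ω ×ˢ Ioo 0 T, l z ≤ b z)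
    (hLne : Lo.Nonempty) (hUne : Up.Nonempty) :
    ∃ u v : EucSp N × ℝ → ℝ, ViscSub Ω T F h α f k u ∧
      ViscSub Ω T (flipF F) h α (fun x t => -f x t) k v ∧
      UpperSemicontinuousOn u (Ω ×ˢ Ioo 0 T) ∧ UpperSemicontinuousOn v (Ω ×ˢ Ioo 0 T) ∧
      ∀ z ∈ Ω ×ˢ Ioo 0 T, -v z ≤ u z ∧ (∀ l ∈ Lo, l z ≤ -v z) ∧ ∀ b ∈ Up, u z ≤ b z := by
  obtain ⟨l₀, hl₀⟩ := hLne
  obtain ⟨b₀, hb₀⟩ := hUne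
  set Q : Set (EucSp N × ℝ) := Ω ×ˢ Ioo 0 T with hQ
  have hQo : IsOpen Q := D.isOpen.prod isOpen_Ioo
  set S : Set (EucSp N × ℝ → ℝ) := {w | ViscSub Ω T F h α f k w ∧ UpperSemicontinuousOn w Q ∧
    ∀ b ∈ Up, ∀ z ∈ Q, w z ≤ b z} with hS
  have hLoS : ∀ l ∈ Lo, l ∈ S := fun l hl =>
    ⟨(hLo l hl).2, (hLo l hl).1.upperSemicontinuousOn, fun b hb z hz => hle l hl b hb z hz⟩
  set U : EucSp N × ℝ → ℝ := fun z => sSup ((fun w : EucSp N × ℝ → ℝ => w z) '' S) with hU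
  have hne : ∀ z, ((fun w : EucSp N × ℝ → ℝ => w z) '' S).Nonempty := fun z =>
    ⟨_, l₀, hLoS l₀ hl₀, rfl⟩
  have hbdd : ∀ z ∈ Q, BddAbove ((fun w : EucSp N × ℝ → ℝ => w z) '' S) := fun z hz => by
    refine ⟨b₀ z, ?_⟩
    rintro _ ⟨w, hw, rfl⟩
    exact hw.2.2 b₀ hb₀ z hz
  have hwU : ∀ w ∈ S, ∀ z ∈ Q, w z ≤ U z := fun w hw z hz => le_csSup (hbdd z hz) ⟨w, hw, rfl⟩
  have hUb : ∀ b ∈ Up, ∀ z ∈ Q, U z ≤ b z := fun b hb z hz => by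
    refine csSup_le (hne z) ?_
    rintro _ ⟨w, hw, rfl⟩
    exact hw.2.2 b hb z hz
  obtain ⟨u, hUu, huc, huap⟩ := exists_usc_hull hQo (hUp b₀ hb₀).1 (hUb b₀ hb₀)
  have huS : ViscSub Ω T F h α f k u := by
    refine ViscSub.of_sup D (S := S) (fun w hw => ⟨hw.1, hw.2.1, fun z hz =>
      (hwU w hw z hz).trans (hUu z hz)⟩) fun z₀ hz₀ ε hε => ?_
    obtain ⟨z, hz, hzd, hzU⟩ := huap z₀ hz₀ ε hε
    obtain ⟨_, ⟨w, hw, rfl⟩, hw2⟩ := exists_lt_of_lt_csSup (hne z) hzU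
    exact ⟨w, hw, z, hz, hzd, hw2⟩
  have hub : ∀ b ∈ Up, ∀ z ∈ Q, u z ≤ b z := fun b hb z hz =>
    le_of_usc_of_approx hz (hUp b hb).1.upperSemicontinuousOn (hUb b hb) (huap z hz)
  have humem : u ∈ S := ⟨huS, huc, hub⟩
  have hmax : ∀ w ∈ S, ∀ z ∈ Q, w z ≤ u z := fun w hw z hz => (hwU w hw z hz).trans (hUu z hz)
  obtain ⟨v, huv, hvc, hvap⟩ := exists_usc_hull (g := fun z => -u z) hQo (hLo l₀ hl₀).1.neg
    (fun z hz => neg_le_neg (hmax l₀ (hLoS l₀ hl₀) z hz))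
  have hvl : ∀ l ∈ Lo, ∀ z ∈ Q, v z ≤ -l z := fun l hl z hz =>
    le_of_usc_of_approx (c := fun y => -l y) hz (hLo l hl).1.neg.upperSemicontinuousOn
      (fun y hy => neg_le_neg (hmax l (hLoS l hl) y hy)) (hvap z hz)
  -- the supersolution obtained as an infimum of the upper family
  set G : EucSp N × ℝ → ℝ := fun z => sSup ((fun b : EucSp N × ℝ → ℝ => -b z) '' Up) with hG
  have hGne : ∀ z, ((fun b : EucSp N × ℝ → ℝ => -b z) '' Up).Nonempty := fun z => ⟨_, b₀, hb₀, rfl⟩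
  have hGbdd : ∀ z ∈ Q, BddAbove ((fun b : EucSp N × ℝ → ℝ => -b z) '' Up) := fun z hz => by
    refine ⟨-u z, ?_⟩
    rintro _ ⟨b, hb, rfl⟩
    exact neg_le_neg (hub b hb z hz)
  have hbG : ∀ b ∈ Up, ∀ z ∈ Q, -b z ≤ G z := fun b hb z hz => le_csSup (hGbdd z hz) ⟨b, hb, rfl⟩
  have hGu : ∀ z ∈ Q, G z ≤ -u z := fun z hz => by
    refine csSup_le (hGne z) ?_
    rintro _ ⟨b, hb, rfl⟩
    exact neg_le_neg (hub b hb z hz)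
  obtain ⟨V, hGV, hVc, hVap⟩ := exists_usc_hull (g := G) hQo (hLo l₀ hl₀).1.neg
    (fun z hz => (hGu z hz).trans (neg_le_neg (hmax l₀ (hLoS l₀ hl₀) z hz)))
  have hVS : ViscSub Ω T (flipF F) h α (fun x t => -f x t) k V := by
    refine ViscSub.of_sup D.flip (S := (fun b z => -b z) '' Up) ?_ fun z₀ hz₀ ε hε => ?_
    · rintro _ ⟨b, hb, rfl⟩
      exact ⟨(hUp b hb).2, (hUp b hb).1.neg.upperSemicontinuousOn, fun z hz =>
        (hbG b hb z hz).trans (hGV z hz)⟩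
    · obtain ⟨z, hz, hzd, hzU⟩ := hVap z₀ hz₀ ε hε
      obtain ⟨_, ⟨b, hb, rfl⟩, hb2⟩ := exists_lt_of_lt_csSup (hGne z) hzU
      exact ⟨_, ⟨b, hb, rfl⟩, z, hz, hzd, hb2⟩
  have hVv : ∀ z ∈ Q, V z ≤ v z := fun z hz =>
    le_of_usc_of_approx hz hvc (fun y hy => (hGu y hy).trans (huv y hy)) (hVap z hz)
  -- no strict subsolution can touch `-v` from below where `V < v`
  have hno : ∀ z₀ ∈ Q, V z₀ < v z₀ → ∀ φ R : EucSp N × ℝ → ℝ, Continuous φ → Continuous R →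
      (∀ z, z ≠ z₀ → 0 < R z) → φ z₀ = -v z₀ → (∀ᶠ z in nhds z₀, φ z + R z ≤ -v z) →
      (∀ᶠ z in nhds z₀, HasSubJet F h α f φ z) → False := by
    intro z₀ hz₀ hlt φ R hφ hR hRpos hφ0 hφR hjet
    set e := (v z₀ - V z₀) / 4 with he
    have he0 : 0 < e := by have := sub_pos.2 hlt; positivity
    have hV1 : ∀ᶠ z in nhds z₀, V z < V z₀ + e := by
      have := hVc z₀ hz₀ (V z₀ + e) (by linarith)
      rwa [hQo.nhdsWithin_eq hz₀] at this
    have hφ1 : ∀ᶠ z in nhds z₀, φ z < φ z₀ + e :=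
      hφ.continuousAt.eventually (gt_mem_nhds (by linarith))
    obtain ⟨r, hr, hball⟩ := Metric.eventually_nhds_iff_ball.1 (hV1.and hφ1)
    have hle' : ∀ᶠ z in nhds z₀, φ z + R z ≤ u z := by
      filter_upwards [hφR, hQo.mem_nhds hz₀] with z h1 h2
      linarith [huv z h2]
    obtain ⟨W, δ, hδ, hWS, hWc, hWle, hWge⟩ := ViscSub.bump D huS huc hφ hR hRpos hle' hjet
      (ε := min r e) (by positivity)
    have hWmem : W ∈ S := by
      refine ⟨hWS, hWc, fun b hb z hz => ?_⟩
      rcases hWle z with h1 | ⟨h1, h2⟩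
      · rw [h1]; exact hub b hb z hz
      · have h3 := hball z (mem_ball.2 (h1.trans_le (min_le_left _ _)))
        have h4 := (hbG b hb z hz).trans (hGV z hz)
        have h5 := min_le_right r e
        linarith [h3.1, h3.2]
    have hφ2 : ∀ᶠ z in nhds z₀, φ z₀ - δ / 2 < φ z :=
      hφ.continuousAt.eventually (lt_mem_nhds (by linarith))
    obtain ⟨s, hs, hsb⟩ := Metric.eventually_nhds_iff_ball.1 (hWge.and hφ2)
    obtain ⟨z, hz, hzd, hzu⟩ := hvap z₀ hz₀ (min s (δ / 4)) (by positivity)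
    have h1 := hsb z (mem_ball.2 (hzd.trans_le (min_le_left _ _)))
    have h2 := hmax W hWmem z hz
    have h3 := min_le_right s (δ / 4)
    linarith [h1.1, h1.2]
  refine ⟨u, v, huS, ?_, huc, hvc, fun z hz => ⟨by linarith [huv z hz], fun l hl => by
    linarith [hvl l hl z hz], fun b hb => hub b hb z hz⟩⟩
  intro x hx t ht
  have hz : (x, t) ∈ Q := ⟨hx, ht⟩
  rcases (hVv _ hz).lt_or_eq with hlt | heq
  · constructor
    · intro p τ X C hp hX htest
      by_contra! hfail
      obtain ⟨φ, R, h1, h2, h3, h4, h5, h6⟩ := D.exists_strict_quad hx ht hp hX htest hfail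
      exact hno _ hz hlt φ R h1 h2 h3 h4 h5 h6
    · intro τ C htest
      by_contra! hfail
      obtain ⟨φ, R, h1, h2, h3, h4, h5, h6⟩ := D.exists_strict_flat hx ht htest hfail
      exact hno _ hz hlt φ R h1 h2 h3 h4 h5 h6
  · refine (hVS x hx t ht).of_le ?_ heq
    filter_upwards [hQo.mem_nhds hz] with z hz using hVv z hz

/-- `w` is a strict stationary subsolution at `x₁`, uniformly over drifts bounded by `Ch`. -/
def StatSubAt (F : EucSp N → EucSp N → MatN N → ℝ) (α Ch K : ℝ) (w : EucSp N → ℝ)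
    (x₁ : EucSp N) : Prop :=
  ∀ (p : EucSp N) (X : MatN N), X.IsSymm →
    (∀ᶠ x in nhds x₁, w x ≤ w x₁ + ⟪p, x - x₁⟫ + 1 / 2 * qf X (x - x₁)) →
    p ≠ 0 ∧ ∀ η : EucSp N, ‖η‖ ≤ Ch → K ≤ F x₁ p X + ⟪η, p⟫ * ‖p‖ ^ α

lemma StatSubAt.of_le {K : ℝ} {w w' : EucSp N → ℝ} {x₁ : EucSp N}
    (hw : StatSubAt F α Ch K w x₁) (hle : ∀ᶠ x in nhds x₁, w x ≤ w' x) (heq : w x₁ = w' x₁) :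
    StatSubAt F α Ch K w' x₁ := fun p X hX ht => by
  refine hw p X hX ?_
  filter_upwards [hle, ht] with x h1 h2
  rw [heq]; exact h1.trans h2

lemma StatSubAt.of_lower (D : EqData Ω T F h α f a A Ch Mf k) {K : ℝ} {w : EucSp N → ℝ}
    {x₁ p : EucSp N} {X : MatN N} (hx₁ : x₁ ∈ Ω) (hX : X.IsSymm)
    (hlow : ∀ᶠ x in nhds x₁, w x₁ + ⟪p, x - x₁⟫ + 1 / 2 * qf X (x - x₁) ≤ w x) (hp : p ≠ 0)
    (hK : ∀ η : EucSp N, ‖η‖ ≤ Ch → K ≤ F x₁ p X + ⟪η, p⟫ * ‖p‖ ^ α) :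
    StatSubAt F α Ch K w x₁ := fun q Y hY ht => by
  have hev : ∀ᶠ z : EucSp N × ℝ in nhds (x₁, (0:ℝ)), ⟪p, z.1 - x₁⟫ + 0 * (z.2 - 0)
      + 1 / 2 * qf X (z.1 - x₁) + 0 * (z.2 - 0) ^ 2 ≤
      ⟪q, z.1 - x₁⟫ + 0 * (z.2 - 0) + 1 / 2 * qf Y (z.1 - x₁) + 0 * (z.2 - 0) ^ 2 := by
    filter_upwards [(continuous_fst.tendsto (x₁, (0:ℝ))).eventually (hlow.and ht)] with z hz
    linarith [hz.1, hz.2]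
  obtain ⟨rfl, -, hXY⟩ := jet_compare hev
  refine ⟨hp, fun η hη => (hK η hη).trans ?_⟩
  have := D.F_mono hx₁ hp hX hY hXY
  linarith

lemma vecMulVec_isSymm (d : EucSp N) : (Matrix.vecMulVec (⇑d) (⇑d)).IsSymm := by
  rw [Matrix.IsSymm, Matrix.transpose_vecMulVec]

lemma qf_vecMulVec (d v : EucSp N) : qf (Matrix.vecMulVec (⇑d) (⇑d)) v = ⟪d, v⟫ ^ 2 := by
  have h1 := dotProduct_mulVec_eq_qf (Matrix.vecMulVec (⇑d) (⇑d)) (⇑v)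
  have h2 : WithLp.toLp 2 (⇑v) = v := rfl
  rw [h2] at h1
  rw [← h1, Matrix.vecMulVec_mulVec]
  simp only [PiLp.inner_apply, dotProduct, Pi.star_apply, star_trivial, Pi.smul_apply,
    MulOpposite.smul_eq_mul_unop, MulOpposite.unop_op, RCLike.inner_apply, conj_trivial, pow_two,
    Finset.sum_mul, Finset.mul_sum]
  rw [Finset.sum_comm]
  exact Finset.sum_congr rfl fun i _ => Finset.sum_congr rfl fun j _ => by ring

lemma trace_vecMulVec_self (d : EucSp N) : (Matrix.vecMulVec (⇑d) (⇑d)).trace = ‖d‖ ^ 2 := by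
  rw [Matrix.trace_vecMulVec, EuclideanSpace.norm_sq_eq]
  exact Finset.sum_congr rfl fun i _ => by rw [Real.norm_eq_abs, sq_abs, pow_two]

lemma EqData.le_F_rank_one (D : EqData Ω T F h α f a A Ch Mf k) {x p d : EucSp N} (hx : x ∈ Ω)
    (hp : p ≠ 0) {b c : ℝ} (hb : 0 ≤ b) (hc : 0 ≤ c) :
    (a * b * ‖d‖ ^ 2 - A * N * c) * ‖p‖ ^ α ≤
      F x p (-(c • 1) + b • Matrix.vecMulVec (⇑d) (⇑d)) := by
  have hs := (vecMulVec_isSymm d).smul b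
  have h1 := D.le_F hx hp (X := -(c • 1)) (isSymm_one.smul c).neg hc fun v => by
    rw [qf_neg_left, qf_smul_left, qf_one]
  have h2 := (D.ell.2.2 x hx p hp (-(c • 1)) (b • Matrix.vecMulVec (⇑d) (⇑d))
    (isSymm_one.smul c).neg hs (posSemidef_of_qf hs fun v => by
      rw [qf_smul_left, qf_vecMulVec]; positivity)).1
  rw [Matrix.trace_smul, trace_vecMulVec_self, smul_eq_mul] at h2
  nlinarith

lemma exp_quadratic_le {y : ℝ} (hy : |y| ≤ 1) : 1 + y + y ^ 2 / 4 ≤ Real.exp y := by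
  have h1 := Real.abs_exp_sub_one_sub_id_le hy
  have h2 := Real.exp_bound hy (n := 3) (by norm_num)
  norm_num [Finset.sum_range_succ, Nat.factorial] at h2
  have h3 := (abs_le.1 h2).1
  have h4 : |y| ^ 3 ≤ y ^ 2 := by
    rw [← sq_abs y]; nlinarith [sq_nonneg |y|, abs_nonneg y]
  nlinarith [sq_nonneg y]

/-- The Gaussian profile centred at `y`, equal to one on the sphere of radius `ρ`. -/
def gaussProfile (y : EucSp N) (ρ l : ℝ) (x : EucSp N) : ℝ :=
  Real.exp (-l * (‖x - y‖ ^ 2 / ρ ^ 2 - 1))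

lemma gaussProfile_pos (y : EucSp N) (ρ l : ℝ) (x : EucSp N) : 0 < gaussProfile y ρ l x :=
  Real.exp_pos _

lemma continuous_gaussProfile (y : EucSp N) (ρ l : ℝ) : Continuous (gaussProfile y ρ l) := by
  unfold gaussProfile; fun_prop

lemma gaussProfile_lower {y x₁ : EucSp N} {ρ l : ℝ} (hρ : 0 < ρ) (hl : 0 < l) :
    ∀ᶠ x in nhds x₁, gaussProfile y ρ l x₁ * (1 - 2 * (l / ρ ^ 2) * ⟪x₁ - y, x - x₁⟫
      - 2 * (l / ρ ^ 2) * ‖x - x₁‖ ^ 2 + (l / ρ ^ 2) ^ 2 / 2 * ⟪x₁ - y, x - x₁⟫ ^ 2) ≤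
      gaussProfile y ρ l x := by
  set m := l / ρ ^ 2 with hm
  have hm0 : 0 < m := by positivity
  set Y : EucSp N → ℝ := fun x => -m * (2 * ⟪x₁ - y, x - x₁⟫ + ‖x - x₁‖ ^ 2) with hY
  have hYc : Continuous Y := by simp only [hY]; fun_prop
  have h1 : ∀ᶠ x in nhds x₁, |Y x| < 1 :=
    hYc.abs.continuousAt.eventually (gt_mem_nhds (by simp [hY]))
  have h2 : ∀ᶠ x in nhds x₁, ‖x - x₁‖ ^ 2 < 4 / m :=
    (show Continuous fun x : EucSp N => ‖x - x₁‖ ^ 2 by fun_prop).continuousAt.eventually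
      (gt_mem_nhds (by simpa using by positivity))
  filter_upwards [h1, h2] with x hx1 hx2
  have he : gaussProfile y ρ l x = gaussProfile y ρ l x₁ * Real.exp (Y x) := by
    unfold gaussProfile
    rw [← Real.exp_add]
    congr 1
    have e1 : x - y = (x₁ - y) + (x - x₁) := by abel
    have e2 : ‖x - y‖ ^ 2 = ‖x₁ - y‖ ^ 2 + 2 * ⟪x₁ - y, x - x₁⟫ + ‖x - x₁‖ ^ 2 := by
      rw [e1, norm_add_sq_real]
    rw [e2, hY, hm]; field_simp; ring
  rw [he]
  refine mul_le_mul_of_nonneg_left ?_ (gaussProfile_pos _ _ _ _).le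
  refine le_trans ?_ (exp_quadratic_le hx1.le)
  have h3 : m * ‖x - x₁‖ ^ 2 ≤ 4 := by
    rw [lt_div_iff₀ hm0] at hx2; linarith
  have h4 : m ^ 2 * (‖x - x₁‖ ^ 2) ^ 2 ≤ 4 * (m * ‖x - x₁‖ ^ 2) := by
    nlinarith [mul_nonneg hm0.le (sq_nonneg ‖x - x₁‖)]
  simp only [hY]
  set b := ⟪x₁ - y, x - x₁⟫
  set s := ‖x - x₁‖ ^ 2
  nlinarith [sq_nonneg (m * (2 * b + 2 * s))]

/-- Outside the ball, the Gaussian profile is a strict stationary subsolution. -/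
lemma EqData.statSubAt_gaussProfile (D : EqData Ω T F h α f a A Ch Mf k) {y x₁ : EucSp N}
    {ρ l c K b : ℝ} (hx₁ : x₁ ∈ Ω) (hρ : 0 < ρ) (hl : 0 < l) (hc : 0 < c)
    (hal : 4 * A * N + 2 ≤ a * l) (hCh : 2 * Ch * ρ ≤ 1) (hy : ρ ≤ ‖x₁ - y‖)
    (hK : K * (2 * ‖x₁ - y‖) ≤
      (2 * c * gaussProfile y ρ l x₁ * (l / ρ ^ 2) * ‖x₁ - y‖) ^ (1 + α)) :
    StatSubAt F α Ch K (fun x => b + c * gaussProfile y ρ l x) x₁ := by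
  set m := l / ρ ^ 2 with hm
  have hm0 : 0 < m := by positivity
  set E := gaussProfile y ρ l x₁ with hE
  have hE0 : 0 < E := gaussProfile_pos _ _ _ _
  set d := x₁ - y with hd
  have hdn : 0 < ‖d‖ := hρ.trans_le hy
  have hd0 : d ≠ 0 := norm_pos_iff.1 hdn
  set p : EucSp N := (-(2 * c * E * m)) • d with hp
  have hp0 : p ≠ 0 := smul_ne_zero (neg_ne_zero.2 (by positivity)) hd0
  have hpn : ‖p‖ = 2 * c * E * m * ‖d‖ := by
    rw [hp, norm_smul, norm_neg, Real.norm_of_nonneg (by positivity)]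
  have hXs : (-((4 * c * E * m) • (1 : MatN N))
      + (c * E * m ^ 2) • Matrix.vecMulVec (⇑d) (⇑d)).IsSymm :=
    (isSymm_one.smul _).neg.add ((vecMulVec_isSymm d).smul _)
  refine StatSubAt.of_lower D (p := p) hx₁ hXs ?_ hp0 fun η hη => ?_
  · filter_upwards [gaussProfile_lower (y := y) (x₁ := x₁) hρ hl] with x hx
    have := mul_le_mul_of_nonneg_left hx hc.le
    simp only [qf_add_left, qf_neg_left, qf_smul_left, qf_one, qf_vecMulVec, hp,
      real_inner_smul_left]
    simp only [← hE, ← hd, ← hm] at this ⊢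
    nlinarith
  · have hF := D.le_F_rank_one (d := d) hx₁ hp0 (b := c * E * m ^ 2) (c := 4 * c * E * m)
      (by positivity) (by positivity)
    have hη1 : -(Ch * ‖p‖) ≤ ⟪η, p⟫ := by
      have h1 := (abs_le.1 (abs_real_inner_le_norm η p)).1
      have h2 := mul_le_mul_of_nonneg_right hη (norm_nonneg p)
      linarith
    have hpα : 0 < ‖p‖ ^ α := Real.rpow_pos_of_pos (norm_pos_iff.2 hp0) _
    have hη2 := mul_le_mul_of_nonneg_right hη1 hpα.le
    have hmain : 1 ≤ a * m * ‖d‖ ^ 2 - 4 * A * N - 2 * Ch * ‖d‖ := by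
      have hA0 : 0 ≤ A * N := by have := D.A_pos; positivity
      obtain ⟨t, ht, ht1⟩ : ∃ t, ‖d‖ = ρ * t ∧ 1 ≤ t :=
        ⟨‖d‖ / ρ, by field_simp, by rwa [le_div_iff₀ hρ, one_mul]⟩
      have e1 : a * m * ‖d‖ ^ 2 = a * l * t ^ 2 := by rw [hm, ht]; field_simp
      have e2 : 2 * Ch * ‖d‖ = 2 * Ch * ρ * t := by rw [ht]; ring
      rw [e1, e2]
      have h1 := mul_le_mul_of_nonneg_right hal (sq_nonneg t)
      have h2 := mul_le_mul_of_nonneg_right hCh (by linarith : 0 ≤ t)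
      have h3 : t ≤ t ^ 2 := by nlinarith
      have h4 := mul_le_mul_of_nonneg_left (ht1.trans h3) hA0
      linarith
    have hval : K ≤ c * E * m * ‖p‖ ^ α := by
      rw [← hpn, Real.rpow_add (norm_pos_iff.2 hp0), Real.rpow_one] at hK
      have : K * (2 * ‖d‖) ≤ (c * E * m * ‖p‖ ^ α) * (2 * ‖d‖) := by
        refine hK.trans (le_of_eq ?_)
        rw [hpn]; ring
      exact le_of_mul_le_mul_right this (by positivity)
    have h5 := mul_le_mul_of_nonneg_left hmain (show 0 ≤ c * E * m * ‖p‖ ^ α by positivity)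
    rw [hpn] at hη2
    rw [← hpn] at hη2
    have e3 : -(Ch * ‖p‖) * ‖p‖ ^ α = -(c * E * m * ‖p‖ ^ α) * (2 * Ch * ‖d‖) := by
      nth_rewrite 1 [hpn]; ring
    rw [e3] at hη2
    linarith

/-- An exterior cone contains balls of comparable size near its vertex. -/
lemma UnifExtCone.exists_balls (hΩ : UnifExtCone Ω) : ∃ κ : ℝ, 0 < κ ∧ κ ≤ 1 / 2 ∧
    ∃ R : ℝ, 0 < R ∧ ∀ z ∈ frontier Ω, ∃ n : EucSp N, ‖n‖ = 1 ∧ ∀ r, 0 < r → r < R →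
      ∀ x ∈ closure Ω, κ * r ≤ ‖x - (z - r • n)‖ := by
  obtain ⟨φ₀, hφ, R, hR, hz⟩ := hΩ
  have hc1 : -1 < Real.cos φ₀ := by
    rw [← Real.cos_pi]
    exact Real.cos_lt_cos_of_nonneg_of_le_pi hφ.1.le le_rfl hφ.2
  have hc2 := Real.cos_le_one φ₀
  set c := Real.cos φ₀
  refine ⟨(1 + c) / 4, by linarith, by linarith, R / 2, by linarith, fun z hzf => ?_⟩
  obtain ⟨n, hn, hcone⟩ := hz z hzf
  refine ⟨n, hn, fun r hr hrR x hx => ?_⟩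
  have e : x - (z - r • n) = (x - z) + r • n := by abel
  rw [e]
  have hrn : ‖r • n‖ = r := by rw [norm_smul, hn, mul_one, Real.norm_of_nonneg hr.le]
  by_cases hxR : ‖x - z‖ < R
  · have hin : c * ‖x - z‖ ≤ ⟪x - z, n⟫ := by
      by_contra hlt
      have : x ∈ ({z} : Set (EucSp N)) := by
        rw [← hcone]
        exact ⟨⟨(not_le.1 hlt).le, hx⟩, by rwa [Metric.mem_ball, dist_eq_norm]⟩
      rw [Set.mem_singleton_iff] at this
      simp [this] at hlt
    refine le_of_sq_le_sq ?_ (norm_nonneg _)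
    rw [norm_add_sq_real, hrn, real_inner_smul_right]
    have hs := norm_nonneg (x - z)
    set s := ‖x - z‖
    have h1 : 2 * (r * (c * s)) ≤ 2 * (r * ⟪x - z, n⟫) := by gcongr
    have hk : ((1 + c) / 4 * r) ^ 2 = ((1 + c) / 4) ^ 2 * r ^ 2 := by ring
    rw [hk]
    have hr2 : 0 < r ^ 2 := by positivity
    rcases le_total (r / 2) s with h2 | h2
    · have h3 : 0 ≤ (1 + c) * r * (s - r / 2) :=
        mul_nonneg (mul_nonneg (by linarith) hr.le) (by linarith)
      have h4 : ((1 + c) / 4) ^ 2 ≤ (1 + c) := by nlinarith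
      have h5 := mul_le_mul_of_nonneg_right h4 hr2.le
      nlinarith [sq_nonneg (s - r)]
    · have h3 : 0 ≤ (1 + c) * r * s := mul_nonneg (mul_nonneg (by linarith) hr.le) hs
      have h4 : ((1 + c) / 4) ^ 2 ≤ 1 / 4 := by nlinarith
      have h5 := mul_le_mul_of_nonneg_right h4 hr2.le
      nlinarith
  · have h1 : ‖x - z‖ ≤ ‖(x - z) + r • n‖ + ‖r • n‖ := by
      simpa using norm_sub_le ((x - z) + r • n) (r • n)
    rw [hrn] at h1
    nlinarith

lemma gaussProfile_le_exp {y x : EucSp N} {ρ l β : ℝ} (hρ : 0 < ρ) (hl : 0 < l) (hβ : 0 ≤ β)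
    (hx : β ≤ ‖x - y‖) : gaussProfile y ρ l x ≤ Real.exp (-l * (β ^ 2 / ρ ^ 2 - 1)) := by
  unfold gaussProfile
  rw [Real.exp_le_exp, neg_mul, neg_mul, neg_le_neg_iff]
  gcongr

lemma exp_le_gaussProfile {y x : EucSp N} {ρ l β : ℝ} (hρ : 0 < ρ) (hl : 0 < l)
    (hx : ‖x - y‖ ≤ β) : Real.exp (-l * (β ^ 2 / ρ ^ 2 - 1)) ≤ gaussProfile y ρ l x := by
  unfold gaussProfile
  rw [Real.exp_le_exp, neg_mul, neg_mul, neg_le_neg_iff]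
  gcongr

lemma EqData.statSubAt_ball (D : EqData Ω T F h α f a A Ch Mf k) {x₁ y : EucSp N}
    {ρ l c K q d : ℝ} (hx₁ : x₁ ∈ Ω) (hρ : 0 < ρ) (hl : 0 < l) (hc : 0 < c) (hK : 0 ≤ K)
    (hal : 4 * A * N + 2 ≤ a * l) (hCh : 2 * Ch * ρ ≤ 1) (hy : ρ ≤ ‖x₁ - y‖)
    (hd : ‖x₁ - y‖ ≤ d) (hq : 0 ≤ q) (hKq : K * (2 * d) ≤ q ^ (1 + α))
    (hqc : q * ρ ≤ 2 * c * Real.exp (-l * (d ^ 2 / ρ ^ 2 - 1)) * l) :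
    StatSubAt F α Ch K (fun x => -(c * (1 - gaussProfile y ρ l x))) x₁ := by
  have h1 : StatSubAt F α Ch K (fun x => -c + c * gaussProfile y ρ l x) x₁ := by
    refine D.statSubAt_gaussProfile hx₁ hρ hl hc hal hCh hy ?_
    have h2 : q ≤ 2 * c * gaussProfile y ρ l x₁ * (l / ρ ^ 2) * ‖x₁ - y‖ := by
      have h3 := exp_le_gaussProfile (y := y) (x := x₁) hρ hl hd
      have hE := gaussProfile_pos y ρ l x₁
      calc q = (q * ρ) / ρ := by field_simp
        _ ≤ (2 * c * Real.exp (-l * (d ^ 2 / ρ ^ 2 - 1)) * l) / ρ := by gcongr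
        _ ≤ (2 * c * gaussProfile y ρ l x₁ * l) / ρ := by gcongr
        _ = 2 * c * gaussProfile y ρ l x₁ * (l / ρ ^ 2) * ρ := by field_simp
        _ ≤ _ := by gcongr
    calc K * (2 * ‖x₁ - y‖) ≤ K * (2 * d) := by gcongr
      _ ≤ q ^ (1 + α) := hKq
      _ ≤ _ := Real.rpow_le_rpow hq h2 (by linarith [D.alpha])
  have e : (fun x => -(c * (1 - gaussProfile y ρ l x))) =
      fun x => -c + c * gaussProfile y ρ l x := by funext x; ring
  rwa [e]

/-- Lateral barriers at a boundary point touched from outside by balls of comparable size at every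
small scale. They are arbitrarily large away from the point and arbitrarily small close to it. -/
structure IsLateralBarrier (Ω : Set (EucSp N)) (F : EucSp N → EucSp N → MatN N → ℝ)
    (α Ch K M ρ₀ : ℝ) (z : EucSp N) (W : EucSp N → ℝ) : Prop where
  cont : ContinuousOn W (closure Ω)
  nonneg : ∀ x ∈ closure Ω, 0 ≤ W x
  large : ∀ x ∈ closure Ω, ρ₀ ≤ ‖x - z‖ → M ≤ W x
  statSub : ∀ x ∈ Ω, StatSubAt F α Ch K (fun x => -W x) x

/-- Gluing a small bump into a lateral barrier close to the boundary point. -/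
lemma IsLateralBarrier.glue {K M ρ₀ R r : ℝ} {z : EucSp N} {W V : EucSp N → ℝ}
    (hW : IsLateralBarrier Ω F α Ch K M ρ₀ z W) (hV : Continuous V)
    (hV0 : ∀ x ∈ closure Ω, 0 ≤ V x) (hr₀ : r ≤ ρ₀) (hrR : r < R)
    (hVW : ∀ x ∈ closure Ω, r ≤ ‖x - z‖ → ‖x - z‖ < R → W x ≤ V x)
    (hVs : ∀ x ∈ Ω, ‖x - z‖ < r → StatSubAt F α Ch K (fun x => -V x) x) :
    IsLateralBarrier Ω F α Ch K M ρ₀ z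
      (fun x => if ‖x - z‖ < r then min (W x) (V x) else W x) := by
  set W' : EucSp N → ℝ := fun x => if ‖x - z‖ < r then min (W x) (V x) else W x with hW'
  have hle : ∀ x, W' x ≤ W x := fun x => by
    simp only [hW']; split_ifs
    · exact min_le_left _ _
    · exact le_rfl
  refine ⟨fun x hx => ?_, fun x hx => ?_, fun x hx hxz => ?_, fun x hx => ?_⟩
  · rcases lt_or_ge ‖x - z‖ R with h1 | h1
    · have hc : ContinuousWithinAt (fun x => min (W x) (V x)) (closure Ω) x :=
        (hW.cont x hx).min hV.continuousWithinAt
      have hev : ∀ᶠ w in nhdsWithin x (closure Ω), W' w = min (W w) (V w) := by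
        have hn : ∀ᶠ w in nhds x, ‖w - z‖ < R :=
          (show Continuous fun w : EucSp N => ‖w - z‖ by fun_prop).continuousAt.eventually
            (gt_mem_nhds h1)
        filter_upwards [self_mem_nhdsWithin, nhdsWithin_le_nhds hn] with w hw hwR
        simp only [hW']; split_ifs with hwr
        · rfl
        · exact (min_eq_left (hVW w hw (not_lt.1 hwr) hwR)).symm
      exact hc.congr_of_eventuallyEq hev (hev.self_of_nhdsWithin hx)
    · have hn : ∀ᶠ w in nhds x, r < ‖w - z‖ :=
        (show Continuous fun w : EucSp N => ‖w - z‖ by fun_prop).continuousAt.eventually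
          (lt_mem_nhds (hrR.trans_le h1))
      have hev : ∀ᶠ w in nhdsWithin x (closure Ω), W' w = W w := by
        filter_upwards [nhdsWithin_le_nhds hn] with w hw
        simp only [hW', if_neg (not_lt.2 hw.le)]
      exact (hW.cont x hx).congr_of_eventuallyEq hev (hev.self_of_nhdsWithin hx)
  · simp only [hW']; split_ifs
    · exact le_min (hW.nonneg x hx) (hV0 x hx)
    · exact hW.nonneg x hx
  · simp only [hW', if_neg (not_lt.2 (hr₀.trans hxz))]
    exact hW.large x hx hxz
  · by_cases he : W' x = W x
    · exact (hW.statSub x hx).of_le (Eventually.of_forall fun w => neg_le_neg (hle w)) (by rw [he])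
    · have hxr : ‖x - z‖ < r := by
        by_contra hcon
        exact he (by simp only [hW', if_neg hcon])
      have hev : ∀ᶠ w in nhds x, ‖w - z‖ < r :=
        (show Continuous fun w : EucSp N => ‖w - z‖ by fun_prop).continuousAt.eventually
          (gt_mem_nhds hxr)
      refine (hVs x hx hxr).of_le ?_ ?_
      · filter_upwards [hev] with w hw
        simp only [hW', if_pos hw]
        exact neg_le_neg (min_le_right _ _)
      · have h1 : W' x = min (W x) (V x) := by simp only [hW', if_pos hxr]
        rcases min_choice (W x) (V x) with h2 | h2
        · exact absurd (h1.trans h2) he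
        · rw [h1, h2]

lemma EqData.exists_barrier (D : EqData Ω T F h α f a A Ch Mf k)
    (hΩb : Bornology.IsBounded Ω) {κ R₀ : ℝ} (hκ : 0 < κ) (hκ2 : κ ≤ 1 / 2) (hR₀ : 0 < R₀)
    {z n : EucSp N} (hn : ‖n‖ = 1)
    (hball : ∀ r, 0 < r → r < R₀ → ∀ x ∈ closure Ω, κ * r ≤ ‖x - (z - r • n)‖)
    {K M ρ₀ ε : ℝ} (hCh : 0 ≤ Ch) (hK : 0 ≤ K) (hρ₀ : 0 < ρ₀) (hε : 0 < ε) :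
    ∃ W, IsLateralBarrier Ω F α Ch K M ρ₀ z W ∧
      ∃ R > 0, ∀ x ∈ closure Ω, ‖x - z‖ ≤ R → W x ≤ ε := by
  have ha := D.ell.1
  have hA := D.A_pos
  have hα := D.alpha
  obtain ⟨l, hl, hal⟩ : ∃ l, 0 < l ∧ 4 * A * N + 2 ≤ a * l :=
    ⟨(4 * A * N + 2) / a, by positivity, by field_simp; rfl⟩
  set G : ℝ → EucSp N → ℝ := fun r => gaussProfile (z - r • n) (κ * r) l with hG
  set e : ℝ → ℝ := fun β => Real.exp (-l * (β ^ 2 / κ ^ 2 - 1)) with he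
  have hscale : ∀ r, 0 < r → ∀ β, Real.exp (-l * ((β * r) ^ 2 / (κ * r) ^ 2 - 1)) = e β :=
    fun r hr β => by simp only [he]; congr 3; field_simp
  have hrn : ∀ r, 0 < r → ‖r • n‖ = r := fun r hr => by
    rw [norm_smul, hn, mul_one, Real.norm_of_nonneg hr.le]
  have hup : ∀ r, 0 < r → ∀ x, ‖x - (z - r • n)‖ ≤ ‖x - z‖ + r := fun r hr x => by
    have := norm_add_le (x - z) (r • n)
    rwa [hrn r hr, show x - z + r • n = x - (z - r • n) by abel] at this
  have hdn : ∀ r, 0 < r → ∀ x, ‖x - z‖ - r ≤ ‖x - (z - r • n)‖ := fun r hr x => by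
    have := norm_sub_le (x - (z - r • n)) (r • n)
    rw [hrn r hr, show x - (z - r • n) - r • n = x - z by abel] at this
    linarith
  have hG1 : ∀ r, 0 < r → r < R₀ → ∀ x ∈ closure Ω, G r x ≤ 1 := fun r hr hrR x hx => by
    have := gaussProfile_le_exp (l := l) (mul_pos hκ hr) hl (mul_pos hκ hr).le (hball r hr hrR x hx)
    rwa [div_self (by positivity), sub_self, mul_zero, Real.exp_zero] at this
  have hGin : ∀ r, 0 < r → ∀ x, ‖x - z‖ ≤ r → e 2 ≤ G r x := fun r hr x hx => by
    rw [← hscale r hr]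
    exact exp_le_gaussProfile (mul_pos hκ hr) hl ((hup r hr x).trans (by linarith))
  have hGout : ∀ r, 0 < r → ∀ x, 4 * r ≤ ‖x - z‖ → G r x ≤ e 3 := fun r hr x hx => by
    rw [← hscale r hr]
    exact gaussProfile_le_exp (mul_pos hκ hr) hl (by positivity)
      (le_trans (by linarith) (hdn r hr x))
  have h32 : e 3 < e 2 := by
    simp only [he]
    rw [Real.exp_lt_exp, neg_mul, neg_mul, neg_lt_neg_iff]
    gcongr; norm_num
  have h21 : e 2 < 1 := by
    simp only [he]
    rw [Real.exp_lt_one_iff]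
    have : 1 < 2 ^ 2 / κ ^ 2 := by rw [one_lt_div (by positivity)]; nlinarith
    nlinarith
  set θ := (1 - e 2) / (1 - e 3) with hθ
  have hθ0 : 0 < θ := div_pos (by linarith) (by linarith)
  have hθ1 : θ < 1 := by rw [hθ, div_lt_one (by linarith)]; linarith
  obtain ⟨δ, hδ, hδCh⟩ : ∃ δ > 0, ∀ r, 0 < r → r ≤ δ → 2 * Ch * (κ * r) ≤ 1 ∧
      K * (2 * (5 * r)) ≤ 1 := by
    refine ⟨1 / (2 * Ch * κ + 10 * K + 1), by positivity, fun r hr hrδ => ?_⟩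
    rw [le_div_iff₀ (by positivity)] at hrδ
    have h1 : 0 ≤ Ch * (κ * r) := by positivity
    have h2 : 0 ≤ K * r := by positivity
    constructor <;> nlinarith
  have key : ∃ Λ, 0 < Λ ∧ ∀ j : ℕ, ∃ W, IsLateralBarrier Ω F α Ch K M ρ₀ z W ∧
      ∃ R > 0, ∀ x ∈ closure Ω, ‖x - z‖ ≤ R → W x ≤ Λ * θ ^ j := by
    obtain ⟨r, hr, hrρ, hrR, hrδ⟩ : ∃ r > 0, r ≤ ρ₀ / 4 ∧ r ≤ R₀ / 2 ∧ r ≤ δ :=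
      ⟨min (ρ₀ / 4) (min (R₀ / 2) δ), by positivity, min_le_left _ _,
        (min_le_right _ _).trans (min_le_left _ _), (min_le_right _ _).trans (min_le_right _ _)⟩
    obtain ⟨d, hd0, hd⟩ : ∃ d, 0 < d ∧ ∀ x ∈ Ω, ‖x - (z - r • n)‖ ≤ d := by
      obtain ⟨B, hB⟩ := hΩb.exists_norm_le
      refine ⟨|B| + ‖z - r • n‖ + 1, by positivity, fun x hx => ?_⟩
      have h1 := norm_sub_le x (z - r • n)
      have h2 := (hB x hx).trans (le_abs_self B)
      linarith
    set E := Real.exp (-l * (d ^ 2 / (κ * r) ^ 2 - 1)) with hE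
    have hE0 : 0 < E := Real.exp_pos _
    set q : ℝ := (K * (2 * d)) ^ (1 / (1 + α)) with hq
    have hq0 : 0 ≤ q := Real.rpow_nonneg (by positivity) _
    have hqp : q ^ (1 + α) = K * (2 * d) := by
      rw [hq, ← Real.rpow_mul (by positivity), one_div_mul_cancel (by linarith), Real.rpow_one]
    have h3 : 0 < 1 - e 3 := by linarith
    set Λ := |M| / (1 - e 3) + q * (κ * r) / (2 * E * l) + 1 with hΛ
    have hΛ0 : 0 < Λ := by positivity
    refine ⟨Λ, hΛ0, fun j => ?_⟩
    induction j with
    | zero =>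
      refine ⟨fun x => Λ * (1 - G r x), ⟨?_, fun x hx => ?_, fun x hx hxz => ?_, fun x hx => ?_⟩,
        1, one_pos, fun x hx _ => ?_⟩
      · exact (continuous_const.mul
          (continuous_const.sub (continuous_gaussProfile _ _ _))).continuousOn
      · have := hG1 r hr (by linarith) x hx
        exact mul_nonneg hΛ0.le (by linarith)
      · have h1 := hGout r hr x (by linarith)
        have h4 : |M| ≤ Λ * (1 - e 3) := by
          rw [← div_le_iff₀ h3, hΛ]
          have : 0 ≤ q * (κ * r) / (2 * E * l) := by positivity
          linarith
        calc M ≤ Λ * (1 - e 3) := (le_abs_self M).trans h4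
          _ ≤ _ := by gcongr
      · refine D.statSubAt_ball hx (mul_pos hκ hr) hl hΛ0 hK hal (hδCh r hr hrδ).1
          (hball r hr (by linarith) x (subset_closure hx)) (hd x hx) hq0 hqp.ge ?_
        rw [← hE]
        have h4 : q * (κ * r) / (2 * E * l) ≤ Λ := by
          have : 0 ≤ |M| / (1 - e 3) := by positivity
          linarith
        rw [div_le_iff₀ (by positivity)] at h4
        linarith
      · have := gaussProfile_pos (z - r • n) (κ * r) l x
        rw [pow_zero]
        refine mul_le_mul_of_nonneg_left ?_ hΛ0.le
        simp only [hG]; linarith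
    | succ j ih =>
      obtain ⟨W, hW, R, hR, hWR⟩ := ih
      set c := Λ * θ ^ j / (1 - e 3) with hc
      have hc0 : 0 < c := by positivity
      have hce : c * (1 - e 3) = Λ * θ ^ j := by rw [hc]; field_simp
      have he5 : 0 < e 5 := Real.exp_pos _
      obtain ⟨s, hs, hsρ, hsR₀, hsδ, hsR, hsc⟩ : ∃ s > 0, s ≤ ρ₀ / 4 ∧ s ≤ R₀ / 2 ∧ s ≤ δ ∧
          s ≤ R / 8 ∧ s ≤ 2 * c * e 5 * l / κ :=
        ⟨min (ρ₀ / 4) (min (R₀ / 2) (min δ (min (R / 8) (2 * c * e 5 * l / κ)))), by positivity,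
          by simp, by simp, by simp, by simp, by simp⟩
      refine ⟨_, hW.glue (V := fun x => c * (1 - G s x)) (r := 4 * s) (R := R)
        (continuous_const.mul (continuous_const.sub (continuous_gaussProfile _ _ _)))
        (fun x hx => ?_) (by linarith) (by linarith) (fun x hx hx1 hx2 => ?_)
        (fun x hx hxs => ?_), s, hs, fun x hx hxs => ?_⟩
      · have := hG1 s hs (by linarith) x hx
        exact mul_nonneg hc0.le (by linarith)
      · refine (hWR x hx hx2.le).trans ?_
        rw [← hce]
        have := hGout s hs x hx1
        gcongr
      · refine D.statSubAt_ball (q := 1) (d := 5 * s) hx (mul_pos hκ hs) hl hc0 hK hal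
          (hδCh s hs hsδ).1 (hball s hs (by linarith) x (subset_closure hx))
          ((hup s hs x).trans (by linarith)) zero_le_one ?_ ?_
        · rw [Real.one_rpow]; exact (hδCh s hs hsδ).2
        · rw [hscale s hs]
          rw [le_div_iff₀ hκ] at hsc
          linarith
      · have h4 : ‖x - z‖ < 4 * s := by linarith
        simp only [if_pos h4]
        refine (min_le_right _ _).trans ?_
        have h5 : c * (1 - e 2) = Λ * θ ^ (j + 1) := by
          rw [pow_succ, ← mul_assoc, ← hce, hθ]; field_simp
        rw [← h5]
        have := hGin s hs x hxs
        gcongr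
  obtain ⟨Λ, hΛ, hj⟩ := key
  obtain ⟨j, hj'⟩ := ((tendsto_pow_atTop_nhds_zero_of_lt_one hθ0.le hθ1).const_mul Λ).eventually
    (gt_mem_nhds (by simpa using hε : Λ * 0 < ε)) |>.exists
  obtain ⟨W, hW, R, hR, hWR⟩ := hj j
  exact ⟨W, hW, R, hR, fun x hx hxR => (hWR x hx hxR).trans hj'.le⟩

lemma le_of_local_slope {g : ℝ → ℝ} {t₁ L τ C : ℝ}
    (hg : ∀ t, g t₁ - L * |t - t₁| ≤ g t)
    (ht : ∀ᶠ t in nhds t₁, g t ≤ g t₁ + τ * (t - t₁) + C * (t - t₁) ^ 2) : τ ≤ L := by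
  have h1 : ∀ᶠ r in nhdsWithin (0:ℝ) (Ioi 0), τ ≤ L + C * r := by
    have hc : Tendsto (fun r : ℝ => t₁ - r) (nhdsWithin 0 (Ioi 0)) (nhds t₁) := by
      have : Continuous fun r : ℝ => t₁ - r := by fun_prop
      simpa using (this.tendsto 0).mono_left nhdsWithin_le_nhds
    filter_upwards [hc.eventually ht, self_mem_nhdsWithin] with r hr hr0
    have hr0 : 0 < r := hr0
    have h2 := (hg (t₁ - r)).trans hr
    rw [show t₁ - r - t₁ = -r by ring, abs_neg, abs_of_pos hr0] at h2
    have h3 : τ * r ≤ (L + C * r) * r := by linarith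
    exact le_of_mul_le_mul_right h3 hr0
  have h2 : Tendsto (fun r : ℝ => L + C * r) (nhdsWithin 0 (Ioi 0)) (nhds L) := by
    have : Continuous fun r : ℝ => L + C * r := by fun_prop
    simpa using (this.tendsto 0).mono_left nhdsWithin_le_nhds
  exact ge_of_tendsto h2 h1

lemma IsLateralBarrier.viscSub (D : EqData Ω T F h α f a A Ch Mf k) {K M ρ₀ : ℝ} {z : EucSp N}
    {W : EucSp N → ℝ} (hW : IsLateralBarrier Ω F α Ch K M ρ₀ z W) {L : ℝ}
    (hK : L + Mf ≤ K) (hL : 0 ≤ L) (c s : ℝ) :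
    ViscSub Ω T F h α f k (fun p => c - L * |p.2 - s| - W p.1) := by
  intro x₁ hx₁ t₁ ht₁
  have hx : Tendsto (fun x : EucSp N => (x, t₁)) (nhds x₁) (nhds (x₁, t₁)) :=
    (show Continuous fun x : EucSp N => (x, t₁) by fun_prop).tendsto x₁
  have ht : Tendsto (fun t : ℝ => (x₁, t)) (nhds t₁) (nhds (x₁, t₁)) :=
    (show Continuous fun t : ℝ => (x₁, t) by fun_prop).tendsto t₁
  constructor
  · intro p τ X C hp hX hev
    have h1 := (hW.statSub x₁ hx₁ p X hX (by
      filter_upwards [hx.eventually hev] with x hx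
      simp only [sub_self] at hx
      linarith)).2 (h x₁ t₁) (D.h_bdd x₁ hx₁ t₁ ht₁)
    have h2 : τ ≤ L := by
      refine le_of_local_slope (g := fun t => c - L * |t - s| - W x₁) (C := C) (t₁ := t₁)
        (fun t => ?_) ?_
      · have := mul_le_mul_of_nonneg_left (abs_sub_le t t₁ s) hL
        linarith
      · filter_upwards [ht.eventually hev] with t ht
        simpa [sub_self, qf_zero] using ht
    have h3 := (abs_le.1 (D.f_bdd x₁ hx₁ t₁ ht₁)).1
    rw [gradTerm]
    linarith
  · intro τ C hev
    exfalso
    refine (hW.statSub x₁ hx₁ 0 ((2 * |C|) • 1) (isSymm_one.smul _) ?_).1 rfl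
    have hnear : ∀ᶠ x in nhds x₁, ‖x - x₁‖ < 1 :=
      (show Continuous fun x : EucSp N => ‖x - x₁‖ by fun_prop).continuousAt.eventually
        (gt_mem_nhds (by simp))
    filter_upwards [hx.eventually hev, hnear] with x hx1 hx2
    simp only [sub_self] at hx1
    rw [qf_smul_left, qf_one, inner_zero_left]
    have h1 : ‖x - x₁‖ ^ (2 * k) ≤ ‖x - x₁‖ ^ 2 :=
      pow_le_pow_of_le_one (norm_nonneg _) hx2.le (by have := D.two_le; omega)
    have h2 : C * ‖x - x₁‖ ^ (2 * k) ≤ |C| * ‖x - x₁‖ ^ (2 * k) := by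
      gcongr; exact le_abs_self C
    have h3 := mul_le_mul_of_nonneg_left h1 (abs_nonneg C)
    linarith

lemma powErr_mono (hA : 0 ≤ A) (hCh : 0 ≤ Ch) (hk : 1 < (2 * k - 1) * (1 + α)) {M r d : ℝ}
    (hM : 0 ≤ M) (hr : 0 ≤ r) (hrd : r ≤ d) : powErr N A Ch α k M r ≤ powErr N A Ch α k M d := by
  have hc : 0 ≤ powConst k := by unfold powConst; positivity
  unfold powErr
  have h1 := Real.rpow_le_rpow hr hrd (by linarith : 0 ≤ (2 * k - 1) * (1 + α) - 1)
  have h2 := Real.rpow_le_rpow hr hrd (by linarith : 0 ≤ (2 * k - 1) * (1 + α))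
  gcongr

lemma EqData.viscSub_initial (D : EqData Ω T F h α f a A Ch Mf k) (hCh : 0 ≤ Ch) {x₀ : EucSp N}
    {C K d : ℝ} (hd : ∀ x ∈ Ω, ‖x - x₀‖ ≤ d) (hC : 0 < C)
    (hK : Mf + powErr N A Ch α k C d ≤ K) (c : ℝ) :
    ViscSub Ω T F h α f k (fun p => c - K * p.2 - C * ‖p.1 - x₀‖ ^ (2 * k)) := by
  intro x₁ hx₁ t₁ ht₁
  have h1 := powErr_mono (N := N) D.A_pos.le hCh D.k_alpha hC.le (norm_nonneg (x₁ - x₀)) (hd x₁ hx₁)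
  have h2 := (abs_le.1 (D.f_bdd x₁ hx₁ t₁ ht₁)).1
  have h3 := D.hasSubJet_power (x₀ := x₀) (t₀ := 0) (c := c) (τ := -K) (B := 0) hx₁ ht₁ hC
    (by linarith)
  have e : (fun p : EucSp N × ℝ => c - K * p.2 - C * ‖p.1 - x₀‖ ^ (2 * k)) =
      fun p => c + -K * (p.2 - 0) + 0 * (p.2 - 0) ^ 2 - C * ‖p.1 - x₀‖ ^ (2 * k) := by
    funext p; ring
  rw [e]
  exact ViscSubAt.of_hasSubJet D hx₁ h3 (c := 0) (Eventually.of_forall fun z => (add_zero _).le)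
    (add_zero _).symm

/-- Bounded continuous subsolutions lying below the boundary data. -/
structure IsLower (Ω : Set (EucSp N)) (T : ℝ) (F : EucSp N → EucSp N → MatN N → ℝ)
    (h : EucSp N → ℝ → EucSp N) (α : ℝ) (f : EucSp N → ℝ → ℝ) (k : ℕ) (ψ : EucSp N → ℝ → ℝ)
    (l : EucSp N × ℝ → ℝ) : Prop where
  cont : ContinuousOn l (Ω ×ˢ Ioo 0 T)
  visc : ViscSub Ω T F h α f k l
  le : ∀ p ∈ Ω ×ˢ Ioo 0 T, l p ≤ ψ p.1 p.2
  bdd : ∃ B, ∀ p ∈ Ω ×ˢ Ioo 0 T, |l p| ≤ B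

lemma PsiHolderLip.sub_le {γ cψ Lψ : ℝ} {ψ : EucSp N → ℝ → ℝ} (hψ : PsiHolderLip Ω T γ cψ Lψ ψ)
    {x y : EucSp N} (hx : x ∈ closure Ω) (hy : y ∈ closure Ω) {t s : ℝ} (ht : t ∈ Icc 0 T)
    (hs : s ∈ Icc 0 T) : ψ y s - cψ * ‖x - y‖ ^ γ - Lψ * |t - s| ≤ ψ x t := by
  have h1 := (abs_le.1 (hψ.1 x hx y hy t ht)).1
  have h2 := (abs_le.1 (hψ.2 y hy t ht s hs)).1
  linarith

lemma exists_holder_radius {γ c ε : ℝ} (hγ : 0 < γ) (hε : 0 < ε) :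
    ∃ ρ > 0, ∀ s, 0 ≤ s → s ≤ ρ → c * s ^ γ ≤ ε := by
  have hc : Tendsto (fun s : ℝ => c * s ^ γ) (nhds 0) (nhds 0) := by
    have := ((Real.continuousAt_rpow_const 0 γ (Or.inr hγ.le)).tendsto).const_mul c
    rwa [Real.zero_rpow hγ.ne', mul_zero] at this
  obtain ⟨ρ, hρ, hb⟩ := Metric.eventually_nhds_iff.1 (hc.eventually (gt_mem_nhds hε))
  refine ⟨ρ / 2, by positivity, fun s hs hsρ => (hb ?_).le⟩
  rw [Real.dist_eq, sub_zero, abs_of_nonneg hs]; linarith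

lemma EqData.exists_isLower_lateral (D : EqData Ω T F h α f a A Ch Mf k) (hCh : 0 ≤ Ch)
    (hMf : 0 ≤ Mf) (hΩb : Bornology.IsBounded Ω) (hcone : UnifExtCone Ω) {γ cψ Lψ : ℝ}
    {ψ : EucSp N → ℝ → ℝ} (hγ : 0 < γ) (hcψ : 0 < cψ) (hLψ : 0 < Lψ)
    (hψ : PsiHolderLip Ω T γ cψ Lψ ψ) {z : EucSp N} (hz : z ∈ frontier Ω) {s : ℝ}
    (hs : s ∈ Icc 0 T) {ε : ℝ} (hε : 0 < ε) :
    ∃ l, IsLower Ω T F h α f k ψ l ∧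
      ∃ ρ > 0, ∀ p ∈ Ω ×ˢ Ioo 0 T, dist p (z, s) < ρ → ψ z s - ε ≤ l p := by
  obtain ⟨κ, hκ, hκ2, R₀, hR₀, hb⟩ := hcone.exists_balls
  obtain ⟨n, hn, hball⟩ := hb z hz
  obtain ⟨ρ₀, hρ₀, hhol⟩ := exists_holder_radius (c := cψ) hγ (show 0 < ε / 3 by positivity)
  obtain ⟨B, hB⟩ := hΩb.closure.exists_norm_le
  have hzc : z ∈ closure Ω := frontier_subset_closure hz
  have hdm : ∀ x ∈ closure Ω, ‖x - z‖ ≤ 2 * B := fun x hx =>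
    (norm_sub_le _ _).trans (by linarith [hB x hx, hB z hzc])
  obtain ⟨W, hW, R, hR, hWR⟩ := D.exists_barrier (K := Lψ + Mf) (M := cψ * (2 * B) ^ γ) hΩb hκ hκ2
    hR₀ hn hball hCh (by positivity) hρ₀ (show 0 < ε / 3 by positivity)
  refine ⟨fun p => (ψ z s - ε / 3) - Lψ * |p.2 - s| - W p.1,
    ⟨?_, hW.viscSub D le_rfl hLψ.le _ _, fun p hp => ?_, ?_⟩, min R (ε / (3 * Lψ)),
    by positivity, fun p hp hd => ?_⟩
  · have h1 : ContinuousOn (fun p : EucSp N × ℝ => W p.1) (Ω ×ˢ Ioo 0 T) :=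
      hW.cont.comp continuousOn_fst fun p hp => subset_closure hp.1
    exact (show Continuous fun p : EucSp N × ℝ => (ψ z s - ε / 3) - Lψ * |p.2 - s| by
      fun_prop).continuousOn.sub h1
  · have hx := subset_closure hp.1
    have h1 := hψ.sub_le hx hzc (Ioo_subset_Icc_self hp.2) hs
    have h2 : cψ * ‖p.1 - z‖ ^ γ ≤ ε / 3 + W p.1 := by
      rcases le_total ‖p.1 - z‖ ρ₀ with h3 | h3
      · linarith [hhol _ (norm_nonneg _) h3, hW.nonneg _ hx]
      · have h4 := Real.rpow_le_rpow (norm_nonneg _) (hdm _ hx) hγ.le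
        have h5 := mul_le_mul_of_nonneg_left h4 hcψ.le
        linarith [hW.large _ hx h3]
    linarith
  · obtain ⟨B', hB'⟩ := (hΩb.isCompact_closure).exists_bound_of_continuousOn hW.cont
    refine ⟨|ψ z s - ε / 3| + Lψ * T + B', fun p hp => ?_⟩
    have h1 := hB' p.1 (subset_closure hp.1)
    rw [Real.norm_eq_abs] at h1
    have h2 : |p.2 - s| ≤ T := by
      rw [abs_le]; constructor <;> linarith [hp.2.1, hp.2.2, hs.1, hs.2]
    have h3 := mul_le_mul_of_nonneg_left h2 hLψ.le
    have h4 : 0 ≤ Lψ * |p.2 - s| := by positivity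
    have h5 := abs_le.1 h1
    have h6 := abs_le.1 (le_refl |ψ z s - ε / 3|)
    rw [abs_le]
    constructor <;> linarith [h5.1, h5.2, h6.1, h6.2]
  · have h1 : ‖p.1 - z‖ ≤ dist p (z, s) := by
      rw [← dist_eq_norm]; exact le_max_left _ _
    have h2 : |p.2 - s| ≤ dist p (z, s) := by
      rw [← Real.dist_eq]; exact le_max_right _ _
    have h3 := hWR p.1 (subset_closure hp.1) (h1.trans (hd.le.trans (min_le_left _ _)))
    have h4 := h2.trans (hd.le.trans (min_le_right _ _))
    rw [le_div_iff₀ (by positivity)] at h4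
    linarith

lemma EqData.exists_isLower_initial (D : EqData Ω T F h α f a A Ch Mf k) (hCh : 0 ≤ Ch)
    (hT : 0 < T) (hΩb : Bornology.IsBounded Ω) {γ cψ Lψ : ℝ}
    {ψ : EucSp N → ℝ → ℝ} (hγ : 0 < γ) (hcψ : 0 < cψ)
    (hψ : PsiHolderLip Ω T γ cψ Lψ ψ) {z : EucSp N} (hz : z ∈ closure Ω) {ε : ℝ} (hε : 0 < ε) :
    ∃ l, IsLower Ω T F h α f k ψ l ∧
      ∃ ρ > 0, ∀ p ∈ Ω ×ˢ Ioo 0 T, dist p (z, 0) < ρ → ψ z 0 - ε ≤ l p := by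
  obtain ⟨ρ₀, hρ₀, hhol⟩ := exists_holder_radius (c := cψ) hγ (show 0 < ε / 2 by positivity)
  obtain ⟨B, hB⟩ := hΩb.closure.exists_norm_le
  have hB0 : 0 ≤ B := (norm_nonneg _).trans (hB z hz)
  have hdm : ∀ x ∈ closure Ω, ‖x - z‖ ≤ 2 * B := fun x hx =>
    (norm_sub_le _ _).trans (by linarith [hB x hx, hB z hz])
  set C := cψ * (2 * B) ^ γ / ρ₀ ^ (2 * k) + 1 with hC
  have hC0 : 0 < C := by positivity
  set K := max Lψ (Mf + powErr N A Ch α k C (2 * B)) with hK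
  set l : EucSp N × ℝ → ℝ := fun p => (ψ z 0 - ε / 2) - K * p.2 - C * ‖p.1 - z‖ ^ (2 * k) with hl
  have hlc : Continuous l := by simp only [hl]; fun_prop
  refine ⟨l, ⟨hlc.continuousOn, D.viscSub_initial hCh (fun x hx => hdm x (subset_closure hx)) hC0
    (le_max_right _ _) _, fun p hp => ?_, ?_⟩, ?_⟩
  · have hx := subset_closure hp.1
    have h1 := hψ.sub_le hx hz (Ioo_subset_Icc_self hp.2) (left_mem_Icc.2 hT.le)
    rw [sub_zero, abs_of_pos hp.2.1] at h1
    have h2 : cψ * ‖p.1 - z‖ ^ γ ≤ ε / 2 + C * ‖p.1 - z‖ ^ (2 * k) := by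
      rcases le_total ‖p.1 - z‖ ρ₀ with h3 | h3
      · have : 0 ≤ C * ‖p.1 - z‖ ^ (2 * k) := by positivity
        linarith [hhol _ (norm_nonneg _) h3]
      · have h4 := Real.rpow_le_rpow (norm_nonneg _) (hdm _ hx) hγ.le
        have h5 := mul_le_mul_of_nonneg_left h4 hcψ.le
        have h6 : cψ * (2 * B) ^ γ ≤ C * ρ₀ ^ (2 * k) := by
          rw [← div_le_iff₀ (by positivity), hC]; linarith
        have h7 : C * ρ₀ ^ (2 * k) ≤ C * ‖p.1 - z‖ ^ (2 * k) := by gcongr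
        linarith
    have h3 := mul_le_mul_of_nonneg_right (le_max_left Lψ (Mf + powErr N A Ch α k C (2 * B)))
      hp.2.1.le
    simp only [hl]
    linarith
  · obtain ⟨B', hB'⟩ := (hΩb.isCompact_closure.prod
      (isCompact_Icc (a := (0:ℝ)) (b := T))).exists_bound_of_continuousOn hlc.continuousOn
    exact ⟨B', fun p hp => hB' p ⟨subset_closure hp.1, Ioo_subset_Icc_self hp.2⟩⟩
  · have hk : 2 * k ≠ 0 := by have := D.two_le; omega
    have h0 : ψ z 0 - ε < l (z, 0) := by
      simp only [hl, sub_self, norm_zero, zero_pow hk]; linarith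
    obtain ⟨ρ, hρ, hb⟩ := Metric.eventually_nhds_iff.1
      (hlc.continuousAt.eventually (lt_mem_nhds h0))
    exact ⟨ρ, hρ, fun p _ hd => (hb hd).le⟩

/-- The parabolic boundary of the closed cylinder. -/
def parBdry (Ω : Set (EucSp N)) (T : ℝ) : Set (EucSp N × ℝ) :=
  frontier Ω ×ˢ Icc 0 T ∪ closure Ω ×ˢ {0}

lemma isCompact_parBdry (hΩb : Bornology.IsBounded Ω) : IsCompact (parBdry Ω T) :=
  ((hΩb.isCompact_closure.of_isClosed_subset isClosed_frontier frontier_subset_closure).prod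
    isCompact_Icc).union (hΩb.isCompact_closure.prod isCompact_singleton)

lemma compl_nonempty_of_isBounded (hN : 1 ≤ N) (hΩb : Bornology.IsBounded Ω) : Ωᶜ.Nonempty := by
  have _ : Nonempty (Fin N) := ⟨⟨0, hN⟩⟩
  rw [Set.nonempty_compl]
  rintro rfl
  exact NormedSpace.unbounded_univ ℝ (EucSp N) hΩb

lemma exists_mem_frontier_of_isPreconnected {X : Type*} [TopologicalSpace X] {s t : Set X}
    (hs : IsPreconnected s) {x y : X} (hx : x ∈ s) (hxt : x ∈ t) (hy : y ∈ s) (hyt : y ∉ t) :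
    ∃ z ∈ s, z ∈ frontier t := by
  by_contra! hno
  obtain ⟨z, -, hz, hz'⟩ := hs (interior t) (interior tᶜ) isOpen_interior isOpen_interior
    (fun z hz => by
      by_cases hzt : z ∈ interior t
      · exact Or.inl hzt
      · rw [interior_compl]
        exact Or.inr fun hc => hno z hz ⟨hc, hzt⟩)
    ⟨x, hx, by_contra fun hc => hno x hx ⟨subset_closure hxt, hc⟩⟩
    ⟨y, hy, by
      rw [interior_compl]
      exact fun hc => hno y hy ⟨hc, fun hi => hyt (interior_subset hi)⟩⟩
  exact interior_subset hz' (interior_subset hz)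

/-- Local boundary estimates on the compact parabolic boundary are uniform. -/
lemma uniform_of_local_boundary (hN : 1 ≤ N) (hΩb : Bornology.IsBounded Ω)
    {u v : EucSp N × ℝ → ℝ}
    (hloc : ∀ ζ ∈ parBdry Ω T, ∀ ε > 0, ∃ ρ > 0, ∀ z ∈ Ω ×ˢ Ioo 0 T, ∀ w ∈ Ω ×ˢ Ioo 0 T,
      dist z ζ < ρ → dist w ζ < ρ → u z + v w ≤ ε) :
    ∀ ε > 0, ∃ ρ > 0, ∀ z ∈ Ω ×ˢ Ioo 0 T, ∀ w ∈ Ω ×ˢ Ioo 0 T, ‖z.1 - w.1‖ < ρ →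
      |z.2 - w.2| < ρ → (infDist z.1 Ωᶜ < ρ ∨ z.2 < ρ) → u z + v w ≤ ε := by
  intro ε hε
  choose! r hr hrb using fun ζ hζ => hloc ζ hζ ε hε
  obtain ⟨δ, hδ, hδb⟩ := lebesgue_number_lemma_of_metric (c := fun ζ : parBdry Ω T =>
    ball (ζ : EucSp N × ℝ) (r ζ)) (isCompact_parBdry hΩb) (fun _ => isOpen_ball)
    (fun ζ hζ => mem_iUnion.2 ⟨⟨ζ, hζ⟩, mem_ball_self (hr ζ hζ)⟩)
  refine ⟨δ / 2, by positivity, fun z hz w hw h1 h2 h3 => ?_⟩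
  have hwz : dist w z < δ / 2 := by
    rw [dist_comm, Prod.dist_eq, max_lt_iff, dist_eq_norm, Real.dist_eq]
    exact ⟨h1, h2⟩
  obtain ⟨ζ, hζ, hzζ⟩ : ∃ ζ ∈ parBdry Ω T, dist z ζ < δ / 2 := by
    rcases h3 with h3 | h3
    · obtain ⟨y, hy, hyz⟩ := (infDist_lt_iff (compl_nonempty_of_isBounded hN hΩb)).1 h3
      obtain ⟨x, hx, hxf⟩ := exists_mem_frontier_of_isPreconnected
        (convex_ball z.1 (δ / 2)).isPreconnected (mem_ball_self (by positivity)) hz.1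
        (show y ∈ ball z.1 (δ / 2) by rwa [mem_ball, dist_comm]) hy
      refine ⟨(x, z.2), Or.inl ⟨hxf, Ioo_subset_Icc_self hz.2⟩, ?_⟩
      rw [Prod.dist_eq, dist_self, max_lt_iff, dist_comm]
      exact ⟨hx, by positivity⟩
    · refine ⟨(z.1, 0), Or.inr ⟨subset_closure hz.1, rfl⟩, ?_⟩
      rw [Prod.dist_eq, dist_self, max_lt_iff, Real.dist_eq, sub_zero, abs_of_pos hz.2.1]
      exact ⟨by positivity, h3⟩
  obtain ⟨i, hi⟩ := hδb ζ hζ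
  refine hrb i i.2 z hz w hw (hi (mem_ball.2 (by linarith))) (hi (mem_ball.2 ?_))
  linarith [dist_triangle w z ζ]

lemma exists_continuousOn_closure {X : Type*} [PseudoMetricSpace X] {Q : Set X} {u : X → ℝ}
    (hu : ∀ ε > 0, ∃ δ > 0, ∀ z ∈ Q, ∀ w ∈ Q, dist z w < δ → u z - u w ≤ ε) :
    ∃ U : X → ℝ, ContinuousOn U (closure Q) ∧ EqOn U u Q := by
  have hc : ContinuousOn u Q := by
    refine Metric.continuousOn_iff.2 fun x hx ε hε => ?_
    obtain ⟨δ, hδ, hd⟩ := hu (ε / 2) (by positivity)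
    refine ⟨δ, hδ, fun y hy hyx => ?_⟩
    rw [Real.dist_eq, abs_lt]
    constructor <;> linarith [hd y hy x hx hyx, hd x hx y hy (by rwa [dist_comm])]
  refine ⟨extendFrom Q u, continuousOn_extendFrom subset_rfl fun x hx => ?_,
    fun x hx => extendFrom_extends hc x hx⟩
  have _ : (nhdsWithin x Q).NeBot := mem_closure_iff_nhdsWithin_neBot.1 hx
  refine cauchy_map_iff_exists_tendsto.1 (Metric.cauchy_iff.2 ⟨inferInstance, fun ε hε => ?_⟩)
  obtain ⟨δ, hδ, hd⟩ := hu (ε / 2) (by positivity)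
  refine ⟨u '' (ball x (δ / 2) ∩ Q), image_mem_map (inter_mem
    (mem_nhdsWithin_of_mem_nhds (ball_mem_nhds x (by positivity))) self_mem_nhdsWithin), ?_⟩
  rintro _ ⟨y, hy, rfl⟩ _ ⟨w, hw, rfl⟩
  have h1 := mem_ball.1 hy.1
  have h2 := mem_ball.1 hw.1
  have h3 : dist y w < δ := by linarith [dist_triangle_right y w x]
  rw [Real.dist_eq, abs_lt]
  constructor <;> linarith [hd y hy.2 w hw.2 h3, hd w hw.2 y hy.2 (by rwa [dist_comm])]

lemma IsSolution.eq_on_parBdry {ψ : EucSp N → ℝ → ℝ} {u u' : EucSp N → ℝ → ℝ} (hΩo : IsOpen Ω)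
    (hT : 0 < T) (hu : IsSolution Ω T F h α f ψ u) (hu' : IsSolution Ω T F h α f ψ u') :
    ∀ ζ ∈ parBdry Ω T, u ζ.1 ζ.2 = u' ζ.1 ζ.2 := by
  have hlat : ∀ x ∈ frontier Ω, ∀ t ∈ Icc 0 T, u x t = u' x t := by
    intro x hx
    have hm : MapsTo (fun t : ℝ => (x, t)) (Icc 0 T) (closure Ω ×ˢ Icc 0 T) :=
      fun t ht => ⟨frontier_subset_closure hx, ht⟩
    have hc : ContinuousOn (fun t : ℝ => (x, t)) (Icc 0 T) := by fun_prop
    have h1 : EqOn (u x) (u' x) (Ioo 0 T) := fun t ht => by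
      rw [hu.2.2.2.1 x hx t ht, hu'.2.2.2.1 x hx t ht]
    exact h1.of_subset_closure (hu.1.comp hc hm) (hu'.1.comp hc hm) Ioo_subset_Icc_self
      (closure_Ioo hT.ne).ge
  rintro ⟨x, t⟩ (hζ | ⟨hx, ht⟩)
  · exact hlat x hζ.1 t hζ.2
  · obtain rfl : t = 0 := ht
    by_cases hxΩ : x ∈ Ω
    · exact (hu.2.2.2.2 x hxΩ).trans (hu'.2.2.2.2 x hxΩ).symm
    · exact hlat x (by rw [hΩo.frontier_eq]; exact ⟨hx, hxΩ⟩) 0 (left_mem_Icc.2 hT.le)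

lemma parBdry_subset (hT : 0 ≤ T) : parBdry Ω T ⊆ closure Ω ×ˢ Icc 0 T := by
  rintro ζ (hζ | hζ)
  · exact ⟨frontier_subset_closure hζ.1, hζ.2⟩
  · exact ⟨hζ.1, by rw [show ζ.2 = 0 from hζ.2]; exact left_mem_Icc.2 hT⟩

lemma cyl_subset : Ω ×ˢ Ioo 0 T ⊆ closure Ω ×ˢ Icc 0 T :=
  prod_mono subset_closure Ioo_subset_Icc_self

lemma EqData.solution_le (D : EqData Ω T F h α f a A Ch Mf k) {ω : ℝ → ℝ} {ωh ch : ℝ}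
    (R : RegData Ω T F h α k ω ωh ch) (hN : 1 ≤ N) (hT : 0 < T) (hΩb : Bornology.IsBounded Ω)
    {ψ u u' : EucSp N → ℝ → ℝ} (hu : IsSolution Ω T F h α f ψ u)
    (hu' : IsSolution Ω T F h α f ψ u') : ∀ z ∈ Ω ×ˢ Ioo 0 T, u z.1 z.2 ≤ u' z.1 z.2 := by
  have hK := hΩb.isCompact_closure.prod (isCompact_Icc (a := (0:ℝ)) (b := T))
  obtain ⟨B, hB⟩ := hK.exists_bound_of_continuousOn hu.1
  obtain ⟨B', hB'⟩ := hK.exists_bound_of_continuousOn hu'.1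
  have huc := hu.1.mono (cyl_subset (Ω := Ω) (T := T))
  have huc' := (hu'.1.mono (cyl_subset (Ω := Ω) (T := T))).neg
  have hv := ViscSub.of_isSubSol D huc hu.2.1
  have hv' := ViscSub.of_isSubSol D.flip (u := fun x t => -u' x t) huc'
    (isSuperSol_iff.1 hu'.2.2.1)
  intro z hz
  refine le_of_forall_pos_le_add fun ε hε => ?_
  have hbd : ∀ ζ ∈ parBdry Ω T, ∀ ε > 0, ∃ ρ > 0, ∀ z ∈ Ω ×ˢ Ioo 0 T, ∀ w ∈ Ω ×ˢ Ioo 0 T,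
      dist z ζ < ρ → dist w ζ < ρ → u z.1 z.2 + -u' w.1 w.2 ≤ ε := by
    intro ζ hζ ε hε
    have hζK := parBdry_subset hT.le hζ
    obtain ⟨δ, hδ, hd⟩ := Metric.continuousOn_iff.1 hu.1 ζ hζK (ε / 2) (by positivity)
    obtain ⟨δ', hδ', hd'⟩ := Metric.continuousOn_iff.1 hu'.1 ζ hζK (ε / 2) (by positivity)
    refine ⟨min δ δ', by positivity, fun z hz w hw h1 h2 => ?_⟩
    have h3 := (abs_lt.1 (hd z (cyl_subset hz) (h1.trans_le (min_le_left _ _)))).2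
    have h4 := (abs_lt.1 (hd' w (cyl_subset hw) (h2.trans_le (min_le_right _ _)))).1
    have h5 := IsSolution.eq_on_parBdry D.isOpen hT hu hu' ζ hζ
    linarith
  obtain ⟨n, hn⟩ := D.comparison R hT hΩb hv hv' huc.upperSemicontinuousOn
    huc'.upperSemicontinuousOn (M := max B B')
    (fun z hz => (le_abs_self _).trans ((hB z (cyl_subset hz)).trans (le_max_left _ _)))
    (fun z hz => (neg_le_abs _).trans ((hB' z (cyl_subset hz)).trans (le_max_right _ _)))
    (uniform_of_local_boundary hN hΩb hbd) hε
  have hk : 2 * k ≠ 0 := by have := D.two_le; omega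
  have := hn z hz z hz
  simp only [sub_self, norm_zero, abs_zero, zero_pow hk, zero_pow two_ne_zero, add_zero,
    mul_zero] at this
  linarith

lemma EqData.exists_isLower (D : EqData Ω T F h α f a A Ch Mf k) (hCh : 0 ≤ Ch)
    (hMf : 0 ≤ Mf) (hT : 0 < T) (hΩb : Bornology.IsBounded Ω) (hcone : UnifExtCone Ω)
    {γ cψ Lψ : ℝ} {ψ : EucSp N → ℝ → ℝ} (hγ : 0 < γ) (hcψ : 0 < cψ) (hLψ : 0 < Lψ)
    (hψ : PsiHolderLip Ω T γ cψ Lψ ψ) {ζ : EucSp N × ℝ} (hζ : ζ ∈ parBdry Ω T)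
    {ε : ℝ} (hε : 0 < ε) :
    ∃ l, IsLower Ω T F h α f k ψ l ∧
      ∃ ρ > 0, ∀ p ∈ Ω ×ˢ Ioo 0 T, dist p ζ < ρ → ψ ζ.1 ζ.2 - ε ≤ l p := by
  obtain ⟨z, s⟩ := ζ
  rcases hζ with hζ | ⟨hz, hs⟩
  · exact D.exists_isLower_lateral hCh hMf hΩb hcone hγ hcψ hLψ hψ hζ.1 hζ.2 hε
  · obtain rfl : s = 0 := hs
    exact D.exists_isLower_initial hCh hT hΩb hγ hcψ hψ hz hε

lemma PsiHolderLip.neg {γ cψ Lψ : ℝ} {ψ : EucSp N → ℝ → ℝ} (hψ : PsiHolderLip Ω T γ cψ Lψ ψ) :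
    PsiHolderLip Ω T γ cψ Lψ (fun x t => -ψ x t) := by
  refine ⟨fun x hx y hy t ht => ?_, fun x hx t ht s hs => ?_⟩
  · rw [neg_sub_neg, abs_sub_comm]; exact hψ.1 x hx y hy t ht
  · rw [neg_sub_neg, abs_sub_comm]; exact hψ.2 x hx t ht s hs

lemma EqData.exists_solution (D : EqData Ω T F h α f a A Ch Mf k) {ω : ℝ → ℝ} {ωh ch : ℝ}
    (R : RegData Ω T F h α k ω ωh ch) (hN : 1 ≤ N) (hΩne : Ω.Nonempty) (hCh : 0 ≤ Ch)
    (hMf : 0 ≤ Mf) (hT : 0 < T) (hΩb : Bornology.IsBounded Ω) (hcone : UnifExtCone Ω)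
    {γ cψ Lψ : ℝ} {ψ : EucSp N → ℝ → ℝ} (hγ : 0 < γ) (hcψ : 0 < cψ) (hLψ : 0 < Lψ)
    (hψ : PsiHolderLip Ω T γ cψ Lψ ψ) : ∃ u, IsSolution Ω T F h α f ψ u := by
  classical
  set Q : Set (EucSp N × ℝ) := Ω ×ˢ Ioo 0 T with hQ
  set K : Set (EucSp N × ℝ) := closure Ω ×ˢ Icc 0 T with hK
  have hQo : IsOpen Q := D.isOpen.prod isOpen_Ioo
  have hKQ : closure Q = K := by rw [hQ, closure_prod_eq, closure_Ioo hT.ne]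
  have hKc : IsCompact K := hΩb.isCompact_closure.prod isCompact_Icc
  have hlow := fun ζ hζ ε hε => D.exists_isLower hCh hMf hT hΩb hcone hγ hcψ hLψ hψ
    (ζ := ζ) hζ (ε := ε) hε
  have hupp := fun ζ hζ ε hε => D.flip.exists_isLower hCh hMf hT hΩb hcone hγ hcψ hLψ hψ.neg
    (ζ := ζ) hζ (ε := ε) hε
  obtain ⟨x₀, hx₀⟩ := hΩne
  have hζ₀ : ((x₀, 0) : EucSp N × ℝ) ∈ parBdry Ω T := Or.inr ⟨subset_closure hx₀, rfl⟩
  obtain ⟨l₀, hl₀, -⟩ := hlow _ hζ₀ 1 one_pos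
  obtain ⟨b₀, hb₀, -⟩ := hupp _ hζ₀ 1 one_pos
  obtain ⟨u, v, hu, hv, huc, hvc, huv⟩ := D.perron
    (Lo := {l | IsLower Ω T F h α f k ψ l})
    (Up := {b | IsLower Ω T (flipF F) h α (fun x t => -f x t) k (fun x t => -ψ x t)
      (fun z => -b z)})
    (fun l hl => ⟨hl.cont, hl.visc⟩)
    (fun b hb => ⟨hb.cont.neg.congr fun z _ => (neg_neg _).symm, hb.visc⟩)
    (fun l hl b hb z hz => (hl.le z hz).trans (neg_le_neg_iff.1 (hb.le z hz)))
    ⟨l₀, hl₀⟩ ⟨fun z => -b₀ z, by simpa using hb₀⟩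
  have hul : ∀ ζ ∈ parBdry Ω T, ∀ ε > 0, ∃ ρ > 0, ∀ p ∈ Q, dist p ζ < ρ →
      u p ≤ ψ ζ.1 ζ.2 + ε ∧ ψ ζ.1 ζ.2 - ε ≤ -v p := by
    intro ζ hζ ε hε
    obtain ⟨l, hl, ρ, hρ, hlρ⟩ := hlow ζ hζ ε hε
    obtain ⟨b, hb, r, hr, hbr⟩ := hupp ζ hζ ε hε
    refine ⟨min ρ r, by positivity, fun p hp hd => ⟨?_, ?_⟩⟩
    · have h1 := (huv p hp).2.2 (fun z => -b z) (by simpa using hb)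
      have h2 := hbr p hp (hd.trans_le (min_le_right _ _))
      linarith
    · exact (hlρ p hp (hd.trans_le (min_le_left _ _))).trans ((huv p hp).2.1 l hl)
  have hcomp : ∀ ε > 0, ∃ n : ℕ, ∀ z ∈ Q, ∀ w ∈ Q,
      u z + v w ≤ ε + n * (‖z.1 - w.1‖ ^ (2 * k) + |z.2 - w.2| ^ 2) := by
    intro ε hε
    obtain ⟨B₁, hB₁⟩ := hl₀.bdd
    obtain ⟨B₂, hB₂⟩ := hb₀.bdd
    refine D.comparison R hT hΩb hu hv huc hvc (M := max B₁ B₂) (fun z hz => ?_) (fun z hz => ?_)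
      (uniform_of_local_boundary hN hΩb fun ζ hζ ε hε => ?_) hε
    · have h1 := (huv z hz).2.2 (fun z => -b₀ z) (by simpa using hb₀)
      exact h1.trans ((neg_le_abs _).trans ((hB₂ z hz).trans (le_max_right _ _)))
    · have h1 := (huv z hz).2.1 l₀ hl₀
      have h2 := (neg_le_abs _).trans ((hB₁ z hz).trans (le_max_left _ B₂))
      linarith
    · obtain ⟨ρ, hρ, hd⟩ := hul ζ hζ (ε / 2) (by positivity)
      refine ⟨ρ, hρ, fun z hz w hw h1 h2 => ?_⟩
      linarith [(hd z hz h1).1, (hd w hw h2).2]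
  have hk : 2 * k ≠ 0 := by have := D.two_le; omega
  have huveq : ∀ z ∈ Q, v z = -u z := by
    intro z hz
    refine le_antisymm (le_of_forall_pos_le_add fun ε hε => ?_) (by linarith [(huv z hz).1])
    obtain ⟨n, hn⟩ := hcomp ε hε
    have := hn z hz z hz
    simp only [sub_self, norm_zero, abs_zero, zero_pow hk, zero_pow two_ne_zero, add_zero,
      mul_zero] at this
    linarith
  have hunif : ∀ ε > 0, ∃ δ > 0, ∀ z ∈ Q, ∀ w ∈ Q, dist z w < δ → u z - u w ≤ ε := by
    intro ε hε
    obtain ⟨n, hn⟩ := hcomp _ (half_pos hε)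
    have hlim : Tendsto (fun r : ℝ => (n:ℝ) * (r ^ (2 * k) + r ^ 2)) (nhds 0) (nhds 0) := by
      have : Continuous fun r : ℝ => (n:ℝ) * (r ^ (2 * k) + r ^ 2) := by fun_prop
      simpa [zero_pow hk] using this.tendsto 0
    obtain ⟨δ, hδ, hd⟩ := Metric.eventually_nhds_iff.1
      (hlim.eventually (gt_mem_nhds (half_pos hε)))
    refine ⟨δ, hδ, fun z hz w hw hzw => ?_⟩
    have h1 := hn z hz w hw
    rw [huveq w hw] at h1
    have h2 := hd (y := dist z w) (by rwa [Real.dist_eq, sub_zero, abs_of_nonneg dist_nonneg])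
    have h3 : ‖z.1 - w.1‖ ≤ dist z w := by rw [← dist_eq_norm]; exact le_max_left _ _
    have h4 : |z.2 - w.2| ≤ dist z w := by rw [← Real.dist_eq]; exact le_max_right _ _
    have h5 : (n:ℝ) * (‖z.1 - w.1‖ ^ (2 * k) + |z.2 - w.2| ^ 2) ≤
      n * (dist z w ^ (2 * k) + dist z w ^ 2) := by gcongr
    linarith
  obtain ⟨U, hUc, hUu⟩ := exists_continuousOn_closure hunif
  rw [hKQ] at hUc
  set V : EucSp N → ℝ → ℝ := fun x t => if (x, t) ∈ K then U (x, t) else 0 with hV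
  have hVU : EqOn (fun z : EucSp N × ℝ => V z.1 z.2) U K := fun z hz => by
    simp only [hV]; exact if_pos hz
  have hVc : ContinuousOn (fun z : EucSp N × ℝ => V z.1 z.2) K := hUc.congr hVU
  have hQK : Q ⊆ K := cyl_subset
  have hVu : ∀ z ∈ Q, V z.1 z.2 = u z := fun z hz => (hVU (hQK hz)).trans (hUu hz)
  have hVcQ := hVc.mono hQK
  obtain ⟨B, hB⟩ := hKc.exists_bound_of_continuousOn hUc
  have hVB : ∀ x t, |V x t| ≤ |B| := fun x t => by
    simp only [hV]; split_ifs with hm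
    · exact (hB _ hm).trans (le_abs_self B)
    · simp
  have hbdry : ∀ ζ ∈ parBdry Ω T, V ζ.1 ζ.2 = ψ ζ.1 ζ.2 := by
    intro ζ hζ
    have hζK := parBdry_subset hT.le hζ
    have _ : (nhdsWithin ζ Q).NeBot := mem_closure_iff_nhdsWithin_neBot.1 (by rw [hKQ]; exact hζK)
    refine tendsto_nhds_unique ((hVc ζ hζK).mono_left (nhdsWithin_mono ζ hQK)) ?_
    refine Metric.tendsto_nhds.2 fun ε hε => ?_
    obtain ⟨ρ, hρ, hd⟩ := hul ζ hζ (ε / 2) (by positivity)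
    filter_upwards [self_mem_nhdsWithin, mem_nhdsWithin_of_mem_nhds (ball_mem_nhds ζ hρ)]
      with z hz hzρ
    have h1 := hd z hz hzρ
    rw [huveq z hz, neg_neg] at h1
    rw [hVu z hz, Real.dist_eq, abs_lt]
    constructor <;> linarith [h1.1, h1.2]
  refine ⟨V, hVc, ?_, ?_, fun x hx t ht => hbdry (x, t) (Or.inl ⟨hx, Ioo_subset_Icc_self ht⟩),
    fun x hx => hbdry (x, 0) (Or.inr ⟨subset_closure hx, rfl⟩)⟩
  · refine ViscSub.isSubSol D hVcQ hVB fun x hx t ht => (hu x hx t ht).of_le ?_ (hVu _ ⟨hx, ht⟩).symm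
    filter_upwards [hQo.mem_nhds (show (x, t) ∈ Q from ⟨hx, ht⟩)] with z hz
    exact (hVu z hz).ge
  · refine isSuperSol_iff.2 (ViscSub.isSubSol D.flip (B := |B|) hVcQ.neg
      (fun x t => by rw [abs_neg]; exact hVB x t)
      fun x hx t ht => (hv x hx t ht).of_le ?_ ?_)
    · filter_upwards [hQo.mem_nhds (show (x, t) ∈ Q from ⟨hx, ht⟩)] with z hz
      rw [huveq z hz, hVu z hz]
    · rw [huveq _ ⟨hx, ht⟩, hVu _ ⟨hx, ht⟩]

end Comparison

/-- Existence and uniqueness via Perron's method. -/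
theorem perron_existence_uniqueness
    (N : ℕ) (hN : 1 ≤ N) (α : ℝ) (hα : -1 < α)
    (Ω : Set (EucSp N)) (hΩo : IsOpen Ω) (hΩconn : IsConnected Ω)
    (hΩb : Bornology.IsBounded Ω) (hcone : UnifExtCone Ω)
    (T : ℝ) (hT : 0 < T)
    (F : EucSp N → EucSp N → MatN N → ℝ) (a A : ℝ)
    (hFc : Fcont Ω F) (hF1 : H1 Ω F α) (hF2 : H2 Ω F α a A) (hF3 : H3 Ω F)
    (h : EucSp N → ℝ → EucSp N) (hh : HContBdd Ω T h) (hh5 : H5 Ω T h α)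
    (γ c₁ c₂ : ℝ) (hbar : IsBarrierFamily Ω T F h α γ c₁ c₂)
    (ψ : EucSp N → ℝ → ℝ) (cψ Lψ : ℝ) (hcψ : 0 < cψ) (hLψ : 0 < Lψ)
    (hψ : PsiHolderLip Ω T γ cψ Lψ ψ)
    (f : EucSp N → ℝ → ℝ)
    (hfc : ContinuousOn (fun p : EucSp N × ℝ => f p.1 p.2) (Ω ×ˢ Set.Ioo 0 T))
    (Mf : ℝ) (hfb : ∀ x ∈ Ω, ∀ t ∈ Set.Ioo (0 : ℝ) T, |f x t| ≤ Mf) :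
    ∃ u : EucSp N → ℝ → ℝ, IsSolution Ω T F h α f ψ u ∧
      ∀ u' : EucSp N → ℝ → ℝ, IsSolution Ω T F h α f ψ u' →
        ∀ x ∈ closure Ω, ∀ t ∈ Set.Icc (0 : ℝ) T, u' x t = u x t := by
  obtain ⟨ω, hωc, hω0, hωF⟩ := hF3
  obtain ⟨Ch, hCh⟩ := hh.2
  obtain ⟨ωh, hωh, -, ch, hch, h_time, h_neg, h_pos⟩ := hh5
  obtain ⟨x₀, hx₀⟩ := hΩconn.nonempty
  have ht₀ : T / 2 ∈ Ioo (0 : ℝ) T := ⟨by positivity, by linarith⟩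
  have hα' : 0 < 1 + α := by linarith
  obtain ⟨k, hk⟩ := exists_nat_ge (2 + 1 / (1 + α) + (1 + α) / ωh)
  have h1 : 0 < 1 / (1 + α) := by positivity
  have h2 : 0 < (1 + α) / ωh := by positivity
  have D : EqData Ω T F h α f a A Ch Mf k :=
    { isOpen := hΩo
      alpha := hα
      cont := hFc
      hom := hF1
      ell := hF2
      h_cont := hh.1
      h_bdd := hCh
      f_cont := hfc
      f_bdd := hfb
      two_le := by
        have : (2 : ℝ) ≤ k := by linarith
        exact_mod_cast this
      k_alpha := (div_lt_iff₀ hα').1 (by linarith) }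
  have R : RegData Ω T F h α k ω ωh ch :=
    { ω_cont := hωc
      ω_zero := hω0
      F_reg := hωF
      ωh_pos := hωh
      ch_nonneg := hch.le
      exponent := (div_le_iff₀ hωh).1 (by linarith)
      h_time := h_time
      h_neg := h_neg
      h_pos := h_pos }
  obtain ⟨u, hu⟩ := D.exists_solution R hN hΩconn.nonempty
    ((norm_nonneg _).trans (hCh x₀ hx₀ _ ht₀)) ((abs_nonneg _).trans (hfb x₀ hx₀ _ ht₀)) hT hΩb
    hcone hbar.1.1 hcψ hLψ hψ
  refine ⟨u, hu, fun u' hu' x hx t ht => ?_⟩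
  have heq : EqOn (fun p : EucSp N × ℝ => u' p.1 p.2) (fun p => u p.1 p.2) (Ω ×ˢ Ioo 0 T) :=
    fun z hz => le_antisymm (D.solution_le R hN hT hΩb hu' hu z hz)
      (D.solution_le R hN hT hΩb hu hu' z hz)
  refine heq.of_subset_closure hu'.1 hu.1 cyl_subset ?_ (show (x, t) ∈ _ from ⟨hx, ht⟩)
  rw [closure_prod_eq, closure_Ioo hT.ne]
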